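/- There exists n₀ ∈ ℕ such that for every odd exponent n ≥ n₀ and every set S containing at least two elements, the free Burnside group B(S,n) is SQ-universal in the Burnside variety B_n: for every countable n-periodic group C there exists a quotient Q of B(S,n) such that C embeds into Q. -/

import Mathlib

open scoped Classical

noncomputable section

universe u u' v w v' w'

/-! ## Words over an alphabet -/

/-- A word over the alphabet `S`: a list of letters together with exponents `±1`. -/
abbrev Word (S : Type u) := List (S × Bool)

namespace Word

variable {S : Type u}

/-- The formal inverse of a word. -/
def inv (w : Word S) : Word S := (w.map fun a => (a.1, !a.2)).reverse

/-- A word is reduced if it contains no cancelling adjacent pair. -/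
def IsReduced (w : Word S) : Prop :=
  List.Chain' (fun a b => ¬(a.1 = b.1 ∧ b.2 = !a.2)) w

/-- A word is cyclically reduced if its square is reduced. -/
def IsCyclicallyReduced (w : Word S) : Prop := IsReduced (w ++ w)

/-- `c` is a cyclic conjugate of `w` if it is obtained from `w` by rotation. -/
def IsCyclicConjugate (w c : Word S) : Prop := ∃ k, c = w.rotate k

/-- The `k`-th power of a word. -/
def pow (w : Word S) : ℕ → Word S
  | 0 => []
  | k + 1 => w ++ pow w k

end Word

/-! ## Burnside quotients, bundled groups and word metrics -/

/-- The (normal) subgroup of `G` generated by all `n`-th powers. -/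
def powerSubgroup (G : Type v) [Group G] (n : ℕ) : Subgroup G :=
  Subgroup.normalClosure { g : G | ∃ x : G, g = x ^ n }

instance powerSubgroup_normal (G : Type v) [Group G] (n : ℕ) :
    (powerSubgroup G n).Normal :=
  Subgroup.normalClosure_normal

/-- The quotient `G/G^n` of `G` by the normal subgroup generated by `n`-th powers. -/
abbrev BurnsideQuotient (G : Type v) [Group G] (n : ℕ) : Type v :=
  G ⧸ powerSubgroup G n

/-- A bundled group. -/
structure GrpB : Type 1 where
  carrier : Type
  [str : Group carrier]

attribute [instance] GrpB.str

instance : CoeSort GrpB Type := ⟨GrpB.carrier⟩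

def GrpB.of (G : Type) [Group G] : GrpB := ⟨G⟩

/-- The word metric on a group `G` associated with a (symmetrized) generating set `A`. -/
def wordDist {G : Type v} [Group G] (A : Set G) (g h : G) : ℝ :=
  sInf { r : ℝ | ∃ l : List G, (∀ a ∈ l, a ∈ A ∨ a⁻¹ ∈ A) ∧ g⁻¹ * h = l.prod ∧
    r = l.length }

/-- The left multiplication action of a group on itself. -/
def leftTransl {G : Type v} [Group G] : G → G → G := fun g x => g * x

/-! ## Labelled graphs (graphs in the sense of Serre with labelling) -/

structure LabGraph (S : Type u) where
  /-- vertices -/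
  V : Type v
  /-- (oriented) edges -/
  E : Type w
  /-- initial vertex -/
  init : E → V
  /-- inversion of edges -/
  bar : E → E
  bar_ne : ∀ e, bar e ≠ e
  bar_bar : ∀ e, bar (bar e) = e
  /-- labelling by `S ⊔ S⁻¹` -/
  label : E → S × Bool
  label_bar_fst : ∀ e, (label (bar e)).1 = (label e).1
  label_bar_snd : ∀ e, (label (bar e)).2 = !(label e).2

namespace LabGraph

variable {S : Type u}

/-- terminal vertex of an edge -/
def term (Γ : LabGraph S) (e : Γ.E) : Γ.V := Γ.init (Γ.bar e)

/-- A path is a list of consecutive edges. -/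
def IsPath (Γ : LabGraph S) (p : List Γ.E) : Prop :=
  List.Chain' (fun e f => Γ.term e = Γ.init f) p

def firstV (Γ : LabGraph S) (p : List Γ.E) : Option Γ.V := p.head?.map Γ.init

def lastV (Γ : LabGraph S) (p : List Γ.E) : Option Γ.V := p.getLast?.map Γ.term

def IsPathFrom (Γ : LabGraph S) (u v : Γ.V) (p : List Γ.E) : Prop :=
  Γ.IsPath p ∧ ((p = [] ∧ u = v) ∨ (Γ.firstV p = some u ∧ Γ.lastV p = some v))

def IsClosedPath (Γ : LabGraph S) (p : List Γ.E) : Prop :=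
  Γ.IsPath p ∧ p ≠ [] ∧ Γ.firstV p = Γ.lastV p

/-- A simple closed path: a closed path visiting no vertex twice. -/
def IsSimpleClosedPath (Γ : LabGraph S) (p : List Γ.E) : Prop :=
  Γ.IsClosedPath p ∧ (p.map Γ.init).Nodup

/-- The label of a path. -/
def wordOf (Γ : LabGraph S) (p : List Γ.E) : Word S := p.map Γ.label

def LabelsPath (Γ : LabGraph S) (w : Word S) : Prop :=
  ∃ p, Γ.IsPath p ∧ Γ.wordOf p = w

def LabelsClosedPath (Γ : LabGraph S) (w : Word S) : Prop :=
  ∃ p, Γ.IsClosedPath p ∧ Γ.wordOf p = w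

def Adj (Γ : LabGraph S) (u v : Γ.V) : Prop := ∃ e, Γ.init e = u ∧ Γ.term e = v

/-- Two vertices are in the same connected component iff they are reachable. -/
def Reachable (Γ : LabGraph S) : Γ.V → Γ.V → Prop := Relation.ReflTransGen Γ.Adj

/-- Label-preserving automorphisms of a labelled graph. -/
structure Aut (Γ : LabGraph S) where
  vmap : Γ.V ≃ Γ.V
  emap : Γ.E ≃ Γ.E
  init_comm : ∀ e, Γ.init (emap e) = vmap (Γ.init e)
  bar_comm : ∀ e, Γ.bar (emap e) = emap (Γ.bar e)
  label_comm : ∀ e, Γ.label (emap e) = Γ.label e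

/-- Label-preserving graph homomorphisms. -/
structure Hom (Γ : LabGraph.{u, v, w} S) (Δ : LabGraph.{u, v', w'} S) where
  vmap : Γ.V → Δ.V
  emap : Γ.E → Δ.E
  init_comm : ∀ e, Δ.init (emap e) = vmap (Γ.init e)
  bar_comm : ∀ e, Δ.bar (emap e) = emap (Γ.bar e)
  label_comm : ∀ e, Δ.label (emap e) = Γ.label e

/-- The connected component of `v₀`, as a labelled graph. -/
def component (Γ : LabGraph S) (v₀ : Γ.V) : LabGraph S where
  V := { v : Γ.V // Γ.Reachable v₀ v }
  E := { e : Γ.E // Γ.Reachable v₀ (Γ.init e) }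
  init e := ⟨Γ.init e.1, e.2⟩
  bar e := ⟨Γ.bar e.1, e.2.tail ⟨e.1, rfl, rfl⟩⟩
  bar_ne e h := Γ.bar_ne e.1 (congrArg Subtype.val h)
  bar_bar e := Subtype.ext (Γ.bar_bar e.1)
  label e := Γ.label e.1
  label_bar_fst e := Γ.label_bar_fst e.1
  label_bar_snd e := Γ.label_bar_snd e.1

/-- A piece: a word labelling two paths of `Γ` which are not identified by any
label-preserving automorphism of `Γ`. -/
def IsPiece (Γ : LabGraph S) (w : Word S) : Prop :=
  ∃ p₁ p₂ : List Γ.E, Γ.IsPath p₁ ∧ Γ.IsPath p₂ ∧ Γ.wordOf p₁ = w ∧ Γ.wordOf p₂ = w ∧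
    ∀ φ : Γ.Aut, p₂ ≠ p₁.map ⇑φ.emap

/-- A labelled graph is reduced if no two distinct edges with the same initial vertex
carry the same label. -/
def Reduced (Γ : LabGraph S) : Prop :=
  ∀ e₁ e₂ : Γ.E, Γ.init e₁ = Γ.init e₂ → Γ.label e₁ = Γ.label e₂ → e₁ = e₂

/-- `w` occurs on the (closed) path `γ`: it labels a subpath of some rotation of `γ`. -/
def OccursOn (Γ : LabGraph S) (w : Word S) (γ : List Γ.E) : Prop :=
  ∃ k, w <:+: Γ.wordOf (γ.rotate k)

/-- The graphical `C'(λ)` small cancellation condition. -/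
def GrSC (Γ : LabGraph S) (lam : ℝ) : Prop :=
  Γ.Reduced ∧
  ∀ γ, Γ.IsSimpleClosedPath γ → ∀ w, Γ.IsPiece w → Γ.OccursOn w γ →
    (w.length : ℝ) < lam * (γ.length : ℝ)

/-- Strongly reduced: no loops, and no closed path labelled `s t⁻¹` for `s ≠ t`. -/
def StronglyReduced (Γ : LabGraph S) : Prop :=
  (∀ e : Γ.E, Γ.init e ≠ Γ.term e) ∧
  ∀ s t : S, s ≠ t → ¬ Γ.LabelsClosedPath [(s, true), (t, false)]

/-- The graphical `C'_n(λ, p)`-condition of Coulon–Gruber. -/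
def GrSCB (Γ : LabGraph S) (n : ℕ) (lam : ℝ) (p : ℕ) : Prop :=
  Γ.StronglyReduced ∧ Γ.GrSC lam ∧
  ∀ w : Word S, Word.IsCyclicallyReduced w → Γ.LabelsPath (Word.pow w p) →
    Γ.LabelsClosedPath (Word.pow w n)

/-- The graphical `C'(λ, p)`-condition: `C'(λ)` and any `p`-th power of a cyclically
reduced word read on `Γ` has all its powers read on `Γ`. -/
def GrSCP (Γ : LabGraph S) (lam : ℝ) (p : ℕ) : Prop :=
  Γ.GrSC lam ∧
  ∀ w : Word S, Word.IsCyclicallyReduced w → Γ.LabelsPath (Word.pow w p) →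
    ∀ k : ℕ, Γ.LabelsPath (Word.pow w k)

/-- The relations of `G(Γ)`: labels of closed paths of `Γ`. -/
def rels (Γ : LabGraph S) : Set (FreeGroup S) :=
  { g | ∃ p, Γ.IsClosedPath p ∧ g = FreeGroup.mk (Γ.wordOf p) }

/-- The group `G(Γ)` defined by the labelled graph `Γ`. -/
abbrev Grp (Γ : LabGraph S) : Type u :=
  FreeGroup S ⧸ Subgroup.normalClosure Γ.rels

/-- Evaluation of a word in `G(Γ)`. -/
def evalWord (Γ : LabGraph S) (w : Word S) : Γ.Grp :=
  QuotientGroup.mk (FreeGroup.mk w)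

/-- The canonical generators of `G(Γ)`. -/
def gen (Γ : LabGraph S) : S → Γ.Grp := fun s => Γ.evalWord [(s, true)]

/-- The Burnside quotient `G_n(Γ) = G(Γ)/G(Γ)ⁿ`. -/
abbrev GrpN (Γ : LabGraph S) (n : ℕ) : Type u := BurnsideQuotient Γ.Grp n

/-- The canonical generators of `G_n(Γ)`. -/
def genN (Γ : LabGraph S) (n : ℕ) : S → Γ.GrpN n :=
  fun s => QuotientGroup.mk (Γ.gen s)

/-- The generating set `S ∪ W` of the cone-off space: the canonical generators together
with all elements of `G(Γ)` represented by labels of paths in `Γ`. -/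
def coneGens (Γ : LabGraph S) : Set Γ.Grp :=
  Set.range Γ.gen ∪ { g | ∃ p, Γ.IsPath p ∧ g = Γ.evalWord (Γ.wordOf p) }

/-- The metric of the cone-off space `Ẋ(Γ)`: the word metric on `G(Γ)` with respect to
`S ∪ W`. -/
def coneDist (Γ : LabGraph S) : Γ.Grp → Γ.Grp → ℝ := wordDist Γ.coneGens

def EveryGeneratorOccurs (Γ : LabGraph S) : Prop :=
  ∀ s : S, ∃ e : Γ.E, (Γ.label e).1 = s

def NoIsolatedVertex (Γ : LabGraph S) : Prop := ∀ v : Γ.V, ∃ e : Γ.E, Γ.init e = v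

/-- The `m`-th iterate of an automorphism is the identity. -/
def AutPowId (Γ : LabGraph S) (φ : Γ.Aut) (m : ℕ) : Prop :=
  (∀ v, (⇑φ.vmap)^[m] v = v) ∧ (∀ e, (⇑φ.emap)^[m] e = e)

/-- The automorphism `φ` has order exactly `m`. -/
def AutOrder (Γ : LabGraph S) (φ : Γ.Aut) (m : ℕ) : Prop :=
  Γ.AutPowId φ m ∧ ∀ k, 0 < k → k < m → ¬ Γ.AutPowId φ k

end LabGraph

/-- An automorphism is the identity. -/
def IsAutId {S : Type u} {Γ : LabGraph S} (φ : Γ.Aut) : Prop :=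
  (∀ v, φ.vmap v = v) ∧ (∀ e, φ.emap e = e)

/-- The Cayley graph of a group `G` with respect to a family of generators `σ : S → G`,
as a labelled graph. -/
def CayleyGraph (G : Type v) [Group G] (S : Type u) (σ : S → G) : LabGraph S where
  V := G
  E := G × S × Bool
  init e := e.1
  bar e := (e.1 * (if e.2.2 then σ e.2.1 else (σ e.2.1)⁻¹), e.2.1, !e.2.2)
  bar_ne e h := by
    have h2 := congrArg (fun x => x.2.2) h
    simp at h2
  bar_bar e := by
    obtain ⟨g, s, b⟩ := e
    cases b <;> simp
  label e := e.2
  label_bar_fst _ := rfl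
  label_bar_snd _ := rfl

/-- Relabelling of a labelled graph along a map of alphabets. -/
def LabGraph.relabel {S : Type u} {T : Type u'} (Γ : LabGraph S) (f : S → T) :
    LabGraph T where
  V := Γ.V
  E := Γ.E
  init := Γ.init
  bar := Γ.bar
  bar_ne := Γ.bar_ne
  bar_bar := Γ.bar_bar
  label e := (f (Γ.label e).1, (Γ.label e).2)
  label_bar_fst e := congrArg f (Γ.label_bar_fst e)
  label_bar_snd e := Γ.label_bar_snd e

/-- Every connected component of `Γ` embeds into `Δ` by a label-preserving graph
homomorphism (which can be chosen to send a base vertex to any prescribed vertex). -/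
def ComponentsEmbed {S : Type u} (Γ : LabGraph.{u, v, w} S)
    (Δ : LabGraph.{u, v', w'} S) : Prop :=
  ∀ (v₀ : Γ.V) (x : Δ.V), ∃ f : LabGraph.Hom Γ Δ, f.vmap v₀ = x ∧
    Set.InjOn f.vmap { u | Γ.Reachable v₀ u } ∧
    Set.InjOn f.emap { e | Γ.Reachable v₀ (Γ.init e) }

/-- The path metric on (the vertices of) a labelled graph. -/
def graphDist {S : Type u} (Γ : LabGraph S) (u v : Γ.V) : ℝ :=
  sInf { r : ℝ | ∃ p, Γ.IsPathFrom u v p ∧ r = p.length }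

/-- Diameter of the connected component of `v`. -/
def compDiam {S : Type u} (Γ : LabGraph S) (v : Γ.V) : ℝ :=
  sSup { r : ℝ | ∃ u w, Γ.Reachable v u ∧ Γ.Reachable v w ∧ r = graphDist Γ u w }

/-- An indexing of the connected components of `Γ` by natural numbers. -/
def LabGraph.IsComponentIndex {S : Type u} (Γ : LabGraph S) (idx : Γ.V → ℕ) : Prop :=
  ∀ u v, Γ.Reachable u v ↔ idx u = idx v

/-- The box-space metric on a labelled graph whose components are indexed by `idx`. -/
def LabGraph.boxDist {S : Type u} (Γ : LabGraph S) (idx : Γ.V → ℕ) (u v : Γ.V) : ℝ :=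
  if Γ.Reachable u v then graphDist Γ u v
  else compDiam Γ u + compDiam Γ v + (idx u : ℝ) + (idx v : ℝ)

/-- Coarse embeddings between spaces endowed with distance functions, via the sequence
characterisation. -/
def IsCoarseEmbeddingWith {A : Type v} {B : Type w} (dA : A → A → ℝ) (dB : B → B → ℝ)
    (f : A → B) : Prop :=
  ∀ x y : ℕ → A,
    (Filter.Tendsto (fun k => dA (x k) (y k)) Filter.atTop Filter.atTop ↔
      Filter.Tendsto (fun k => dB (f (x k)) (f (y k))) Filter.atTop Filter.atTop)

/-- Distance between two subsets. -/
def setDist {Y : Type v} (ρ : Y → Y → ℝ) (A B : Set Y) : ℝ :=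
  sInf { r : ℝ | ∃ a ∈ A, ∃ b ∈ B, r = ρ a b }

/-! ## Hyperbolicity, boundary and group actions, relative to a distance function -/

/-- The Gromov product. -/
def gromovProd {Y : Type v} (ρ : Y → Y → ℝ) (x y t : Y) : ℝ :=
  (ρ x t + ρ y t - ρ x y) / 2

/-- `δ`-hyperbolicity via the four point condition. -/
def IsHyperbolicDist {Y : Type v} (ρ : Y → Y → ℝ) (δ : ℝ) : Prop :=
  ∀ x y z t : Y, min (gromovProd ρ x y t) (gromovProd ρ y z t) - δ ≤ gromovProd ρ x z t

/-- Length space (via approximate midpoints). -/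
def IsLengthDist {Y : Type v} (ρ : Y → Y → ℝ) : Prop :=
  ∀ x y : Y, ∀ ε : ℝ, 0 < ε → ∃ m : Y, ρ x m ≤ ρ x y / 2 + ε ∧ ρ m y ≤ ρ x y / 2 + ε

/-- A sequence converges at infinity if its Gromov products tend to infinity. -/
def ConvergesAtInfinity {Y : Type v} (ρ : Y → Y → ℝ) (b : Y) (u : ℕ → Y) : Prop :=
  ∀ M : ℝ, ∃ K : ℕ, ∀ i j : ℕ, K ≤ i → K ≤ j → M ≤ gromovProd ρ (u i) (u j) b

/-- Two sequences converging at infinity define the same boundary point. -/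
def EquivAtInfinity {Y : Type v} (ρ : Y → Y → ℝ) (b : Y) (u v : ℕ → Y) : Prop :=
  ∀ M : ℝ, ∃ K : ℕ, ∀ i j : ℕ, K ≤ i → K ≤ j → M ≤ gromovProd ρ (u i) (v j) b

section GroupAction

variable {G : Type v} [Group G] {Y : Type w}

/-- An element is elliptic if it has a bounded orbit. -/
def EllipticElt (ρ : Y → Y → ℝ) (act : G → Y → Y) (g : G) : Prop :=
  ∃ (x : Y) (C : ℝ), ∀ k : ℤ, ρ (act (g ^ k) x) x ≤ C

/-- A set of group elements is elliptic if it has a bounded orbit. -/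
def EllipticSet (ρ : Y → Y → ℝ) (act : G → Y → Y) (H : Set G) : Prop :=
  ∃ (x : Y) (C : ℝ), ∀ h ∈ H, ρ (act h x) x ≤ C

/-- An element is loxodromic (hyperbolic) if `m ↦ gᵐ • x` is a quasi-isometric
embedding of `ℤ`. -/
def LoxodromicElt (ρ : Y → Y → ℝ) (act : G → Y → Y) (g : G) : Prop :=
  ∃ (x : Y) (lam c : ℝ), 0 < lam ∧ 0 ≤ c ∧ ∀ m n : ℤ,
    lam⁻¹ * |(m : ℝ) - (n : ℝ)| - c ≤ ρ (act (g ^ m) x) (act (g ^ n) x) ∧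
    ρ (act (g ^ m) x) (act (g ^ n) x) ≤ lam * |(m : ℝ) - (n : ℝ)| + c

/-- The action is non-elementary: the limit set of an orbit contains at least three
points of the Gromov boundary. -/
def NonElementaryOn (ρ : Y → Y → ℝ) (act : G → Y → Y) : Prop :=
  ∃ (b : Y) (u₁ u₂ u₃ : ℕ → G),
    ConvergesAtInfinity ρ b (fun k => act (u₁ k) b) ∧
    ConvergesAtInfinity ρ b (fun k => act (u₂ k) b) ∧
    ConvergesAtInfinity ρ b (fun k => act (u₃ k) b) ∧
    ¬ EquivAtInfinity ρ b (fun k => act (u₁ k) b) (fun k => act (u₂ k) b) ∧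
    ¬ EquivAtInfinity ρ b (fun k => act (u₁ k) b) (fun k => act (u₃ k) b) ∧
    ¬ EquivAtInfinity ρ b (fun k => act (u₂ k) b) (fun k => act (u₃ k) b)

/-- A `(d, L, N)`-acylindrical action. -/
def AcylindricalOn (ρ : Y → Y → ℝ) (act : G → Y → Y) (d L : ℝ) (N : ℕ) : Prop :=
  ∀ x y : Y, L ≤ ρ x y →
    { u : G | ρ (act u x) x ≤ d ∧ ρ (act u y) y ≤ d }.Finite ∧
    { u : G | ρ (act u x) x ≤ d ∧ ρ (act u y) y ≤ d }.ncard ≤ N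

/-- A lineal subgroup: the limit set of its orbit consists of exactly two points. -/
def LinealSubgroup (ρ : Y → Y → ℝ) (act : G → Y → Y) (H : Subgroup G) : Prop :=
  ∃ (b : Y) (u v : ℕ → G), (∀ k, u k ∈ H) ∧ (∀ k, v k ∈ H) ∧
    ConvergesAtInfinity ρ b (fun k => act (u k) b) ∧
    ConvergesAtInfinity ρ b (fun k => act (v k) b) ∧
    ¬ EquivAtInfinity ρ b (fun k => act (u k) b) (fun k => act (v k) b) ∧
    ∀ w : ℕ → G, (∀ k, w k ∈ H) → ConvergesAtInfinity ρ b (fun k => act (w k) b) →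
      (EquivAtInfinity ρ b (fun k => act (w k) b) (fun k => act (u k) b) ∨
        EquivAtInfinity ρ b (fun k => act (w k) b) (fun k => act (v k) b))

/-- A maximal lineal subgroup. -/
def MaximalLineal (ρ : Y → Y → ℝ) (act : G → Y → Y) (E : Subgroup G) : Prop :=
  LinealSubgroup ρ act E ∧
  ∀ E' : Subgroup G, LinealSubgroup ρ act E' → E ≤ E' → E = E'

/-- `F` is the maximal finite normal subgroup of `E`. -/
def MaxFiniteNormalIn (F E : Subgroup G) : Prop :=
  F ≤ E ∧ (F : Set G).Finite ∧ (∀ g ∈ E, ∀ f ∈ F, g * f * g⁻¹ ∈ F) ∧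
  ∀ F' : Subgroup G, F' ≤ E → (F' : Set G).Finite →
    (∀ g ∈ E, ∀ f ∈ F', g * f * g⁻¹ ∈ F') → F' ≤ F

end GroupAction

/-- The exponent of the holomorph `Hol(H) = H ⋊ Aut(H)`. -/
def holExponent (H : Type v) [Group H] : ℕ :=
  Monoid.exponent (SemidirectProduct H (MulAut H) (MonoidHom.id (MulAut H)))

/-- `e` is the least common multiple of the exponents of the holomorphs of the maximal
finite normal subgroups of the maximal lineal subgroups (the invariant `e(G, X)`). -/
def IsHolLcm {G : Type v} [Group G] {Y : Type w} (ρ : Y → Y → ℝ) (act : G → Y → Y)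
    (e : ℕ) : Prop :=
  (∀ E F : Subgroup G, MaximalLineal ρ act E → MaxFiniteNormalIn F E →
    holExponent ↥F ∣ e) ∧
  ∀ m : ℕ, (∀ E F : Subgroup G, MaximalLineal ρ act E → MaxFiniteNormalIn F E →
    holExponent ↥F ∣ m) → e ∣ m

/-! ## Relators, geodesic sequences and parallelism -/

/-- A relator: the embedded image of a connected component of `Γ` in `Δ` under a
label-preserving graph homomorphism. -/
def IsRelatorIn {S : Type u} (Γ : LabGraph.{u, v, w} S) (Δ : LabGraph.{u, v', w'} S)
    (R : Set Δ.V) : Prop :=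
  ∃ (f : LabGraph.Hom Γ Δ) (v₀ : Γ.V),
    Set.InjOn f.vmap { u | Γ.Reachable v₀ u } ∧
    R = f.vmap '' { u | Γ.Reachable v₀ u }

/-- A chain of relators with consecutive nonempty intersections. -/
def IsRelChain {S : Type u} (Γ : LabGraph.{u, v, w} S) (Δ : LabGraph.{u, v', w'} S)
    (c : List (Set Δ.V)) : Prop :=
  (∀ R ∈ c, IsRelatorIn Γ Δ R) ∧ List.Chain' (fun R T => (R ∩ T).Nonempty) c

/-- A geodesic sequence of relators. -/
def IsGeoSeq {S : Type u} (Γ : LabGraph.{u, v, w} S) (Δ : LabGraph.{u, v', w'} S)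
    (c : List (Set Δ.V)) : Prop :=
  IsRelChain Γ Δ c ∧ c ≠ [] ∧
  ∀ c' : List (Set Δ.V), IsRelChain Γ Δ c' → c'.head? = c.head? →
    c'.getLast? = c.getLast? → c.length ≤ c'.length

/-- Two sequences of relators are parallel. -/
def AreParallel {V : Type v} (c d : List (Set V)) : Prop :=
  c.length = d.length ∧
  ∀ (i : ℕ) (hi : i < c.length) (hj : i < d.length),
    (c.get ⟨i, hi⟩ ∩ d.get ⟨i, hj⟩).Nonempty

/-- Conclusion of the parallelism proposition: truncations by at most `9ε + 3` terms of
the two sequences are parallel. -/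
def ParallelTruncation {V : Type v} (c d : List (Set V)) (ε : ℝ) : Prop :=
  ∃ k k' l l' : ℕ, 1 ≤ k ∧ 1 ≤ k' ∧ 1 ≤ l ∧ 1 ≤ l' ∧
    (k : ℝ) ≤ 9 * ε + 3 ∧ (k' : ℝ) ≤ 9 * ε + 3 ∧
    (l : ℝ) ≤ 9 * ε + 3 ∧ (l' : ℝ) ≤ 9 * ε + 3 ∧
    k + l = k' + l' ∧
    AreParallel ((c.drop (k - 1)).take (c.length + 2 - l - k))
      ((d.drop (k' - 1)).take (d.length + 2 - l' - k'))

/-- The conclusions of the chord lemma for cyclic configurations of 3 and 4 relators. -/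
def ChordProperty {V : Type v} (Rel : Set V → Prop) : Prop :=
  (∀ R₁ R₂ R₃, Rel R₁ → Rel R₂ → Rel R₃ →
    (R₁ ∩ R₂).Nonempty → (R₂ ∩ R₃).Nonempty → (R₃ ∩ R₁).Nonempty →
    (R₁ ∩ R₂ ∩ R₃).Nonempty) ∧
  (∀ R₁ R₂ R₃ R₄, Rel R₁ → Rel R₂ → Rel R₃ → Rel R₄ →
    (R₁ ∩ R₂).Nonempty → (R₂ ∩ R₃).Nonempty → (R₃ ∩ R₄).Nonempty → (R₄ ∩ R₁).Nonempty →
    (R₁ ∩ R₃).Nonempty ∨ (R₂ ∩ R₄).Nonempty)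

/-- The union of a sequence of sets of vertices is convex: any geodesic between two of
its vertices stays inside the union. -/
def ConvexUnion {S : Type u} (Δ : LabGraph S) (c : List (Set Δ.V)) : Prop :=
  ∀ u v : Δ.V, (∃ R ∈ c, u ∈ R) → (∃ R ∈ c, v ∈ R) →
    ∀ p : List Δ.E, Δ.IsPathFrom u v p → (p.length : ℝ) = graphDist Δ u v →
      ∀ e ∈ p, (∃ R ∈ c, Δ.init e ∈ R) ∧ (∃ R ∈ c, Δ.term e ∈ R)

/-! ## Classical small cancellation -/

/-- A classical piece: a common prefix of two distinct cyclic conjugates of elements of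
`R ∪ R⁻¹`. -/
def IsClassicalPiece {S : Type u} (R : Set (Word S)) (u : Word S) : Prop :=
  ∃ c₁ c₂ : Word S, c₁ ≠ c₂ ∧
    (∃ r ∈ R, Word.IsCyclicConjugate r c₁ ∨ Word.IsCyclicConjugate (Word.inv r) c₁) ∧
    (∃ r ∈ R, Word.IsCyclicConjugate r c₂ ∨ Word.IsCyclicConjugate (Word.inv r) c₂) ∧
    u <+: c₁ ∧ u <+: c₂

/-- The classical `C'(λ)` small cancellation condition. -/
def ClassicalSC {S : Type u} (R : Set (Word S)) (lam : ℝ) : Prop :=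
  (∀ r ∈ R, Word.IsCyclicallyReduced r) ∧
  ∀ u, IsClassicalPiece R u → ∀ r ∈ R, ∀ c, Word.IsCyclicConjugate r c → u <:+: c →
    (u.length : ℝ) < lam * (r.length : ℝ)

/-! ## Free products: syllables and classical small cancellation over free products -/

section FreeProducts

variable {ι : Type u} (M : ι → Type v) [∀ i, Group (M i)]

open Monoid

/-- The list of syllables of the normal form of an element of a free product. -/
def sylList (g : CoprodI M) : List (Σ i, M i) := by
  classical exact (CoprodI.Word.equiv (M := M) g).toList

/-- The syllable length `|g|_*` of an element of a free product. -/
def sylLen (g : CoprodI M) : ℕ := (sylList M g).length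

/-- The product `g * h` is weakly reduced. -/
def WeaklyRedProd (g h : CoprodI M) : Prop :=
  sylLen M g + sylLen M h ≤ sylLen M (g * h) + 1

/-- `g` is cyclically reduced: syllable length at most one, or first and last syllables
in distinct factors. -/
def CyclRed (g : CoprodI M) : Prop :=
  sylLen M g ≤ 1 ∨
    (sylList M g).head?.map Sigma.fst ≠ (sylList M g).getLast?.map Sigma.fst

/-- `g` is weakly cyclically reduced: syllable length at most one, or the product of the
last and first syllables does not vanish. -/
def WeaklyCyclRed (g : CoprodI M) : Prop :=
  sylLen M g ≤ 1 ∨ ∀ (i : ι) (a b : M i),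
    (sylList M g).getLast? = some ⟨i, a⟩ → (sylList M g).head? = some ⟨i, b⟩ →
      a * b ≠ 1

/-- `c` is a weakly cyclic conjugate of `r`. -/
def WeakCyclConj (r c : CoprodI M) : Prop :=
  ∃ u v : CoprodI M, r = u * v ∧ WeaklyRedProd M u v ∧ c = v * u ∧ WeaklyCyclRed M c

/-- A symmetrized subset of a free product. -/
def Symmetrized (R : Set (CoprodI M)) : Prop :=
  (∀ r ∈ R, CyclRed M r) ∧
  ∀ r ∈ R, ∀ c, (WeakCyclConj M r c ∨ WeakCyclConj M r⁻¹ c) → c ∈ R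

/-- A piece for free product small cancellation. -/
def FPPiece (R : Set (CoprodI M)) (u : CoprodI M) : Prop :=
  ∃ r₁ ∈ R, ∃ r₂ ∈ R, r₁ ≠ r₂ ∧
    ∃ v₁ v₂ : CoprodI M, r₁ = u * v₁ ∧ WeaklyRedProd M u v₁ ∧
      r₂ = u * v₂ ∧ WeaklyRedProd M u v₂

/-- The power-free `C'_*(λ)` small cancellation condition over a free product. -/
def PowerFreeSC (R : Set (CoprodI M)) (lam : ℝ) : Prop :=
  (∀ r ∈ R, ∀ u v : CoprodI M, r = u * v → WeaklyRedProd M u v → FPPiece M R u →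
    (sylLen M u : ℝ) < lam * (sylLen M r : ℝ)) ∧
  (∀ r ∈ R, 1 / lam < (sylLen M r : ℝ)) ∧
  (∀ r ∈ R, ¬ ∃ (x : CoprodI M) (k : ℕ), 2 ≤ k ∧ r = x ^ k)

/-- The power-free `C'_*(λ, p)` small cancellation condition over a free product. -/
def PowerFreeSCP (R : Set (CoprodI M)) (lam : ℝ) (p : ℕ) : Prop :=
  PowerFreeSC M R lam ∧
  ∀ r ∈ R, ∀ (w v : CoprodI M) (k : ℕ), CyclRed M w → 1 < sylLen M w →
    r = w ^ k * v → WeaklyRedProd M (w ^ k) v → k ≤ p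

end FreeProducts

/-! ## Graphical small cancellation over free products -/

section FPGraphical

variable {ι : Type u} (M : ι → Type v) [∀ i, Group (M i)] (S : ι → Type u')
  (σ : ∀ i, S i → M i)

open Monoid

/-- The image in the free product of a letter of a word over `Σ i, S i`. -/
def letterFP (x : (Σ i, S i) × Bool) : CoprodI M :=
  if x.2 = true then CoprodI.of (σ x.1.1 x.1.2)
  else (CoprodI.of (σ x.1.1 x.1.2))⁻¹

/-- Evaluation of a word in the free product. -/
def evalFPWord (w : Word (Σ i, S i)) : CoprodI M :=
  (w.map (letterFP M S σ)).prod

/-- The relations of `G(Γ)` over the free product. -/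
def fpRels (Γ : LabGraph (Σ i, S i)) : Set (CoprodI M) :=
  { g | ∃ p, Γ.IsClosedPath p ∧ g = evalFPWord M S σ (Γ.wordOf p) }

/-- The group defined by a labelled graph over a free product. -/
abbrev FPGrp (Γ : LabGraph (Σ i, S i)) :=
  CoprodI M ⧸ Subgroup.normalClosure (fpRels M S σ Γ)

/-- Evaluation of a word in `G(Γ)`. -/
def fpEval (Γ : LabGraph (Σ i, S i)) (w : Word (Σ i, S i)) : FPGrp M S σ Γ :=
  QuotientGroup.mk (evalFPWord M S σ w)

/-- The canonical map of a factor into `G(Γ)`. -/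
def fpOf (Γ : LabGraph (Σ i, S i)) {i : ι} (x : M i) : FPGrp M S σ Γ :=
  QuotientGroup.mk (CoprodI.of x)

/-- The canonical generators of `G(Γ)`. -/
def fpGen (Γ : LabGraph (Σ i, S i)) : (Σ i, S i) → FPGrp M S σ Γ :=
  fun x => fpEval M S σ Γ [(x, true)]

/-- The canonical generators of `G_n(Γ)`. -/
def fpGenN (Γ : LabGraph (Σ i, S i)) (n : ℕ) :
    (Σ i, S i) → BurnsideQuotient (FPGrp M S σ Γ) n :=
  fun x => QuotientGroup.mk (fpGen M S σ Γ x)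

/-- The generating set of the cone-off space in the free product case. -/
def fpConeGens (Γ : LabGraph (Σ i, S i)) : Set (FPGrp M S σ Γ) :=
  Set.range (fpGen M S σ Γ) ∪
    { g | ∃ p, Γ.IsPath p ∧ g = fpEval M S σ Γ (Γ.wordOf p) }

/-- The metric of the cone-off space in the free product case. -/
def fpConeDist (Γ : LabGraph (Σ i, S i)) :
    FPGrp M S σ Γ → FPGrp M S σ Γ → ℝ :=
  wordDist (fpConeGens M S σ Γ)

/-- A word is locally geodesic: it labels a geodesic of the Cayley graph of the free
product. -/
def LocallyGeodesic (w : Word (Σ i, S i)) : Prop :=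
  ∀ w' : Word (Σ i, S i), evalFPWord M S σ w' = evalFPWord M S σ w →
    w.length ≤ w'.length

/-- The Cayley graph of the factor `M i`, as a graph labelled by `Σ j, S j`. -/
def FactorCayley (i : ι) : LabGraph (Σ j, S j) :=
  (CayleyGraph (M i) (S i) (σ i)).relabel fun s => ⟨i, s⟩

/-- An attached Cayley graph: an embedded copy of the Cayley graph of a factor,
saturated for edges labelled in that factor. -/
def IsAttachedCayley {Γ : LabGraph (Σ i, S i)} (i : ι)
    (f : LabGraph.Hom (FactorCayley M S σ i) Γ) : Prop :=
  Function.Injective f.vmap ∧ Function.Injective f.emap ∧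
  ∀ e : Γ.E, (Γ.label e).1.1 = i → (∃ v, f.vmap v = Γ.init e) → ∃ e', f.emap e' = e

/-- `Γ` coincides with its completion and all attached Cayley graphs are embedded. -/
def IsCompleted (Γ : LabGraph (Σ i, S i)) : Prop :=
  (∀ i, ∃ f : LabGraph.Hom (FactorCayley M S σ i) Γ, IsAttachedCayley M S σ i f) ∧
  (∀ (i : ι) (v : Γ.V), (∃ e, Γ.init e = v ∧ (Γ.label e).1.1 = i) →
    ∃ f : LabGraph.Hom (FactorCayley M S σ i) Γ,
      IsAttachedCayley M S σ i f ∧ v ∈ Set.range f.vmap)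

/-- The graphical `C'_*(λ)`-condition over a free product. -/
def FPSC (Γ : LabGraph (Σ i, S i)) (lam : ℝ) : Prop :=
  IsCompleted M S σ Γ ∧
  ∀ γ, Γ.IsSimpleClosedPath γ → evalFPWord M S σ (Γ.wordOf γ) ≠ 1 →
    ∀ w, Γ.IsPiece w → LocallyGeodesic M S σ w → Γ.OccursOn w γ →
      (w.length : ℝ) < lam * (γ.length : ℝ)

/-- Cylinder-freeness: no nontrivial label-preserving automorphism of a component
preserves two disjoint attached Cayley graphs. -/
def CylinderFree (Γ : LabGraph (Σ i, S i)) : Prop :=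
  ∀ (v₀ : Γ.V) (i₁ i₂ : ι)
    (f₁ : LabGraph.Hom (FactorCayley M S σ i₁) (Γ.component v₀))
    (f₂ : LabGraph.Hom (FactorCayley M S σ i₂) (Γ.component v₀)),
    IsAttachedCayley M S σ i₁ f₁ → IsAttachedCayley M S σ i₂ f₂ →
    Disjoint (Set.range f₁.vmap) (Set.range f₂.vmap) →
    ∀ φ : (Γ.component v₀).Aut,
      ⇑φ.vmap '' Set.range f₁.vmap = Set.range f₁.vmap →
      ⇑φ.vmap '' Set.range f₂.vmap = Set.range f₂.vmap →
      IsAutId φ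

/-- The graphical `C'_*(λ, p)`-condition over a free product. -/
def FPSCP (Γ : LabGraph (Σ i, S i)) (lam : ℝ) (p : ℕ) : Prop :=
  FPSC M S σ Γ lam ∧ CylinderFree M S σ Γ ∧
  ∀ w : Word (Σ i, S i), Word.IsCyclicallyReduced w → Γ.LabelsPath (Word.pow w p) →
    ∀ k : ℕ, Γ.LabelsPath (Word.pow w k)

end FPGraphical

/-! ## Finite presentations relative to the Burnside variety, and decision problems -/

/-- Code for a finite presentation relative to the Burnside variety: a number of
generators and a finite list of relator words. -/
abbrev BPres : Type := ℕ × List (List (ℕ × Bool))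

/-- The relations determined by such a code: the listed relators, the generators beyond
the prescribed ones, and all `n`-th powers. -/
def presRels (n : ℕ) (P : BPres) : Set (FreeGroup ℕ) :=
  { g | ∃ w ∈ P.2, g = FreeGroup.mk w } ∪
  { g | ∃ m : ℕ, P.1 ≤ m ∧ g = FreeGroup.of m } ∪
  { g | ∃ x : FreeGroup ℕ, g = x ^ n }

/-- The `n`-periodic group presented by a code. -/
abbrev presGroup (n : ℕ) (P : BPres) : Type :=
  FreeGroup ℕ ⧸ Subgroup.normalClosure (presRels n P)

/-- `G` is finitely presented relative to the Burnside variety `B_n`. -/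
def FinPresRelBurnside (n : ℕ) (G : Type v) [Group G] : Prop :=
  ∃ (S : Type) (R : Set (FreeGroup S)), Finite S ∧ R.Finite ∧
    Nonempty (G ≃* (FreeGroup S ⧸
      Subgroup.normalClosure (R ∪ { g : FreeGroup S | ∃ x : FreeGroup S, g = x ^ n })))

/-! ## Expanders and property A -/

/-- Number of edges from `A` to its complement. -/
def edgeBoundaryCard {V : Type v} (G : SimpleGraph V) (A : Set V) : ℕ :=
  Set.ncard { p : V × V | p.1 ∈ A ∧ p.2 ∉ A ∧ G.Adj p.1 p.2 }

/-- An expander family: finite graphs of uniformly bounded valency, of sizes tending to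
infinity, with Cheeger constants uniformly bounded away from `0`. -/
def IsExpanderFamily (V : ℕ → Type) (G : ∀ k, SimpleGraph (V k)) : Prop :=
  (∀ k, Finite (V k)) ∧
  (∃ D : ℕ, ∀ (k : ℕ) (v : V k), Set.ncard { u | (G k).Adj v u } ≤ D) ∧
  Filter.Tendsto (fun k => Nat.card (V k)) Filter.atTop Filter.atTop ∧
  ∃ c : ℝ, 0 < c ∧ ∀ (k : ℕ) (A : Set (V k)), A.Nonempty →
    2 * A.ncard ≤ Nat.card (V k) →
    c * (A.ncard : ℝ) ≤ (edgeBoundaryCard (G k) A : ℝ)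

/-- Diameter of a simple graph (as a real number). -/
def sgDiam {V : Type v} (G : SimpleGraph V) : ℝ :=
  sSup { r : ℝ | ∃ u v, r = (G.dist u v : ℝ) }

/-- The box-space metric on the disjoint union of a family of finite graphs. -/
def expBoxDist (V : ℕ → Type) (G : ∀ k, SimpleGraph (V k)) (x y : Σ k, V k) : ℝ :=
  if h : x.1 = y.1 then ((G y.1).dist (h ▸ x.2) y.2 : ℝ)
  else sgDiam (G x.1) + sgDiam (G y.1) + (x.1 : ℝ) + (y.1 : ℝ)

/-- Yu's property A for a group endowed with the word metric of a generating set. -/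
def HasPropertyA {Q : Type v} [Group Q] (A : Set Q) : Prop :=
  ∀ R ε : ℝ, 0 < ε → ∃ (B : Q → Set (Q × ℕ)) (Sb : ℝ),
    (∀ g, (B g).Finite ∧ (B g).Nonempty) ∧
    (∀ g h : Q, wordDist A g h ≤ R →
      ((symmDiff (B g) (B h)).ncard : ℝ) ≤ ε * ((B g ∩ B h).ncard : ℝ)) ∧
    ∀ g : Q, ∀ x ∈ B g, wordDist A g x.1 ≤ Sb

end

set_option linter.unusedSectionVars false

namespace BurnsideSQ

/-! ### Discrete hyperbolic metrics -/

/-- A discretely geodesic `ℕ`-valued pseudometric satisfying the four-point condition with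
constant `300`. -/
structure HypMet {X : Type*} (d : X → X → ℕ) : Prop where
  self : ∀ x, d x x = 0
  symm : ∀ x y, d x y = d y x
  tri : ∀ x y z, d x z ≤ d x y + d y z
  geod : ∀ x y k, k ≤ d x y → ∃ z, d x z = k ∧ k + d z y = d x y
  hyp : ∀ x y z t, d x z + d y t ≤ d x y + d z t + 300 ∨ d x z + d y t ≤ d x t + d y z + 300

namespace HypMet

variable {X : Type*} {d : X → X → ℕ}

/-- A point with small excess over a pair is close to the interval between the pair. -/
theorem near_interval (h : HypMet d) {x y z : X} {c : ℕ} (hz : d x z + d z y ≤ d x y + c) :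
    ∃ v, d x v + d v y = d x y ∧ d z v ≤ c + 300 := by
  obtain ⟨v, h1, h2⟩ := h.geod x y (min (d x z) (d x y)) (min_le_right _ _)
  refine ⟨v, by omega, ?_⟩
  have h3 := h.hyp x z y v
  have := h.symm y v
  have := h.symm z y
  have := h.tri x z y
  have := h.symm v x
  omega

theorem near_triangle (h : HypMet d) {x y z : X} (hz : d x z + d z y = d x y) (w : X) :
    d x z + d z w ≤ d x w + 300 ∨ d w z + d z y ≤ d w y + 300 := by
  have h3 := h.hyp x z y w
  have := h.symm w z
  have := h.symm z y
  have := h.symm w y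
  omega

/-- Triangles are thin. -/
theorem thin (h : HypMet d) {x y z : X} (hz : d x z + d z y = d x y) (w : X) :
    (∃ v, d x v + d v w = d x w ∧ d z v ≤ 600) ∨ ∃ v, d w v + d v y = d w y ∧ d z v ≤ 600 := by
  rcases h.near_triangle hz w with h1 | h1
  · obtain ⟨v, h2, h3⟩ := h.near_interval h1
    exact Or.inl ⟨v, h2, by omega⟩
  · obtain ⟨v, h2, h3⟩ := h.near_interval h1
    exact Or.inr ⟨v, h2, by omega⟩

/-- If `x`, `z` are almost on the way from `p` to `q`, and `x` comes first, then `x`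
is almost between `p` and `z`. -/
theorem order_left (h : HypMet d) {p q x z : X} {c₁ c₂ : ℕ} (hx : d p x + d x q ≤ d p q + c₁)
    (hz : d p z + d z q ≤ d p q + c₂) (hxz : d p x ≤ d p z) :
    d p x + d x z ≤ d p z + max c₁ c₂ + 300 := by
  have h1 := h.hyp p x q z
  have := h.symm z q
  have := h.tri p x q
  have := h.symm x z
  omega

theorem order_right (h : HypMet d) {p q x z : X} {c₁ c₂ : ℕ} (hx : d p x + d x q ≤ d p q + c₁)
    (hz : d p z + d z q ≤ d p q + c₂) (hxz : d p x ≤ d p z) :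
    d x z + d z q ≤ d x q + max c₁ c₂ + c₂ + 300 := by
  have h1 := h.order_left hx hz hxz
  have := h.tri p x q
  omega

/-- A point between two almost-geodesic points is almost in their interval. -/
theorem between (h : HypMet d) {p q x y z : X} {c : ℕ} (hx : d p x + d x q ≤ d p q + c)
    (hy : d p y + d y q ≤ d p q + c) (hz : d p z + d z q = d p q) (h1 : d p x ≤ d p z)
    (h2 : d p z ≤ d p y) : d x z + d z y ≤ d x y + 2 * c + 600 := by
  have h3 := h.order_left (c₂ := 0) hx hz.le h1
  have h4 := h.order_left (c₁ := 0) hz.le hy h2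
  have := h.tri p x y
  omega

theorem between_point (h : HypMet d) {p q x y z : X} {c : ℕ} (hx : d p x + d x q ≤ d p q + c)
    (hy : d p y + d y q ≤ d p q + c) (hz : d p z + d z q = d p q) (h1 : d p x ≤ d p z)
    (h2 : d p z ≤ d p y) : ∃ v, d x v + d v y = d x y ∧ d z v ≤ 2 * c + 900 := by
  obtain ⟨v, h3, h4⟩ := h.near_interval (h.between hx hy hz h1 h2 |>.trans (Nat.le_of_eq
    (Nat.add_assoc _ _ _)))
  exact ⟨v, h3, by omega⟩

end HypMet

/-! ### Families of quasiconvex subsets -/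

section Proj

variable {G ι : Type*} [Group G] [MulAction G ι]

/-- A point of `Z` nearest to `1`. -/
noncomputable def baseProj (d : G → G → ℕ) (Z : Set G) : G :=
  if (1 : G) ∈ Z then 1 else
    if h : ∃ p ∈ Z, ∀ y ∈ Z, d 1 p ≤ d 1 y then h.choose else 1

/-- The equivariant nearest point projection to the member `Y a` of a family. -/
noncomputable def pr (d : G → G → ℕ) (Y : ι → Set G) (a : ι) (x : G) : G :=
  x * baseProj d (Y (x⁻¹ • a))

/-- The distance between the projections to `Y a`. -/
noncomputable def prDist (d : G → G → ℕ) (Y : ι → Set G) (a : ι) (x y : G) : ℕ :=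
  d (pr d Y a x) (pr d Y a y)

/-- A left-invariant metric on `G` with an equivariant family of quasiconvex subsets. -/
structure PreFam (d : G → G → ℕ) (Y : ι → Set G) : Prop where
  met : HypMet d
  inv : ∀ g x y, d (g * x) (g * y) = d x y
  nonempty : ∀ a, (Y a).Nonempty
  qc : ∀ a, ∀ x ∈ Y a, ∀ y ∈ Y a, ∀ z, d x z + d z y = d x y → ∃ w ∈ Y a, d z w ≤ 15000
  equiv : ∀ (g : G) a x, x ∈ Y a → g * x ∈ Y (g • a)

/-- A left-invariant metric on `G` with an equivariant family of quasiconvex subsets with small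
overlaps and large rotations. -/
structure Fam (d : G → G → ℕ) (Y : ι → Set G) (Γ : ι → Subgroup G) (κ Θ : ℕ) : Prop
    extends PreFam d Y where
  large : 10000000 ≤ κ
  conj : ∀ (g : G) a s, s ∈ Γ a → g * s * g⁻¹ ∈ Γ (g • a)
  fix : ∀ a, ∀ s ∈ Γ a, s • a = a
  overlap : ∀ a b, a ≠ b → ∀ x ∈ Y b, ∀ y ∈ Y b, prDist d Y a x y ≤ κ
  spin : ∀ a, ∀ x ∈ Y a, ∀ s ∈ Γ a, s ≠ 1 → Θ ≤ d x (s * x)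

namespace PreFam

variable {d : G → G → ℕ} {Y : ι → Set G}

theorem pr_smul (d : G → G → ℕ) (Y : ι → Set G) (g : G) (a : ι) (x : G) :
    pr d Y (g • a) (g * x) = g * pr d Y a x := by
  simp [pr, mul_smul, mul_assoc]

theorem baseProj_spec (F : PreFam d Y) (a : ι) :
    baseProj d (Y a) ∈ Y a ∧ ∀ y ∈ Y a, d 1 (baseProj d (Y a)) ≤ d 1 y := by
  have h : ∃ p ∈ Y a, ∀ y ∈ Y a, d 1 p ≤ d 1 y := by
    obtain ⟨p, hp, hm⟩ := exists_minimalFor_of_wellFoundedLT (· ∈ Y a) (d 1) (F.nonempty a)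
    refine ⟨p, hp, fun y hy => ?_⟩
    by_contra hc
    push Not at hc
    exact absurd (hm hy hc.le) (by simpa using hc)
  unfold baseProj
  split_ifs with h1
  · exact ⟨h1, fun y hy => by simp [F.met.self]⟩
  · exact h.choose_spec

theorem pr_mem (F : PreFam d Y) (a : ι) (x : G) : pr d Y a x ∈ Y a := by
  have := F.equiv x _ _ (F.baseProj_spec (x⁻¹ • a)).1
  rwa [smul_inv_smul] at this

theorem pr_near (F : PreFam d Y) {a : ι} (x : G) {y : G} (hy : y ∈ Y a) :
    d x (pr d Y a x) ≤ d x y := by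
  have h1 := (F.baseProj_spec (x⁻¹ • a)).2 _ (F.equiv x⁻¹ a y hy)
  have h2 := F.inv x 1 (baseProj d (Y (x⁻¹ • a)))
  have h3 := F.inv x 1 (x⁻¹ * y)
  rw [mul_one] at h2 h3
  rw [mul_inv_cancel_left] at h3
  rw [pr, h2, h3]
  exact h1

theorem pr_self (F : PreFam d Y) {a : ι} {x : G} (hx : x ∈ Y a) : pr d Y a x = x := by
  have := F.equiv x⁻¹ a x hx
  rw [inv_mul_cancel] at this
  simp [pr, baseProj, this]

theorem prDist_smul (F : PreFam d Y) (g : G) (a : ι) (x y : G) :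
    prDist d Y (g • a) (g * x) (g * y) = prDist d Y a x y := by
  simp only [prDist, pr_smul, F.inv]

theorem prDist_self (F : PreFam d Y) (a : ι) (x : G) : prDist d Y a x x = 0 := F.met.self _

theorem prDist_symm (F : PreFam d Y) (a : ι) (x y : G) :
    prDist d Y a x y = prDist d Y a y x := F.met.symm _ _

theorem prDist_tri (F : PreFam d Y) (a : ι) (x y z : G) :
    prDist d Y a x z ≤ prDist d Y a x y + prDist d Y a y z := F.met.tri _ _ _

theorem prDist_of_mem (F : PreFam d Y) {a : ι} {x y : G} (hx : x ∈ Y a) (hy : y ∈ Y a) :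
    prDist d Y a x y = d x y := by rw [prDist, F.pr_self hx, F.pr_self hy]

/-- Projections are almost on the way to any point of the set. -/
theorem pr_excess (F : PreFam d Y) {a : ι} (x : G) {y : G} (hy : y ∈ Y a) :
    d x (pr d Y a x) + d (pr d Y a x) y ≤ d x y + 30601 := by
  have h0 := fun w (hw : w ∈ Y a) => F.pr_near x hw
  have hp := F.pr_mem a x
  generalize pr d Y a x = p at *
  obtain ⟨z, h1, h2⟩ := F.met.geod p y (min 15301 (d p y)) (min_le_right _ _)
  obtain ⟨w, hw, hzw⟩ := F.qc a p hp y hy z (by omega)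
  have h3 := h0 w hw
  have h4 := F.met.tri x z w
  have h5 := F.met.hyp x p z y
  have h6 := h0 y hy
  have := F.met.symm p x
  omega

theorem prDist_excess (F : PreFam d Y) {a : ι} {x z : G} (h : 100000 < prDist d Y a x z) :
    d x (pr d Y a x) + prDist d Y a x z + d (pr d Y a z) z ≤ d x z + 100000 := by
  have h1 := F.pr_excess x (F.pr_mem a z)
  have h2 := F.pr_excess z (F.pr_mem a x)
  have h3 := F.met.hyp x (pr d Y a x) (pr d Y a z) z
  have h4 := F.met.symm (pr d Y a x) (pr d Y a z)
  have h5 := F.met.symm (pr d Y a z) z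
  have h6 := F.met.symm (pr d Y a x) z
  unfold prDist at h ⊢
  omega

theorem prDist_le (F : PreFam d Y) (a : ι) (x z : G) :
    prDist d Y a x z ≤ d x z + 100000 := by
  by_contra hc
  have := F.prDist_excess (a := a) (x := x) (z := z) (by omega)
  omega

theorem near_pr_left (F : PreFam d Y) {a : ι} {x z : G} (h : 100000 < prDist d Y a x z) :
    d x (pr d Y a x) + d (pr d Y a x) z ≤ d x z + 100000 := by
  have := F.prDist_excess h
  have := F.met.tri (pr d Y a x) (pr d Y a z) z
  unfold prDist at *
  omega

theorem near_pr_right (F : PreFam d Y) {a : ι} {x z : G} (h : 100000 < prDist d Y a x z) :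
    d x (pr d Y a z) + d (pr d Y a z) z ≤ d x z + 100000 := by
  have := F.prDist_excess h
  have := F.met.tri x (pr d Y a x) (pr d Y a z)
  unfold prDist at *
  omega

end PreFam

namespace Fam

variable {d : G → G → ℕ} {Y : ι → Set G} {Γ : ι → Subgroup G} {κ Θ : ℕ}

/-- Behrstock's inequality. -/
theorem behrstock (F : Fam d Y Γ κ Θ) {a b : ι} (hab : a ≠ b) {x y w : G} (hy : y ∈ Y b)
    (hw : w ∈ Y a) (h : 2 * κ < prDist d Y a x y) : prDist d Y b x w ≤ 2 * κ := by
  by_contra hc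
  have hk := F.large
  have h1 := F.overlap a b hab y hy _ (F.pr_mem b x)
  have h2 := F.overlap b a hab.symm w hw _ (F.pr_mem a x)
  have h3 := F.prDist_tri a x (pr d Y b x) y
  have h4 := F.prDist_tri b x (pr d Y a x) w
  have := F.prDist_symm a (pr d Y b x) y
  have := F.prDist_symm b (pr d Y a x) w
  have h5 := F.prDist_excess (a := a) (x := x) (z := pr d Y b x) (by omega)
  have h6 := F.prDist_excess (a := b) (x := x) (z := pr d Y a x) (by omega)
  omega

theorem mem_of_rot (F : Fam d Y Γ κ Θ) {a : ι} {s x : G} (hs : s ∈ Γ a) (hx : x ∈ Y a) :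
    s * x ∈ Y a := by
  have := F.equiv s a x hx
  rwa [F.fix a s hs] at this

theorem prDist_rot (F : Fam d Y Γ κ Θ) {a : ι} {s : G} (hs : s ∈ Γ a) (x y : G) :
    prDist d Y a (s * x) (s * y) = prDist d Y a x y := by
  have := F.prDist_smul s a x y
  rwa [F.fix a s hs] at this

theorem prDist_spin (F : Fam d Y Γ κ Θ) {a : ι} {s : G} (hs : s ∈ Γ a) (h1 : s ≠ 1) (x : G) :
    Θ ≤ prDist d Y a x (s * x) := by
  have := PreFam.pr_smul d Y s a x
  rw [F.fix a s hs] at this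
  rw [prDist, this]
  exact F.spin a _ (F.pr_mem a x) s hs h1

end Fam
end Proj

/-! ### The windmill argument -/

section Windmill

variable {G ι : Type*} [Group G] [MulAction G ι]

/-- Reduction of `h` to `1` by successively unbending the broken geodesic from `y` to `h * y` -/
inductive Red (d : G → G → ℕ) (Y : ι → Set G) (Γ : ι → Subgroup G) (κ : ℕ) (y : G) : G → Prop
  | one : Red d Y Γ κ y 1
  | step (a : ι) (s h : G) (hs : s ∈ Γ a) (hs1 : s ≠ 1)
      (hD : prDist d Y a (s * y) (h * y) ≤ 14 * κ) (hr : Red d Y Γ κ y (s⁻¹ * h)) :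
      Red d Y Γ κ y h

/-- The subgroup generated by the rotation groups with indices in `I`. -/
def rotGroup (Γ : ι → Subgroup G) (I : Set ι) : Subgroup G :=
  Subgroup.closure {s | ∃ a ∈ I, s ∈ Γ a}

/-- A windmill. -/
structure Windmill (d : G → G → ℕ) (Y : ι → Set G) (Γ : ι → Subgroup G) (κ : ℕ) (y : G)
    (W : Set G) (I : Set ι) : Prop where
  invW : ∀ m ∈ rotGroup Γ I, ∀ w ∈ W, m * w ∈ W
  invI : ∀ m ∈ rotGroup Γ I, ∀ a ∈ I, m • a ∈ I
  base : y ∈ W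
  sub : ∀ a ∈ I, Y a ⊆ W
  qc : ∀ p ∈ W, ∀ q ∈ W, ∀ z, d p z + d z q = d p q → ∃ w ∈ W, d z w ≤ 400000
  proj : ∀ b, b ∉ I → ∀ p ∈ W, ∀ q ∈ W, prDist d Y b p q ≤ 10 * κ
  red : ∀ m ∈ rotGroup Γ I, Red d Y Γ κ y m

/-- The indices of the family members which come close to `W`. -/
def newIdx (d : G → G → ℕ) (Y : ι → Set G) (W : Set G) (I : Set ι) : Set ι :=
  {b | b ∉ I ∧ ∃ x ∈ Y b, ∃ w ∈ W, d x w ≤ 600000}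

/-- The fixed-size neighbourhood of `W`. -/
def thick (d : G → G → ℕ) (W : Set G) : Set G := {x | ∃ w ∈ W, d x w ≤ 600000}

/-- The neighbourhood of `W` together with the nearby family members. -/
def hub (d : G → G → ℕ) (Y : ι → Set G) (W : Set G) (I : Set ι) : Set G :=
  {x | x ∈ thick d W ∨ ∃ b ∈ newIdx d Y W I, x ∈ Y b}

/-- Points reached from `hub` through alternating rotations, the first of which is not in
the member `b`. -/
inductive Alt (d : G → G → ℕ) (Y : ι → Set G) (Γ : ι → Subgroup G) (W : Set G) (I : Set ι) :
    Option ι → G → Prop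
  | thick (b : Option ι) (q : G) (hq : q ∈ thick d W) : Alt d Y Γ W I b q
  | mem (b : Option ι) (c : ι) (q : G) (hc : c ∈ newIdx d Y W I) (hb : b ≠ some c)
      (hq : q ∈ Y c) : Alt d Y Γ W I b q
  | rot (b : Option ι) (c : ι) (s q : G) (hc : c ∈ newIdx d Y W I) (hb : b ≠ some c)
      (hs : s ∈ Γ c) (hs1 : s ≠ 1) (hq : Alt d Y Γ W I (some c) q) : Alt d Y Γ W I b (s * q)

/-- Group elements that are alternating products of rotations. -/
inductive GAlt (d : G → G → ℕ) (Y : ι → Set G) (Γ : ι → Subgroup G) (W : Set G) (I : Set ι) :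
    Option ι → G → Prop
  | mem (b : Option ι) (h : G) (hh : h ∈ rotGroup Γ I) : GAlt d Y Γ W I b h
  | rot (b : Option ι) (c : ι) (s h : G) (hc : c ∈ newIdx d Y W I) (hb : b ≠ some c)
      (hs : s ∈ Γ c) (hs1 : s ≠ 1) (hq : GAlt d Y Γ W I (some c) h) : GAlt d Y Γ W I b (s * h)

variable {d : G → G → ℕ} {Y : ι → Set G} {Γ : ι → Subgroup G} {κ Θ : ℕ} {y : G}
  {W : Set G} {I : Set ι}

namespace Windmill

theorem inv_new (F : Fam d Y Γ κ Θ) (w : Windmill d Y Γ κ y W I) {u : G}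
    (hu : u ∈ rotGroup Γ I) {b : ι} (hb : b ∈ newIdx d Y W I) : u • b ∈ newIdx d Y W I := by
  obtain ⟨h1, x, hx, p, hp, hd⟩ := hb
  refine ⟨fun h => h1 ?_, u * x, F.equiv u b x hx, u * p, w.invW u hu p hp, by rwa [F.inv]⟩
  simpa using w.invI u⁻¹ (inv_mem hu) _ h

theorem inv_thick (F : Fam d Y Γ κ Θ) (w : Windmill d Y Γ κ y W I) {u : G}
    (hu : u ∈ rotGroup Γ I) {x : G} (hx : x ∈ thick d W) : u * x ∈ thick d W := by
  obtain ⟨p, hp, hd⟩ := hx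
  exact ⟨u * p, w.invW u hu p hp, by rwa [F.inv]⟩

theorem sub_thick (F : Fam d Y Γ κ Θ) {x : G} (hx : x ∈ W) : x ∈ thick d W :=
  ⟨x, hx, by simp [F.met.self]⟩

theorem alt_none {b : Option ι} {q : G} (h : Alt d Y Γ W I b q) : Alt d Y Γ W I none q := by
  cases h with
  | thick _ _ hq => exact .thick _ _ hq
  | mem _ c _ hc _ hq => exact .mem _ c _ hc (by simp) hq
  | rot _ c s q hc _ hs hs1 hq => exact .rot _ c s q hc (by simp) hs hs1 hq

theorem alt_split {q : G} (h : Alt d Y Γ W I none q) (b : ι) :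
    Alt d Y Γ W I (some b) q ∨ (b ∈ newIdx d Y W I ∧ q ∈ Y b) ∨
      ∃ s ∈ Γ b, s ≠ 1 ∧ ∃ q₁, Alt d Y Γ W I (some b) q₁ ∧ q = s * q₁ := by
  cases h with
  | thick _ _ hq => exact Or.inl (.thick _ _ hq)
  | mem _ c _ hc _ hq =>
    by_cases hbc : b = c
    · subst hbc; exact Or.inr (Or.inl ⟨hc, hq⟩)
    · exact Or.inl (.mem _ c _ hc (by simpa using hbc) hq)
  | rot _ c s q hc _ hs hs1 hq =>
    by_cases hbc : b = c
    · subst hbc; exact Or.inr (Or.inr ⟨s, hs, hs1, q, hq, rfl⟩)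
    · exact Or.inl (.rot _ c s q hc (by simpa using hbc) hs hs1 hq)

theorem alt_rot (F : Fam d Y Γ κ Θ) {q : G} (h : Alt d Y Γ W I none q) {b : ι}
    (hb : b ∈ newIdx d Y W I) {s : G} (hs : s ∈ Γ b) : Alt d Y Γ W I none (s * q) := by
  by_cases hs1 : s = 1
  · simpa [hs1] using h
  rcases alt_split h b with h' | ⟨_, h'⟩ | ⟨s', hs', -, q₁, h', rfl⟩
  · exact .rot _ b s q hb (by simp) hs hs1 h'
  · exact .mem _ b _ hb (by simp) (F.mem_of_rot hs h')
  · rw [← mul_assoc]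
    by_cases hss : s * s' = 1
    · rw [hss, one_mul]; exact alt_none h'
    · exact .rot _ b _ q₁ hb (by simp) (mul_mem hs hs') hss h'

theorem alt_inv (F : Fam d Y Γ κ Θ) (w : Windmill d Y Γ κ y W I) {u : G}
    (hu : u ∈ rotGroup Γ I) {b : Option ι} {q : G} (h : Alt d Y Γ W I b q) :
    Alt d Y Γ W I (b.map (u • ·)) (u * q) := by
  induction h with
  | thick b q hq => exact .thick _ _ (w.inv_thick F hu hq)
  | mem b c q hc hb hq =>
    refine .mem _ (u • c) _ (w.inv_new F hu hc) ?_ (F.equiv u c q hq)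
    cases b <;> simp_all
  | rot b c s q hc hb hs hs1 _ ih =>
    have := Alt.rot (b.map (u • ·)) (u • c) (u * s * u⁻¹) (u * q) (w.inv_new F hu hc)
      (by cases b <;> simp_all) (F.conj u c s hs) (by simpa [mul_inv_eq_one] using hs1) ih
    simpa [mul_assoc] using this

theorem galt_none {b : Option ι} {q : G} (h : GAlt d Y Γ W I b q) : GAlt d Y Γ W I none q := by
  cases h with
  | mem _ _ hq => exact .mem _ _ hq
  | rot _ c s q hc _ hs hs1 hq => exact .rot _ c s q hc (by simp) hs hs1 hq

theorem galt_rot {q : G} (h : GAlt d Y Γ W I none q) {b : ι}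
    (hb : b ∈ newIdx d Y W I) {s : G} (hs : s ∈ Γ b) : GAlt d Y Γ W I none (s * q) := by
  by_cases hs1 : s = 1
  · simpa [hs1] using h
  cases h with
  | mem _ _ hq => exact .rot _ b s q hb (by simp) hs hs1 (.mem _ _ hq)
  | rot _ c s' q hc _ hs' hs1' hq =>
    by_cases hbc : b = c
    · subst hbc
      rw [← mul_assoc]
      by_cases hss : s * s' = 1
      · rw [hss, one_mul]; exact galt_none hq
      · exact .rot _ b _ q hb (by simp) (mul_mem hs hs') hss hq
    · exact .rot _ b s _ hb (by simp) hs hs1 (.rot _ c s' q hc (by simpa using hbc) hs' hs1' hq)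

theorem galt_inv (F : Fam d Y Γ κ Θ) (w : Windmill d Y Γ κ y W I) {u : G}
    (hu : u ∈ rotGroup Γ I) {b : Option ι} {q : G} (h : GAlt d Y Γ W I b q) :
    GAlt d Y Γ W I (b.map (u • ·)) (u * q) := by
  induction h with
  | mem b q hq => exact .mem _ _ (mul_mem hu hq)
  | rot b c s q hc hb hs hs1 _ ih =>
    have := GAlt.rot (b.map (u • ·)) (u • c) (u * s * u⁻¹) (u * q) (w.inv_new F hu hc)
      (by cases b <;> simp_all) (F.conj u c s hs) (by simpa [mul_inv_eq_one] using hs1) ih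
    simpa [mul_assoc] using this

theorem galt_alt (F : Fam d Y Γ κ Θ) (w : Windmill d Y Γ κ y W I) {b : Option ι} {h : G}
    (hh : GAlt d Y Γ W I b h) : Alt d Y Γ W I b (h * y) := by
  induction hh with
  | mem b q hq => exact .thick _ _ (sub_thick F (w.invW _ hq _ w.base))
  | rot b c s q hc hb hs hs1 _ ih =>
    rw [mul_assoc]; exact .rot _ c s _ hc hb hs hs1 ih

/-- The subgroup generated in the next stage. -/
theorem mem_rotGroup_new {g : G} {b : ι} (hb : b ∈ newIdx d Y W I) (hg : g ∈ Γ b) :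
    g ∈ rotGroup Γ (I ∪ newIdx d Y W I) :=
  Subgroup.subset_closure ⟨b, Or.inr hb, hg⟩

theorem rotGroup_mono {J : Set ι} (h : I ⊆ J) : rotGroup Γ I ≤ rotGroup Γ J :=
  Subgroup.closure_mono fun _ ⟨a, ha, hs⟩ => ⟨a, h ha, hs⟩

theorem rotGroup_induction {p : G → Prop} {g : G} (hg : g ∈ rotGroup Γ (I ∪ newIdx d Y W I))
    {x : G} (h0 : p x) (h1 : ∀ u ∈ rotGroup Γ I, ∀ z, p z → p (u * z))
    (h2 : ∀ b ∈ newIdx d Y W I, ∀ s ∈ Γ b, ∀ z, p z → p (s * z)) : p (g * x) := by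
  have key : ∀ g ∈ rotGroup Γ (I ∪ newIdx d Y W I), ∀ z, p z → p (g * z) := by
    intro g hg
    refine Subgroup.closure_induction_left
      (p := fun g _ => ∀ z, p z → p (g * z)) (fun z hz => by simpa using hz) ?_ ?_ hg
    · rintro s ⟨a, ha, hs⟩ g _ ih z hz
      rw [mul_assoc]
      rcases ha with ha | ha
      · exact h1 s (Subgroup.subset_closure ⟨a, ha, hs⟩) _ (ih z hz)
      · exact h2 a ha s hs _ (ih z hz)
    · rintro s ⟨a, ha, hs⟩ g _ ih z hz
      rw [mul_assoc]
      rcases ha with ha | ha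
      · exact h1 _ (inv_mem (Subgroup.subset_closure ⟨a, ha, hs⟩)) _ (ih z hz)
      · exact h2 a ha _ (inv_mem hs) _ (ih z hz)
  exact key g hg x h0

theorem alt_of_mem (F : Fam d Y Γ κ Θ) (w : Windmill d Y Γ κ y W I) {g : G}
    (hg : g ∈ rotGroup Γ (I ∪ newIdx d Y W I)) {x : G} (hx : x ∈ hub d Y W I) :
    Alt d Y Γ W I none (g * x) := by
  refine rotGroup_induction hg (p := Alt d Y Γ W I none) ?_ (fun u hu z hz => ?_)
    (fun b hb s hs z hz => alt_rot F hz hb hs)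
  · rcases hx with hx | ⟨b, hb, hx⟩
    · exact .thick _ _ hx
    · exact .mem _ b _ hb (by simp) hx
  · simpa using w.alt_inv F hu hz

theorem galt_of_mem (F : Fam d Y Γ κ Θ) (w : Windmill d Y Γ κ y W I) {g : G}
    (hg : g ∈ rotGroup Γ (I ∪ newIdx d Y W I)) : GAlt d Y Γ W I none g := by
  have := rotGroup_induction hg (p := GAlt d Y Γ W I none) (x := 1) (.mem _ _ (one_mem _))
    (fun u hu z hz => by simpa using w.galt_inv F hu hz)
    (fun b hb s hs z hz => galt_rot hz hb hs)
  simpa using this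

theorem proj_new (F : Fam d Y Γ κ Θ) (w : Windmill d Y Γ κ y W I) {b : ι}
    (hb : b ∈ newIdx d Y W I) {x p : G} (hx : x ∈ thick d W) (hp : p ∈ W) :
    prDist d Y b x p ≤ 11 * κ := by
  obtain ⟨x', hx', hd⟩ := hx
  have h1 := F.prDist_le b x x'
  have h2 := w.proj b hb.1 x' hx' p hp
  have h3 := F.prDist_tri b x x' p
  have := F.large
  omega

theorem proj_new_mem (F : Fam d Y Γ κ Θ) (w : Windmill d Y Γ κ y W I) {b c : ι}
    (hb : b ∈ newIdx d Y W I) (hc : c ∈ newIdx d Y W I) (hbc : b ≠ c) {x p : G} (hx : x ∈ Y c)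
    (hp : p ∈ W) : prDist d Y b x p ≤ 12 * κ := by
  obtain ⟨x', hx', x'', hx'', hd⟩ := hc.2
  have h1 := F.prDist_le b x' x''
  have h2 := w.proj b hb.1 x'' hx'' p hp
  have h3 := F.prDist_tri b x x' p
  have h4 := F.prDist_tri b x' x'' p
  have h5 := F.overlap b c hbc x hx x' hx'
  have := F.large
  omega

/-- The key application of Behrstock's inequality. -/
theorem proj_flip (F : Fam d Y Γ κ Θ) (w : Windmill d Y Γ κ y W I) (hΘ : 1000 * κ ≤ Θ) {b c : ι}
    (hb : b ∈ newIdx d Y W I) (hc : c ∈ newIdx d Y W I) (hbc : b ≠ c) {s : G} (hs : s ∈ Γ c)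
    (hs1 : s ≠ 1) {p : G} (hp : ∀ v ∈ W, prDist d Y c p v ≤ 14 * κ) {v : G} (hv : v ∈ W) :
    prDist d Y b (s * p) v ≤ 14 * κ := by
  obtain ⟨x, hx, v', hv', hd⟩ := hb.2
  have h1 := F.prDist_spin hs hs1 v'
  have h2 := F.prDist_rot hs v' p
  have h3 := hp v' hv'
  have h4 := F.prDist_le c x v'
  have h5 := F.prDist_tri c v' (s * p) (s * v')
  have h6 := F.prDist_symm c (s * v') (s * p)
  have h7 := F.prDist_tri c v' x (s * p)
  have h8 := F.prDist_symm c v' x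
  have h9 := F.prDist_symm c x (s * p)
  have h10 := F.prDist_symm c v' p
  have hk := F.large
  have h11 := F.behrstock (Ne.symm hbc) hx (F.pr_mem c v') (x := s * p) (by omega)
  have h12 := w.proj_new_mem F hb hc hbc (F.pr_mem c v') hv
  have h13 := F.prDist_tri b (s * p) (pr d Y c v') v
  omega

theorem alt_proj (F : Fam d Y Γ κ Θ) (w : Windmill d Y Γ κ y W I) (hΘ : 1000 * κ ≤ Θ)
    {b : Option ι} {q : G} (h : Alt d Y Γ W I b q) {c : ι} (hb : b = some c)
    (hc : c ∈ newIdx d Y W I) {v : G} (hv : v ∈ W) : prDist d Y c q v ≤ 14 * κ := by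
  induction h generalizing c v with
  | thick b q hq => exact (w.proj_new F hc hq hv).trans (by omega)
  | mem b c' q hc' hb' hq =>
    subst hb
    exact (w.proj_new_mem F hc hc' (by simpa using hb') hq hv).trans (by omega)
  | rot b c' s q hc' hb' hs hs1 _ ih =>
    subst hb
    exact w.proj_flip F hΘ hc hc' (by simpa using hb') hs hs1 (fun v hv => ih rfl hc' hv) hv

theorem red_galt (F : Fam d Y Γ κ Θ) (w : Windmill d Y Γ κ y W I) (hΘ : 1000 * κ ≤ Θ)
    {b : Option ι} {h : G} (hh : GAlt d Y Γ W I b h) :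
    ∀ u ∈ rotGroup Γ I, Red d Y Γ κ y (u * h) := by
  induction hh with
  | mem b h hh => exact fun u hu => w.red _ (mul_mem hu hh)
  | rot b c s h hc hb hs hs1 hh ih =>
    intro u hu
    refine .step (u • c) (u * s * u⁻¹) _ (F.conj u c s hs) (by simpa [mul_inv_eq_one] using hs1)
      ?_ ?_
    · have h1 := w.alt_proj F hΘ (w.alt_inv F hu (w.galt_alt F hh)) rfl
        (w.inv_new F hu hc) w.base
      have h2 := F.prDist_rot (F.conj u c s hs) y (u * (h * y))
      rw [F.prDist_symm, ← h2] at h1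
      simpa [mul_assoc] using h1
    · simpa [mul_assoc] using ih u hu

end Windmill
end Windmill

section Windmill

variable {G ι : Type*} [Group G] [MulAction G ι]
variable {d : G → G → ℕ} {Y : ι → Set G} {Γ : ι → Subgroup G} {κ Θ : ℕ} {y : G}
  {W : Set G} {I : Set ι}

/-- The points of the next stage of the windmill. -/
def nextSet (d : G → G → ℕ) (Y : ι → Set G) (Γ : ι → Subgroup G) (W : Set G) (I : Set ι) :
    Set G :=
  {x | ∃ g ∈ rotGroup Γ (I ∪ newIdx d Y W I), ∃ h ∈ hub d Y W I, x = g * h}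

/-- The indices of the next stage of the windmill. -/
def nextIdx (d : G → G → ℕ) (Y : ι → Set G) (Γ : ι → Subgroup G) (W : Set G) (I : Set ι) :
    Set ι :=
  {b | ∃ g ∈ rotGroup Γ (I ∪ newIdx d Y W I), ∃ a ∈ I ∪ newIdx d Y W I, b = g • a}

namespace Windmill

theorem hub_anchor (F : Fam d Y Γ κ Θ) {p : G}
    (hp : p ∈ hub d Y W I) :
    ∃ v ∈ W, ∀ z, d p z + d z v = d p v → ∃ h ∈ hub d Y W I, d z h ≤ 15600 := by
  rcases hp with ⟨v, hv, hd⟩ | ⟨b, hb, hp⟩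
  · refine ⟨v, hv, fun z hz => ⟨z, Or.inl ⟨v, hv, by omega⟩, by simp [F.met.self]⟩⟩
  · obtain ⟨x, hx, v, hv, hd⟩ := hb.2
    refine ⟨v, hv, fun z hz => ?_⟩
    rcases F.met.thin hz x with ⟨t, ht, htz⟩ | ⟨t, ht, htz⟩
    · obtain ⟨r, hr, hrt⟩ := F.qc b p hp x hx t ht
      exact ⟨r, Or.inr ⟨b, hb, hr⟩, by have := F.met.tri z t r; omega⟩
    · exact ⟨t, Or.inl ⟨v, hv, by omega⟩, by omega⟩

theorem hub_qc (F : Fam d Y Γ κ Θ) (w : Windmill d Y Γ κ y W I) {p q z : G}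
    (hp : p ∈ hub d Y W I) (hq : q ∈ hub d Y W I) (hz : d p z + d z q = d p q) :
    ∃ h ∈ hub d Y W I, d z h ≤ 20000 := by
  obtain ⟨v, hv, hpv⟩ := hub_anchor F hp
  obtain ⟨v', hv', hqv⟩ := hub_anchor F hq
  rcases F.met.thin hz v with ⟨t, ht, htz⟩ | ⟨t, ht, htz⟩
  · obtain ⟨r, hr, hrt⟩ := hpv t ht
    exact ⟨r, hr, by have := F.met.tri z t r; omega⟩
  rcases F.met.thin ht v' with ⟨t', ht', htz'⟩ | ⟨t', ht', htz'⟩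
  · obtain ⟨r, hr, hrt⟩ := w.qc v hv v' hv' t' ht'
    exact ⟨t', Or.inl ⟨r, hr, by omega⟩, by have := F.met.tri z t t'; omega⟩
  · have h1 := F.met.symm q t'
    have h2 := F.met.symm v' t'
    have h3 := F.met.symm v' q
    obtain ⟨r, hr, hrt⟩ := hqv t' (by omega)
    exact ⟨r, hr, by have := F.met.tri z t t'; have := F.met.tri z t' r; omega⟩

theorem hub_sub_next {x : G} (hx : x ∈ hub d Y W I) : x ∈ nextSet d Y Γ W I :=
  ⟨1, one_mem _, x, hx, by simp⟩

theorem next_mul {g x : G} (hg : g ∈ rotGroup Γ (I ∪ newIdx d Y W I))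
    (hx : x ∈ nextSet d Y Γ W I) : g * x ∈ nextSet d Y Γ W I := by
  obtain ⟨g', hg', h, hh, rfl⟩ := hx
  exact ⟨g * g', mul_mem hg hg', h, hh, by rw [mul_assoc]⟩

theorem between_hub (F : Fam d Y Γ κ Θ) (w : Windmill d Y Γ κ y W I) {p q x x' z : G}
    (hx : x ∈ hub d Y W I) (hx' : x' ∈ hub d Y W I) (h1 : d p x + d x q ≤ d p q + 100000)
    (h2 : d p x' + d x' q ≤ d p q + 100000) (hz : d p z + d z q = d p q) (h3 : d p x ≤ d p z)
    (h4 : d p z ≤ d p x') : ∃ r ∈ nextSet d Y Γ W I, d z r ≤ 400000 := by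
  obtain ⟨v, hv, hvz⟩ := F.met.between_point h1 h2 hz h3 h4
  obtain ⟨r, hr, hrv⟩ := w.hub_qc F hx hx' hv
  exact ⟨r, hub_sub_next hr, by have := F.met.tri z v r; omega⟩

theorem proj_big (F : Fam d Y Γ κ Θ) (w : Windmill d Y Γ κ y W I) (hΘ : 1000 * κ ≤ Θ) {c : ι}
    (hc : c ∈ newIdx d Y W I) {s q p : G} (hs : s ∈ Γ c) (hs1 : s ≠ 1)
    (hq : Alt d Y Γ W I (some c) q) (hp : ∀ v ∈ W, prDist d Y c p v ≤ 14 * κ) :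
    900 * κ ≤ prDist d Y c p (s * q) := by
  have h1 := w.alt_proj F hΘ hq rfl hc w.base
  have h2 := F.prDist_rot hs q y
  have h3 := F.prDist_spin hs hs1 y
  have h4 := hp y w.base
  have h5 := F.prDist_tri c y p (s * y)
  have h6 := F.prDist_tri c p (s * q) (s * y)
  have h7 := F.prDist_symm c p y
  omega

theorem alt_qc (F : Fam d Y Γ κ Θ) (w : Windmill d Y Γ κ y W I) (hΘ : 1000 * κ ≤ Θ)
    {b : Option ι} {q : G} (h : Alt d Y Γ W I b q) :
    ∀ p, (∀ c ∈ newIdx d Y W I, b ≠ some c → ∀ v ∈ W, prDist d Y c p v ≤ 14 * κ) →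
    ∀ x ∈ hub d Y W I, d p x + d x q ≤ d p q + 100000 → ∀ z, d p z + d z q = d p q →
    d p x ≤ d p z → ∃ r ∈ nextSet d Y Γ W I, d z r ≤ 400000 := by
  have hk := F.large
  induction h with
  | thick b q hq =>
    intro p _ x hx hxq z hz hxz
    exact w.between_hub F hx (Or.inl hq) hxq (by simp [F.met.self]) hz hxz (by omega)
  | mem b c q hc hb hq =>
    intro p _ x hx hxq z hz hxz
    exact w.between_hub F hx (Or.inr ⟨c, hc, hq⟩) hxq (by simp [F.met.self]) hz hxz (by omega)
  | rot b c s q hc hb hs hs1 hq ih =>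
    intro p hp x hx hxq z hz hxz
    have hbig := w.proj_big F hΘ hc hs hs1 hq (hp c hc hb)
    have he := F.near_pr_left (a := c) (x := p) (z := s * q) (by omega)
    have hf := F.near_pr_right (a := c) (x := p) (z := s * q) (by omega)
    have hem : pr d Y c p ∈ hub d Y W I := Or.inr ⟨c, hc, F.pr_mem c p⟩
    have hfm : pr d Y c (s * q) ∈ hub d Y W I := Or.inr ⟨c, hc, F.pr_mem c _⟩
    rcases le_total (d p z) (d p (pr d Y c p)) with h1 | h1
    · exact w.between_hub F hx hem hxq he hz hxz h1
    rcases le_total (d p z) (d p (pr d Y c (s * q))) with h2 | h2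
    · exact w.between_hub F hem hfm he hf hz h1 h2
    have hinv : ∀ u v, d (s⁻¹ * u) (s⁻¹ * v) = d u v := F.inv s⁻¹
    have hq' : s⁻¹ * (s * q) = q := by simp
    obtain ⟨r, hr, hrz⟩ := ih (s⁻¹ * p)
      (fun c' hc' hcc v hv => w.proj_flip F hΘ hc' hc (fun h => hcc (by rw [h])) (inv_mem hs)
        (by simpa using hs1) (hp c hc hb) hv)
      (s⁻¹ * pr d Y c (s * q)) (Or.inr ⟨c, hc, F.mem_of_rot (inv_mem hs) (F.pr_mem c _)⟩)
      (by rw [← hq', hinv, hinv, hinv, hq']; exact hf)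
      (s⁻¹ * z) (by rw [← hq', hinv, hinv, hinv]; exact hz) (by rw [hinv, hinv]; exact h2)
    refine ⟨s * r, next_mul (mem_rotGroup_new hc hs) hr, ?_⟩
    rw [← F.inv s⁻¹]; simpa using hrz

theorem next_qc (F : Fam d Y Γ κ Θ) (w : Windmill d Y Γ κ y W I) (hΘ : 1000 * κ ≤ Θ)
    {p q z : G} (hp : p ∈ nextSet d Y Γ W I) (hq : q ∈ nextSet d Y Γ W I)
    (hz : d p z + d z q = d p q) : ∃ r ∈ nextSet d Y Γ W I, d z r ≤ 400000 := by
  obtain ⟨g, hg, p, hp, rfl⟩ := hp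
  obtain ⟨g', hg', q, hq, rfl⟩ := hq
  have hA := w.alt_of_mem F (mul_mem (inv_mem hg) hg') hq
  have hinv : ∀ u v, d (g⁻¹ * u) (g⁻¹ * v) = d u v := F.inv g⁻¹
  have h1 := hinv (g * p) z
  have h2 := hinv z (g' * q)
  have h3 := hinv (g * p) (g' * q)
  rw [inv_mul_cancel_left] at h1 h3
  suffices ∃ r ∈ nextSet d Y Γ W I, d (g⁻¹ * z) r ≤ 400000 by
    obtain ⟨r, hr, hrz⟩ := this
    refine ⟨g * r, next_mul hg hr, ?_⟩
    rw [← hinv]; simpa using hrz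
  simp only [← mul_assoc] at h1 h2 h3
  generalize g⁻¹ * g' * q = q₁ at *
  generalize g⁻¹ * z = z₁ at *
  have hz₁ : d p z₁ + d z₁ q₁ = d p q₁ := by omega
  have hself : d p p + d p q₁ ≤ d p q₁ + 100000 := by simp [F.met.self]
  have hself' : d p p ≤ d p z₁ := by simp [F.met.self]
  rcases hp with hp | ⟨b, hb, hpb⟩
  · exact w.alt_qc F hΘ hA p
      (fun c hc _ v hv => (w.proj_new F hc hp hv).trans (by omega)) p (Or.inl hp) hself z₁
      hz₁ hself'
  · have hbb : ∀ p₁ ∈ Y b, ∀ c ∈ newIdx d Y W I, some b ≠ some c → ∀ v ∈ W,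
        prDist d Y c p₁ v ≤ 14 * κ := fun p₁ hp₁ c hc hbc v hv =>
      (w.proj_new_mem F hc hb (fun h => hbc (by rw [h])) hp₁ hv).trans (by omega)
    have hph : ∀ p₁ ∈ Y b, p₁ ∈ hub d Y W I := fun p₁ hp₁ => Or.inr ⟨b, hb, hp₁⟩
    rcases alt_split hA b with h | ⟨_, h⟩ | ⟨s, hs, hs1, q₂, h, rfl⟩
    · exact w.alt_qc F hΘ h p (hbb p hpb) p (hph p hpb) hself z₁ hz₁ hself'
    · obtain ⟨r, hr, hrz⟩ := F.qc b p hpb q₁ h z₁ hz₁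
      exact ⟨r, hub_sub_next (hph r hr), by omega⟩
    · have hsinv : ∀ u v, d (s⁻¹ * u) (s⁻¹ * v) = d u v := F.inv s⁻¹
      have hq' : s⁻¹ * (s * q₂) = q₂ := by simp
      have hm := F.mem_of_rot (inv_mem hs) hpb
      obtain ⟨r, hr, hrz⟩ := w.alt_qc F hΘ h (s⁻¹ * p) (hbb _ hm) (s⁻¹ * p) (hph _ hm)
        (by simp [F.met.self]) (s⁻¹ * z₁) (by rw [← hq', hsinv, hsinv, hsinv]; exact hz₁)
        (by simp [F.met.self])
      refine ⟨s * r, next_mul (mem_rotGroup_new hb hs) hr, ?_⟩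
      rw [← F.inv s⁻¹]; simpa using hrz

theorem hub_proj (F : Fam d Y Γ κ Θ) (w : Windmill d Y Γ κ y W I) {b : ι}
    (hb : b ∉ I ∪ newIdx d Y W I) {p q : G} (hp : p ∈ hub d Y W I) (hq : q ∈ hub d Y W I) :
    prDist d Y b p q ≤ 3 * κ := by
  have hk := F.large
  have hbI : b ∉ I := fun h => hb (Or.inl h)
  have hW : ∀ v ∈ W, ∀ v' ∈ W, prDist d Y b v v' ≤ 100000 := by
    intro v hv v' hv'
    by_contra hc
    obtain ⟨t, ht, htz⟩ := F.met.near_interval (F.near_pr_left (a := b) (x := v) (z := v')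
      (by omega))
    obtain ⟨r, hr, hrt⟩ := w.qc v hv v' hv' t ht
    exact hb (Or.inr ⟨hbI, _, F.pr_mem b v, r, hr,
      by have := F.met.tri (pr d Y b v) t r; omega⟩)
  have hH : ∀ x ∈ hub d Y W I, ∃ v ∈ W, prDist d Y b x v ≤ κ + 700000 := by
    rintro x (⟨v, hv, hd⟩ | ⟨c, hc, hx⟩)
    · exact ⟨v, hv, by have := F.prDist_le b x v; omega⟩
    · obtain ⟨x', hx', v, hv, hd⟩ := hc.2
      refine ⟨v, hv, ?_⟩
      have h1 := F.overlap b c (fun h => hb (h ▸ Or.inr hc)) x hx x' hx'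
      have h2 := F.prDist_le b x' v
      have h3 := F.prDist_tri b x x' v
      omega
  obtain ⟨v, hv, h1⟩ := hH p hp
  obtain ⟨v', hv', h2⟩ := hH q hq
  have h3 := hW v hv v' hv'
  have h4 := F.prDist_tri b p v q
  have h5 := F.prDist_tri b v v' q
  have h6 := F.prDist_symm b v' q
  omega

theorem smul_nextIdx {g : G} (hg : g ∈ rotGroup Γ (I ∪ newIdx d Y W I)) {b : ι}
    (hb : b ∉ nextIdx d Y Γ W I) : g • b ∉ nextIdx d Y Γ W I := by
  rintro ⟨g', hg', a, ha, h⟩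
  exact hb ⟨g⁻¹ * g', mul_mem (inv_mem hg) hg', a, ha, by rw [mul_smul, ← h, inv_smul_smul]⟩

theorem sub_nextIdx {a : ι} (ha : a ∈ I ∪ newIdx d Y W I) : a ∈ nextIdx d Y Γ W I :=
  ⟨1, one_mem _, a, ha, by simp⟩

theorem alt_far (F : Fam d Y Γ κ Θ) (w : Windmill d Y Γ κ y W I) (hΘ : 1000 * κ ≤ Θ)
    {b : Option ι} {q : G} (h : Alt d Y Γ W I b q) :
    ∀ p, (∀ c ∈ newIdx d Y W I, b ≠ some c → ∀ v ∈ W, prDist d Y c p v ≤ 14 * κ) →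
    ∀ e, e ∉ nextIdx d Y Γ W I → ∀ x ∈ hub d Y W I, prDist d Y e p x ≤ 2 * κ →
    prDist d Y e p q ≤ 10 * κ := by
  have hk := F.large
  have base : ∀ p q, q ∈ hub d Y W I → ∀ e, e ∉ nextIdx d Y Γ W I → ∀ x ∈ hub d Y W I,
      prDist d Y e p x ≤ 2 * κ → prDist d Y e p q ≤ 5 * κ := by
    intro p q hq e he x hx hpx
    have h1 := w.hub_proj F (fun h => he (sub_nextIdx h)) hx hq
    have h2 := F.prDist_tri e p x q
    omega
  induction h with
  | thick b q hq => 
    intro p _ e he x hx hpx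
    have := base p q (Or.inl hq) e he x hx hpx
    omega
  | mem b c q hc hb hq => 
    intro p _ e he x hx hpx
    have := base p q (Or.inr ⟨c, hc, hq⟩) e he x hx hpx
    omega
  | rot b c s q hc hb hs hs1 hq ih =>
    intro p hp e he x hx hpx
    have hec : e ≠ c := fun h => he (h ▸ sub_nextIdx (Or.inr hc))
    have hbig := w.proj_big F hΘ hc hs hs1 hq (hp c hc hb)
    have hv := F.pr_mem c p
    have hvh : pr d Y c p ∈ hub d Y W I := Or.inr ⟨c, hc, hv⟩
    have hy := F.pr_mem e p
    have htri := F.prDist_tri c p (pr d Y e p) (s * q)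
    have hsy := F.prDist_symm c (pr d Y e p) (s * q)
    by_cases hcase : 2 * κ < prDist d Y c (s * q) (pr d Y e p)
    · have h1 := F.behrstock hec.symm hy hv hcase
      have h2 := base p _ hvh e he x hx hpx
      have h3 := F.prDist_tri e p (pr d Y c p) (s * q)
      have h4 := F.prDist_symm e (pr d Y c p) (s * q)
      omega
    · have h1 := F.behrstock hec.symm hy hv (x := p) (by omega)
      have hsm := mem_rotGroup_new hc hs
      have h2 := ih (s⁻¹ * p) (fun c' hc' hcc v hv => w.proj_flip F hΘ hc' hc
        (fun h => hcc (by rw [h])) (inv_mem hs) (by simpa using hs1) (hp c hc hb) hv)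
        (s⁻¹ • e) (smul_nextIdx (inv_mem hsm) he) (s⁻¹ * pr d Y c p)
        (Or.inr ⟨c, hc, F.mem_of_rot (inv_mem hs) hv⟩) (by rw [F.prDist_smul]; exact h1)
      rw [← F.prDist_smul s] at h2
      simpa using h2

theorem next_proj (F : Fam d Y Γ κ Θ) (w : Windmill d Y Γ κ y W I) (hΘ : 1000 * κ ≤ Θ)
    {e : ι} (he : e ∉ nextIdx d Y Γ W I)
    {p q : G} (hp : p ∈ nextSet d Y Γ W I) (hq : q ∈ nextSet d Y Γ W I) :
    prDist d Y e p q ≤ 10 * κ := by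
  obtain ⟨g, hg, p, hp, rfl⟩ := hp
  obtain ⟨g', hg', q, hq, rfl⟩ := hq
  have hA := w.alt_of_mem F (mul_mem (inv_mem hg) hg') hq
  have he' := smul_nextIdx (inv_mem hg) he
  have h1 := F.prDist_smul g⁻¹ e (g * p) (g' * q)
  rw [inv_mul_cancel_left, ← mul_assoc] at h1
  rw [← h1]
  generalize g⁻¹ * g' * q = q₁ at *
  generalize g⁻¹ • e = e' at *
  have hself : ∀ e p, prDist d Y e p p ≤ 2 * κ := fun e p => by simp [F.prDist_self]
  rcases hp with hp | ⟨b, hb, hpb⟩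
  · exact w.alt_far F hΘ hA p
      (fun c hc _ v hv => (w.proj_new F hc hp hv).trans (by omega)) e' he' p (Or.inl hp)
      (hself _ _)
  · have hbb : ∀ p₁ ∈ Y b, ∀ c ∈ newIdx d Y W I, some b ≠ some c → ∀ v ∈ W,
        prDist d Y c p₁ v ≤ 14 * κ := fun p₁ hp₁ c hc hbc v hv =>
      (w.proj_new_mem F hc hb (fun h => hbc (by rw [h])) hp₁ hv).trans (by omega)
    have hph : ∀ p₁ ∈ Y b, p₁ ∈ hub d Y W I := fun p₁ hp₁ => Or.inr ⟨b, hb, hp₁⟩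
    rcases alt_split hA b with h | ⟨_, h⟩ | ⟨s, hs, hs1, q₂, h, rfl⟩
    · exact w.alt_far F hΘ h p (hbb p hpb) e' he' p (hph p hpb) (hself _ _)
    · exact (w.hub_proj F (fun h => he' (sub_nextIdx h)) (hph _ hpb) (hph _ h)).trans (by omega)
    · have hm := F.mem_of_rot (inv_mem hs) hpb
      have h2 := w.alt_far F hΘ h (s⁻¹ * p) (hbb _ hm) (s⁻¹ • e')
        (smul_nextIdx (inv_mem (mem_rotGroup_new hb hs)) he') (s⁻¹ * p) (hph _ hm) (hself _ _)
      rw [← F.prDist_smul s] at h2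
      simpa using h2

theorem rotGroup_next (F : Fam d Y Γ κ Θ) :
    rotGroup Γ (nextIdx d Y Γ W I) = rotGroup Γ (I ∪ newIdx d Y W I) := by
  apply le_antisymm
  · refine (Subgroup.closure_le _).2 ?_
    rintro s ⟨_, ⟨g, hg, a, ha, rfl⟩, hs⟩
    have h1 := F.conj g⁻¹ _ _ hs
    rw [inv_smul_smul, inv_inv] at h1
    have h2 : g⁻¹ * s * g ∈ rotGroup Γ (I ∪ newIdx d Y W I) :=
      Subgroup.subset_closure ⟨a, ha, h1⟩
    have h3 := mul_mem (mul_mem hg h2) (inv_mem hg)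
    simpa [mul_assoc] using h3
  · exact rotGroup_mono fun a ha => sub_nextIdx ha

theorem next (F : Fam d Y Γ κ Θ) (w : Windmill d Y Γ κ y W I) (hΘ : 1000 * κ ≤ Θ) :
    Windmill d Y Γ κ y (nextSet d Y Γ W I) (nextIdx d Y Γ W I) where
  invW m hm x hx := by rw [rotGroup_next F] at hm; exact next_mul hm hx
  invI m hm a ha := by
    rw [rotGroup_next F] at hm
    obtain ⟨g, hg, b, hb, rfl⟩ := ha
    exact ⟨m * g, mul_mem hm hg, b, hb, by rw [mul_smul]⟩
  base := hub_sub_next (Or.inl (sub_thick F w.base))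
  sub := by
    rintro _ ⟨g, hg, a, ha, rfl⟩ x hx
    have h1 := F.equiv g⁻¹ _ x hx
    rw [inv_smul_smul] at h1
    refine ⟨g, hg, g⁻¹ * x, ?_, by simp⟩
    rcases ha with ha | ha
    · exact Or.inl (sub_thick F (w.sub a ha h1))
    · exact Or.inr ⟨a, ha, h1⟩
  qc p hp q hq z hz := w.next_qc F hΘ hp hq hz
  proj b hb p hp q hq := w.next_proj F hΘ hb hp hq
  red m hm := by
    rw [rotGroup_next F] at hm
    simpa using w.red_galt F hΘ (w.galt_of_mem F hm) 1 (one_mem _)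

theorem init (F : Fam d Y Γ κ Θ) (y : G) : Windmill d Y Γ κ y {y} ∅ where
  invW m hm x hx := by
    have : m = 1 := by simpa [rotGroup] using hm
    simpa [this] using hx
  invI m _ a ha := ha.elim
  base := rfl
  sub a ha := ha.elim
  qc := by
    rintro p rfl q rfl z hz
    refine ⟨_, rfl, ?_⟩
    have := F.met.self q
    omega
  proj := by
    rintro b - p rfl q rfl
    simp [F.prDist_self]
  red m hm := by
    have : m = 1 := by simpa [rotGroup] using hm
    rw [this]; exact .one

end Windmill

/-- Every element of the group generated by all the rotations reduces to `1`. -/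
theorem red_of_mem (F : Fam d Y Γ κ Θ) (hΘ : 1000 * κ ≤ Θ) {h : G}
    (hh : h ∈ rotGroup Γ Set.univ) (y : G) : Red d Y Γ κ y h := by
  have key : ∀ k : ℕ, ∃ W I, Windmill d Y Γ κ y W I ∧ (∀ x, d x y ≤ k → x ∈ W) ∧
      ∀ a, ∀ x ∈ Y a, d x y ≤ k → a ∈ I := by
    have aux : ∀ k : ℕ, ∃ W I, Windmill d Y Γ κ y W I ∧ ∀ x, d x y ≤ k → x ∈ W := by
      intro k
      induction k with
      | zero =>
        refine ⟨_, _, (Windmill.init F y).next F hΘ, fun x hx => Windmill.hub_sub_next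
          (Or.inl ⟨y, rfl, by omega⟩)⟩
      | succ k ih =>
        obtain ⟨W, I, w, hW⟩ := ih
        refine ⟨_, _, w.next F hΘ, fun x hx => Windmill.hub_sub_next (Or.inl ?_)⟩
        obtain ⟨z, h1, h2⟩ := F.met.geod x y (min 1 (d x y)) (min_le_right _ _)
        exact ⟨z, hW z (by omega), by omega⟩
    intro k
    obtain ⟨W, I, w, hW⟩ := aux k
    refine ⟨_, _, w.next F hΘ, fun x hx => Windmill.hub_sub_next
      (Or.inl (Windmill.sub_thick F (hW x hx))), fun a x hx hxy => ?_⟩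
    by_cases ha : a ∈ I
    · exact Windmill.sub_nextIdx (Or.inl ha)
    · exact Windmill.sub_nextIdx (Or.inr ⟨ha, x, hx, x, hW x hxy, by simp [F.met.self]⟩)
  have bdd : ∃ k : ℕ, ∀ I : Set ι, (∀ a, ∀ x ∈ Y a, d x y ≤ k → a ∈ I) → h ∈ rotGroup Γ I := by
    refine Subgroup.closure_induction (p := fun h _ => ∃ k : ℕ, ∀ I : Set ι,
      (∀ a, ∀ x ∈ Y a, d x y ≤ k → a ∈ I) → h ∈ rotGroup Γ I) ?_ ?_ ?_ ?_ hh
    · rintro s ⟨a, -, hs⟩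
      obtain ⟨x, hx⟩ := F.nonempty a
      exact ⟨d x y, fun I hI => Subgroup.subset_closure ⟨a, hI a x hx le_rfl, hs⟩⟩
    · exact ⟨0, fun I _ => one_mem _⟩
    · rintro g g' - - ⟨k, hk⟩ ⟨k', hk'⟩
      refine ⟨max k k', fun I hI => mul_mem (hk I fun a x hx h => hI a x hx ?_)
        (hk' I fun a x hx h => hI a x hx ?_)⟩ <;> omega
    · rintro g - ⟨k, hk⟩
      exact ⟨k, fun I hI => inv_mem (hk I hI)⟩
  obtain ⟨k, hk⟩ := bdd
  obtain ⟨W, I, w, -, hI⟩ := key k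
  exact w.red h (hk I hI)

end Windmill

/-! ### Graph metrics -/

section Graph

variable {X : Type*}

/-- `Walk E S n x y`: there is a walk of length `n` from `x` to `y` inside `S`. -/
def Walk (E : X → X → Prop) (S : Set X) : ℕ → X → X → Prop
  | 0, x, y => x = y ∧ x ∈ S
  | n + 1, x, y => ∃ w, Walk E S n x w ∧ E w y ∧ y ∈ S

/-- The graph distance. -/
noncomputable def graphDist (E : X → X → Prop) (x y : X) : ℕ := sInf {n | Walk E Set.univ n x y}

variable {E : X → X → Prop} {S T : Set X}

theorem Walk.mem_right {n : ℕ} {x y : X} (h : Walk E S n x y) : y ∈ S := by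
  cases n with
  | zero => exact h.1 ▸ h.2
  | succ n => obtain ⟨w, -, -, h⟩ := h; exact h

theorem Walk.mono (hST : S ⊆ T) {n : ℕ} {x y : X} (h : Walk E S n x y) : Walk E T n x y := by
  induction n generalizing y with
  | zero => exact ⟨h.1, hST h.2⟩
  | succ n ih => obtain ⟨w, h1, h2, h3⟩ := h; exact ⟨w, ih h1, h2, hST h3⟩

theorem Walk.trans {m n : ℕ} {x y z : X} (h : Walk E S m x y) (h' : Walk E S n y z) :
    Walk E S (m + n) x z := by
  induction n generalizing z with
  | zero => exact h'.1 ▸ h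
  | succ n ih => obtain ⟨w, h1, h2, h3⟩ := h'; exact ⟨w, ih h1, h2, h3⟩

theorem Walk.split {m n : ℕ} {x z : X} (h : Walk E S (m + n) x z) :
    ∃ y, Walk E S m x y ∧ Walk E S n y z := by
  induction n generalizing z with
  | zero => exact ⟨z, h, rfl, h.mem_right⟩
  | succ n ih =>
    obtain ⟨w, h1, h2, h3⟩ := h
    obtain ⟨y, h4, h5⟩ := ih h1
    exact ⟨y, h4, w, h5, h2, h3⟩

theorem Walk.symm (hE : ∀ x y, E x y → E y x) {n : ℕ} {x y : X} (h : Walk E S n x y) :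
    Walk E S n y x := by
  induction n generalizing y with
  | zero => exact ⟨h.1.symm, h.1 ▸ h.2⟩
  | succ n ih =>
    have hy := h.mem_right
    obtain ⟨w, h1, h2, h3⟩ := h
    have h4 : Walk E S 1 y w := ⟨y, ⟨rfl, hy⟩, hE _ _ h2, h1.mem_right⟩
    rw [Nat.add_comm]
    exact h4.trans (ih h1)

theorem Walk.left_mem (hE : ∀ x y, E x y → E y x) {n : ℕ} {x y : X} (h : Walk E S n x y) :
    x ∈ S := (h.symm hE).mem_right

/-- The properties of an adjacency relation that are needed for its graph distance to be a
geodesic metric. -/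
structure IsGraph (E : X → X → Prop) : Prop where
  refl : ∀ x, E x x
  symm : ∀ x y, E x y → E y x
  conn : ∀ x y, ∃ n, Walk E Set.univ n x y

namespace IsGraph

theorem walk (hE : IsGraph E) (x y : X) : Walk E Set.univ (graphDist E x y) x y :=
  Nat.sInf_mem (hE.conn x y)

theorem le_of_walk {n : ℕ} {x y : X} (h : Walk E S n x y) : graphDist E x y ≤ n :=
  Nat.sInf_le (h.mono (Set.subset_univ S))

theorem dist_self (x : X) : graphDist E x x = 0 :=
  Nat.le_zero.1 (le_of_walk (S := Set.univ) ⟨rfl, trivial⟩)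

theorem dist_symm (hE : IsGraph E) (x y : X) : graphDist E x y = graphDist E y x :=
  le_antisymm (le_of_walk ((hE.walk y x).symm hE.symm)) (le_of_walk ((hE.walk x y).symm hE.symm))

theorem dist_tri (hE : IsGraph E) (x y z : X) :
    graphDist E x z ≤ graphDist E x y + graphDist E y z :=
  le_of_walk ((hE.walk x y).trans (hE.walk y z))

theorem dist_sep (hE : IsGraph E) {x y : X} (h : graphDist E x y = 0) : x = y := by
  have := hE.walk x y
  rw [h] at this
  exact this.1

theorem dist_le_one {x y : X} (h : E x y) : graphDist E x y ≤ 1 :=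
  le_of_walk (S := Set.univ) ⟨x, ⟨rfl, trivial⟩, h, trivial⟩

theorem adj (hE : IsGraph E) {x y : X} (h : graphDist E x y ≤ 1) : E x y := by
  rcases Nat.le_one_iff_eq_zero_or_eq_one.1 h with h | h
  · rw [hE.dist_sep h]; exact hE.refl y
  · have := hE.walk x y
    rw [h] at this
    obtain ⟨w, ⟨h1, -⟩, h2, -⟩ := this
    rwa [h1]

/-- Geodesics as functions. -/
theorem exists_geodesic (hE : IsGraph E) (x y : X) :
    ∃ f : ℕ → X, f 0 = x ∧ f (graphDist E x y) = y ∧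
      ∀ i j, i ≤ j → j ≤ graphDist E x y → graphDist E (f i) (f j) = j - i := by
  have key : ∀ n, ∀ y, Walk E Set.univ n x y →
      ∃ f : ℕ → X, f 0 = x ∧ f n = y ∧ ∀ i, i < n → E (f i) (f (i + 1)) := by
    intro n
    induction n with
    | zero => exact fun y h => ⟨fun _ => x, rfl, h.1, by simp⟩
    | succ n ih =>
      rintro y ⟨w, h1, h2, -⟩
      obtain ⟨f, h3, h4, h5⟩ := ih w h1
      refine ⟨Function.update f (n + 1) y, by simpa using h3, by simp, fun i hi => ?_⟩
      rcases Nat.lt_succ_iff_lt_or_eq.1 hi with hi | rfl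
      · rw [Function.update_of_ne (by omega), Function.update_of_ne (by omega)]
        exact h5 i hi
      · rw [Function.update_of_ne (by omega), Function.update_self, h4]
        exact h2
  obtain ⟨f, h1, h2, h3⟩ := key _ y (hE.walk x y)
  have hle : ∀ i j, i ≤ j → j ≤ graphDist E x y → graphDist E (f i) (f j) ≤ j - i := by
    intro i j hij
    induction j, hij using Nat.le_induction with
    | base => simp [dist_self]
    | succ j hij ih =>
      intro hj
      have h4 := ih (by omega)
      have h5 := dist_le_one (h3 j (by omega))
      have h6 := hE.dist_tri (f i) (f j) (f (j + 1))
      omega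
  refine ⟨f, h1, h2, fun i j hij hj => ?_⟩
  have h4 := hle 0 i (by omega) (by omega)
  have h5 := hle i j hij hj
  have h6 := hle j _ hj le_rfl
  have h7 := hE.dist_tri (f 0) (f i) (f (graphDist E x y))
  have h8 := hE.dist_tri (f i) (f j) (f (graphDist E x y))
  rw [h1, h2] at h7
  rw [h2] at h6 h8
  rw [h1] at h4
  omega

theorem dist_geod (hE : IsGraph E) (x y : X) (k : ℕ) (hk : k ≤ graphDist E x y) :
    ∃ z, graphDist E x z = k ∧ k + graphDist E z y = graphDist E x y := by
  obtain ⟨f, h1, h2, h3⟩ := hE.exists_geodesic x y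
  have h4 := h3 0 k (by omega) hk
  have h5 := h3 k _ hk le_rfl
  rw [h1] at h4
  rw [h2] at h5
  exact ⟨f k, by omega, by omega⟩

theorem walk_geodesic (hE : IsGraph E) {f : ℕ → X} {n : ℕ}
    (hf : ∀ i j, i ≤ j → j ≤ n → graphDist E (f i) (f j) = j - i) {i j : ℕ} (hij : i ≤ j)
    (hj : j ≤ n) : Walk E {x | ∃ k ≤ n, x = f k} (j - i) (f i) (f j) := by
  induction j, hij using Nat.le_induction with
  | base => rw [Nat.sub_self]; exact ⟨rfl, i, hj, rfl⟩
  | succ j hij ih =>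
    rw [Nat.succ_sub hij]
    exact ⟨f j, ih (by omega), hE.adj (by rw [hf j (j + 1) (by omega) hj]; omega), j + 1, hj, rfl⟩

theorem walk_ball (hE : IsGraph E) {x y : X} :
    Walk E {v | graphDist E x v ≤ graphDist E x y} (graphDist E x y) x y := by
  obtain ⟨f, h1, h2, h3⟩ := hE.exists_geodesic x y
  have := (hE.walk_geodesic h3 (Nat.zero_le _) le_rfl).mono
    (T := {v | graphDist E x v ≤ graphDist E x y}) (by
      rintro _ ⟨k, hk, rfl⟩
      have := h3 0 k (by omega) hk
      rw [h1] at this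
      simp only [Set.mem_ofPred_eq]
      omega)
  rwa [h1, h2, Nat.sub_zero] at this

end IsGraph

/-- A discrete intermediate value theorem. -/
theorem exists_first {p : ℕ → Prop} {n : ℕ} (h0 : ¬ p 0) (hn : p n) :
    ∃ k < n, ¬ p k ∧ p (k + 1) := by
  induction n with
  | zero => exact absurd hn h0
  | succ n ih =>
    by_cases h : p n
    · obtain ⟨k, hk, h1⟩ := ih h
      exact ⟨k, by omega, h1⟩
    · exact ⟨n, by omega, h, hn⟩

/-- Slim triangles imply the four-point condition. -/
theorem IsGraph.hypMet_of_slim (hE : IsGraph E)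
    (hs : ∀ x y z w, graphDist E x z + graphDist E z y = graphDist E x y →
      (∃ v, graphDist E x v + graphDist E v w = graphDist E x w ∧ graphDist E z v ≤ 30) ∨
      ∃ v, graphDist E w v + graphDist E v y = graphDist E w y ∧ graphDist E z v ≤ 30) :
    HypMet (graphDist E) where
  self := dist_self
  symm := hE.dist_symm
  tri := hE.dist_tri
  geod := hE.dist_geod
  hyp x y z t := by
    obtain ⟨f, h1, h2, h3⟩ := hE.exists_geodesic x z
    generalize hD : graphDist E = D at *
    have symm := hE.dist_symm
    have tri := hE.dist_tri
    rw [hD] at symm tri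
    have self : ∀ x, D x x = 0 := hD ▸ dist_self
    have key : ∀ w, ∃ i ≤ D x z, D x (f i) + D (f i) w ≤ D x w + 62 ∧
        D w (f i) + D (f i) z ≤ D w z + 62 := by
      intro w
      by_cases hP : ∃ v, D w v + D v z = D w z ∧ D (f 0) v ≤ 30
      · obtain ⟨v, hv1, hv2⟩ := hP
        refine ⟨0, by omega, ?_, ?_⟩
        · rw [h1, self]; omega
        · have := tri w v (f 0)
          have := tri (f 0) v z
          have := symm v (f 0)
          omega
      · obtain ⟨k, hk, hk1, hk2⟩ := exists_first (n := D x z)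
          (p := fun i => ∃ v, D w v + D v z = D w z ∧ D (f i) v ≤ 30) hP
          ⟨z, by rw [self, add_zero], by rw [h2, self]; omega⟩
        have h4 := h3 0 k (by omega) hk.le
        have h5 := h3 k _ hk.le le_rfl
        rw [h1] at h4
        rw [h2] at h5
        rcases hs x z (f k) w (by omega) with ⟨v, hv1, hv2⟩ | ⟨v, hv1, hv2⟩
        · obtain ⟨v', hv3, hv4⟩ := hk2
          have h6 := h3 k (k + 1) (by omega) hk
          refine ⟨k, hk.le, ?_, ?_⟩
          · have := tri x v (f k)
            have := tri (f k) v w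
            have := symm v (f k)
            omega
          · have := tri (f k) (f (k + 1)) v'
            have := tri w v' (f k)
            have := tri (f k) v' z
            have := symm v' (f k)
            omega
        · exact absurd ⟨v, hv1, hv2⟩ hk1
    obtain ⟨i, hi, hi1, hi2⟩ := key y
    obtain ⟨j, hj, hj1, hj2⟩ := key t
    have a1 := h3 0 i (by omega) hi
    have a2 := h3 i _ hi le_rfl
    have a3 := h3 0 j (by omega) hj
    have a4 := h3 j _ hj le_rfl
    rw [h1] at a1 a3
    rw [h2] at a2 a4
    have b1 := symm t z
    have b2 := symm y (f i)
    have b3 := symm t (f j)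
    have b4 := symm x t
    have b5 := tri y (f i) (f j)
    have b6 := tri y (f j) t
    rcases le_total i j with hij | hij
    · have a5 := h3 i j hij hj
      right; omega
    · have a5 := h3 j i hij hi
      have b7 := symm (f i) (f j)
      left; omega

end Graph

/-! ### The cone-off metric -/

section Cone

variable {G ι : Type*} [Group G] [MulAction G ι]

/-- Adjacency in the coned-off graph. -/
def coneAdj (d : G → G → ℕ) (Y : ι → Set G) (κ : ℕ) (x y : G) : Prop :=
  d x y ≤ κ ∨ ∃ a, x ∈ Y a ∧ y ∈ Y a

/-- The cone-off metric. -/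
noncomputable def coneDist (d : G → G → ℕ) (Y : ι → Set G) (κ : ℕ) : G → G → ℕ :=
  graphDist (coneAdj d Y κ)

variable {d : G → G → ℕ} {Y : ι → Set G} {Γ : ι → Subgroup G} {κ Θ : ℕ}

namespace Fam

theorem cone_of_le (_F : Fam d Y Γ κ Θ) {x y : G} (h : d x y ≤ κ) : coneDist d Y κ x y ≤ 1 :=
  IsGraph.dist_le_one (Or.inl h)

theorem cone_of_mem (_F : Fam d Y Γ κ Θ) {a : ι} {x y : G} (hx : x ∈ Y a) (hy : y ∈ Y a) :
    coneDist d Y κ x y ≤ 1 :=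
  IsGraph.dist_le_one (Or.inr ⟨a, hx, hy⟩)

theorem walk_of_le (F : Fam d Y Γ κ Θ) (k : ℕ) {x y : G} (h : d x y ≤ κ * (k + 1)) :
    Walk (coneAdj d Y κ) Set.univ (k + 1) x y := by
  induction k generalizing y with
  | zero => exact ⟨x, ⟨rfl, trivial⟩, Or.inl (by simpa using h), trivial⟩
  | succ k ih =>
    obtain ⟨z, h1, h2⟩ := F.met.geod x y (min (κ * (k + 1)) (d x y)) (min_le_right _ _)
    refine ⟨z, ih (by omega), Or.inl ?_, trivial⟩
    rw [Nat.mul_add] at h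
    omega

theorem cone_le (F : Fam d Y Γ κ Θ) {k : ℕ} (hk : 1 ≤ k) {x y : G} (h : d x y ≤ κ * k) :
    coneDist d Y κ x y ≤ k := by
  obtain ⟨k, rfl⟩ : ∃ j, k = j + 1 := ⟨k - 1, by omega⟩
  exact IsGraph.le_of_walk (F.walk_of_le k h)

theorem isGraph (F : Fam d Y Γ κ Θ) : IsGraph (coneAdj d Y κ) where
  refl x := Or.inl (by simp [F.met.self])
  symm x y h := by
    rcases h with h | ⟨a, h1, h2⟩
    · exact Or.inl (by rwa [F.met.symm])
    · exact Or.inr ⟨a, h2, h1⟩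
  conn x y := ⟨d x y + 1, F.walk_of_le (d x y) (by
    have := F.large
    calc d x y ≤ 1 * (d x y + 1) := by omega
      _ ≤ κ * (d x y + 1) := Nat.mul_le_mul_right _ (by omega))⟩

theorem cone_tri (F : Fam d Y Γ κ Θ) (x y z : G) :
    coneDist d Y κ x z ≤ coneDist d Y κ x y + coneDist d Y κ y z := F.isGraph.dist_tri x y z

theorem cone_symm (F : Fam d Y Γ κ Θ) (x y : G) : coneDist d Y κ x y = coneDist d Y κ y x :=
  F.isGraph.dist_symm x y

theorem cone_self (d : G → G → ℕ) (Y : ι → Set G) (κ : ℕ) (x : G) : coneDist d Y κ x x = 0 :=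
  IsGraph.dist_self x

theorem coneAdj_smul (F : Fam d Y Γ κ Θ) (g x y : G) :
    coneAdj d Y κ (g * x) (g * y) ↔ coneAdj d Y κ x y := by
  unfold coneAdj
  rw [F.inv]
  refine or_congr Iff.rfl ⟨fun ⟨a, h1, h2⟩ => ⟨g⁻¹ • a, ?_, ?_⟩, fun ⟨a, h1, h2⟩ =>
    ⟨g • a, F.equiv g a x h1, F.equiv g a y h2⟩⟩
  · simpa using F.equiv g⁻¹ a _ h1
  · simpa using F.equiv g⁻¹ a _ h2

theorem cone_inv (F : Fam d Y Γ κ Θ) (g x y : G) :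
    coneDist d Y κ (g * x) (g * y) = coneDist d Y κ x y := by
  have key : ∀ g n x y, Walk (coneAdj d Y κ) Set.univ n x y →
      Walk (coneAdj d Y κ) Set.univ n (g * x) (g * y) := by
    intro g n
    induction n with
    | zero => rintro x y ⟨rfl, -⟩; exact ⟨rfl, trivial⟩
    | succ n ih =>
      rintro x y ⟨w, h1, h2, -⟩
      exact ⟨g * w, ih x w h1, (F.coneAdj_smul g w y).2 h2, trivial⟩
  refine le_antisymm (IsGraph.le_of_walk (key g _ _ _ (F.isGraph.walk x y))) ?_
  have := IsGraph.le_of_walk (key g⁻¹ _ _ _ (F.isGraph.walk (g * x) (g * y)))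
  rw [inv_mul_cancel_left, inv_mul_cancel_left] at this
  exact this

theorem interval_of_adj (F : Fam d Y Γ κ Θ) {x y z : G} (h : coneAdj d Y κ x y)
    (hz : d x z + d z y = d x y) : coneDist d Y κ z x ≤ 2 := by
  have hk := F.large
  rcases h with h | ⟨a, h1, h2⟩
  · have := F.cone_of_le (x := z) (y := x) (by rw [F.met.symm]; omega)
    omega
  · obtain ⟨w, hw, hd⟩ := F.qc a x h1 y h2 z hz
    have h3 := F.cone_of_le (x := z) (y := w) (by omega)
    have h4 := F.cone_of_mem hw h1
    have h5 := F.cone_tri z w x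
    omega

/-- Intervals of `d` are logarithmically close to paths in the coned-off graph. -/
theorem walk_log (F : Fam d Y Γ κ Θ) {S : Set G} (j : ℕ) : ∀ {n : ℕ} {x y z : G},
    Walk (coneAdj d Y κ) S n x y → n ≤ 2 ^ j → d x z + d z y = d x y →
    ∃ s ∈ S, coneDist d Y κ z s ≤ j + 2 := by
  have hk := F.large
  induction j with
  | zero =>
    intro n x y z h hn hz
    have hx := h.left_mem F.isGraph.symm
    have h1 : graphDist (coneAdj d Y κ) x y ≤ 1 := (IsGraph.le_of_walk h).trans (by simpa using hn)
    exact ⟨x, hx, F.interval_of_adj (F.isGraph.adj h1) hz⟩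
  | succ j ih =>
    intro n x y z h hn hz
    obtain ⟨m, hm⟩ : ∃ m, n = min n (2 ^ j) + m := ⟨n - min n (2 ^ j), by omega⟩
    rw [hm] at h
    obtain ⟨w, h1, h2⟩ := h.split
    rw [pow_succ] at hn
    rcases F.met.thin hz w with ⟨v, hv, hzv⟩ | ⟨v, hv, hzv⟩
    · obtain ⟨s, hs, hvs⟩ := ih h1 (by omega) hv
      have h3 := F.cone_of_le (x := z) (y := v) (by omega)
      have h4 := F.cone_tri z v s
      exact ⟨s, hs, by omega⟩
    · obtain ⟨s, hs, hvs⟩ := ih h2 (by omega) hv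
      have h3 := F.cone_of_le (x := z) (y := v) (by omega)
      have h4 := F.cone_tri z v s
      exact ⟨s, hs, by omega⟩

/-- A discrete geodesic for `d` with controlled steps. -/
theorem exists_path (F : Fam d Y Γ κ Θ) (x z : G) :
    ∃ w : ℕ → G, w 0 = x ∧ d (w (d x z)) z = 0 ∧
      (∀ k, k ≤ d x z → d x (w k) = k ∧ k + d (w k) z = d x z) ∧
      ∀ k, k < d x z → d (w k) (w (k + 1)) ≤ 301 := by
  have hw : ∀ k, ∃ w, (k = 0 → w = x) ∧ (k ≤ d x z → d x w = k ∧ k + d w z = d x z) := fun k => by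
    by_cases h0 : k = 0
    · exact ⟨x, fun _ => rfl, fun _ => by simp [h0, F.met.self]⟩
    by_cases hk : k ≤ d x z
    · obtain ⟨w, h1, h2⟩ := F.met.geod x z k hk
      exact ⟨w, fun h => absurd h h0, fun _ => ⟨h1, h2⟩⟩
    · exact ⟨x, fun _ => rfl, fun h => absurd h hk⟩
  choose w hw0 hw using hw
  refine ⟨w, hw0 0 rfl, ?_, hw, fun k hk => ?_⟩
  · have := hw _ le_rfl
    omega
  · have h1 := hw k (by omega)
    have h2 := hw (k + 1) (by omega)
    have h3 := F.met.hyp x (w k) z (w (k + 1))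
    have h4 := F.met.symm z (w (k + 1))
    omega

theorem far_point (F : Fam d Y Γ κ Θ) (x z : G) {t : ℕ} (ht : 1 ≤ t) :
    ∃ x', d x x' + d x' z = d x z ∧ coneDist d Y κ x' z ≤ t + 1 ∧
      (x' = x ∨ t ≤ coneDist d Y κ x' z) := by
  have hk := F.large
  by_cases h : coneDist d Y κ x z ≤ t
  · exact ⟨x, by simp [F.met.self], by omega, Or.inl rfl⟩
  obtain ⟨w, hw0, hwn, hw, hs⟩ := F.exists_path x z
  obtain ⟨k, hk1, hk2, hk3⟩ := exists_first (n := d x z)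
    (p := fun k => coneDist d Y κ (w k) z ≤ t) (by rwa [hw0]) (by
      have h4 := F.cone_of_le (x := w (d x z)) (y := z) (by omega)
      omega)
  have h5 := hs k hk1
  have h6 := hw k hk1.le
  have h7 := F.cone_of_le (x := w k) (y := w (k + 1)) (by omega)
  have h8 := F.cone_tri (w k) (w (k + 1)) z
  exact ⟨w k, by omega, by omega, Or.inr (by omega)⟩

/-- Intervals of `d` are close to geodesics of the coned-off graph. -/
theorem interval_near_geodesic (F : Fam d Y Γ κ Θ) {f : ℕ → G} {n : ℕ}
    (hf : ∀ i j, i ≤ j → j ≤ n → coneDist d Y κ (f i) (f j) = j - i) {z : G}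
    (hz : d (f 0) z + d z (f n) = d (f 0) (f n)) : ∃ k ≤ n, coneDist d Y κ z (f k) ≤ 9 := by
  have hG := F.isGraph
  have step : ∀ T, 10 ≤ T → (∀ z, d (f 0) z + d z (f n) = d (f 0) (f n) →
      ∃ k ≤ n, coneDist d Y κ z (f k) ≤ T) → ∀ z, d (f 0) z + d z (f n) = d (f 0) (f n) →
      ∃ k ≤ n, coneDist d Y κ z (f k) ≤ T - 1 := by
    intro T hT H z hz
    obtain ⟨x', hx1, hx2, hx3⟩ := F.far_point (f 0) z (t := 2 * T) (by omega)
    obtain ⟨y', hy1, hy2, hy3⟩ := F.far_point (f n) z (t := 2 * T) (by omega)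
    have e1 := F.met.symm (f n) y'
    have e2 := F.met.symm y' z
    have e3 := F.met.symm (f n) z
    have e4 := F.cone_symm y' z
    have t1 := F.met.tri (f 0) x' (f n)
    have t2 := F.met.tri x' z (f n)
    have t3 := F.met.tri (f 0) y' (f n)
    have t4 := F.met.tri (f 0) z y'
    have t5 := F.met.tri (f 0) x' y'
    have t6 := F.met.tri x' z y'
    obtain ⟨i, hi, hxi⟩ : ∃ i ≤ n, coneDist d Y κ x' (f i) ≤ T ∧ (x' = f 0 → x' = f i) := by
      rcases hx3 with h | h
      · exact ⟨0, by omega, by rw [h, cone_self]; omega, fun h => h⟩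
      · obtain ⟨i, hi, h'⟩ := H x' (by omega)
        by_cases hx0 : x' = f 0
        · exact ⟨0, by omega, by rw [hx0, cone_self]; omega, fun h => h⟩
        · exact ⟨i, hi, h', fun h => absurd h hx0⟩
    obtain ⟨j, hj, hyj⟩ : ∃ j ≤ n, coneDist d Y κ y' (f j) ≤ T ∧ (y' = f n → y' = f j) := by
      by_cases hy0 : y' = f n
      · exact ⟨n, le_rfl, by rw [hy0, cone_self]; omega, fun h => h⟩
      · obtain ⟨j, hj, h'⟩ := H y' (by omega)
        exact ⟨j, hj, h', fun h => absurd h hy0⟩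
    obtain ⟨S, hS⟩ : ∃ S : Set G, S = {s | (∃ k ≤ n, s = f k) ∨
      (x' ≠ f 0 ∧ coneDist d Y κ x' s ≤ T) ∨ (y' ≠ f n ∧ coneDist d Y κ y' s ≤ T)} := ⟨_, rfl⟩
    have wx : Walk (coneAdj d Y κ) S (coneDist d Y κ x' (f i)) x' (f i) := by
      by_cases hx0 : x' = f 0
      · rw [← hxi.2 hx0, cone_self, hS]
        exact ⟨rfl, Or.inl ⟨0, by omega, hx0⟩⟩
      · refine hG.walk_ball.mono fun v hv => ?_
        rw [hS]
        exact Or.inr (Or.inl ⟨hx0, le_trans hv hxi.1⟩)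
    have wy : Walk (coneAdj d Y κ) S (coneDist d Y κ y' (f j)) y' (f j) := by
      by_cases hy0 : y' = f n
      · rw [← hyj.2 hy0, cone_self, hS]
        exact ⟨rfl, Or.inl ⟨n, le_rfl, hy0⟩⟩
      · refine hG.walk_ball.mono fun v hv => ?_
        rw [hS]
        exact Or.inr (Or.inr ⟨hy0, le_trans hv hyj.1⟩)
    have wf : ∃ l, l ≤ coneDist d Y κ (f i) (f j) ∧ Walk (coneAdj d Y κ) S l (f i) (f j) := by
      have hmono : {x | ∃ k ≤ n, x = f k} ⊆ S := fun v hv => by rw [hS]; exact Or.inl hv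
      rcases le_total i j with h | h
      · exact ⟨j - i, (hf i j h hj).ge, (hG.walk_geodesic hf h hj).mono hmono⟩
      · refine ⟨i - j, ?_, ((hG.walk_geodesic hf h hi).mono hmono).symm hG.symm⟩
        rw [F.cone_symm]; exact (hf j i h hi).ge
    obtain ⟨l, hl, wf⟩ := wf
    have c1 := F.cone_tri (f i) x' (f j)
    have c2 := F.cone_tri x' y' (f j)
    have c3 := F.cone_tri x' z y'
    have c4 := F.cone_symm (f i) x'
    obtain ⟨s, hs, hzs⟩ := F.walk_log (T - 3) (z := z) ((wx.trans wf).trans (wy.symm hG.symm)) (by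
      have : 8 * T + 2 ≤ 2 ^ (T - 3) := by
        obtain ⟨u, rfl⟩ : ∃ u, T = u + 10 := ⟨T - 10, by omega⟩
        clear * -
        induction u with
        | zero => norm_num
        | succ u ih =>
          have e : u + 1 + 10 - 3 = (u + 10 - 3) + 1 := by omega
          rw [e, pow_succ]
          omega
      omega) (by omega)
    rw [hS] at hs
    rcases hs with ⟨k, hk, rfl⟩ | ⟨h0, h⟩ | ⟨h0, h⟩
    · exact ⟨k, hk, by omega⟩
    · have := F.cone_tri x' s z
      have := F.cone_symm s z
      rcases hx3 with h3 | h3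
      · exact absurd h3 h0
      · omega
    · have := F.cone_tri y' s z
      have := F.cone_symm s z
      rcases hy3 with h3 | h3
      · exact absurd h3 h0
      · omega
  have key : ∀ T, (∀ z, d (f 0) z + d z (f n) = d (f 0) (f n) →
      ∃ k ≤ n, coneDist d Y κ z (f k) ≤ T + 9) → ∀ z, d (f 0) z + d z (f n) = d (f 0) (f n) →
      ∃ k ≤ n, coneDist d Y κ z (f k) ≤ 9 := by
    intro T
    induction T with
    | zero => exact fun h => by simpa using h
    | succ T ih => exact fun h => ih (step (T + 1 + 9) (by omega) h)
  refine key n (fun z hz => ?_) z hz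
  obtain ⟨s, ⟨k, hk, rfl⟩, hs⟩ := F.walk_log n (hG.walk_geodesic hf (Nat.zero_le n) le_rfl)
    (by simpa using Nat.lt_two_pow_self.le) hz
  exact ⟨k, hk, by omega⟩

theorem exists_cone_geodesic (F : Fam d Y Γ κ Θ) (x y : G) :
    ∃ f : ℕ → G, f 0 = x ∧ f (coneDist d Y κ x y) = y ∧
      ∀ i j, i ≤ j → j ≤ coneDist d Y κ x y → coneDist d Y κ (f i) (f j) = j - i :=
  F.isGraph.exists_geodesic x y

theorem exists_geodesic_through (F : Fam d Y Γ κ Θ) {x y v : G}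
    (hv : coneDist d Y κ x v + coneDist d Y κ v y = coneDist d Y κ x y) :
    ∃ f : ℕ → G, f 0 = x ∧ f (coneDist d Y κ x y) = y ∧ f (coneDist d Y κ x v) = v ∧
      ∀ i j, i ≤ j → j ≤ coneDist d Y κ x y → coneDist d Y κ (f i) (f j) = j - i := by
  obtain ⟨f, f1, f2, f3⟩ := F.exists_cone_geodesic x v
  obtain ⟨g, g1, g2, g3⟩ := F.exists_cone_geodesic v y
  obtain ⟨m, hm⟩ : ∃ m, m = coneDist d Y κ x v := ⟨_, rfl⟩
  rw [← hm] at f2 f3 hv ⊢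
  refine ⟨fun i => if i ≤ m then f i else g (i - m), by simp [f1], ?_, by simp [f2], ?_⟩
  · by_cases h : coneDist d Y κ x y ≤ m
    · have h0 : coneDist d Y κ v y = 0 := by omega
      have h1 : coneDist d Y κ x y = m := by omega
      simp [h1, f2, F.isGraph.dist_sep h0]
    · simp only [h, if_false]
      have e : coneDist d Y κ x y - m = coneDist d Y κ v y := by omega
      rw [e, g2]
  · intro i j hij hj
    by_cases hi : i ≤ m <;> by_cases hjm : j ≤ m
    · simp only [hi, hjm, if_true]; exact f3 i j hij hjm
    · simp only [hi, hjm, if_true, if_false]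
      have a1 := f3 0 i (by omega) hi
      have a2 := f3 i m hi le_rfl
      have a3 := g3 0 (j - m) (by omega) (by omega)
      have a4 := g3 (j - m) _ (by omega) le_rfl
      rw [f1] at a1; rw [f2] at a2; rw [g1] at a3; rw [g2] at a4
      have t1 := F.cone_tri (f i) v (g (j - m))
      have t2 := F.cone_tri x (f i) y
      have t3 := F.cone_tri (f i) (g (j - m)) y
      omega
    · omega
    · simp only [hi, hjm, if_false]
      rw [g3 _ _ (by omega) (by omega)]
      omega

theorem interval_near_cone (F : Fam d Y Γ κ Θ) {x y z : G} (hz : d x z + d z y = d x y) :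
    ∃ v, coneDist d Y κ x v + coneDist d Y κ v y = coneDist d Y κ x y ∧
      coneDist d Y κ z v ≤ 9 := by
  obtain ⟨f, f1, f2, f3⟩ := F.exists_cone_geodesic x y
  obtain ⟨k, hk, h⟩ := F.interval_near_geodesic f3 (by rw [f1, f2]; exact hz)
  refine ⟨f k, ?_, h⟩
  have h1 := f3 0 k (by omega) hk
  have h2 := f3 k _ hk le_rfl
  rw [f1] at h1; rw [f2] at h2
  omega

theorem cone_near_interval (F : Fam d Y Γ κ Θ) {x y v : G}
    (hv : coneDist d Y κ x v + coneDist d Y κ v y = coneDist d Y κ x y) :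
    ∃ z, d x z + d z y = d x y ∧ coneDist d Y κ v z ≤ 18 := by
  have hk := F.large
  obtain ⟨f, f1, f2, f3, f4⟩ := F.exists_geodesic_through hv
  generalize coneDist d Y κ x v = j at *
  obtain ⟨n, hn⟩ : ∃ n, n = coneDist d Y κ x y := ⟨_, rfl⟩
  rw [← hn] at f2 f4 hv
  obtain ⟨w, hw0, hwn, hw, hs⟩ := F.exists_path x y
  by_cases h0 : ∃ i, j ≤ i ∧ i ≤ n ∧ coneDist d Y κ (w 0) (f i) ≤ 9
  · obtain ⟨i, hi, hin, h⟩ := h0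
    refine ⟨x, by simp [F.met.self], ?_⟩
    have := f4 0 i (by omega) hin
    have := f4 0 j (by omega) (by omega)
    rw [f1] at *
    rw [hw0] at h
    rw [F.cone_symm, ← f3]
    omega
  obtain ⟨k, hk1, hk2, i', hi1, hi2, hi3⟩ := exists_first (n := d x y)
    (p := fun k => ∃ i, j ≤ i ∧ i ≤ n ∧ coneDist d Y κ (w k) (f i) ≤ 9) h0
    ⟨n, by omega, le_rfl, by
      rw [f2]; exact (F.cone_of_le (by omega)).trans (by omega)⟩
  obtain ⟨i, hi, hwi⟩ := F.interval_near_geodesic f4 (z := w k)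
    (by rw [f1, f2]; have := hw k hk1.le; omega)
  have hij : i < j := by
    by_contra hc
    exact hk2 ⟨i, by omega, hi, hwi⟩
  have h7 := F.cone_of_le (x := w k) (y := w (k + 1)) ((hs k hk1).trans (by omega))
  have c1 := f4 i i' (by omega) hi2
  have c2 := f4 i j (by omega) (by omega)
  have c3 := f4 j i' (by omega) (by omega)
  have c4 := F.cone_tri (f i) (w k) (f i')
  have c5 := F.cone_tri (w k) (w (k + 1)) (f i')
  have c6 := F.cone_symm (f i) (w k)
  have c7 := F.cone_symm (f i') (w (k + 1))
  have c8 := F.cone_tri (f j) (f i) (w k)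
  have c9 := F.cone_tri (f j) (f i') (w (k + 1))
  have c10 := F.cone_symm (f i) (f j)
  rw [f3] at c8 c9 c10 c2 c3
  by_cases hh : coneDist d Y κ v (w k) ≤ 18
  · exact ⟨w k, by have := hw k hk1.le; omega, hh⟩
  · exact ⟨w (k + 1), by have := hw (k + 1) hk1; omega, by omega⟩

/-- The coned-off graph is hyperbolic, with the same constant. -/
theorem cone_met (F : Fam d Y Γ κ Θ) : HypMet (coneDist d Y κ) := by
  have hk := F.large
  refine F.isGraph.hypMet_of_slim fun x y v w hv => ?_
  obtain ⟨z, hz, hvz⟩ := F.cone_near_interval hv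
  rcases F.met.thin hz w with ⟨z', h1, h2⟩ | ⟨z', h1, h2⟩
  · obtain ⟨u, h3, h4⟩ := F.interval_near_cone h1
    have h5 := F.cone_of_le (x := z) (y := z') (by omega)
    have h6 := F.cone_tri v z u
    have h7 := F.cone_tri z z' u
    exact Or.inl ⟨u, h3, show coneDist d Y κ v u ≤ 30 by omega⟩
  · obtain ⟨u, h3, h4⟩ := F.interval_near_cone h1
    have h5 := F.cone_of_le (x := z) (y := z') (by omega)
    have h6 := F.cone_tri v z u
    have h7 := F.cone_tri z z' u
    exact Or.inr ⟨u, h3, show coneDist d Y κ v u ≤ 30 by omega⟩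

end Fam
end Cone

/-! ### Bounded geodesic image -/

section Image

variable {G ι : Type*} [Group G] [MulAction G ι]
variable {d : G → G → ℕ} {Y : ι → Set G} {Γ : ι → Subgroup G} {κ Θ : ℕ}

namespace Fam

theorem prDist_of_adj (F : Fam d Y Γ κ Θ) {a : ι} {x y : G} (h : coneAdj d Y κ x y)
    (hn : ¬ (x ∈ Y a ∧ y ∈ Y a)) : prDist d Y a x y ≤ κ + 100000 := by
  rcases h with h | ⟨b, hx, hy⟩
  · have := F.prDist_le a x y
    omega
  · have hab : a ≠ b := by rintro rfl; exact hn ⟨hx, hy⟩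
    have := F.overlap a b hab x hx y hy
    omega

theorem prDist_geodesic (F : Fam d Y Γ κ Θ) {a : ι} {f : ℕ → G} {n : ℕ}
    (hf : ∀ i j, i ≤ j → j ≤ n → coneDist d Y κ (f i) (f j) = j - i)
    (hn : ∀ k < n, ¬ (f k ∈ Y a ∧ f (k + 1) ∈ Y a)) (i m : ℕ) (h : i + m ≤ n) :
    prDist d Y a (f i) (f (i + m)) ≤ m * (κ + 100000) := by
  induction m with
  | zero => simp [F.prDist_self]
  | succ m ih =>
    have h1 := F.prDist_of_adj (a := a) (x := f (i + m)) (y := f (i + m + 1))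
      (F.isGraph.adj (by
        have := hf (i + m) (i + m + 1) (by omega) (by omega)
        change coneDist d Y κ _ _ ≤ 1
        omega)) (hn _ (by omega))
    have h2 := F.prDist_tri a (f i) (f (i + m)) (f (i + m + 1))
    have h3 := ih (by omega)
    rw [Nat.add_mul, ← Nat.add_assoc i m 1]
    omega

/-- A geodesic of the coned-off graph which stays far from `Y a` has small projection. -/
theorem prDist_far (F : Fam d Y Γ κ Θ) {a : ι} {f : ℕ → G} {n : ℕ}
    (hf : ∀ i j, i ≤ j → j ≤ n → coneDist d Y κ (f i) (f j) = j - i)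
    (hn : ∀ k ≤ n, ∀ y ∈ Y a, 11 < coneDist d Y κ (f k) y) :
    prDist d Y a (f 0) (f n) ≤ 100000 := by
  have hk := F.large
  by_contra hc
  push Not at hc
  obtain ⟨z, hz, h1⟩ := F.met.near_interval (F.near_pr_left hc)
  obtain ⟨k, hk, h2⟩ := F.interval_near_geodesic hf hz
  have h3 := hn k hk _ (F.pr_mem a (f 0))
  have h4 := F.cone_of_le (x := pr d Y a (f 0)) (y := z) (by omega)
  have h5 := F.cone_tri (pr d Y a (f 0)) z (f k)
  have h6 := F.cone_symm (f k) (pr d Y a (f 0))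
  omega

theorem geodesic_reverse (F : Fam d Y Γ κ Θ) {f : ℕ → G} {n : ℕ}
    (hf : ∀ i j, i ≤ j → j ≤ n → coneDist d Y κ (f i) (f j) = j - i) (i j : ℕ) (hij : i ≤ j)
    (hj : j ≤ n) : coneDist d Y κ (f (n - i)) (f (n - j)) = j - i := by
  rw [F.cone_symm, hf (n - j) (n - i) (by omega) (by omega)]
  omega

theorem prDist_first (F : Fam d Y Γ κ Θ) {a : ι} {f : ℕ → G} {n : ℕ}
    (hf : ∀ i j, i ≤ j → j ≤ n → coneDist d Y κ (f i) (f j) = j - i)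
    (hn : ∀ k < n, ¬ (f k ∈ Y a ∧ f (k + 1) ∈ Y a)) :
    prDist d Y a (f 0) (f n) ≤ 100000 ∨ ∃ i ≤ n, (∃ y ∈ Y a, coneDist d Y κ (f i) y ≤ 11) ∧
      prDist d Y a (f 0) (f i) ≤ κ + 200000 := by
  by_cases h : ∃ i, i ≤ n ∧ ∃ y ∈ Y a, coneDist d Y κ (f i) y ≤ 11
  · right
    refine ⟨Nat.find h, (Nat.find_spec h).1, (Nat.find_spec h).2, ?_⟩
    have h1 := (Nat.find_spec h).1
    have h2 : ∀ m < Nat.find h, ¬ (m ≤ n ∧ ∃ y ∈ Y a, coneDist d Y κ (f m) y ≤ 11) :=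
      fun m => Nat.find_min h
    generalize Nat.find h = i at *
    rcases i with _ | i
    · simp [F.prDist_self]
    · have h3 := F.prDist_far (a := a) (f := f) (n := i) (fun i j h h' => hf i j h (by omega))
        (fun k hk y hy => by
          by_contra hc
          exact h2 k (by omega) ⟨by omega, y, hy, by omega⟩)
      have h4 := F.prDist_geodesic hf hn i 1 (by omega)
      have h5 := F.prDist_tri a (f 0) (f i) (f (i + 1))
      omega
  · left
    refine F.prDist_far hf fun k hk y hy => ?_
    by_contra hc
    exact h ⟨k, hk, y, hy, by omega⟩

/-- A geodesic of the coned-off graph whose projection to `Y a` is large crosses `Y a`. -/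
theorem geodesic_crosses (F : Fam d Y Γ κ Θ) {a : ι} {f : ℕ → G} {n : ℕ}
    (hf : ∀ i j, i ≤ j → j ≤ n → coneDist d Y κ (f i) (f j) = j - i)
    (h : 100 * κ < prDist d Y a (f 0) (f n)) : ∃ k < n, f k ∈ Y a ∧ f (k + 1) ∈ Y a := by
  have hk := F.large
  by_contra hc
  push Not at hc
  have hn : ∀ k < n, ¬ (f k ∈ Y a ∧ f (k + 1) ∈ Y a) := fun k hk h => hc k hk h.1 h.2
  rcases F.prDist_first hf hn with h1 | ⟨i, hi, ⟨y, hy, h1⟩, h2⟩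
  · omega
  rcases F.prDist_first (a := a) (f := fun k => f (n - k)) (n := n) (F.geodesic_reverse hf)
    (fun k hk h => hn (n - k - 1) (by omega) (by
      have e : n - k - 1 + 1 = n - k := by omega
      rw [e]
      refine ⟨?_, h.1⟩
      rw [Nat.sub_sub]; exact h.2)) with h3 | ⟨j, hj, ⟨z, hz, h3⟩, h4⟩
  · have := F.prDist_symm a (f 0) (f n)
    simp only [Nat.sub_zero, Nat.sub_self] at h3
    omega
  simp only [Nat.sub_zero] at h3 h4
  obtain ⟨j, hj', rfl⟩ : ∃ l ≤ n, j = n - l := ⟨n - j, by omega, by omega⟩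
  have e : n - (n - j) = j := by omega
  rw [e] at h3 h4
  have c1 := F.cone_tri (f i) y (f j)
  have c2 := F.cone_tri y z (f j)
  have c3 := F.cone_of_mem hy hz
  have c4 := F.cone_symm (f j) z
  have c5 := F.prDist_symm a (f n) (f j)
  have c6 := F.prDist_tri a (f 0) (f i) (f n)
  have c7 := F.prDist_tri a (f i) (f j) (f n)
  rcases le_total i j with hij | hij
  · have c8 := hf i j hij hj'
    obtain ⟨m, rfl⟩ := Nat.exists_eq_add_of_le hij
    have c9 := F.prDist_geodesic hf hn i m hj'
    have c10 : m * (κ + 100000) ≤ 23 * (κ + 100000) := Nat.mul_le_mul_right _ (by omega)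
    omega
  · have c8 := hf j i hij hi
    obtain ⟨m, rfl⟩ := Nat.exists_eq_add_of_le hij
    have c9 := F.prDist_geodesic hf hn j m hi
    have c10 : m * (κ + 100000) ≤ 23 * (κ + 100000) := Nat.mul_le_mul_right _ (by
      have := F.cone_symm (f j) (f (j + m))
      omega)
    have := F.prDist_symm a (f j) (f (j + m))
    omega

theorem exists_crossing (F : Fam d Y Γ κ Θ) {a : ι} {p q : G}
    (h : 100 * κ < prDist d Y a p q) :
    ∃ v ∈ Y a, ∃ w ∈ Y a, coneDist d Y κ p v + 1 + coneDist d Y κ w q = coneDist d Y κ p q := by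
  obtain ⟨f, f1, f2, f3⟩ := F.exists_cone_geodesic p q
  obtain ⟨k, hk, h1, h2⟩ := F.geodesic_crosses f3 (by rwa [f1, f2])
  refine ⟨_, h1, _, h2, ?_⟩
  have h3 := f3 0 k (by omega) (by omega)
  have h4 := f3 (k + 1) _ (by omega) le_rfl
  rw [f1] at h3
  rw [f2] at h4
  omega

theorem prDist_entry (F : Fam d Y Γ κ Θ) {a : ι} {p q v w : G} (hw : w ∈ Y a)
    (h : coneDist d Y κ p v + 1 + coneDist d Y κ w q ≤ coneDist d Y κ p q) :
    prDist d Y a p v ≤ 100 * κ := by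
  by_contra hc
  push Not at hc
  obtain ⟨v', hv', w', -, h1⟩ := F.exists_crossing hc
  have h2 := F.cone_of_mem hv' hw
  have h3 := F.cone_tri p v' w
  have h4 := F.cone_tri p w q
  omega

theorem prDist_exit (F : Fam d Y Γ κ Θ) {a : ι} {p q v w : G} (hv : v ∈ Y a)
    (h : coneDist d Y κ p v + 1 + coneDist d Y κ w q ≤ coneDist d Y κ p q) :
    prDist d Y a w q ≤ 100 * κ := by
  rw [F.prDist_symm]
  refine F.prDist_entry (q := p) hv ?_
  rw [F.cone_symm q w, F.cone_symm v p, F.cone_symm q p]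
  omega

/-- If all projections are bounded then the two metrics are comparable. -/
theorem dist_le_mul_cone (F : Fam d Y Γ κ Θ) {B : ℕ} {p q : G}
    (h : ∀ a, prDist d Y a p q ≤ B) : d p q ≤ (B + 201 * κ) * coneDist d Y κ p q := by
  obtain ⟨f, f1, f2, f3⟩ := F.exists_cone_geodesic p q
  generalize hn : coneDist d Y κ p q = n at *
  have key : ∀ k ≤ n, d p (f k) ≤ (B + 201 * κ) * k := by
    intro k
    induction k with
    | zero => simp [f1, F.met.self]
    | succ k ih =>
      intro hk
      have h1 := ih (by omega)
      have h2 := F.met.tri p (f k) (f (k + 1))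
      have h3 := f3 0 k (by omega) (by omega)
      have h4 := f3 (k + 1) n (by omega) le_rfl
      have h5 := f3 k (k + 1) (by omega) (by omega)
      rw [f1] at h3
      rw [f2] at h4
      have h6 : d (f k) (f (k + 1)) ≤ B + 201 * κ := by
        rcases F.isGraph.adj (x := f k) (y := f (k + 1)) (h5.le.trans (by omega)) with
          h | ⟨a, ha, hb⟩
        · omega
        · rw [← F.prDist_of_mem ha hb]
          have h7 := F.prDist_entry (p := p) (q := q) (v := f k) hb (by omega)
          have h8 := F.prDist_exit (p := p) (q := q) (w := f (k + 1)) ha (by omega)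
          have h9 := F.prDist_tri a (f k) p (f (k + 1))
          have h10 := F.prDist_tri a p q (f (k + 1))
          have h11 := h a
          have h12 := F.prDist_symm a (f k) p
          have h13 := F.prDist_symm a (f (k + 1)) q
          omega
      rw [Nat.mul_add]
      omega
  have := key n le_rfl
  rwa [f2] at this

end Fam
end Image

/-! ### The quotient metric -/

section Quot

variable {G ι : Type*} [Group G] [MulAction G ι]

/-- The normal subgroup generated by all rotations. -/
def rot (Γ : ι → Subgroup G) : Subgroup G := rotGroup Γ Set.univ

/-- The quotient of the cone-off metric by the rotations, as a pseudometric on `G`. -/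
noncomputable def quotDist (d : G → G → ℕ) (Y : ι → Set G) (Γ : ι → Subgroup G) (κ : ℕ)
    (x y : G) : ℕ := sInf {k | ∃ h ∈ rot Γ, coneDist d Y κ x (h * y) = k}

variable {d : G → G → ℕ} {Y : ι → Set G} {Γ : ι → Subgroup G} {κ Θ : ℕ}

theorem mem_rot {a : ι} {s : G} (hs : s ∈ Γ a) : s ∈ rot Γ :=
  Subgroup.subset_closure ⟨a, trivial, hs⟩

theorem quotDist_spec (d : G → G → ℕ) (Y : ι → Set G) (Γ : ι → Subgroup G) (κ : ℕ) (x y : G) :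
    ∃ h ∈ rot Γ, coneDist d Y κ x (h * y) = quotDist d Y Γ κ x y :=
  Nat.sInf_mem (s := {k | ∃ h ∈ rot Γ, coneDist d Y κ x (h * y) = k})
    ⟨_, 1, (rot Γ).one_mem, rfl⟩

theorem quotDist_le (d : G → G → ℕ) (Y : ι → Set G) (κ : ℕ) {h : G} (hh : h ∈ rot Γ) (x y : G) :
    quotDist d Y Γ κ x y ≤ coneDist d Y κ x (h * y) :=
  Nat.sInf_le ⟨h, hh, rfl⟩

theorem quotDist_le_cone (d : G → G → ℕ) (Y : ι → Set G) (Γ : ι → Subgroup G) (κ : ℕ) (x y : G) :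
    quotDist d Y Γ κ x y ≤ coneDist d Y κ x y := by
  simpa using quotDist_le d Y κ (rot Γ).one_mem x y

/-- A type of sides of polygons which can be bent along rotations. -/
structure Side (d : G → G → ℕ) (Y : ι → Set G) (Γ : ι → Subgroup G) (B : ℕ)
    (S : G → G → Prop) : Prop where
  inv : ∀ g ∈ rot Γ, ∀ x y, S x y → S (g * x) (g * y)
  bend : ∀ a, ∀ s ∈ Γ a, ∀ x y, B < prDist d Y a x y → S x y → S x (s * y)

namespace Fam

theorem rot_normal (F : Fam d Y Γ κ Θ) : (rot Γ).Normal := by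
  refine ⟨fun n hn g => ?_⟩
  have : (rot Γ).map (MulAut.conj g).toMonoidHom ≤ rot Γ := by
    rw [rot, rotGroup, MonoidHom.map_closure, Subgroup.closure_le]
    rintro _ ⟨s, ⟨a, -, hs⟩, rfl⟩
    exact mem_rot (F.conj g a s hs)
  exact this ⟨n, hn, rfl⟩

theorem conj_mem (F : Fam d Y Γ κ Θ) {h : G} (hh : h ∈ rot Γ) (g : G) : g * h * g⁻¹ ∈ rot Γ :=
  F.rot_normal.conj_mem h hh g

theorem quotDist_self (_F : Fam d Y Γ κ Θ) (x : G) : quotDist d Y Γ κ x x = 0 := by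
  have := quotDist_le_cone d Y Γ κ x x
  rw [cone_self] at this
  omega

theorem quotDist_smul_right (_F : Fam d Y Γ κ Θ) {h : G} (hh : h ∈ rot Γ) (x y : G) :
    quotDist d Y Γ κ x (h * y) = quotDist d Y Γ κ x y := by
  apply le_antisymm
  · obtain ⟨g, hg, h1⟩ := quotDist_spec d Y Γ κ x y
    rw [← h1]
    have := quotDist_le d Y κ ((rot Γ).mul_mem hg ((rot Γ).inv_mem hh)) x (h * y)
    simpa [mul_assoc] using this
  · obtain ⟨g, hg, h1⟩ := quotDist_spec d Y Γ κ x (h * y)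
    rw [← h1, ← mul_assoc]
    exact quotDist_le d Y κ ((rot Γ).mul_mem hg hh) x y

theorem quotDist_inv (F : Fam d Y Γ κ Θ) (g x y : G) :
    quotDist d Y Γ κ (g * x) (g * y) = quotDist d Y Γ κ x y := by
  have key : ∀ g x y, quotDist d Y Γ κ (g * x) (g * y) ≤ quotDist d Y Γ κ x y := by
    intro g x y
    obtain ⟨h, hh, h1⟩ := quotDist_spec d Y Γ κ x y
    have := quotDist_le d Y κ (F.conj_mem hh g) (g * x) (g * y)
    have e : g * h * g⁻¹ * (g * y) = g * (h * y) := by group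
    rw [e, F.cone_inv, h1] at this
    exact this
  refine le_antisymm (key g x y) ?_
  simpa using key g⁻¹ (g * x) (g * y)

theorem quotDist_symm (F : Fam d Y Γ κ Θ) (x y : G) :
    quotDist d Y Γ κ x y = quotDist d Y Γ κ y x := by
  have key : ∀ x y, quotDist d Y Γ κ x y ≤ quotDist d Y Γ κ y x := by
    intro x y
    obtain ⟨h, hh, h1⟩ := quotDist_spec d Y Γ κ y x
    have := quotDist_le d Y κ ((rot Γ).inv_mem hh) x y
    rw [← F.cone_inv h, mul_inv_cancel_left, F.cone_symm, h1] at this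
    exact this
  exact le_antisymm (key x y) (key y x)

theorem quotDist_smul_left (F : Fam d Y Γ κ Θ) {h : G} (hh : h ∈ rot Γ) (x y : G) :
    quotDist d Y Γ κ (h * x) y = quotDist d Y Γ κ x y := by
  rw [F.quotDist_symm, F.quotDist_smul_right hh, F.quotDist_symm]

theorem quotDist_tri (F : Fam d Y Γ κ Θ) (x y z : G) :
    quotDist d Y Γ κ x z ≤ quotDist d Y Γ κ x y + quotDist d Y Γ κ y z := by
  obtain ⟨g, hg, h1⟩ := quotDist_spec d Y Γ κ x y
  obtain ⟨h, hh, h2⟩ := quotDist_spec d Y Γ κ y z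
  rw [← h1, ← h2]
  have := quotDist_le d Y κ ((rot Γ).mul_mem hg hh) x z
  have h3 := F.cone_tri x (g * y) (g * (h * z))
  rw [F.cone_inv] at h3
  rw [mul_assoc] at this
  omega

theorem quotDist_sep (F : Fam d Y Γ κ Θ) {x y : G} (h : quotDist d Y Γ κ x y = 0) :
    ∃ g ∈ rot Γ, x = g * y := by
  obtain ⟨g, hg, h1⟩ := quotDist_spec d Y Γ κ x y
  exact ⟨g, hg, F.isGraph.dist_sep (h1.trans h)⟩

theorem quotDist_geod (F : Fam d Y Γ κ Θ) (x y : G) (k : ℕ) (hk : k ≤ quotDist d Y Γ κ x y) :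
    ∃ z, quotDist d Y Γ κ x z = k ∧ k + quotDist d Y Γ κ z y = quotDist d Y Γ κ x y := by
  obtain ⟨g, hg, h1⟩ := quotDist_spec d Y Γ κ x y
  obtain ⟨z, h2, h3⟩ := F.cone_met.geod x (g * y) k (by omega)
  have h4 := quotDist_le_cone d Y Γ κ x z
  have h5 := quotDist_le_cone d Y Γ κ z (g * y)
  have h6 := F.quotDist_tri x z (g * y)
  simp only [F.quotDist_smul_right hg] at h5 h6
  exact ⟨z, by omega, by omega⟩

/-- A polygon with bendable sides which closes up modulo rotations can be closed. -/
theorem exists_closed (F : Fam d Y Γ κ Θ) (hΘ : 1000 * κ ≤ Θ) {B : ℕ} (hB : 4 * B + 15 * κ ≤ Θ)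
    {S₁ S₂ S₃ S₄ : G → G → Prop} (h₁ : Side d Y Γ B S₁) (h₂ : Side d Y Γ B S₂)
    (h₃ : Side d Y Γ B S₃) (h₄ : Side d Y Γ B S₄) {z₀ z₁ z₂ z₃ h : G} (hh : h ∈ rot Γ)
    (s₁ : S₁ z₀ z₁) (s₂ : S₂ z₁ z₂) (s₃ : S₃ z₂ z₃) (s₄ : S₄ z₃ (h * z₀)) :
    ∃ g₁ ∈ rot Γ, ∃ g₂ ∈ rot Γ, ∃ g₃ ∈ rot Γ, S₁ z₀ (g₁ * z₁) ∧ S₂ (g₁ * z₁) (g₂ * z₂) ∧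
      S₃ (g₂ * z₂) (g₃ * z₃) ∧ S₄ (g₃ * z₃) z₀ := by
  have hk := F.large
  have hr := red_of_mem F hΘ hh z₀
  induction hr generalizing z₁ z₂ z₃ with
  | one =>
    have o := (rot Γ).one_mem
    exact ⟨1, o, 1, o, 1, o, by simpa using s₁, by simpa using s₂, by simpa using s₃,
      by simpa using s₄⟩
  | step a s h hs hs1 hD hr ih =>
    have hs' := (Γ a).inv_mem hs
    have m := mem_rot hs'
    have hm := (rot Γ).mul_mem m hh
    have h5 := F.prDist_spin hs hs1 z₀
    have h6 := F.prDist_tri a z₀ (h * z₀) (s * z₀)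
    have h7 := F.prDist_symm a (h * z₀) (s * z₀)
    have h8 := F.prDist_tri a z₀ z₁ (h * z₀)
    have h9 := F.prDist_tri a z₁ z₂ (h * z₀)
    have h10 := F.prDist_tri a z₂ z₃ (h * z₀)
    rcases lt_or_ge B (prDist d Y a z₀ z₁) with b | b1
    · obtain ⟨g₁, m₁, g₂, m₂, g₃, m₃, e⟩ := ih (z₁ := s⁻¹ * z₁) (z₂ := s⁻¹ * z₂)
        (z₃ := s⁻¹ * z₃) hm (h₁.bend a _ hs' _ _ b s₁) (h₂.inv _ m _ _ s₂) (h₃.inv _ m _ _ s₃)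
        (by rw [mul_assoc]; exact h₄.inv _ m _ _ s₄)
      exact ⟨g₁ * s⁻¹, mul_mem m₁ m, g₂ * s⁻¹, mul_mem m₂ m, g₃ * s⁻¹, mul_mem m₃ m,
        by simpa only [mul_assoc] using e⟩
    rcases lt_or_ge B (prDist d Y a z₁ z₂) with b | b2
    · obtain ⟨g₁, m₁, g₂, m₂, g₃, m₃, e⟩ := ih (z₁ := z₁) (z₂ := s⁻¹ * z₂)
        (z₃ := s⁻¹ * z₃) hm s₁ (h₂.bend a _ hs' _ _ b s₂) (h₃.inv _ m _ _ s₃)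
        (by rw [mul_assoc]; exact h₄.inv _ m _ _ s₄)
      exact ⟨g₁, m₁, g₂ * s⁻¹, mul_mem m₂ m, g₃ * s⁻¹, mul_mem m₃ m,
        by simpa only [mul_assoc] using e⟩
    rcases lt_or_ge B (prDist d Y a z₂ z₃) with b | b3
    · obtain ⟨g₁, m₁, g₂, m₂, g₃, m₃, e⟩ := ih (z₁ := z₁) (z₂ := z₂)
        (z₃ := s⁻¹ * z₃) hm s₁ s₂ (h₃.bend a _ hs' _ _ b s₃)
        (by rw [mul_assoc]; exact h₄.inv _ m _ _ s₄)
      exact ⟨g₁, m₁, g₂, m₂, g₃ * s⁻¹, mul_mem m₃ m,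
        by simpa only [mul_assoc] using e⟩
    rcases lt_or_ge B (prDist d Y a z₃ (h * z₀)) with b | b4
    · exact ih hm s₁ s₂ s₃ (by rw [mul_assoc]; exact h₄.bend a _ hs' _ _ b s₄)
    · omega

theorem cone_bend (F : Fam d Y Γ κ Θ) {a : ι} {s x y : G} (hs : s ∈ Γ a)
    (h : 100 * κ < prDist d Y a x y) : coneDist d Y κ x (s * y) ≤ coneDist d Y κ x y := by
  obtain ⟨v, hv, w, hw, h1⟩ := F.exists_crossing h
  have h2 := F.cone_tri x v (s * y)
  have h3 := F.cone_tri v (s * w) (s * y)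
  have h4 := F.cone_of_mem hv (F.mem_of_rot hs hw)
  rw [F.cone_inv] at h3
  omega

/-- The sides realising the quotient metric. -/
theorem side_quotDist (F : Fam d Y Γ κ Θ) {B : ℕ} (hB : 100 * κ ≤ B) :
    Side d Y Γ B (fun x y => coneDist d Y κ x y = quotDist d Y Γ κ x y) where
  inv g _ x y h := by rw [F.cone_inv, F.quotDist_inv, h]
  bend a s hs x y hD h := by
    have h1 := F.cone_bend hs (hB.trans_lt hD)
    have h2 := quotDist_le_cone d Y Γ κ x (s * y)
    rw [F.quotDist_smul_right (mem_rot hs)] at h2 ⊢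
    omega

/-- The sides which are translates of a given pair of points with bounded projections. -/
theorem side_translate (F : Fam d Y Γ κ Θ) {B : ℕ} {p q : G}
    (hpq : ∀ a, prDist d Y a p q ≤ B) :
    Side d Y Γ B (fun x y => ∃ g ∈ rot Γ, x = g * p ∧ y = g * q) where
  inv g hg x y := by
    rintro ⟨n, hn, rfl, rfl⟩
    exact ⟨g * n, mul_mem hg hn, by rw [mul_assoc], by rw [mul_assoc]⟩
  bend a s _ x y hD := by
    rintro ⟨n, hn, rfl, rfl⟩
    have := hpq (n⁻¹ • a)
    rw [← F.prDist_smul n, smul_inv_smul] at this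
    omega

theorem quotDist_met (F : Fam d Y Γ κ Θ) (hΘ : 1000 * κ ≤ Θ) : HypMet (quotDist d Y Γ κ) where
  self := F.quotDist_self
  symm := F.quotDist_symm
  tri := F.quotDist_tri
  geod := F.quotDist_geod
  hyp x y z t := by
    have S := F.side_quotDist le_rfl
    obtain ⟨n₁, m₁, e₁⟩ := quotDist_spec d Y Γ κ x y
    obtain ⟨n₂, m₂, e₂⟩ := quotDist_spec d Y Γ κ y z
    obtain ⟨n₃, m₃, e₃⟩ := quotDist_spec d Y Γ κ z t
    obtain ⟨n₄, m₄, e₄⟩ := quotDist_spec d Y Γ κ t x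
    have m₁₂ := mul_mem m₁ m₂
    have m₁₃ := mul_mem m₁₂ m₃
    have m₁₄ := mul_mem m₁₃ m₄
    obtain ⟨g₁, l₁, g₂, l₂, g₃, l₃, e⟩ := F.exists_closed hΘ (B := 100 * κ) (by omega) S S S S
      (z₀ := x) (z₁ := n₁ * y) (z₂ := n₁ * n₂ * z) (z₃ := n₁ * n₂ * n₃ * t) m₁₄
      (by rw [e₁, F.quotDist_smul_right m₁])
      (by rw [F.quotDist_smul_right m₁₂, F.quotDist_smul_left m₁, mul_assoc, F.cone_inv, e₂])
      (by rw [F.quotDist_smul_right m₁₃, F.quotDist_smul_left m₁₂, mul_assoc (n₁ * n₂),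
            F.cone_inv, e₃])
      (by rw [F.quotDist_smul_right m₁₄, F.quotDist_smul_left m₁₃, mul_assoc (n₁ * n₂ * n₃),
            F.cone_inv, e₄])
    simp only [F.quotDist_smul_right l₁, F.quotDist_smul_right l₂, F.quotDist_smul_right l₃,
      F.quotDist_smul_left l₁, F.quotDist_smul_left l₂, F.quotDist_smul_left l₃,
      F.quotDist_smul_right m₁, F.quotDist_smul_right m₁₂, F.quotDist_smul_right m₁₃,
      F.quotDist_smul_left m₁, F.quotDist_smul_left m₁₂, F.quotDist_smul_left m₁₃] at e
    have h1 := quotDist_le_cone d Y Γ κ x (g₂ * (n₁ * n₂ * z))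
    have h2 := quotDist_le_cone d Y Γ κ (g₁ * (n₁ * y)) (g₃ * (n₁ * n₂ * n₃ * t))
    rw [F.quotDist_smul_right l₂, F.quotDist_smul_right m₁₂] at h1
    rw [F.quotDist_smul_right l₃, F.quotDist_smul_right m₁₃, F.quotDist_smul_left l₁,
      F.quotDist_smul_left m₁] at h2
    have h3 := F.cone_met.hyp x (g₁ * (n₁ * y)) (g₂ * (n₁ * n₂ * z)) (g₃ * (n₁ * n₂ * n₃ * t))
    rw [F.cone_symm x (g₃ * (n₁ * n₂ * n₃ * t))] at h3
    rw [F.quotDist_symm x t]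
    omega

/-- Pairs of points which cannot be brought closer by rotations realise the quotient metric. -/
theorem quotDist_of_tight (F : Fam d Y Γ κ Θ) (hΘ : 1000 * κ ≤ Θ) {c : ℕ} (hc : c + 300 * κ ≤ Θ)
    {x y : G} (h : ∀ a, ∀ s ∈ Γ a, prDist d Y a x y ≤ prDist d Y a x (s * y) + c) :
    quotDist d Y Γ κ x y = coneDist d Y κ x y := by
  have hk := F.large
  have key : ∀ g ∈ rot Γ, coneDist d Y κ x (g * y) = quotDist d Y Γ κ x y →
      quotDist d Y Γ κ x y = coneDist d Y κ x y := by
    intro g hg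
    have hr := red_of_mem F hΘ hg y
    induction hr with
    | one => intro h; rw [← h, one_mul]
    | step a s g hs hs1 hD hr ih =>
      intro e
      have hs' := (Γ a).inv_mem hs
      have m := mem_rot hs'
      by_cases hD' : 100 * κ < prDist d Y a x (g * y)
      · refine ih (mul_mem m hg) ?_
        have h1 := F.cone_bend hs' hD'
        have h2 := quotDist_le d Y κ (mul_mem m hg) x y
        rw [mul_assoc] at h2 ⊢
        omega
      · have h1 := h a s hs
        have h2 := F.prDist_spin hs hs1 y
        have h3 := F.prDist_tri a y x (s * y)
        have h4 := F.prDist_tri a x (g * y) (s * y)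
        have h5 := F.prDist_symm a (g * y) (s * y)
        have h6 := F.prDist_symm a x y
        omega
  obtain ⟨g, hg, e⟩ := quotDist_spec d Y Γ κ x y
  exact key g hg e

/-- Every pair of points has a lift which realises the quotient metric and is tight. -/
theorem exists_tight (F : Fam d Y Γ κ Θ) (x y : G) :
    ∃ h ∈ rot Γ, coneDist d Y κ x (h * y) = quotDist d Y Γ κ x y ∧
      ∀ a, ∀ s ∈ Γ a, prDist d Y a x (h * y) ≤ prDist d Y a x (s * (h * y)) + 100 * κ := by
  have hk := F.large
  have hex : ∃ k, ∃ h ∈ rot Γ, coneDist d Y κ x (h * y) = quotDist d Y Γ κ x y ∧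
      d x (h * y) = k := by
    obtain ⟨h, hh, e⟩ := quotDist_spec d Y Γ κ x y
    exact ⟨_, h, hh, e, rfl⟩
  obtain ⟨h, hh, e, h1⟩ := Nat.find_spec hex
  refine ⟨h, hh, e, fun a s hs => ?_⟩
  by_cases hD : 100 * κ < prDist d Y a x (h * y)
  · have h2 := F.cone_bend hs hD
    have m := mul_mem (mem_rot hs) hh
    have h3 := quotDist_le d Y κ m x y
    have h4 := Nat.find_min' hex ⟨s * h, m, by rw [mul_assoc] at h3 ⊢; omega, rfl⟩
    rw [← h1, mul_assoc] at h4
    have h5 := F.prDist_excess (a := a) (x := x) (z := h * y) (by omega)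
    have h6 := F.met.tri x (pr d Y a x) (s * (h * y))
    have h7 := F.met.tri (pr d Y a x) (pr d Y a (s * (h * y))) (s * (h * y))
    have h8 := PreFam.pr_smul d Y s a (h * y)
    rw [F.fix a s hs] at h8
    have h9 : d (pr d Y a (s * (h * y))) (s * (h * y)) = d (pr d Y a (h * y)) (h * y) := by
      rw [h8, F.inv]
    have h10 : prDist d Y a x (s * (h * y)) = d (pr d Y a x) (pr d Y a (s * (h * y))) := rfl
    omega
  · omega

/-- Simultaneous lifting of two displacements along a pair with bounded projections. -/
theorem exists_lift (F : Fam d Y Γ κ Θ) (hΘ : 1000 * κ ≤ Θ) {B : ℕ} (hκ : 100 * κ ≤ B)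
    (hB : 4 * B + 15 * κ ≤ Θ) {p q u : G} (hpq : ∀ a, prDist d Y a p q ≤ B) :
    ∃ g ∈ rot Γ, coneDist d Y κ p (g * (u * p)) = quotDist d Y Γ κ p (u * p) ∧
      coneDist d Y κ q (g * (u * q)) = quotDist d Y Γ κ q (u * q) := by
  obtain ⟨n₁, m₁, e₁⟩ := quotDist_spec d Y Γ κ q (u * q)
  obtain ⟨n₂, m₂, e₂⟩ := quotDist_spec d Y Γ κ (u * p) p
  have S := F.side_quotDist hκ
  have m := mul_mem m₁ m₂
  obtain ⟨g₁, l₁, g₂, l₂, g₃, l₃, ⟨n, hn, e3, e4⟩, e5, ⟨n', hn', e6, e7⟩, e8⟩ :=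
    F.exists_closed hΘ hB (F.side_translate hpq) S
    (F.side_translate (p := u * q) (q := u * p) (fun a => by
      have := hpq (u⁻¹ • a)
      rwa [← F.prDist_smul u, smul_inv_smul, F.prDist_symm] at this)) S
    (z₀ := p) (z₁ := q) (z₂ := n₁ * (u * q)) (z₃ := n₁ * (u * p)) m
    ⟨1, one_mem _, by simp, by simp⟩ (by rw [e₁, F.quotDist_smul_right m₁])
    ⟨n₁, m₁, rfl, rfl⟩
    (by rw [F.quotDist_smul_right m, F.quotDist_smul_left m₁, mul_assoc, F.cone_inv, e₂])
  have hn1 : n = 1 := by simpa using e3.symm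
  rw [hn1, one_mul] at e4
  refine ⟨n', hn', ?_, ?_⟩
  · rw [e7, F.quotDist_smul_left hn', F.cone_symm, F.quotDist_symm] at e8
    exact e8
  · rw [e4, e6, F.quotDist_smul_right hn'] at e5
    exact e5

end Fam
end Quot

/-! ### Loxodromic elements -/

section Lox

variable {G : Type*} [Group G] {d : G → G → ℕ}

/-- A left-invariant hyperbolic metric on a group. -/
structure InvMet (d : G → G → ℕ) : Prop where
  met : HypMet d
  inv : ∀ g x y, d (g * x) (g * y) = d x y

/-- `u` translates every point, at speed at least `1 / m`. -/
def TLox (d : G → G → ℕ) (m : ℕ) (u : G) : Prop := ∀ k z, k ≤ m * d z (u ^ k * z)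

namespace InvMet

theorem dist_pow_le (I : InvMet d) (u z : G) (k : ℕ) : d z (u ^ k * z) ≤ k * d z (u * z) := by
  induction k with
  | zero => simp [I.met.self]
  | succ k ih =>
    have h1 := I.met.tri z (u * z) (u * (u ^ k * z))
    rw [I.inv, ← mul_assoc, ← pow_succ'] at h1
    rw [Nat.add_mul]
    omega

theorem dist_inv (I : InvMet d) (u z : G) : d z (u⁻¹ * z) = d z (u * z) := by
  rw [← I.inv u, mul_inv_cancel_left, I.met.symm]

theorem disp_change (I : InvMet d) (u y z : G) : d z (u * z) ≤ d y (u * y) + 2 * d y z := by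
  have h1 := I.met.tri z y (u * z)
  have h2 := I.met.tri y (u * y) (u * z)
  have h3 := I.met.symm y z
  rw [I.inv] at h2
  omega

theorem disp_mul_le (I : InvMet d) (u v z : G) :
    d z (u * v * z) ≤ d z (u * z) + d z (v * z) := by
  have h1 := I.met.tri z (u * z) (u * v * z)
  rw [mul_assoc, I.inv] at h1
  rwa [mul_assoc]

theorem disp_conj (I : InvMet d) (g u z : G) :
    d (g * z) (g * u * g⁻¹ * (g * z)) = d z (u * z) := by
  have e : g * u * g⁻¹ * (g * z) = g * (u * z) := by group
  rw [e, I.inv]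

theorem disp_commute (I : InvMet d) {u w : G} (h : Commute u w) (z : G) :
    d (w * z) (u * (w * z)) = d z (u * z) := by
  have e : u * (w * z) = w * (u * z) := by rw [← mul_assoc, h.eq, mul_assoc]
  rw [e, I.inv]

theorem disp_shift (I : InvMet d) (u z : G) (i j : ℕ) :
    d (u ^ i * z) (u ^ (i + j) * z) = d z (u ^ j * z) := by
  rw [pow_add, mul_assoc, I.inv]

/-- An element which moves some point along a quasi-geodesic is loxodromic. -/
theorem step_le (I : InvMet d) {w y : G} {s : ℕ} (hs : 1 ≤ s)
    (h : d y (w * y) + 300 + s ≤ d y (w ^ 2 * y)) (k : ℕ) :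
    d y (w ^ k * y) + s ≤ d y (w ^ (k + 1) * y) := by
  induction k with
  | zero =>
    have h1 := I.dist_pow_le w y 2
    simp only [pow_zero, one_mul, zero_add, pow_one, I.met.self]
    omega
  | succ k ih =>
    have h1 := I.met.hyp y (w * y) (w ^ 2 * y) (w ^ (k + 2) * y)
    have e1 := I.disp_shift w y 1 (k + 1)
    have e2 := I.disp_shift w y 2 k
    have e3 := I.disp_shift w y 1 1
    rw [show 1 + (k + 1) = k + 2 by omega] at e1
    rw [show 2 + k = k + 2 by omega] at e2
    rw [show 1 + 1 = 2 by omega] at e3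
    rw [pow_one] at e1 e3
    rw [show k + 1 + 1 = k + 2 by omega]
    omega

theorem mul_le_disp (I : InvMet d) {w y : G} {s : ℕ} (hs : 1 ≤ s)
    (h : d y (w * y) + 300 + s ≤ d y (w ^ 2 * y)) (k : ℕ) : s * k ≤ d y (w ^ k * y) := by
  induction k with
  | zero => simp
  | succ k ih =>
    have := I.step_le hs h k
    rw [Nat.mul_add]
    omega

/-- Lower bounds for displacements do not depend on the point. -/
theorem transfer (I : InvMet d) {w y : G} {a b c : ℕ}
    (h : ∀ k, a * k ≤ b * d y (w ^ k * y) + c) (k : ℕ) (z : G) :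
    a * k ≤ b * d z (w ^ k * z) := by
  by_contra hc
  push Not at hc
  have h1 := h (k * (c + b * (2 * d z y) + 1))
  obtain ⟨j, hj⟩ : ∃ j, j = c + b * (2 * d z y) + 1 := ⟨_, rfl⟩
  rw [← hj] at h1
  have h2 := I.disp_change (w ^ (k * j)) z y
  have h3 := I.dist_pow_le (w ^ k) z j
  rw [← pow_mul] at h3
  have h4 : b * d y (w ^ (k * j) * y) ≤ b * (j * d z (w ^ k * z) + 2 * d z y) :=
    Nat.mul_le_mul_left _ (by omega)
  have h5 : (b * d z (w ^ k * z) + 1) * j ≤ a * k * j := Nat.mul_le_mul_right _ hc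
  nlinarith

theorem speed (I : InvMet d) {w y : G} {s : ℕ} (hs : 1 ≤ s)
    (h : d y (w * y) + 300 + s ≤ d y (w ^ 2 * y)) (k : ℕ) (z : G) :
    s * k ≤ d z (w ^ k * z) := by
  have := I.transfer (a := s) (b := 1) (c := 0) (y := y) (w := w)
    (fun k => by have := I.mul_le_disp hs h k; omega) k z
  omega

theorem tlox_of_step (I : InvMet d) {w y : G}
    (h : d y (w * y) + 301 ≤ d y (w ^ 2 * y)) : TLox d 1 w := fun k z => by
  have := I.speed (s := 1) le_rfl h k z
  omega

end InvMet

namespace TLox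

theorem mono {m m' : ℕ} (hm : m ≤ m') {u : G} (h : TLox d m u) : TLox d m' u :=
  fun k z => (h k z).trans (Nat.mul_le_mul_right _ hm)

theorem ne_one (I : InvMet d) {m : ℕ} {u : G} (h : TLox d m u) : u ≠ 1 := by
  rintro rfl
  have := h 1 1
  simp [I.met.self] at this

theorem pow_ne_one (I : InvMet d) {m : ℕ} {u : G} (h : TLox d m u) {k : ℕ} (hk : 1 ≤ k) :
    u ^ k ≠ 1 := by
  intro h1
  have := h k 1
  simp [h1, I.met.self] at this
  omega

theorem of_pow (I : InvMet d) {m j : ℕ} {u : G} (h : TLox d m (u ^ j)) : TLox d (m * j) u := by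
  intro k z
  have h1 := h k z
  have h2 := I.dist_pow_le (u ^ k) z j
  rw [← pow_mul, mul_comm k j, pow_mul] at h2
  calc k ≤ m * d z ((u ^ j) ^ k * z) := h1
    _ ≤ m * (j * d z (u ^ k * z)) := Nat.mul_le_mul_left _ h2
    _ = m * j * d z (u ^ k * z) := by ring

theorem pow {m : ℕ} {u : G} (h : TLox d m u) {j : ℕ} (hj : 1 ≤ j) : TLox d m (u ^ j) := by
  intro k z
  have := h (j * k) z
  rw [pow_mul] at this
  nlinarith

theorem conj (I : InvMet d) {m : ℕ} {u : G} (h : TLox d m u) (g : G) :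
    TLox d m (g * u * g⁻¹) := by
  intro k z
  have h1 := h k (g⁻¹ * z)
  have h2 := I.disp_conj g (u ^ k) (g⁻¹ * z)
  rw [mul_inv_cancel_left] at h2
  rw [conj_pow, h2]
  exact h1

/-- Some power of a loxodromic element moves a given point along a quasi-geodesic. -/
theorem exists_step (_I : InvMet d) {m : ℕ} {u : G} (h : TLox d m u) (z : G) (c : ℕ) :
    ∃ j, 1 ≤ j ∧ d z (u ^ j * z) + c ≤ d z ((u ^ j) ^ 2 * z) := by
  by_contra hc
  push Not at hc
  have key : ∀ i, d z (u ^ 2 ^ i * z) ≤ d z (u * z) + i * c := by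
    intro i
    induction i with
    | zero => simp
    | succ i ih =>
      have := hc (2 ^ i) Nat.one_le_two_pow
      rw [← pow_mul, ← pow_succ] at this
      rw [Nat.add_mul]
      omega
  obtain ⟨i, hi⟩ : ∃ i, m * (d z (u * z) + i * c) < 2 ^ i := by
    have hb : ∀ b k : ℕ, ∃ i, b + k * i < 2 ^ i := by
      intro b k
      refine ⟨2 * (b + k + 2), ?_⟩
      have h1 : b + k + 2 < 2 ^ (b + k + 2) := Nat.lt_two_pow_self
      have h2 : 2 ^ (2 * (b + k + 2)) = 2 ^ (b + k + 2) * 2 ^ (b + k + 2) := by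
        rw [two_mul, pow_add]
      have h3 : b + k + 3 ≤ 2 ^ (b + k + 2) := h1
      have h5 : (b + k + 3) * (b + k + 3) ≤ 2 ^ (b + k + 2) * 2 ^ (b + k + 2) :=
        Nat.mul_le_mul h3 h3
      have h6 : 2 ^ (b + k + 2) = 4 * 2 ^ (b + k) := by rw [pow_add]; ring
      have h7 : b + k + 1 ≤ 2 ^ (b + k) := Nat.lt_two_pow_self
      nlinarith
    obtain ⟨i, hi⟩ := hb (m * d z (u * z)) (m * c)
    exact ⟨i, by nlinarith⟩
  have h1 := h (2 ^ i) z
  have h2 := Nat.mul_le_mul_left m (key i)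
  omega

end TLox
end Lox

/-! ### Almost fixed intervals -/

section Shift

theorem HypMet.trim {X : Type*} {d : X → X → ℕ} (h : HypMet d) (p q : X) {r : ℕ}
    (hr : 2 * r ≤ d p q) : ∃ p₁ q₁, d p p₁ = r ∧ d q₁ q = r ∧ d p₁ q₁ + 2 * r = d p q ∧
      d p p₁ + d p₁ q = d p q ∧ d p q₁ + d q₁ q = d p q := by
  obtain ⟨p₁, h1, h2⟩ := h.geod p q r (by omega)
  obtain ⟨q₁, h3, h4⟩ := h.geod p₁ q (d p q - 2 * r) (by omega)
  have := h.tri p p₁ q₁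
  have := h.tri p q₁ q
  exact ⟨p₁, q₁, h1, by omega, by omega, by omega, by omega⟩

theorem HypMet.buse {X : Type*} {d : X → X → ℕ} (h : HypMet d) {p p' x y : X}
    (hxy : d p p' + d x y ≤ d p y + d p' x) : d p x + d p' y ≤ d p y + d p' x + 300 := by
  have := h.hyp p p' x y
  have := h.symm p' x
  omega

variable {G : Type*} [Group G] {d : G → G → ℕ}

namespace InvMet

theorem disp_between (I : InvMet d) {p q z u : G} {l c : ℕ} (hp : d p (u * p) ≤ l)
    (hq : d q (u * q) ≤ l) (hz : d p z + d z q ≤ d p q + c) : d z (u * z) ≤ l + c + 300 := by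
  have h1 := I.met.hyp p z q (u * z)
  have h2 := I.met.tri p (u * p) (u * z)
  have h3 := I.met.tri q (u * q) (u * z)
  have h4 := I.met.symm q (u * z)
  have h5 := I.met.symm q z
  rw [I.inv] at h2 h3
  omega

theorem near_move (I : InvMet d) {p q z u : G} {l : ℕ} (hp : d p (u * p) ≤ l)
    (hq : d q (u * q) ≤ l) (hz : d p z + d z q = d p q) (h1 : 2 * l + 300 ≤ d p z)
    (h2 : 2 * l + 300 ≤ d z q) : d p (u * z) + d (u * z) q ≤ d p q + 600 := by
  have a1 := I.inv u p z
  have a2 := I.inv u z q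
  have a3 := I.inv u p q
  have b1 := I.met.hyp (u * p) p (u * q) (u * z)
  have b2 := I.met.hyp (u * q) q p (u * z)
  have s1 := I.met.symm (u * p) (u * z)
  have s2 := I.met.symm (u * q) (u * z)
  have s3 := I.met.symm q p
  have s4 := I.met.symm q (u * z)
  have s5 := I.met.symm (u * q) p
  have s6 := I.met.symm p (u * z)
  have t1 := I.met.tri p (u * p) (u * z)
  have t2 := I.met.tri q (u * q) (u * z)
  have t3 := I.met.tri (u * p) p (u * z)
  have t4 := I.met.tri (u * q) q (u * z)
  have t5 := I.met.tri p q (u * q)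
  have t6 := I.met.tri p (u * q) q
  have s7 := I.met.symm (u * q) q
  have s8 := I.met.symm (u * p) p
  omega

/-- Commutators of elements which almost fix both ends of an interval move the points deep inside
the interval very little. -/
theorem comm_small (I : InvMet d) {p q z u v : G} {l : ℕ} (hup : d p (u * p) ≤ l)
    (huq : d q (u * q) ≤ l) (hvp : d p (v * p) ≤ l) (hvq : d q (v * q) ≤ l)
    (hz : d p z + d z q = d p q) (h1 : 10 * l + 3000 ≤ d p z)
    (h2 : 10 * l + 3000 ≤ d z q) : d (u * (v * z)) (v * (u * z)) ≤ 1500 := by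
  have huz := I.disp_between (c := 0) hup huq hz.le
  have hvz := I.disp_between (c := 0) hvp hvq hz.le
  have nuv := I.near_move (u := u * v) (l := 2 * l) ((I.disp_mul_le u v p).trans (by omega))
    ((I.disp_mul_le u v q).trans (by omega)) hz (by omega) (by omega)
  have nvu := I.near_move (u := v * u) (l := 2 * l) ((I.disp_mul_le v u p).trans (by omega))
    ((I.disp_mul_le v u q).trans (by omega)) hz (by omega) (by omega)
  rw [mul_assoc] at nuv nvu
  have i1 := I.inv u p z
  have i2 := I.inv u q z
  have i3 := I.inv v p z
  have i4 := I.inv v q z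
  have i5 := I.inv u p (v * z)
  have i6 := I.inv u q (v * z)
  have i7 := I.inv v p (u * z)
  have i8 := I.inv v q (u * z)
  have i9 := I.inv u z (v * z)
  have i10 := I.inv v z (u * z)
  have t1 := I.met.tri p (u * z) z
  have t2 := I.met.tri q (u * z) z
  have t3 := I.met.tri p (v * z) z
  have t4 := I.met.tri q (v * z) z
  have s1 := I.met.symm (u * z) z
  have s2 := I.met.symm (v * z) z
  have s3 := I.met.symm q z
  have t5 := I.met.tri p (u * (v * z)) (u * z)
  have t6 := I.met.tri q (u * (v * z)) (u * z)
  have t7 := I.met.tri p (v * (u * z)) (v * z)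
  have t8 := I.met.tri q (v * (u * z)) (v * z)
  have s5 := I.met.symm (u * (v * z)) (u * z)
  have s6 := I.met.symm (v * (u * z)) (v * z)
  have b1 := I.met.buse (p := p) (p' := u * p) (x := u * z) (y := u * (v * z)) (by omega)
  have b2 := I.met.buse (p := p) (p' := u * p) (x := u * (v * z)) (y := u * z) (by omega)
  have b3 := I.met.buse (p := q) (p' := u * q) (x := u * z) (y := u * (v * z)) (by omega)
  have b4 := I.met.buse (p := q) (p' := u * q) (x := u * (v * z)) (y := u * z) (by omega)
  have b5 := I.met.buse (p := p) (p' := v * p) (x := v * z) (y := v * (u * z)) (by omega)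
  have b6 := I.met.buse (p := p) (p' := v * p) (x := v * (u * z)) (y := v * z) (by omega)
  have b7 := I.met.buse (p := q) (p' := v * q) (x := v * z) (y := v * (u * z)) (by omega)
  have b8 := I.met.buse (p := q) (p' := v * q) (x := v * (u * z)) (y := v * z) (by omega)
  have f := I.met.hyp p (u * (v * z)) q (v * (u * z))
  have s7 := I.met.symm (u * (v * z)) q
  have s8 := I.met.symm (v * (u * z)) q
  clear t1 t2 t3 t4 t5 t6 t7 t8 huz hvz
  omega

/-- An element which almost fixes both ends of an interval translates along the interval. -/
theorem double_move (I : InvMet d) {p q z u : G} {l : ℕ} (hup : d p (u * p) ≤ l)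
    (huq : d q (u * q) ≤ l) (hz : d p z + d z q = d p q) (h1 : 10 * l + 3000 ≤ d p z)
    (h2 : 10 * l + 3000 ≤ d z q) : 2 * d z (u * z) ≤ d z (u ^ 2 * z) + 1500 := by
  have huz := I.disp_between (c := 0) hup huq hz.le
  have n1 := I.near_move hup huq hz (by omega) (by omega)
  rw [pow_two, mul_assoc]
  have i1 := I.inv u p z
  have i2 := I.inv u q z
  have i5 := I.inv u p (u * z)
  have i6 := I.inv u q (u * z)
  have i9 := I.inv u z (u * z)
  have t1 := I.met.tri p (u * z) z
  have t2 := I.met.tri q (u * z) z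
  have s1 := I.met.symm (u * z) z
  have s3 := I.met.symm q z
  have t5 := I.met.tri p (u * (u * z)) (u * z)
  have t6 := I.met.tri q (u * (u * z)) (u * z)
  have s5 := I.met.symm (u * (u * z)) (u * z)
  have b1 := I.met.buse (p := p) (p' := u * p) (x := u * z) (y := u * (u * z)) (by omega)
  have b2 := I.met.buse (p := p) (p' := u * p) (x := u * (u * z)) (y := u * z) (by omega)
  have b3 := I.met.buse (p := q) (p' := u * q) (x := u * z) (y := u * (u * z)) (by omega)
  have b4 := I.met.buse (p := q) (p' := u * q) (x := u * (u * z)) (y := u * z) (by omega)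
  have f := I.met.hyp p z q (u * z)
  have s7 := I.met.symm (u * z) q
  have t7 := I.met.tri p (u * (u * z)) z
  have t8 := I.met.tri q (u * (u * z)) z
  have t9 := I.met.tri p z (u * (u * z))
  have t10 := I.met.tri q z (u * (u * z))
  have s8 := I.met.symm (u * (u * z)) z
  clear t5 t6 t1 t2
  omega

end InvMet

end Shift

/-! ### Acylindricity -/

section Acyl

variable {G : Type*} [Group G] {d : G → G → ℕ}

/-- Elements which move two distant points a little commute, and are trivial or loxodromic. -/
def Acyl (d : G → G → ℕ) (L m : ℕ) : Prop := ∀ u v x y, L ≤ d x y → d x (u * x) ≤ 300000 →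
  d y (u * y) ≤ 300000 → d x (v * x) ≤ 300000 → d y (v * y) ≤ 300000 →
    u * v = v * u ∧ (u = 1 ∨ TLox d m u)

namespace InvMet

set_option maxRecDepth 4000 in
theorem commute_commutator (I : InvMet d) {L m l : ℕ} (A : Acyl d L m) {p q u v : G}
    (hup : d p (u * p) ≤ l) (huq : d q (u * q) ≤ l) (hvp : d p (v * p) ≤ l)
    (hvq : d q (v * q) ≤ l) (hL : L + 100 * l + 200000 * (1500 * m + 1) ≤ d p q) :
    Commute u ((v * u)⁻¹ * (u * v)) := by
  obtain ⟨J, hJ⟩ : ∃ J, J = 1500 * m + 1 := ⟨_, rfl⟩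
  rw [← hJ] at hL
  obtain ⟨c, hc⟩ : ∃ c, c = (v * u)⁻¹ * (u * v) := ⟨_, rfl⟩
  rw [← hc]
  have c0 : u * v = v * u * c := by rw [hc, mul_inv_cancel_left]
  have c1 : ∀ z, d p z + d z q = d p q → 10 * l + 3000 ≤ d p z → 10 * l + 3000 ≤ d z q →
      d z (c * z) ≤ 1500 := by
    intro z h1 h2 h3
    have := I.comm_small hup huq hvp hvq h1 h2 h3
    have e : u * (v * z) = v * (u * (c * z)) := by rw [← mul_assoc, c0]; simp only [mul_assoc]
    rwa [e, I.inv, I.inv, I.met.symm] at this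
  obtain ⟨p₁, q₁, a1, a2, a3, a4, a5⟩ := I.met.trim p q (r := 10 * l + 3000) (by omega)
  have hp₁ := c1 p₁ a4 (by omega) (by omega)
  have hq₁ := c1 q₁ a5 (by omega) (by omega)
  obtain ⟨p₂, q₂, b1, b2, b3, b4, b5⟩ := I.met.trim p₁ q₁ (r := 2 * l + 1000) (by omega)
  have up₁ := I.disp_between (c := 0) hup huq a4.le
  have uq₁ := I.disp_between (c := 0) hup huq a5.le
  have n1 : ∀ z, d p₁ z + d z q₁ = d p₁ q₁ → 2 * l + 1000 ≤ d p₁ z → 2 * l + 1000 ≤ d z q₁ →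
      d z (c * z) ≤ 1800 ∧ d z (u * c * u⁻¹ * z) ≤ 2400 := by
    intro z h1 h2 h3
    refine ⟨I.disp_between (c := 0) hp₁ hq₁ h1.le, ?_⟩
    have h4 := I.near_move (u := u⁻¹) (l := l + 0 + 300) (by rwa [I.dist_inv])
      (by rwa [I.dist_inv]) h1 (by omega) (by omega)
    have h5 := I.disp_between hp₁ hq₁ h4
    rw [← I.disp_conj u, mul_inv_cancel_left] at h5
    omega
  have hcc := A c (u * c * u⁻¹) p₂ q₂ (by omega)
    ((n1 p₂ b4 (by omega) (by omega)).1.trans (by omega))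
    ((n1 q₂ b5 (by omega) (by omega)).1.trans (by omega))
    ((n1 p₂ b4 (by omega) (by omega)).2.trans (by omega))
    ((n1 q₂ b5 (by omega) (by omega)).2.trans (by omega))
  obtain ⟨t, ht⟩ : ∃ t, t = u * c * u⁻¹ * c⁻¹ := ⟨_, rfl⟩
  have htc : Commute t c := by
    have : Commute (u * c * u⁻¹) c := hcc.1.symm
    rw [ht]
    exact this.mul_left (Commute.refl c).inv_left
  have ht2 : ∀ j, u * c ^ j = t ^ j * c ^ j * u := by
    intro j
    rw [← htc.mul_pow, ht, inv_mul_cancel_right, conj_pow, inv_mul_cancel_right]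
  have hcp : ∀ j ≤ J, d p₁ (c ^ j * p₁) ≤ l + 1500 * J ∧ d q₁ (c ^ j * q₁) ≤ l + 1500 * J := by
    intro j hj
    have e1 := I.dist_pow_le c p₁ j
    have e2 := I.dist_pow_le c q₁ j
    have e3 := Nat.mul_le_mul hj hp₁
    have e4 := Nat.mul_le_mul hj hq₁
    exact ⟨by omega, by omega⟩
  obtain ⟨p₃, q₃, d1, d2, d3, d4, d5⟩ := I.met.trim p₁ q₁ (r := 10 * (l + 1500 * J) + 6000)
    (by omega)
  have ht3 : ∀ j ≤ J, ∀ z, d p₁ z + d z q₁ = d p₁ q₁ → 10 * (l + 1500 * J) + 6000 ≤ d p₁ z →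
      10 * (l + 1500 * J) + 6000 ≤ d z q₁ → d (u * z) (t ^ j * (u * z)) ≤ 1500 := by
    intro j hj z h1 h2 h3
    have h4 := I.comm_small (l := l + 1500 * J + 300) (u := u) (v := c ^ j) (by omega) (by omega)
      ((hcp j hj).1.trans (by omega)) ((hcp j hj).2.trans (by omega)) h1 (by omega) (by omega)
    rw [I.met.symm, ← mul_assoc u, ht2, mul_assoc, mul_assoc] at h4
    have : t ^ j * (c ^ j * (u * z)) = c ^ j * (t ^ j * (u * z)) := by
      rw [← mul_assoc, (htc.pow_pow j j).eq, mul_assoc]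
    rwa [this, I.inv] at h4
  have hJ1 : 1 ≤ J := by omega
  have e1 := ht3 1 hJ1 p₃ d4 (by omega) (by omega)
  have e2 := ht3 1 hJ1 q₃ d5 (by omega) (by omega)
  rw [pow_one] at e1 e2
  have e3 := ht3 J le_rfl p₃ d4 (by omega) (by omega)
  have e4 := A t t (u * p₃) (u * q₃) (by rw [I.inv]; omega) (by omega) (by omega)
    (by omega) (by omega)
  rcases e4.2 with h | h
  · have := ht2 1
    rw [h, pow_one, one_pow, one_mul] at this
    exact this
  · have h1 := h J (u * p₃)
    have h2 := Nat.mul_le_mul_left m e3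
    omega

set_option maxRecDepth 4000 in
/-- Acylindricity with arbitrary displacements. -/
theorem acyl_long (I : InvMet d) {L m l : ℕ} (A : Acyl d L m) (hm : 1 ≤ m) {p q u v : G}
    (hup : d p (u * p) ≤ l) (huq : d q (u * q) ≤ l) (hvp : d p (v * p) ≤ l)
    (hvq : d q (v * q) ≤ l) (hL : L + 100 * l + 1000000000 * m ≤ d p q) :
    u * v = v * u ∧ (u = 1 ∨ TLox d m u) := by
  obtain ⟨J, hJ⟩ : ∃ J, J = 1500 * m + 1 := ⟨_, rfl⟩
  have hu := I.commute_commutator A hup huq hvp hvq (by omega)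
  have hv := I.commute_commutator A hvp hvq hup huq (by omega)
  obtain ⟨c, hc⟩ : ∃ c, c = (v * u)⁻¹ * (u * v) := ⟨_, rfl⟩
  have hc' : (u * v)⁻¹ * (v * u) = c⁻¹ := by rw [hc]; group
  rw [← hc] at hu
  rw [hc'] at hv
  replace hv : Commute v c := by simpa using hv
  have c0 : u * v = v * u * c := by rw [hc, mul_inv_cancel_left]
  have c1 : ∀ z, d p z + d z q = d p q → 10 * l + 3000 ≤ d p z → 10 * l + 3000 ≤ d z q →
      d z (c * z) ≤ 1500 := by
    intro z h1 h2 h3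
    have := I.comm_small hup huq hvp hvq h1 h2 h3
    have e : u * (v * z) = v * (u * (c * z)) := by rw [← mul_assoc, c0]; simp only [mul_assoc]
    rwa [e, I.inv, I.inv, I.met.symm] at this
  obtain ⟨p₁, q₁, a1, a2, a3, a4, a5⟩ := I.met.trim p q (r := 10 * l + 3000) (by omega)
  have hp₁ := c1 p₁ a4 (by omega) (by omega)
  have hq₁ := c1 q₁ a5 (by omega) (by omega)
  have hc1 : c = 1 := by
    rcases (A c c p₁ q₁ (by omega) (by omega) (by omega) (by omega) (by omega)).2 with h | h
    · exact h
    exfalso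
    have hpow : ∀ k : ℕ, u ^ k * v = v * u ^ k * c ^ k := by
      intro k
      induction k with
      | zero => simp
      | succ k ih =>
        have := (hu.pow_left k).eq
        calc u ^ (k + 1) * v = u * (u ^ k * v) := by rw [pow_succ', mul_assoc]
          _ = u * v * u ^ k * c ^ k := by rw [ih]; simp only [mul_assoc]
          _ = v * u * (c * u ^ k) * c ^ k := by rw [c0]; simp only [mul_assoc]
          _ = v * (u * u ^ k) * (c * c ^ k) := by rw [← this]; simp only [mul_assoc]
          _ = _ := by rw [← pow_succ', ← pow_succ']
    obtain ⟨k, hk⟩ : ∃ k, k = m * (2 * (10 * (J * l) + 3000)) := ⟨_, rfl⟩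
    have h1 := h k p
    have h2 : 2 * (10 * (J * l) + 3000) ≤ d p (c ^ k * p) := by
      rw [hk] at h1 ⊢
      exact Nat.le_of_mul_le_mul_left h1 hm
    obtain ⟨z, -, hz, -, -, h3, -⟩ := I.met.trim p (c ^ k * p) h2
    have g1 := I.disp_commute (hu.pow_right k) p
    have g2 := I.disp_commute (hv.pow_right k) p
    have e1 := I.dist_pow_le u p J
    have e2 := I.dist_pow_le u (c ^ k * p) J
    have e3 : J * d p (u * p) ≤ J * l := Nat.mul_le_mul_left _ hup
    have e4 : J * d (c ^ k * p) (u * (c ^ k * p)) ≤ J * l := Nat.mul_le_mul_left _ (by omega)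
    have e5 : l ≤ J * l := Nat.le_mul_of_pos_left _ (by omega)
    have e6 := I.comm_small (l := J * l) (u := u ^ J) (v := v) (e1.trans e3) (e2.trans e4)
      (by omega) (by omega) h3 (by omega) (by omega)
    rw [← mul_assoc, hpow, mul_assoc, mul_assoc, I.inv, I.inv, I.met.symm] at e6
    have := h J z
    have := Nat.mul_le_mul_left m e6
    omega
  refine ⟨by rw [c0, hc1, mul_one], ?_⟩
  by_cases hs : d p₁ (u * p₁) ≤ 300000
  · by_cases hs' : d q₁ (u * q₁) ≤ 300000
    · exact (A u u p₁ q₁ (by omega) hs hs' hs hs').2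
    · have := I.double_move hup huq a5 (by omega) (by omega)
      exact Or.inr ((I.tlox_of_step (y := q₁) (by omega)).mono hm)
  · have := I.double_move hup huq a4 (by omega) (by omega)
    exact Or.inr ((I.tlox_of_step (y := p₁) (by omega)).mono hm)

end InvMet

end Acyl

/-! ### Axes -/

section Axis

variable {G : Type*} [Group G] {d : G → G → ℕ}

/-- A hyperbolic metric on a group to which small cancellation theory applies. -/
structure Stage (d : G → G → ℕ) (L m n : ℕ) : Prop extends InvMet d where
  sep : ∀ x y, d x y = 0 → x = y
  pos : 1 ≤ m
  acyl : Acyl d L m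
  tors : ∀ u : G, u ^ n = 1 ∨ ∃ m', TLox d m' u
  odd : Odd n

/-- The properties of centralizers of loxodromic elements. -/
structure Axial (d : G → G → ℕ) (m : ℕ) (E : Subgroup G) : Prop where
  comm : ∀ u ∈ E, ∀ v ∈ E, u * v = v * u
  lox : ∀ u ∈ E, u ≠ 1 → TLox d m u
  mem : ∀ w ∈ E, w ≠ 1 → ∀ x, x * w = w * x → x ∈ E
  nontriv : ∃ w ∈ E, w ≠ 1

/-- The point `z` is moved by `w` along an axis. -/
def OnAxis (d : G → G → ℕ) (w z : G) : Prop :=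
  ∃ K, ∀ k, K ≤ k → 2 * d z (w ^ k * z) ≤ d z (w ^ (2 * k) * z) + 1200

def axis (d : G → G → ℕ) (E : Subgroup G) : Set G := {z | ∃ w ∈ E, w ≠ 1 ∧ OnAxis d w z}

theorem TLox.pos {m : ℕ} {u : G} (h : TLox d m u) : 1 ≤ m := by
  have := h 1 1
  rcases Nat.eq_zero_or_pos m with rfl | h
  · omega
  · exact h

theorem TLox.far {m : ℕ} {u : G} (h : TLox d m u) (z : G) (c : ℕ) {k : ℕ} (hk : m * c ≤ k) :
    c ≤ d z (u ^ k * z) :=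
  Nat.le_of_mul_le_mul_left (hk.trans (h k z)) h.pos

theorem HypMet.extend {X : Type*} {d : X → X → ℕ} (h : HypMet d) {p p' q z : X} {c R : ℕ}
    (h1 : d p z + d z q ≤ d p q + c) (h2 : d p' p + d p z ≤ d p' z + R)
    (h3 : R + c + 300 < 2 * d p z) : d p' z + d z q ≤ d p' q + c + 300 := by
  have := h.hyp p' p z q
  have := h.symm z p
  omega

namespace InvMet

theorem commute_of_lox (I : InvMet d) {L m m' : ℕ} (A : Acyl d L m) (hm : 1 ≤ m) {w u v : G}
    (hw : TLox d m' w) (hu : Commute u w) (hv : Commute v w) :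
    u * v = v * u ∧ (u = 1 ∨ TLox d m u) := by
  obtain ⟨l, hl⟩ : ∃ l, l = d 1 (u * 1) + d 1 (v * 1) := ⟨_, rfl⟩
  obtain ⟨k, hk⟩ : ∃ k, k = m' * (L + 100 * l + 1000000000 * m) := ⟨_, rfl⟩
  have h1 := hw.far 1 (L + 100 * l + 1000000000 * m) hk.ge
  have h2 := I.disp_commute (hu.pow_right k) 1
  have h3 := I.disp_commute (hv.pow_right k) 1
  exact I.acyl_long A hm (l := l) (by omega) (by omega) (by omega) (by omega) h1

/-- A point is almost between its translates if the displacement of the square is large. -/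
theorem disp_back (I : InvMet d) (w z : G) : d (w⁻¹ * z) (w * z) = d z (w ^ 2 * z) := by
  rw [← I.inv w, mul_inv_cancel_left, pow_two, mul_assoc]

theorem back_le (I : InvMet d) {w z : G} {c : ℕ} (h : 2 * d z (w * z) ≤ d z (w ^ 2 * z) + c) :
    d (w⁻¹ * z) z + d z (w * z) ≤ d (w⁻¹ * z) (w * z) + c := by
  rw [I.disp_back, I.met.symm (w⁻¹ * z), I.dist_inv]
  omega

theorem exists_back (I : InvMet d) {m' : ℕ} {w z : G} (hw : TLox d m' w)
    (h : OnAxis d w z) (c : ℕ) : ∃ g : G, (∃ k : ℕ, g = w ^ k) ∧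
      d (g⁻¹ * z) z + d z (g * z) ≤ d (g⁻¹ * z) (g * z) + 1200 ∧ c ≤ d z (g * z) ∧
      c ≤ d (g⁻¹ * z) z := by
  obtain ⟨K, hK⟩ := h
  have h1 := hK (K + m' * c) (by omega)
  have h2 := hw.far z c (k := K + m' * c) (by omega)
  refine ⟨w ^ (K + m' * c), ⟨_, rfl⟩, I.back_le ?_, h2, ?_⟩
  · rwa [← pow_mul, mul_comm _ 2]
  · rwa [I.met.symm, I.dist_inv]

theorem excess_orbit (I : InvMet d) {w y : G} {s : ℕ} (hs : 151 ≤ s)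
    (h : d y (w * y) + 300 + s ≤ d y (w ^ 2 * y)) (i : ℕ) {j : ℕ} (hj : 1 ≤ j) :
    d y (w ^ i * y) + d y (w ^ j * y) ≤ d y (w ^ (i + j) * y) + d y (w * y) + 300 := by
  obtain ⟨j, rfl⟩ : ∃ k, j = k + 1 := ⟨j - 1, by omega⟩
  have h1 := I.met.hyp y (w ^ i * y) (w ^ (i + 1) * y) (w ^ (i + (j + 1)) * y)
  have e1 := I.disp_shift w y i (j + 1)
  have e2 := I.disp_shift w y (i + 1) j
  have e3 := I.disp_shift w y i 1
  rw [show i + 1 + j = i + (j + 1) by omega] at e2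
  rw [pow_one] at e3
  have h2 := I.step_le (by omega) h i
  have h3 := I.step_le (by omega) h j
  omega

theorem exists_onAxis (I : InvMet d) {m' : ℕ} {u : G} (hu : TLox d m' u) :
    ∃ j, 1 ≤ j ∧ ∃ z, OnAxis d (u ^ j) z := by
  obtain ⟨y, hy⟩ : ∃ y : G, y = 1 := ⟨1, rfl⟩
  obtain ⟨j, hj, h⟩ := hu.exists_step I y 451
  refine ⟨j, hj, ?_⟩
  obtain ⟨w, hw⟩ : ∃ w, w = u ^ j := ⟨_, rfl⟩
  rw [← hw] at h ⊢
  have hlox : TLox d m' w := hw ▸ hu.pow hj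
  obtain ⟨R, hR⟩ : ∃ R, R = d y (w * y) + 300 := ⟨_, rfl⟩
  have ex : ∀ i j : ℕ, d y (w ^ i * y) + d y (w ^ j * y) ≤ d y (w ^ (i + j) * y) + R := by
    intro i j
    rcases Nat.eq_zero_or_pos j with rfl | hj
    · simp [I.met.self]
    · have := I.excess_orbit (s := 151) le_rfl (by omega) i hj
      omega
  have back : ∀ k : ℕ, d ((w ^ k)⁻¹ * y) y = d y (w ^ k * y) := fun k => by
    rw [I.met.symm, I.dist_inv]
  have across : ∀ i j : ℕ, d ((w ^ i)⁻¹ * y) (w ^ j * y) = d y (w ^ (i + j) * y) := fun i j => by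
    rw [← I.inv (w ^ i), mul_inv_cancel_left, ← mul_assoc, pow_add]
  have across' : ∀ i j : ℕ, d ((w ^ (i + j))⁻¹ * y) ((w ^ i)⁻¹ * y) = d y (w ^ j * y) :=
    fun i j => by
      rw [← I.inv (w ^ (i + j)), mul_inv_cancel_left, add_comm, pow_add, mul_assoc,
        mul_inv_cancel_left]
  obtain ⟨N, hN⟩ : ∃ N, N = m' * (100 * R + 10000) := ⟨_, rfl⟩
  have hNf := hlox.far y (100 * R + 10000) hN.ge
  have hexN := ex N N
  obtain ⟨z, hz1, hz2⟩ := I.met.near_interval (x := (w ^ N)⁻¹ * y) (y := w ^ N * y) (z := y)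
    (c := R) (by rw [back, across]; exact hexN)
  refine ⟨z, N + N, fun k hk => ?_⟩
  obtain ⟨i, rfl⟩ : ∃ i, k = N + i := ⟨k - N, by omega⟩
  have f1 := ex N i
  have f2 := across' N i
  have f3 := back (N + i)
  have f4 := back N
  have hs : d ((w ^ (N + i))⁻¹ * z) ((w ^ (N + i))⁻¹ * y) = d z y := I.inv _ _ _
  have hs' : d (w ^ (N + i) * z) (w ^ (N + i) * y) = d z y := I.inv _ _ _
  have f5 := I.disp_shift w y N i
  have s1 := I.met.symm y z
  have s2 := I.met.symm ((w ^ (N + i))⁻¹ * y) ((w ^ (N + i))⁻¹ * z)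
  have s3 := I.met.symm (w ^ N * y) y
  have t1 := I.met.tri ((w ^ N)⁻¹ * y) z y
  have t2 := I.met.tri ((w ^ N)⁻¹ * y) y z
  have t3 := I.met.tri y z (w ^ N * y)
  have t4 := I.met.tri z y (w ^ N * y)
  have t5 := I.met.tri ((w ^ (N + i))⁻¹ * z) ((w ^ (N + i))⁻¹ * y) ((w ^ N)⁻¹ * y)
  have t6 := I.met.tri ((w ^ (N + i))⁻¹ * y) ((w ^ (N + i))⁻¹ * z) z
  have t7 := I.met.tri ((w ^ (N + i))⁻¹ * y) z y
  have g1 := I.met.extend (p := (w ^ N)⁻¹ * y) (p' := (w ^ (N + i))⁻¹ * z) (q := w ^ N * y) (z := z)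
    (c := 0) (R := 6 * R + 2000) (by omega) (by omega) (by omega)
  have t8 := I.met.tri (w ^ N * y) (w ^ (N + i) * y) (w ^ (N + i) * z)
  have t9 := I.met.tri y z (w ^ (N + i) * z)
  have t10 := I.met.tri y (w ^ (N + i) * z) (w ^ (N + i) * y)
  have s4 := I.met.symm (w ^ (N + i) * y) (w ^ (N + i) * z)
  have s5 := I.met.symm (w ^ N * y) z
  have s6 := I.met.symm (w ^ (N + i) * z) (w ^ N * y)
  have s7 := I.met.symm (w ^ (N + i) * z) z
  have s8 := I.met.symm z ((w ^ (N + i))⁻¹ * z)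
  have s9 := I.met.symm (w ^ N * y) ((w ^ (N + i))⁻¹ * z)
  have g2 := I.met.extend (p := w ^ N * y) (p' := w ^ (N + i) * z) (q := (w ^ (N + i))⁻¹ * z)
    (z := z) (c := 300) (R := 6 * R + 2000) (by omega) (by omega) (by omega)
  have g3 := I.disp_back (w ^ (N + i)) z
  have g4 := I.dist_inv (w ^ (N + i)) z
  rw [← pow_mul, mul_comm _ 2] at g3
  have s10 := I.met.symm (w ^ (N + i) * z) ((w ^ (N + i))⁻¹ * z)
  omega

end InvMet

end Axis

section AxisGeometry

variable {G : Type*} [Group G] {d : G → G → ℕ} {L m n : ℕ}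

theorem Stage.axial_centralizer (S : Stage d L m n) {m' : ℕ} {u : G} (hu : TLox d m' u) :
    Axial d m (Subgroup.centralizer {u}) where
  comm x hx y hy := by
    rw [Subgroup.mem_centralizer_singleton_iff] at hx hy
    exact (S.commute_of_lox S.acyl S.pos hu hx hy).1
  lox x hx h1 := by
    rw [Subgroup.mem_centralizer_singleton_iff] at hx
    exact (S.commute_of_lox S.acyl S.pos hu hx hx).2.resolve_left h1
  mem w hw h1 x hx := by
    rw [Subgroup.mem_centralizer_singleton_iff] at hw ⊢
    have h2 := (S.commute_of_lox S.acyl S.pos hu hw hw).2.resolve_left h1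
    exact (S.commute_of_lox S.acyl S.pos h2 hx hw.symm).1
  nontriv := ⟨u, by rw [Subgroup.mem_centralizer_singleton_iff], hu.ne_one S.toInvMet⟩

theorem HypMet.mid_excess {X : Type*} {d : X → X → ℕ} (h : HypMet d) {P Q z₁ z₂ x : X}
    (h1 : d P z₁ + d z₁ Q ≤ d P Q + 11100) (h2 : d P z₂ + d z₂ Q ≤ d P Q + 11100)
    (hx : d z₁ x + d x z₂ = d z₁ z₂) (hx1 : 15000 < d z₁ x) (hx2 : 15000 < d x z₂) :
    d P x + d x Q ≤ d P Q + 600 := by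
  wlog h12 : d P z₁ ≤ d P z₂ generalizing z₁ z₂
  · have s1 := h.symm z₁ x
    have s2 := h.symm x z₂
    have s3 := h.symm z₁ z₂
    exact this h2 h1 (by omega) (by omega) (by omega) (by omega)
  have o1 := h.order_left h1 h2 h12
  have o2 := h.order_right h1 h2 h12
  rw [max_self] at o1 o2
  have t1 := h.tri P x z₂
  have e1 := h.extend (p := z₁) (p' := P) (q := z₂) (z := x) (c := 0) (R := 11400)
    (by omega) (by omega) (by omega)
  have s2 := h.symm x z₂
  have s4 := h.symm z₂ Q
  have s5 := h.symm x Q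
  have s6 := h.symm P z₂
  have s7 := h.symm P x
  have s8 := h.symm P Q
  have t2 := h.tri z₁ x Q
  have e2 := h.extend (p := z₂) (p' := Q) (q := P) (z := x) (c := 300) (R := 22500)
    (by omega) (by omega) (by omega)
  omega

namespace Axial

variable {E : Subgroup G}

theorem axis_move (I : InvMet d) (A : Axial d m E) {z : G} (hz : z ∈ axis d E) {u : G}
    (hu : u ∈ E) : 2 * d z (u * z) ≤ d z (u ^ 2 * z) + 10500 := by
  obtain ⟨w, hw, hw1, hax⟩ := hz
  obtain ⟨g, ⟨k, rfl⟩, h1, h2, h3⟩ := I.exists_back (A.lox w hw hw1) hax (10 * d z (u * z) + 5000)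
  obtain ⟨z', h4, h5⟩ := I.met.near_interval h1
  have hc : Commute u (w ^ k) := (show Commute u w from A.comm u hu w hw).pow_right k
  have g1 := I.disp_commute hc z
  have g2 := I.disp_commute hc.inv_right z
  have t1 := I.met.tri ((w ^ k)⁻¹ * z) z' z
  have t2 := I.met.tri z z' (w ^ k * z)
  have s1 := I.met.symm z z'
  have h6 := I.double_move (l := d z (u * z)) g2.le g1.le h4 (by omega) (by omega)
  have c1 := I.disp_change u z' z
  have c2 := I.disp_change (u ^ 2) z z'
  omega

theorem axis_excess (I : InvMet d) (A : Axial d m E) {z : G} (hz : z ∈ axis d E) {u : G}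
    (hu : u ∈ E) : d (u⁻¹ * z) z + d z (u * z) ≤ d (u⁻¹ * z) (u * z) + 10500 :=
  I.back_le (A.axis_move I hz hu)

theorem axis_short (I : InvMet d) (A : Axial d m E) {z : G} (hz : z ∈ axis d E) {u : G}
    (hu : u ∈ E) {y : G} (hy : d y (u * y) ≤ 60000) : d z (u * z) ≤ 71000 := by
  by_contra hc
  push Not at hc
  have h1 := A.axis_move I hz hu
  have h2 := I.speed (w := u) (y := z) (s := 60001) (by omega) (by omega) 1 y
  rw [pow_one] at h2
  omega

theorem _root_.BurnsideSQ.InvMet.change_base (I : InvMet d) {w z z' : G} {c k : ℕ}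
    (h : d ((w ^ k)⁻¹ * z) z + d z (w ^ k * z) ≤ d ((w ^ k)⁻¹ * z) (w ^ k * z) + c)
    (hk : d z z' + c + 1000 ≤ d z (w ^ k * z)) :
    d ((w ^ k)⁻¹ * z') z + d z (w ^ k * z') ≤ d ((w ^ k)⁻¹ * z') (w ^ k * z') + c + 600 := by
  have s0 := I.dist_inv (w ^ k) z
  have s1 : d ((w ^ k)⁻¹ * z') ((w ^ k)⁻¹ * z) = d z z' := by rw [I.inv, I.met.symm]
  have s2 : d (w ^ k * z') (w ^ k * z) = d z z' := by rw [I.inv, I.met.symm]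
  have s3 := I.met.symm ((w ^ k)⁻¹ * z) z
  have s4 := I.met.symm (w ^ k * z) z
  have s5 := I.met.symm (w ^ k * z') z
  have s6 := I.met.symm ((w ^ k)⁻¹ * z') z
  have s7 := I.met.symm (w ^ k * z) ((w ^ k)⁻¹ * z')
  have s8 := I.met.symm (w ^ k * z') ((w ^ k)⁻¹ * z')
  have t1 := I.met.tri ((w ^ k)⁻¹ * z) ((w ^ k)⁻¹ * z') z
  have t2 := I.met.tri (w ^ k * z) (w ^ k * z') z
  have s9 := I.met.symm ((w ^ k)⁻¹ * z) ((w ^ k)⁻¹ * z')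
  have s10 := I.met.symm (w ^ k * z) (w ^ k * z')
  have e1 := I.met.extend (p := (w ^ k)⁻¹ * z) (p' := (w ^ k)⁻¹ * z') (q := w ^ k * z) (z := z)
    (c := c) (R := 2 * d z z') h (by omega) (by omega)
  have e2 := I.met.extend (p := w ^ k * z) (p' := w ^ k * z') (q := (w ^ k)⁻¹ * z') (z := z)
    (c := c + 300) (R := 2 * d z z') (by omega) (by omega) (by omega)
  omega

theorem axis_line (I : InvMet d) (A : Axial d m E) {z : G} (hz : z ∈ axis d E) {w : G}
    (hw : w ∈ E) (hw1 : w ≠ 1) (z₀ : G) : ∃ K, ∀ k, K ≤ k →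
      d ((w ^ k)⁻¹ * z₀) z + d z (w ^ k * z₀) ≤ d ((w ^ k)⁻¹ * z₀) (w ^ k * z₀) + 11100 := by
  refine ⟨m * (d z z₀ + 11500), fun k hk => ?_⟩
  exact I.change_base (A.axis_excess I hz (E.pow_mem hw k))
    (by have := (A.lox w hw hw1).far z _ hk; omega)

theorem axis_mid (I : InvMet d) (A : Axial d m E) {z₁ z₂ x : G} (h1 : z₁ ∈ axis d E)
    (h2 : z₂ ∈ axis d E) (hx : d z₁ x + d x z₂ = d z₁ z₂) (hx1 : 15000 < d z₁ x)
    (hx2 : 15000 < d x z₂) : x ∈ axis d E := by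
  obtain ⟨w, hw, hw1⟩ := A.nontriv
  obtain ⟨K₁, hK₁⟩ := A.axis_line I h1 hw hw1 x
  obtain ⟨K₂, hK₂⟩ := A.axis_line I h2 hw hw1 x
  refine ⟨w, hw, hw1, K₁ + K₂, fun k hk => ?_⟩
  have h3 := I.met.mid_excess (hK₁ k (by omega)) (hK₂ k (by omega)) hx hx1 hx2
  have h4 := I.disp_back (w ^ k) x
  have h5 := I.dist_inv (w ^ k) x
  have h6 := I.met.symm ((w ^ k)⁻¹ * x) x
  rw [← pow_mul, mul_comm] at h4
  omega

theorem axis_qc (I : InvMet d) (A : Axial d m E) {z₁ z₂ x : G} (h1 : z₁ ∈ axis d E)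
    (h2 : z₂ ∈ axis d E) (hx : d z₁ x + d x z₂ = d z₁ z₂) :
    ∃ w ∈ axis d E, d x w ≤ 15000 := by
  by_cases hx1 : 15000 < d z₁ x
  · by_cases hx2 : 15000 < d x z₂
    · exact ⟨x, A.axis_mid I h1 h2 hx hx1 hx2, by simp [I.met.self]⟩
    · exact ⟨z₂, h2, by omega⟩
  · exact ⟨z₁, h1, by rw [I.met.symm]; omega⟩

theorem axis_nonempty (I : InvMet d) (A : Axial d m E) : (axis d E).Nonempty := by
  obtain ⟨w, hw, hw1⟩ := A.nontriv
  obtain ⟨j, hj, z, hz⟩ := I.exists_onAxis (A.lox w hw hw1)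
  exact ⟨z, w ^ j, E.pow_mem hw j, (A.lox w hw hw1).pow_ne_one I hj, hz⟩

theorem eq_of_mem (A : Axial d m E) {E' : Subgroup G} (A' : Axial d m E') {u : G} (hu : u ∈ E)
    (hu2 : u ∈ E') (h1 : u ≠ 1) : E = E' := by
  ext x
  exact ⟨fun hx => A'.mem u hu2 h1 x (A.comm x hx u hu),
    fun hx => A.mem u hu h1 x (A'.comm x hx u hu2)⟩

/-- Two elements which move a point by the same amount along an interval. -/
theorem _root_.BurnsideSQ.InvMet.two_moves (I : InvMet d) {p q z u v : G} {l s : ℕ}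
    (hup : d p (u * p) ≤ l) (huq : d q (u * q) ≤ l) (hvp : d p (v * p) ≤ l)
    (hvq : d q (v * q) ≤ l) (hz : d p z + d z q = d p q) (h1 : 10 * l + 3000 ≤ d p z)
    (h2 : 10 * l + 3000 ≤ d z q) (h3 : d z (u * z) ≤ d z (v * z) + s)
    (h4 : d z (v * z) ≤ d z (u * z) + s) :
    d (u * z) (v * z) ≤ s + 3000 ∨ d z (u * (v * z)) ≤ s + 3000 := by
  have huz := I.disp_between (c := 0) hup huq hz.le
  have hvz := I.disp_between (c := 0) hvp hvq hz.le
  have nu := I.near_move hup huq hz (by omega) (by omega)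
  have nv := I.near_move hvp hvq hz (by omega) (by omega)
  have nuv := I.near_move (u := u * v) (l := 2 * l) ((I.disp_mul_le u v p).trans (by omega))
    ((I.disp_mul_le u v q).trans (by omega)) hz (by omega) (by omega)
  rw [mul_assoc] at nuv
  have i1 := I.inv u p z
  have i2 := I.inv u q z
  have i5 := I.inv u p (v * z)
  have i6 := I.inv u q (v * z)
  have i9 := I.inv u z (v * z)
  have t1 := I.met.tri p (u * z) z
  have t2 := I.met.tri q (u * z) z
  have t3 := I.met.tri p (v * z) z
  have t4 := I.met.tri q (v * z) z
  have s1 := I.met.symm (u * z) z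
  have s2 := I.met.symm (v * z) z
  have s3 := I.met.symm q z
  have t5 := I.met.tri p (u * (v * z)) (u * z)
  have t6 := I.met.tri q (u * (v * z)) (u * z)
  have s5 := I.met.symm (u * (v * z)) (u * z)
  have b1 := I.met.buse (p := p) (p' := u * p) (x := u * z) (y := u * (v * z)) (by omega)
  have b2 := I.met.buse (p := p) (p' := u * p) (x := u * (v * z)) (y := u * z) (by omega)
  have b3 := I.met.buse (p := q) (p' := u * q) (x := u * z) (y := u * (v * z)) (by omega)
  have b4 := I.met.buse (p := q) (p' := u * q) (x := u * (v * z)) (y := u * z) (by omega)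
  have f1 := I.met.hyp p (u * z) q (v * z)
  have f2 := I.met.hyp p z q (u * (v * z))
  have f3 := I.met.hyp p z q (u * z)
  have f4 := I.met.hyp p z q (v * z)
  have s7 := I.met.symm (u * (v * z)) q
  have s8 := I.met.symm (u * z) q
  have s9 := I.met.symm (v * z) q
  have w1 := I.met.tri p z (u * z)
  have w2 := I.met.tri q z (u * z)
  have w3 := I.met.tri p z (v * z)
  have w4 := I.met.tri q z (v * z)
  have w5 := I.met.tri p z q
  clear t5 t6 huz hvz
  omega

theorem mem_of_conj (S : Stage d L m n) (A : Axial d m E) {g : G}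
    (hg : ∀ u ∈ E, g * u * g⁻¹ ∈ E) : g ∈ E := by
  have I := S.toInvMet
  obtain ⟨u, hu, hu1⟩ := A.nontriv
  have hlox := A.lox u hu hu1
  obtain ⟨v, hv⟩ : ∃ v, v = g * u * g⁻¹ := ⟨_, rfl⟩
  have hvE : v ∈ E := hv ▸ hg u hu
  obtain ⟨z, hz⟩ := A.axis_nonempty I
  obtain ⟨s, hs⟩ : ∃ s, s = 2 * d z (g * z) := ⟨_, rfl⟩
  have key : v = u ∨ v = u⁻¹ := by
    obtain ⟨k, hk⟩ : ∃ k, k = m * (s + 20000) + 1 := ⟨_, rfl⟩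
    have conjk : v ^ k = g * u ^ k * g⁻¹ := by rw [hv, conj_pow]
    have dv := I.disp_conj g (u ^ k) z
    rw [← conjk] at dv
    have d1 := I.disp_change (v ^ k) z (g * z)
    have d2 := I.disp_change (v ^ k) (g * z) z
    rw [I.met.symm (g * z) z] at d2
    obtain ⟨w, hw, hw1, hax⟩ := hz
    obtain ⟨h, ⟨j, rfl⟩, h1, h2, h3⟩ := I.exists_back (A.lox w hw hw1) hax
      (10 * (d z (u ^ k * z) + d z (v ^ k * z)) + 10000)
    obtain ⟨z', h4, h5⟩ := I.met.near_interval h1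
    have t1 := I.met.tri ((w ^ j)⁻¹ * z) z' z
    have t2 := I.met.tri z z' (w ^ j * z)
    have s1 := I.met.symm z z'
    have cu : Commute (u ^ k) (w ^ j) := (show Commute u w from A.comm u hu w hw).pow_pow k j
    have cv : Commute (v ^ k) (w ^ j) := (show Commute v w from A.comm v hvE w hw).pow_pow k j
    have c1 := I.disp_change (u ^ k) z' z
    have c2 := I.disp_change (u ^ k) z z'
    have c3 := I.disp_change (v ^ k) z' z
    have c4 := I.disp_change (v ^ k) z z'
    have := I.two_moves (l := d z (u ^ k * z) + d z (v ^ k * z)) (s := s + 6000)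
      (u := u ^ k) (v := v ^ k)
      ((I.disp_commute cu.inv_right z).le.trans (by omega))
      ((I.disp_commute cu z).le.trans (by omega))
      ((I.disp_commute cv.inv_right z).le.trans (by omega))
      ((I.disp_commute cv z).le.trans (by omega)) h4 (by omega) (by omega) (by omega) (by omega)
    have cuv : Commute u v := A.comm u hu v hvE
    rcases this with h | h
    · left
      by_contra hne
      have h6 := A.lox (u⁻¹ * v) (E.mul_mem (E.inv_mem hu) hvE)
        (fun h => hne (inv_mul_eq_one.mp h).symm) k z'
      rw [(cuv.inv_left).mul_pow, inv_pow, ← I.inv (u ^ k), ← mul_assoc (u ^ k) _ z',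
        mul_inv_cancel_left] at h6
      have := Nat.mul_le_mul_left m h
      have : m * (s + 6000 + 3000) ≤ m * (s + 20000) := Nat.mul_le_mul_left m (by omega)
      omega
    · right
      by_contra hne
      have h6 := A.lox (u * v) (E.mul_mem hu hvE)
        (fun h => hne (eq_inv_of_mul_eq_one_right h)) k z'
      rw [cuv.mul_pow, mul_assoc] at h6
      have := Nat.mul_le_mul_left m h
      have : m * (s + 6000 + 3000) ≤ m * (s + 20000) := Nat.mul_le_mul_left m (by omega)
      omega
  rcases key with h | h
  · exact A.mem u hu hu1 g (by rw [← mul_inv_eq_iff_eq_mul, ← hv, h])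
  · have hg2 : g ^ 2 ∈ E := by
      refine A.mem u hu hu1 _ ?_
      have e1 : g * u = u⁻¹ * g := by rw [← h, hv, inv_mul_cancel_right]
      have e2 : g * u⁻¹ = u * g := by
        have e3 : u * (g * u) = g := by rw [e1, mul_inv_cancel_left]
        calc g * u⁻¹ = u * (g * u) * u⁻¹ := by rw [e3]
          _ = u * g := by group
      rw [pow_two, mul_assoc, e1, ← mul_assoc, e2, mul_assoc]
    rcases S.tors g with h1 | ⟨m', h1⟩
    · obtain ⟨k, hk⟩ := S.odd
      have : g = (g ^ 2) ^ (k + 1) := by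
        rw [← pow_mul, show 2 * (k + 1) = n + 1 by omega, pow_succ, h1, one_mul]
      rw [this]
      exact E.pow_mem hg2 _
    · exact A.mem _ hg2 (h1.pow_ne_one I (by norm_num)) g (by rw [← pow_succ', ← pow_succ])

end Axial

end AxisGeometry

/-! ### The family of axes of short elements and of relators -/

section Family

variable {G : Type*} [Group G] {d : G → G → ℕ} {L m n κ Θ : ℕ} {R : Set G}

def conjSub (g : G) (E : Subgroup G) : Subgroup G := E.comap (MulAut.conj g⁻¹).toMonoidHom

theorem mem_conjSub {g x : G} {E : Subgroup G} : x ∈ conjSub g E ↔ g⁻¹ * x * g ∈ E := by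
  simp [conjSub, Subgroup.mem_comap]

theorem conj_mem_conjSub {g x : G} {E : Subgroup G} : g * x * g⁻¹ ∈ conjSub g E ↔ x ∈ E := by
  rw [mem_conjSub]
  group

theorem conjSub_centralizer (g u : G) :
    conjSub g (Subgroup.centralizer {u}) = Subgroup.centralizer {g * u * g⁻¹} := by
  ext x
  rw [mem_conjSub, Subgroup.mem_centralizer_singleton_iff, Subgroup.mem_centralizer_singleton_iff]
  constructor
  · intro h
    calc x * (g * u * g⁻¹) = g * (g⁻¹ * x * g * u) * g⁻¹ := by group
      _ = g * (u * (g⁻¹ * x * g)) * g⁻¹ := by rw [h]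
      _ = _ := by group
  · intro h
    calc g⁻¹ * x * g * u = g⁻¹ * (x * (g * u * g⁻¹)) * g := by group
      _ = g⁻¹ * ((g * u * g⁻¹) * x) * g := by rw [h]
      _ = _ := by group

/-- Centralizers of short loxodromic elements and of relators. -/
def Member (d : G → G → ℕ) (R : Set G) (E : Subgroup G) : Prop :=
  ∃ u m', TLox d m' u ∧ E = Subgroup.centralizer {u} ∧ ((∃ y, d y (u * y) ≤ 60000) ∨ u ∈ R)

/-- Relators which can be added to the powers of short elements. -/
structure Relators (d : G → G → ℕ) (κ Θ : ℕ) (R : Set G) : Prop where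
  conj : ∀ r ∈ R, ∀ g : G, g * r * g⁻¹ ∈ R
  lox : ∀ r ∈ R, ∃ m', TLox d m' r
  big : ∀ r ∈ R, ∀ w ∈ Subgroup.centralizer {r}, w ≠ 1 → ∀ z, Θ ≤ d z (w * z)
  overlap : ∀ r ∈ R, ∀ E, Member d R E → E ≠ Subgroup.centralizer {r} → ∀ p q,
    ∀ x ∈ axis d E, ∀ y ∈ axis d E, ∀ x' ∈ axis d (Subgroup.centralizer {r}),
    ∀ y' ∈ axis d (Subgroup.centralizer {r}), d x p + d p y ≤ d x y + 100000 →
    d x q + d q y ≤ d x y + 100000 → d x' p + d p y' ≤ d x' y' + 100000 →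
    d x' q + d q y' ≤ d x' y' + 100000 → d p q ≤ κ

/-- The members of the family of axes. -/
def Mem (d : G → G → ℕ) (R : Set G) (_ : Relators d κ Θ R) (_ : InvMet d) : Type _ :=
  {E : Subgroup G // Member d R E}

theorem Member.conjSub (I : InvMet d) (hR : Relators d κ Θ R) {E : Subgroup G}
    (h : Member d R E) (g : G) : Member d R (conjSub g E) := by
  obtain ⟨u, m', hu, rfl, h1⟩ := h
  refine ⟨g * u * g⁻¹, m', hu.conj I g, conjSub_centralizer g u, ?_⟩
  rcases h1 with ⟨y, hy⟩ | h1
  · exact Or.inl ⟨g * y, by rwa [I.disp_conj]⟩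
  · exact Or.inr (hR.conj u h1 g)

theorem Member.axial (S : Stage d L m n) {E : Subgroup G} (h : Member d R E) : Axial d m E := by
  obtain ⟨u, m', hu, rfl, -⟩ := h
  exact S.axial_centralizer hu

variable (hR : Relators d κ Θ R) (I : InvMet d)

instance : MulAction G (Mem d R hR I) where
  smul g a := ⟨conjSub g a.1, a.2.conjSub I hR g⟩
  one_smul a := Subtype.ext (by
    change conjSub 1 a.1 = a.1
    ext x
    simp [mem_conjSub])
  mul_smul g h a := Subtype.ext (by
    change conjSub (g * h) a.1 = conjSub g (conjSub h a.1)
    ext x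
    simp [mem_conjSub, mul_assoc])

variable {hR I}

theorem Mem.smul_val (g : G) (a : Mem d R hR I) : (g • a).1 = BurnsideSQ.conjSub g a.1 := rfl

def Mem.axis (a : Mem d R hR I) : Set G := BurnsideSQ.axis d a.1

/-- The subgroup of rotations to be killed. -/
noncomputable def Mem.kill (n : ℕ) (a : Mem d R hR I) : Subgroup G :=
  if ∃ r ∈ R, a.1 = Subgroup.centralizer {r} then a.1 else
    Subgroup.closure {x | ∃ w ∈ a.1, x = w ^ n}

theorem Mem.kill_le (a : Mem d R hR I) : a.kill n ≤ a.1 := by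
  unfold Mem.kill
  split_ifs
  · exact le_rfl
  · rw [Subgroup.closure_le]
    rintro x ⟨w, hw, rfl⟩
    exact a.1.pow_mem hw n

theorem Mem.pow_mem_kill (a : Mem d R hR I) {w : G} (hw : w ∈ a.1) : w ^ n ∈ a.kill n := by
  unfold Mem.kill
  split_ifs
  · exact a.1.pow_mem hw n
  · exact Subgroup.subset_closure ⟨w, hw, rfl⟩

theorem Mem.axis_smul (g : G) (a : Mem d R hR I) {x : G} (hx : x ∈ a.axis) :
    g * x ∈ (g • a).axis := by
  obtain ⟨w, hw, hw1, K, hK⟩ := hx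
  refine ⟨g * w * g⁻¹, conj_mem_conjSub.mpr hw, by rwa [ne_eq, conj_eq_one_iff], K, fun k hk => ?_⟩
  simp only [conj_pow, I.disp_conj]
  exact hK k hk

theorem Mem.smul_of_mem (S : Stage d L m n) (a : Mem d R hR I) {s : G} (hs : s ∈ a.1) :
    s • a = a := by
  apply Subtype.ext
  rw [Mem.smul_val]
  have A := a.2.axial S
  ext x
  rw [mem_conjSub]
  constructor
  · intro h
    have h2 := a.1.mul_mem (a.1.mul_mem hs h) (a.1.inv_mem hs)
    rwa [show s * (s⁻¹ * x * s) * s⁻¹ = x by group] at h2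
  · exact fun h => a.1.mul_mem (a.1.mul_mem (a.1.inv_mem hs) h) hs

theorem Mem.mem_of_smul (S : Stage d L m n) (a : Mem d R hR I) {g : G} (hg : g • a = a) :
    g ∈ a.1 := by
  refine (a.2.axial S).mem_of_conj S fun u hu => ?_
  have : g * u * g⁻¹ ∈ (g • a).1 := conj_mem_conjSub.mpr hu
  rwa [hg] at this

theorem Mem.preFam (S : Stage d L m n) : PreFam d (fun a : Mem d R hR I => a.axis) where
  met := S.met
  inv := S.inv
  nonempty a := (a.2.axial S).axis_nonempty S.toInvMet
  qc a _ hx _ hy _ hz := (a.2.axial S).axis_qc S.toInvMet hx hy hz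
  equiv g a _ hx := Mem.axis_smul g a hx

theorem Mem.fam (S : Stage d L m n) (hκ : 10000000 ≤ κ) (hL : L ≤ κ) (hn : m * Θ ≤ n) :
    Fam d (fun a : Mem d R hR I => a.axis) (fun a => a.kill n) κ Θ where
  toPreFam := Mem.preFam S
  large := hκ
  conj g a s hs := by
    have hr : (∃ r ∈ R, (g • a).1 = Subgroup.centralizer {r}) ↔
        ∃ r ∈ R, a.1 = Subgroup.centralizer {r} := by
      have : ∀ (g : G) (a : Mem d R hR I), (∃ r ∈ R, a.1 = Subgroup.centralizer {r}) →
          ∃ r ∈ R, (g • a).1 = Subgroup.centralizer {r} := by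
        rintro g a ⟨r, h1, h2⟩
        exact ⟨g * r * g⁻¹, hR.conj r h1 g, by rw [Mem.smul_val, h2, conjSub_centralizer]⟩
      refine ⟨fun h => ?_, this g a⟩
      have := this g⁻¹ _ h
      rwa [inv_smul_smul] at this
    change g * s * g⁻¹ ∈ Mem.kill n (g • a)
    have hs' : s ∈ Mem.kill n a := hs
    unfold Mem.kill at hs' ⊢
    rw [hr]
    split_ifs at hs' ⊢ with h
    · exact conj_mem_conjSub.mpr hs'
    · have : s ∈ (Subgroup.closure {x | ∃ w ∈ (g • a).1, x = w ^ n}).comap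
          (MulAut.conj g).toMonoidHom := by
        refine (Subgroup.closure_le _).mpr ?_ hs'
        rintro x ⟨w, hw, rfl⟩
        refine Subgroup.subset_closure ⟨g * w * g⁻¹, conj_mem_conjSub.mpr hw, ?_⟩
        simp [conj_pow]
      simpa using this
  fix a s hs := a.smul_of_mem S (a.kill_le hs)
  overlap a b hab x hx y hy := by
    by_contra hc
    push Not at hc
    have F : PreFam d (fun a : Mem d R hR I => a.axis) := Mem.preFam S
    have h1 := F.near_pr_left (a := a) (x := x) (z := y) (by omega)
    have h2 := F.near_pr_right (a := a) (x := x) (z := y) (by omega)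
    have hp := F.pr_mem a x
    have hq := F.pr_mem a y
    unfold prDist at hc
    generalize pr d (fun a : Mem d R hR I => a.axis) a x = p at *
    generalize pr d (fun a : Mem d R hR I => a.axis) a y = q at *
    have hne : a.1 ≠ b.1 := fun h => hab (Subtype.ext h)
    have k1 : d p p + d p q ≤ d p q + 100000 := by rw [S.met.self]; omega
    have k2 : d p q + d q q ≤ d p q + 100000 := by rw [S.met.self]; omega
    have Aa := a.2.axial S
    have Ab := b.2.axial S
    obtain ⟨u, mu, hu, hEu, hu'⟩ := a.2
    obtain ⟨v, mv, hv, hEv, hv'⟩ := b.2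
    rcases hu' with ⟨yu, hu'⟩ | hu'
    · rcases hv' with ⟨yv, hv'⟩ | hv'
      · have ua : u ∈ a.1 := by rw [hEu, Subgroup.mem_centralizer_singleton_iff]
        have vb : v ∈ b.1 := by rw [hEv, Subgroup.mem_centralizer_singleton_iff]
        have e1 := Aa.axis_short S.toInvMet hp ua hu'
        have e2 := Aa.axis_short S.toInvMet hq ua hu'
        have e3 := Ab.axis_short S.toInvMet hx vb hv'
        have e4 := Ab.axis_short S.toInvMet hy vb hv'
        have e5 := S.disp_between e3 e4 h1
        have e6 := S.disp_between e3 e4 h2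
        have e7 := S.acyl u v p q (by omega) (by omega) (by omega) (by omega) (by omega)
        refine hne (Aa.eq_of_mem Ab ua ?_ (hu.ne_one S.toInvMet))
        rw [hEv, Subgroup.mem_centralizer_singleton_iff]
        exact e7.1
      · have := hR.overlap v hv' a.1 a.2 (by rwa [hEv] at hne) p q p hp q hq x
          (by rw [← hEv]; exact hx) y (by rw [← hEv]; exact hy) k1 k2 h1 h2
        omega
    · have := hR.overlap u hu' b.1 b.2 (by rw [hEu] at hne; exact hne.symm) p q x hx y hy p
        (by rw [← hEu]; exact hp) q (by rw [← hEu]; exact hq) h1 h2 k1 k2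
      omega
  spin a x hx s hs h1 := by
    have hs' : s ∈ Mem.kill n a := hs
    have A := a.2.axial S
    unfold Mem.kill at hs'
    split_ifs at hs' with h
    · obtain ⟨r, hr, har⟩ := h
      exact hR.big r hr s (har ▸ hs') h1 x
    · have : ∃ w ∈ a.1, s = w ^ n := by
        clear h1 hs
        induction hs' using Subgroup.closure_induction with
        | mem _ hx => exact hx
        | one => exact ⟨1, a.1.one_mem, (one_pow n).symm⟩
        | mul _ _ _ _ hx hy =>
          obtain ⟨v, hv, rfl⟩ := hx
          obtain ⟨w, hw, rfl⟩ := hy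
          exact ⟨v * w, a.1.mul_mem hv hw,
            ((show Commute v w from A.comm v hv w hw).mul_pow n).symm⟩
        | inv _ _ hx =>
          obtain ⟨v, hv, rfl⟩ := hx
          exact ⟨v⁻¹, a.1.inv_mem hv, (inv_pow v n).symm⟩
      obtain ⟨w, hw, rfl⟩ := this
      have h2 := A.lox w hw (fun h => h1 (by rw [h, one_pow])) n x
      exact Nat.le_of_mul_le_mul_left (hn.trans h2) S.pos

end Family

/-! ### Elements of minimal displacement stay loxodromic -/

theorem HypMet.order {X : Type*} {d : X → X → ℕ} (h : HypMet d) {p q x z : X} {c : ℕ}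
    (hx : d p x + d x q ≤ d p q + c) (hz : d p z + d z q ≤ d p q + c) :
    d p x + d x z ≤ d p z + c + 300 ∨ d p z + d x z ≤ d p x + c + 300 := by
  rcases le_total (d p x) (d p z) with h1 | h1
  · have := h.order_left hx hz h1
    omega
  · have := h.order_left hz hx h1
    have := h.symm x z
    omega

section Minimal

variable {G ι : Type*} [Group G] [MulAction G ι]
variable {d : G → G → ℕ} {Y : ι → Set G} {Γ : ι → Subgroup G} {κ Θ : ℕ}

namespace InvMet

theorem square_of_min (I : InvMet d) {u p : G} (hmin : ∀ z, d p (u * p) ≤ d z (u * z))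
    (hl : 60000 ≤ d p (u * p)) : 2 * d p (u * p) ≤ d p (u ^ 2 * p) + 602 := by
  obtain ⟨z, h1, h2⟩ := I.met.geod p (u * p) (d p (u * p) / 2) (by omega)
  have h3 := hmin z
  have e1 := I.inv u p z
  have e2 := I.inv u z (u * p)
  have e3 := I.inv u p (u * p)
  have t1 := I.met.tri z (u * p) (u * z)
  have g1 := I.met.hyp p z (u * p) (u * z)
  have g2 := I.met.hyp p (u * p) (u * z) (u * (u * p))
  rw [pow_two, mul_assoc]
  omega

theorem excess_of_min (I : InvMet d) {u p : G} (hmin : ∀ z, d p (u * p) ≤ d z (u * z))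
    (hl : 60000 ≤ d p (u * p)) (i j : ℕ) :
    d p (u ^ i * p) + d p (u ^ j * p) ≤ d p (u ^ (i + j) * p) + 1202 := by
  rcases Nat.eq_zero_or_pos j with rfl | hj
  · simp [I.met.self]
  obtain ⟨j, rfl⟩ : ∃ k, j = k + 1 := ⟨j - 1, by omega⟩
  have h0 := I.square_of_min hmin hl
  obtain ⟨s, hs⟩ : ∃ s, s + 902 = d p (u * p) := ⟨d p (u * p) - 902, by omega⟩
  have h1 := I.met.hyp p (u ^ i * p) (u ^ (i + 1) * p) (u ^ (i + (j + 1)) * p)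
  have e1 := I.disp_shift u p i (j + 1)
  have e2 := I.disp_shift u p (i + 1) j
  have e3 := I.disp_shift u p i 1
  rw [show i + 1 + j = i + (j + 1) by omega] at e2
  rw [pow_one] at e3
  have h2 := I.step_le (w := u) (y := p) (s := s) (by omega) (by omega) i
  have h3 := I.step_le (w := u) (y := p) (s := s) (by omega) (by omega) j
  omega

end InvMet

namespace Fam

variable (F : Fam d Y Γ κ Θ)
include F

theorem invMet : InvMet d := ⟨F.met, F.inv⟩

/-- Two consecutive translates of a member cannot both follow a geodesic. -/
theorem shift_overlap {a : ι} {u x y : G} (ha : u • a ≠ a) (hx : x ∈ Y a) (hy : y ∈ Y a)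
    (h1 : d x (u * x) + d (u * x) y ≤ d x y + 1000000)
    (h2 : d (u * x) y + d y (u * y) ≤ d (u * x) (u * y) + 1000000) :
    d (u * x) y ≤ κ + 3000000 := by
  have h3 := F.overlap a (u • a) ha.symm (u * x) (F.equiv u a x hx) (u * y) (F.equiv u a y hy)
  obtain ⟨v, h4, h5⟩ := F.met.near_interval h1
  obtain ⟨w, hw, h6⟩ := F.qc a x hx y hy v h4
  have h7 := F.pr_near (u * x) hw
  have h8 := F.met.tri (u * x) v w
  have h9 : d y (pr d Y a (u * y)) ≤ 100000 ∨
      d y (pr d Y a (u * y)) + d (pr d Y a (u * y)) (u * y) ≤ d y (u * y) + 100000 := by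
    rcases Nat.lt_or_ge 100000 (prDist d Y a y (u * y)) with h | h
    · have := F.prDist_excess h
      unfold prDist at this
      rw [F.pr_self hy] at this
      omega
    · unfold prDist at h
      rw [F.pr_self hy] at h
      exact Or.inl h
  unfold prDist at h3
  generalize pr d Y a (u * x) = p at *
  generalize pr d Y a (u * y) = q at *
  have t1 := F.met.tri (u * x) p q
  have t2 := F.met.tri (u * x) q (u * y)
  have t3 := F.met.tri (u * x) q y
  have t4 := F.met.symm y q
  omega

theorem overlap_axis {a : ι} {u p : G} (ha : u • a ≠ a)
    (hmin : ∀ z, d p (u * p) ≤ d z (u * z)) (hl : 60000 ≤ d p (u * p)) (k : ℕ) :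
    prDist d Y a p (u ^ k * p) ≤ d p (u * p) + 2 * κ := by
  by_contra hc
  push Not at hc
  have hκ := F.large
  have I := F.invMet
  have h1 := F.near_pr_left (a := a) (x := p) (z := u ^ k * p) (by omega)
  have h2 := F.near_pr_right (a := a) (x := p) (z := u ^ k * p) (by omega)
  have h3 := F.prDist_excess (a := a) (x := p) (z := u ^ k * p) (by omega)
  have hx := F.pr_mem a p
  have hy := F.pr_mem a (u ^ k * p)
  have e1 := I.excess_of_min hmin hl 1 k
  have e2 : u * (u ^ k * p) = u ^ (k + 1) * p := by rw [← mul_assoc, pow_succ']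
  have e3 := I.disp_shift u p k 1
  unfold prDist at hc h3
  rw [pow_one] at e1 e3
  rw [← e2] at e3
  rw [add_comm 1 k, ← e2] at e1
  generalize pr d Y a p = x at *
  generalize pr d Y a (u ^ k * p) = y at *
  generalize u ^ k * p = q at *
  have d1 := I.disp_between (u := u) (l := d p (u * p)) le_rfl e3.le h1
  have d2 := I.disp_between (u := u) (l := d p (u * p)) le_rfl e3.le h2
  have i1 := I.inv u p x
  have i2 := I.inv u x q
  have i3 := I.inv u p y
  have i4 := I.inv u y q
  have i5 := I.inv u x y
  have i6 := I.inv u p q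
  have t1 := I.met.tri x q (u * q)
  have t2 := I.met.tri y q (u * q)
  have t3 := I.met.tri p (u * p) (u * x)
  have t4 := I.met.tri p (u * p) (u * y)
  have t5 := I.met.tri p x (u * q)
  have t6 := I.met.tri p (u * x) (u * q)
  have t7 := I.met.tri p y (u * q)
  have t8 := I.met.tri p (u * y) (u * q)
  have f1 : d p x + d x (u * q) ≤ d p (u * q) + 101202 := by omega
  have f2 : d p y + d y (u * q) ≤ d p (u * q) + 101202 := by omega
  have f3 : d p (u * x) + d (u * x) (u * q) ≤ d p (u * q) + 101202 := by omega
  have f4 : d p (u * y) + d (u * y) (u * q) ≤ d p (u * q) + 101202 := by omega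
  have o1 := I.met.order f1 f3
  have o2 := I.met.order f3 f2
  have o3 := I.met.order f2 f4
  have o4 := I.met.tri p x (u * x)
  have o5 := I.met.tri p y (u * y)
  have o6 := I.met.tri p x y
  have o7 := I.met.tri p (u * x) (u * y)
  have o8 := I.met.tri x (u * x) y
  have := F.shift_overlap ha hx hy (by omega) (by omega)
  omega

theorem tight_axis {a : ι} {u p s : G} (ha : u • a ≠ a)
    (hmin : ∀ h ∈ rot Γ, ∀ z, d p (u * p) ≤ d z (h * u * z)) (hl : 60000 ≤ d p (u * p))
    (hs : s ∈ Γ a) (k : ℕ) :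
    prDist d Y a p (u ^ k * p) ≤ prDist d Y a p (s * (u ^ k * p)) + 5 * κ := by
  by_contra hc
  push Not at hc
  have hκ := F.large
  have I := F.invMet
  have hmin1 : ∀ z, d p (u * p) ≤ d z (u * z) := fun z => by
    simpa using hmin 1 (one_mem _) z
  have h0 := F.overlap_axis ha hmin1 hl k
  have h1 := F.near_pr_left (a := a) (x := p) (z := u ^ k * p) (by omega)
  have h2 := F.near_pr_right (a := a) (x := p) (z := u ^ k * p) (by omega)
  have h3 := F.prDist_excess (a := a) (x := p) (z := u ^ k * p) (by omega)
  have h4 := PreFam.pr_smul d Y s a (u ^ k * p)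
  rw [F.fix a s hs] at h4
  have h5 := hmin s (mem_rot hs) (u⁻¹ * pr d Y a (u ^ k * p))
  rw [mul_assoc, mul_inv_cancel_left] at h5
  have e1 := I.excess_of_min hmin1 hl 1 k
  have e3 := I.disp_shift u p k 1
  have e2 : u * (u ^ k * p) = u ^ (k + 1) * p := by rw [← mul_assoc, pow_succ']
  unfold prDist at hc h3 h0
  rw [h4] at hc
  rw [pow_one] at e1 e3
  rw [← e2] at e3
  rw [add_comm 1 k, ← e2] at e1
  generalize pr d Y a p = x at *
  generalize pr d Y a (u ^ k * p) = y at *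
  generalize u ^ k * p = q at *
  have d2 := I.disp_between (u := u) (l := d p (u * p)) le_rfl e3.le h2
  have i0 := hmin1 y
  have i1 := I.inv u (u⁻¹ * p) (u⁻¹ * y)
  have i2 := I.inv u (u⁻¹ * y) y
  have i3 := I.inv u (u⁻¹ * y) q
  have i4 := I.inv u (u⁻¹ * p) q
  have i5 := I.inv u (u⁻¹ * p) p
  have i6 := I.inv u p q
  simp only [mul_inv_cancel_left] at i1 i2 i3 i4 i5
  have t1 := I.met.tri (u⁻¹ * p) p x
  have t2 := I.met.tri (u⁻¹ * p) p y
  have t3 := I.met.tri (u⁻¹ * y) q (u * q)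
  have t4 := I.met.tri y q (u * q)
  have t6 := I.met.tri (u⁻¹ * y) y q
  have t7 := I.met.tri (u⁻¹ * p) x q
  have t8 := I.met.tri (u⁻¹ * p) (u⁻¹ * y) q
  have t9 := I.met.tri (u⁻¹ * p) y q
  have f1 : d (u⁻¹ * p) x + d x q ≤ d (u⁻¹ * p) q + 101202 := by omega
  have f2 : d (u⁻¹ * p) y + d y q ≤ d (u⁻¹ * p) q + 101202 := by omega
  have f3 : d (u⁻¹ * p) (u⁻¹ * y) + d (u⁻¹ * y) q ≤ d (u⁻¹ * p) q + 101202 := by omega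
  have o1 := I.met.order f1 f3
  have o2 := I.met.order f1 f2
  have o3 := I.met.order f3 f2
  have o5 := I.met.tri (u⁻¹ * y) x (s * y)
  have o6 := I.met.symm x (u⁻¹ * y)
  have o7 := I.met.tri (u⁻¹ * p) x y
  omega

/-- Elements of minimal displacement in their coset, which fix no member, are loxodromic in the
quotient. -/
theorem tlox_of_min (hΘ : 1000 * κ ≤ Θ) {u p : G} (ha : ∀ a : ι, u • a ≠ a)
    (hmin : ∀ h ∈ rot Γ, ∀ z, d p (u * p) ≤ d z (h * u * z)) (hl : 60000 ≤ d p (u * p)) :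
    ∃ m', TLox (quotDist d Y Γ κ) m' u := by
  have hκ := F.large
  have I := F.invMet
  have hmin1 : ∀ z, d p (u * p) ≤ d z (u * z) := fun z => by
    simpa using hmin 1 (one_mem _) z
  have I' : InvMet (quotDist d Y Γ κ) := ⟨F.quotDist_met hΘ, F.quotDist_inv⟩
  refine ⟨d p (u * p) + 2 * κ + 201 * κ, fun k z => ?_⟩
  have := I'.transfer (w := u) (y := p) (a := 1) (b := d p (u * p) + 2 * κ + 201 * κ) (c := 0)
    (fun k => ?_) k z
  · simpa using this
  · rw [F.quotDist_of_tight hΘ (c := 5 * κ) (by omega)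
      (fun a s hs => F.tight_axis (ha a) hmin hl hs k)]
    have h1 := F.dist_le_mul_cone (fun a => F.overlap_axis (ha a) hmin1 hl k)
    have h2 := I.square_of_min hmin1 hl
    have h3 := I.mul_le_disp (w := u) (y := p) (s := 1) le_rfl (by omega) k
    omega

end Fam
end Minimal

/-- Elements are periodic or loxodromic in the quotient. -/
theorem Mem.tors {G : Type*} [Group G] {d : G → G → ℕ} {L m n κ Θ : ℕ} {R : Set G}
    {hR : Relators d κ Θ R} {I : InvMet d} (S : Stage d L m n) (hκ : 10000000 ≤ κ) (hL : L ≤ κ)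
    (hn : m * Θ ≤ n) (hΘ : 1000 * κ ≤ Θ) (u : G) :
    u ^ n ∈ rot (fun a : Mem d R hR I => a.kill n) ∨
      ∃ m', TLox (quotDist d (fun a : Mem d R hR I => a.axis) (fun a => a.kill n) κ) m' u := by
  have F := Mem.fam (hR := hR) (I := I) S hκ hL hn
  have key : ∀ a : Mem d R hR I, ∀ w : G, w ∈ a.1 →
      w ^ n ∈ rot (fun a : Mem d R hR I => a.kill n) := fun a w hw => mem_rot (a.pow_mem_kill hw)
  have N := F.rot_normal
  generalize hr : rot (fun a : Mem d R hR I => a.kill n) = K at *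
  have hex : ∃ k, ∃ h ∈ K, ∃ p, d p (h * u * p) = k := ⟨_, 1, one_mem _, 1, rfl⟩
  obtain ⟨h, hh, p, e⟩ := Nat.find_spec hex
  obtain ⟨w, hw⟩ : ∃ w, w = h * u := ⟨_, rfl⟩
  rw [← hw] at e
  have hmin : ∀ g ∈ K, ∀ z, d p (w * p) ≤ d z (g * w * z) := fun g hg z => by
    rw [e]
    exact Nat.find_min' hex ⟨g * h, mul_mem hg hh, z, by rw [hw, mul_assoc g]⟩
  have hq : ∀ k : ℕ, ∃ g ∈ K, u ^ k = g * w ^ k := by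
    intro k
    refine ⟨u ^ k * (w ^ k)⁻¹, ?_, by group⟩
    have : (QuotientGroup.mk u : G ⧸ K) = QuotientGroup.mk w := by
      rw [hw, QuotientGroup.mk_mul, (QuotientGroup.eq_one_iff h).mpr hh, one_mul]
    rw [← QuotientGroup.eq_one_iff, QuotientGroup.mk_mul, QuotientGroup.mk_inv,
      QuotientGroup.mk_pow, QuotientGroup.mk_pow, this, mul_inv_cancel]
  have conv : w ^ n ∈ K → u ^ n ∈ K := fun h => by
    obtain ⟨g, hg, e⟩ := hq n
    rw [e]
    exact mul_mem hg h
  by_cases hl : d p (w * p) ≤ 60000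
  · refine Or.inl (conv ?_)
    rcases S.tors w with h | ⟨m', h⟩
    · rw [h]
      exact one_mem _
    · exact key ⟨_, w, m', h, rfl, Or.inl ⟨p, hl⟩⟩ w
        (Subgroup.mem_centralizer_singleton_iff.mpr rfl)
  by_cases ha : ∃ a : Mem d R hR I, w • a = a
  · obtain ⟨a, ha⟩ := ha
    exact Or.inl (conv (key a w (a.mem_of_smul S ha)))
  push Not at ha hl
  obtain ⟨m', h⟩ := F.tlox_of_min hΘ ha (by rw [hr]; exact hmin) hl.le
  refine Or.inr ⟨m', fun k z => ?_⟩
  obtain ⟨g, hg, e⟩ := hq k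
  rw [e, mul_assoc, F.quotDist_smul_right (by rwa [hr])]
  exact h k z

/-! ### Crossings -/

section Crossing

variable {G ι : Type*} [Group G] [MulAction G ι]

/-- A geodesic of the cone-off from `x` to `y` crosses `Y a` at time `t`, entering at `v` and
leaving at `w`. -/
structure Cross (d : G → G → ℕ) (Y : ι → Set G) (κ : ℕ) (a : ι) (x y : G) (t : ℕ) (v w : G) :
    Prop where
  left : v ∈ Y a
  right : w ∈ Y a
  time : coneDist d Y κ x v = t
  total : t + 1 + coneDist d Y κ w y = coneDist d Y κ x y

variable {d : G → G → ℕ} {Y : ι → Set G} {Γ : ι → Subgroup G} {κ Θ : ℕ}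

namespace Fam

variable (F : Fam d Y Γ κ Θ)
include F

theorem exists_cross {a : ι} {x y : G} (h : 100 * κ < prDist d Y a x y) :
    ∃ t v w, Cross d Y κ a x y t v w := by
  obtain ⟨v, hv, w, hw, h⟩ := F.exists_crossing h
  exact ⟨_, v, w, hv, hw, rfl, h⟩

theorem cross_min {a : ι} {x y v w z : G} {t : ℕ} (C : Cross d Y κ a x y t v w) (hz : z ∈ Y a) :
    t ≤ coneDist d Y κ x z ∧ coneDist d Y κ x y ≤ t + 1 + coneDist d Y κ z y := by
  have h1 := F.cone_of_mem hz C.right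
  have h2 := F.cone_of_mem C.left hz
  have h3 := F.cone_tri x z w
  have h4 := F.cone_tri x w y
  have h5 := F.cone_tri x v z
  have h6 := F.cone_tri x z y
  have := C.time
  have := C.total
  omega

theorem cross_time {a : ι} {x y y' v w v' w' : G} {t t' : ℕ} (C : Cross d Y κ a x y t v w)
    (C' : Cross d Y κ a x y' t' v' w') : t = t' := by
  have h1 := (F.cross_min C C'.left).1
  have h2 := (F.cross_min C' C.left).1
  have := C.time
  have := C'.time
  omega

theorem cross_entry {a : ι} {x y v w : G} {t : ℕ} (C : Cross d Y κ a x y t v w) :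
    prDist d Y a x v ≤ 100 * κ :=
  F.prDist_entry (v := v) (q := y) C.right (by have := C.time; have := C.total; omega)

theorem cross_exit {a : ι} {x y v w : G} {t : ℕ} (C : Cross d Y κ a x y t v w) :
    prDist d Y a w y ≤ 100 * κ :=
  F.prDist_exit (w := w) (p := x) C.left (by have := C.time; have := C.total; omega)

theorem cross_dist {a : ι} {x y v w : G} {t : ℕ} (C : Cross d Y κ a x y t v w) :
    d v w ≤ prDist d Y a x y + 200 * κ ∧ prDist d Y a x y ≤ d v w + 200 * κ := by
  have h1 := F.cross_entry C
  have h2 := F.cross_exit C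
  rw [← F.prDist_of_mem C.left C.right]
  have h3 := F.prDist_tri a v x w
  have h4 := F.prDist_tri a x y w
  have h5 := F.prDist_tri a x v y
  have h6 := F.prDist_tri a v w y
  have h7 := F.prDist_symm a v x
  have h8 := F.prDist_symm a y w
  omega

theorem cross_smul {a : ι} {x y v w : G} {t : ℕ} (C : Cross d Y κ a x y t v w) (g : G) :
    Cross d Y κ (g • a) (g * x) (g * y) t (g * v) (g * w) :=
  ⟨F.equiv g a v C.left, F.equiv g a w C.right, by rw [F.cone_inv, C.time],
    by rw [F.cone_inv, F.cone_inv, C.total]⟩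

/-- A crossing of a part of a geodesic is a crossing of the geodesic. -/
theorem cross_between {a : ι} {x y p q : G} {M : ℕ}
    (h : coneDist d Y κ x p + coneDist d Y κ p q + coneDist d Y κ q y = coneDist d Y κ x y)
    (hD : M + 200 * κ < prDist d Y a p q) :
    M < prDist d Y a x y ∧ ∃ t v w, Cross d Y κ a x y t v w ∧ coneDist d Y κ x p ≤ t ∧
      t + 1 ≤ coneDist d Y κ x p + coneDist d Y κ p q ∧
      coneDist d Y κ x v = coneDist d Y κ x p + coneDist d Y κ p v := by
  obtain ⟨t, v, w, C⟩ := F.exists_cross (a := a) (x := p) (y := q) (by omega)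
  have h1 := F.cone_tri x p v
  have h2 := F.cone_tri w q y
  have h3 := F.cone_tri x v y
  have h4 := F.cone_tri v w y
  have h5 := F.cone_of_mem C.left C.right
  have h6 := C.time
  have h7 := C.total
  have h8 := F.prDist_entry (a := a) (p := x) (q := y) (v := p) C.right (by omega)
  have h9 := F.prDist_exit (a := a) (p := x) (q := y) (w := q) C.left (by omega)
  have h10 := F.prDist_tri a p x q
  have h11 := F.prDist_tri a x y q
  have h12 := F.prDist_symm a p x
  have h13 := F.prDist_symm a y q
  exact ⟨by omega, _, v, w, ⟨C.left, C.right, rfl, by omega⟩, by omega, by omega, by omega⟩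

theorem cross_order {a b : ι} {x y v w v' w' : G} {t t' : ℕ}
    (C : Cross d Y κ a x y t v w) (C' : Cross d Y κ b x y t' v' w')
    (hb : 200 * κ < prDist d Y b x y) (h : prDist d Y b x w ≤ 2 * κ) : t < t' := by
  have hκ := F.large
  have h1 := F.prDist_tri b x w y
  obtain ⟨t'', v'', w'', C''⟩ := F.exists_cross (a := b) (x := w) (y := y) (by omega)
  have h2 := (F.cross_min C' C''.right).2
  have h3 := C.total
  have h4 := C''.total
  omega

/-- Members crossed at the same time coincide. -/
theorem cross_eq {a b : ι} {x y v w v' w' : G} {t : ℕ}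
    (C : Cross d Y κ a x y t v w) (C' : Cross d Y κ b x y t v' w')
    (ha : 200 * κ < prDist d Y a x y) (hb : 200 * κ < prDist d Y b x y) : a = b := by
  by_contra hab
  rcases Nat.lt_or_ge (2 * κ) (prDist d Y a x w') with h | h
  · exact lt_irrefl _ (F.cross_order C C' hb (F.behrstock hab C'.right C.right h))
  · exact lt_irrefl _ (F.cross_order C' C ha h)

end Fam

/-! ### Crossings in the quotient -/

/-- A crossing, in the quotient metric, with large angle. -/
def QCross (d : G → G → ℕ) (Y : ι → Set G) (Γ : ι → Subgroup G) (κ M : ℕ) (a : ι) (x y : G)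
    (t : ℕ) : Prop :=
  ∃ v ∈ Y a, ∃ w ∈ Y a, quotDist d Y Γ κ x v = t ∧
    t + 1 + quotDist d Y Γ κ w y = quotDist d Y Γ κ x y ∧ ∀ s ∈ Γ a, M < d v (s * w)

/-- A lift of a geodesic of the quotient together with a crossing. -/
def LiftCross (d : G → G → ℕ) (Y : ι → Set G) (Γ : ι → Subgroup G) (κ M : ℕ) (a : ι) (t : ℕ)
    (x y : G) : Prop :=
  coneDist d Y κ x y = quotDist d Y Γ κ x y ∧ ∃ g ∈ rot Γ, ∃ v w,
    Cross d Y κ (g • a) x y t v w ∧ ∀ s ∈ Γ (g • a), M < d v (s * w)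

theorem QCross.mono {M M' : ℕ} (h : M' ≤ M) {a : ι} {x y : G} {t : ℕ}
    (Q : QCross d Y Γ κ M a x y t) : QCross d Y Γ κ M' a x y t := by
  obtain ⟨v, hv, w, hw, h1, h2, h3⟩ := Q
  exact ⟨v, hv, w, hw, h1, h2, fun s hs => h.trans_lt (h3 s hs)⟩

theorem Side.symm {B : ℕ} {S : G → G → Prop} (F : Fam d Y Γ κ Θ) (h : Side d Y Γ B S) :
    Side d Y Γ B (fun x y => S y x) where
  inv g hg x y := h.inv g hg y x
  bend a s hs x y hD h1 := by
    have h2 := h.inv s (mem_rot hs) _ _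
      (h.bend a s⁻¹ ((Γ a).inv_mem hs) y x (by rwa [F.prDist_symm]) h1)
    rwa [mul_inv_cancel_left] at h2

namespace Fam

variable (F : Fam d Y Γ κ Θ)
include F

theorem conj_rot {a : ι} (g : G) {s : G} (hs : s ∈ Γ (g • a)) : g⁻¹ * s * g ∈ Γ a := by
  have := F.conj g⁻¹ _ s hs
  rwa [inv_smul_smul, inv_inv] at this

theorem side_liftCross (M : ℕ) (a : ι) (t : ℕ) :
    Side d Y Γ (300 * κ) (LiftCross d Y Γ κ M a t) where
  inv h hh x y := by
    rintro ⟨e, g, hg, v, w, C, hM⟩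
    refine ⟨by rw [F.cone_inv, F.quotDist_inv, e], h * g, mul_mem hh hg, h * v, h * w, ?_,
      fun s hs => ?_⟩
    · rw [mul_smul]
      exact F.cross_smul C h
    · rw [mul_smul] at hs
      have := hM _ (F.conj_rot h hs)
      rw [← F.inv h] at this
      convert this using 2
      group
  bend b s hs x y hD := by
    rintro ⟨e, g, hg, v, w, C, hM⟩
    have hκ := F.large
    have hs' := mem_rot hs
    have e1 : coneDist d Y κ x (s * y) = quotDist d Y Γ κ x (s * y) :=
      (F.side_quotDist (B := 300 * κ) (by omega)).bend b s hs x y hD e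
    have e2 : coneDist d Y κ x (s * y) = coneDist d Y κ x y := by
      rw [e1, e, F.quotDist_smul_right hs']
    refine ⟨e1, ?_⟩
    by_cases hb : g • a = b
    · subst hb
      refine ⟨g, hg, v, s * w, ⟨C.left, F.mem_of_rot hs C.right, C.time, ?_⟩, fun s' h' => ?_⟩
      · rw [F.cone_inv, e2, C.total]
      · rw [← mul_assoc]
        exact hM _ (mul_mem h' hs)
    · have h1 := F.overlap b (g • a) (Ne.symm hb) v C.left w C.right
      have h2 := F.prDist_tri b x v y
      have h3 := F.prDist_tri b v w y
      have h4 := C.total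
      have h5 := C.time
      rcases Nat.lt_or_ge (100 * κ) (prDist d Y b w y) with h6 | h6
      · refine ⟨g, hg, v, w, ⟨C.left, C.right, C.time, ?_⟩, hM⟩
        have h7 := F.cone_bend hs h6
        have h8 := F.cone_tri x v (s * y)
        have h9 := F.cone_tri v w (s * y)
        have h10 := F.cone_of_mem C.left C.right
        omega
      · have h7 := F.cone_bend (x := x) (y := v) hs (by omega)
        have h8 := F.cone_tri x (s * v) (s * y)
        have h9 := F.cone_tri (s * v) (s * w) (s * y)
        rw [F.cone_inv s v w, F.cone_inv s w y] at h9
        have h10 := F.cone_of_mem C.left C.right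
        refine ⟨s * g, mul_mem hs' hg, s * v, s * w, ⟨?_, ?_, ?_, ?_⟩, fun s' h' => ?_⟩
        · rw [mul_smul]
          exact F.equiv s _ _ C.left
        · rw [mul_smul]
          exact F.equiv s _ _ C.right
        · omega
        · rw [F.cone_inv s w y]
          omega
        · rw [mul_smul] at h'
          have := hM _ (F.conj_rot s h')
          rw [← F.inv s] at this
          convert this using 2
          group

/-- Lifting a crossing of the quotient. -/
theorem exists_liftCross {M : ℕ} {a : ι} {x y : G} {t : ℕ} (Q : QCross d Y Γ κ M a x y t) :
    ∃ h ∈ rot Γ, LiftCross d Y Γ κ M a t x (h * y) := by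
  obtain ⟨v, hv, w, hw, h1, h2, h3⟩ := Q
  obtain ⟨g, hg, e⟩ := quotDist_spec d Y Γ κ x v
  obtain ⟨g', hg', e'⟩ := quotDist_spec d Y Γ κ w y
  have c1 := F.cone_tri x (g * v) (g * (g' * y))
  have c2 := F.cone_tri (g * v) (g * w) (g * (g' * y))
  rw [F.cone_inv g v w, F.cone_inv g w] at c2
  have c3 := F.cone_of_mem hv hw
  have c4 := quotDist_le_cone d Y Γ κ x (g * (g' * y))
  rw [F.quotDist_smul_right hg, F.quotDist_smul_right hg'] at c4
  refine ⟨g * g', mul_mem hg hg', ?_⟩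
  rw [mul_assoc]
  refine ⟨?_, g, hg, g * v, g * w, ⟨F.equiv g a v hv, F.equiv g a w hw, by omega, ?_⟩,
    fun s hs => ?_⟩
  · rw [F.quotDist_smul_right hg, F.quotDist_smul_right hg']
    omega
  · rw [F.cone_inv]
    omega
  · have := h3 _ (F.conj_rot g hs)
    rw [← F.inv g] at this
    convert this using 2
    group

/-- Crossings of lifts descend. -/
theorem qcross_of_lift {M : ℕ} {a : ι} {x y h : G} {t : ℕ} (hh : h ∈ rot Γ)
    (Q : LiftCross d Y Γ κ M a t x (h * y)) : QCross d Y Γ κ M a x y t := by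
  obtain ⟨e, g, hg, v, w, C, hM⟩ := Q
  have hg' := (rot Γ).inv_mem hg
  have hv := F.equiv g⁻¹ _ _ C.left
  have hw := F.equiv g⁻¹ _ _ C.right
  rw [inv_smul_smul] at hv hw
  have c1 := quotDist_le_cone d Y Γ κ x v
  have c2 := quotDist_le_cone d Y Γ κ w (h * y)
  have c3 := F.quotDist_tri x v y
  have c4 := F.quotDist_tri v w y
  have c5 := quotDist_le_cone d Y Γ κ v w
  have c6 := F.cone_of_mem C.left C.right
  rw [F.quotDist_smul_right hh] at e c2
  have h1 := C.time
  have h2 := C.total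
  refine ⟨g⁻¹ * v, hv, g⁻¹ * w, hw, ?_, ?_, fun s hs => ?_⟩
  · rw [F.quotDist_smul_right hg']
    omega
  · rw [F.quotDist_smul_left hg']
    omega
  · have := hM _ (F.conj g a s hs)
    rw [← F.inv g⁻¹] at this
    convert this using 2
    group

theorem qcross_symm {M : ℕ} {a : ι} {x y : G} {t : ℕ} (Q : QCross d Y Γ κ M a x y t) :
    ∃ t', QCross d Y Γ κ M a y x t' ∧ t + 1 + t' = quotDist d Y Γ κ x y := by
  obtain ⟨v, hv, w, hw, h1, h2, h3⟩ := Q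
  refine ⟨_, ⟨w, hw, v, hv, rfl, ?_, fun s hs => ?_⟩, by rw [F.quotDist_symm y w]; exact h2⟩
  · rw [F.quotDist_symm y w, F.quotDist_symm v x, F.quotDist_symm y x]
    omega
  · have := h3 _ ((Γ a).inv_mem hs)
    rw [← F.inv s, mul_inv_cancel_left, F.met.symm] at this
    exact this

theorem qcross_smul {M : ℕ} {a : ι} {x y : G} {t : ℕ} (Q : QCross d Y Γ κ M a x y t) (g : G) :
    QCross d Y Γ κ M (g • a) (g * x) (g * y) t := by
  obtain ⟨v, hv, w, hw, h1, h2, h3⟩ := Q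
  refine ⟨_, F.equiv g a v hv, _, F.equiv g a w hw, by rw [F.quotDist_inv, h1], ?_,
    fun s hs => ?_⟩
  · rw [F.quotDist_inv, F.quotDist_inv, h2]
  · have := h3 _ (F.conj_rot g hs)
    rw [← F.inv g] at this
    convert this using 2
    group

theorem qcross_time {M : ℕ} {a : ι} {x y : G} {t t' : ℕ} (Q : QCross d Y Γ κ M a x y t)
    (Q' : QCross d Y Γ κ M a x y t') : t = t' := by
  obtain ⟨v, hv, w, hw, h1, h2, -⟩ := Q
  obtain ⟨v', hv', w', hw', h1', h2', -⟩ := Q'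
  have c1 := F.cone_of_mem hv hw'
  have c2 := F.cone_of_mem hv' hw
  have c3 := quotDist_le_cone d Y Γ κ v w'
  have c4 := quotDist_le_cone d Y Γ κ v' w
  have c5 := F.quotDist_tri x v y
  have c6 := F.quotDist_tri v w' y
  have c7 := F.quotDist_tri x v' y
  have c8 := F.quotDist_tri v' w y
  omega

theorem side_refl (B : ℕ) (x : G) :
    Side d Y Γ B (fun y z => ∃ g ∈ rot Γ, y = g * x ∧ z = g * x) :=
  F.side_translate fun a => by rw [F.prDist_self]; exact Nat.zero_le _

/-- Crossings persist when an endpoint is moved. -/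
theorem qcross_move (hΘ : 2000 * κ ≤ Θ) {M D : ℕ} (hM : 500 * κ ≤ M) {a : ι} {x y₁ y : G} {t : ℕ}
    (Q : QCross d Y Γ κ M a x y₁ t) (hD : quotDist d Y Γ κ y₁ y ≤ D)
    (ht : t + D + 12 < quotDist d Y Γ κ x y₁) : QCross d Y Γ κ (M - 500 * κ) a x y t := by
  have hκ := F.large
  obtain ⟨h, hh, P⟩ := F.exists_liftCross Q
  obtain ⟨k₁, m₁, e₁⟩ := quotDist_spec d Y Γ κ y₁ y
  obtain ⟨k₂, m₂, e₂⟩ := quotDist_spec d Y Γ κ y x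
  have S := F.side_quotDist (B := 300 * κ) (by omega)
  have m := mul_mem hh m₁
  have m' := mul_mem m m₂
  obtain ⟨g₁, l₁, g₂, l₂, g₃, l₃, ⟨e, g, hg, v, w, C, hC⟩, s₂, s₃, n, -, e₃, e₄⟩ :=
    F.exists_closed (B := 300 * κ) (by omega)
    (by omega) (F.side_liftCross M a t) S S (F.side_refl _ x) (z₀ := x) (z₁ := h * y₁)
    (z₂ := h * k₁ * y) (z₃ := h * k₁ * k₂ * x) m' P
    (by rw [F.quotDist_smul_right m, F.quotDist_smul_left hh, mul_assoc, F.cone_inv, e₁])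
    (by rw [F.quotDist_smul_right m', F.quotDist_smul_left m, mul_assoc (h * k₁), F.cone_inv, e₂])
    ⟨_, m', rfl, rfl⟩
  rw [← e₄] at e₃
  rw [e₃, F.cone_symm, F.quotDist_symm] at s₃
  have m₂ := mul_mem l₂ m
  refine F.qcross_of_lift m₂ ⟨by rw [mul_assoc g₂, s₃], g, hg, ?_⟩
  rw [mul_assoc g₂]
  rw [F.quotDist_smul_right l₁, F.quotDist_smul_right hh] at e
  rw [F.quotDist_smul_right l₂, F.quotDist_smul_right m, F.quotDist_smul_left l₁,
    F.quotDist_smul_left hh] at s₂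
  generalize g₁ * (h * y₁) = z at *
  generalize g₂ * (h * k₁ * y) = z' at *
  have h1 := C.time
  have h2 := C.total
  have h3 : prDist d Y (g • a) z z' ≤ 100000 := by
    obtain ⟨f, f1, f2, f3⟩ := F.exists_cone_geodesic z z'
    have hfar := F.prDist_far (a := g • a) (f := f) (n := coneDist d Y κ z z') f3
        fun k hk y' hy' => by
      have h4 := f3 0 k (by omega) hk
      rw [f1] at h4
      have h5 := (F.cross_min C hy').2
      have h6 := F.cone_tri z (f k) y'
      have h7 := F.cone_symm y' z
      omega
    rwa [f1, f2] at hfar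
  have h4 := F.cross_entry C
  have h5 := F.cross_exit C
  have h6 := (F.cross_dist C).1
  have h7 := hC 1 (one_mem _)
  rw [one_mul] at h7
  have h8 := F.prDist_tri (g • a) x z' z
  have h9 := F.prDist_symm (g • a) z z'
  obtain ⟨t', v', w', C'⟩ := F.exists_cross (a := g • a) (x := x) (y := z') (by omega)
  obtain rfl := F.cross_time C C'
  refine ⟨v', w', C', fun s hs => ?_⟩
  have i1 := F.cross_entry C'
  have i2 := F.cross_exit C'
  have i3 := F.prDist_tri (g • a) v x v'
  have i4 := F.prDist_symm (g • a) v x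
  have i5 := F.prDist_tri (g • a) w' z' w
  have i6 := F.prDist_tri (g • a) z' z w
  have i7 := F.prDist_symm (g • a) z' z
  have i8 := F.prDist_symm (g • a) w z
  rw [F.prDist_of_mem C.left C'.left] at i3
  rw [F.prDist_of_mem C'.right C.right] at i5
  have i9 := hC s hs
  have i10 := F.met.tri v v' (s * w)
  have i11 := F.met.tri v' (s * w') (s * w)
  rw [F.inv] at i11
  omega

/-- Crossings of a geodesic at the same time agree up to rotations. -/
theorem qcross_eq (hΘ : 2000 * κ ≤ Θ) {M : ℕ} (hM : 400 * κ ≤ M) {a b : ι} {x y : G} {t : ℕ}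
    (Q : QCross d Y Γ κ M a x y t) (Q' : QCross d Y Γ κ M b x y t) : ∃ g ∈ rot Γ, g • a = b := by
  have hκ := F.large
  obtain ⟨h, hh, P⟩ := F.exists_liftCross Q
  obtain ⟨h', hh', P'⟩ := F.exists_liftCross Q'
  have m := mul_mem hh ((rot Γ).inv_mem hh')
  have R := F.side_refl (300 * κ) x
  obtain ⟨g₁, l₁, g₂, l₂, g₃, l₃, ⟨e, g, hg, v, w, C, hC⟩,
      ⟨e', g', hg', v', w', C', hC'⟩, ⟨n, -, e₁, e₂⟩, n', -, e₃, e₄⟩ :=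
    F.exists_closed (B := 300 * κ) (by omega)
    (by omega) (F.side_liftCross M a t) (Side.symm F (F.side_liftCross M b t)) R R
    (z₀ := x) (z₁ := h * y) (z₂ := h * h'⁻¹ * x) (z₃ := h * h'⁻¹ * x) m P
    (by
      have := (F.side_liftCross M b t).inv _ m _ _ P'
      rwa [← mul_assoc, inv_mul_cancel_right] at this)
    ⟨_, m, rfl, rfl⟩ ⟨_, m, rfl, rfl⟩
  rw [e₁, ← e₂, e₃, ← e₄] at C'
  have h1 := (F.cross_dist C).1
  have h2 := (F.cross_dist C').1
  have h3 := hC 1 (one_mem _)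
  have h4 := hC' 1 (one_mem _)
  rw [one_mul] at h3 h4
  have := F.cross_eq C C' (by omega) (by omega)
  refine ⟨g'⁻¹ * g, mul_mem ((rot Γ).inv_mem hg') hg, ?_⟩
  rw [mul_smul, this, inv_smul_smul]

/-- Elements which move both endpoints slightly shift the crossings. -/
theorem qcross_shift (hΘ : 2000 * κ ≤ Θ) {M D : ℕ} (hM : 1500 * κ ≤ M) {a : ι} {x y u : G} {t : ℕ}
    (Q : QCross d Y Γ κ M a x y t) (hx : quotDist d Y Γ κ x (u * x) ≤ D)
    (hy : quotDist d Y Γ κ y (u * y) ≤ D) (h1 : 3 * D + 20 ≤ t)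
    (h2 : t + 3 * D + 20 ≤ quotDist d Y Γ κ x y) :
    ∃ t', QCross d Y Γ κ (M - 1000 * κ) (u • a) x y t' ∧
      t' + quotDist d Y Γ κ (u * x) y = t + quotDist d Y Γ κ x y := by
  have hκ := F.large
  have e := F.quotDist_inv u x y
  have e1 := F.quotDist_tri (u * x) (u * y) y
  have e2 := F.quotDist_tri (u * x) y (u * y)
  have e3 := F.quotDist_symm (u * y) y
  have e4 := F.quotDist_symm (u * x) x
  have e5 := F.quotDist_symm (u * x) y
  have Q1 := F.qcross_move hΘ (D := D) (by omega) (F.qcross_smul Q u) (y := y) (by omega) (by omega)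
  obtain ⟨t1, Q2, h3⟩ := F.qcross_symm Q1
  have Q3 := F.qcross_move hΘ (D := D) (by omega) Q2 (y := x) (by omega) (by omega)
  obtain ⟨t2, Q4, h4⟩ := F.qcross_symm Q3
  have e6 := F.quotDist_symm y x
  exact ⟨t2, Q4.mono (by omega), by omega⟩

end Fam
end Crossing

/-! ### Acylindricity of the quotient: two crossings -/

section TwoCross

variable {G ι : Type*} [Group G] [MulAction G ι]

variable {d : G → G → ℕ} {Y : ι → Set G} {Γ : ι → Subgroup G} {κ Θ : ℕ}

namespace Fam

variable (F : Fam d Y Γ κ Θ)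
include F

theorem side_stab {B : ℕ} (hB : κ ≤ B) {a : ι} {p : G} (hp : p ∈ Y a) :
    Side d Y Γ B (fun x y => ∃ g ∈ rot Γ, ∃ e : G, e • a = a ∧ x = g * p ∧ y = g * (e * p)) where
  inv g hg x y := by
    rintro ⟨n, hn, e, he, rfl, rfl⟩
    exact ⟨g * n, mul_mem hg hn, e, he, by rw [mul_assoc], by rw [mul_assoc]⟩
  bend b s hs x y hD := by
    rintro ⟨n, hn, e, he, rfl, rfl⟩
    have h1 := F.equiv n a _ hp
    have h2 := F.equiv e a _ hp
    rw [he] at h2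
    have h2 := F.equiv n a _ h2
    by_cases hb : b = n • a
    · subst hb
      refine ⟨n, hn, n⁻¹ * s * n * e, ?_, rfl, by group⟩
      rw [mul_smul, he]
      exact F.fix a _ (F.conj_rot n hs)
    · have := F.overlap b (n • a) hb _ h1 _ h2
      omega

/-- An element whose image fixes the images of two consecutive members is a product of
rotations. -/
theorem mem_rot_of_fix (hΘ : 1000 * κ ≤ Θ)
    (stab : ∀ a b : ι, a ≠ b → ∀ g : G, g • a = a → g • b = b → g = 1)
    {B : ℕ} (hB : κ ≤ B) (hBΘ : 4 * B + 15 * κ ≤ Θ) {a b : ι} (hab : a ≠ b) {p q c : G}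
    (hp : p ∈ Y a) (hq : q ∈ Y b) (hD : ∀ f, prDist d Y f p q ≤ B)
    (ha : ∃ g ∈ rot Γ, g • a = c • a) (hb : ∃ g ∈ rot Γ, g • b = c • b) : c ∈ rot Γ := by
  obtain ⟨ga, ma, ea⟩ := ha
  obtain ⟨gb, mb, eb⟩ := hb
  have mb' := (rot Γ).inv_mem mb
  have m := mul_mem mb' ma
  obtain ⟨g₁, l₁, g₂, l₂, g₃, l₃, ⟨n₁, -, e₁, e₂⟩, ⟨n₂, -, e, he, e₃, e₄⟩, ⟨n₃, k₃, e₅, e₆⟩,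
      ⟨n₄, -, e', he', e₇, e₈⟩⟩ :=
    F.exists_closed hΘ hBΘ (F.side_translate hD) (F.side_stab hB hq)
    (F.side_translate (p := c * q) (q := c * p) (fun f => by
      have := hD (c⁻¹ • f)
      rwa [← F.prDist_smul c, smul_inv_smul, F.prDist_symm] at this))
    (Side.symm F (F.side_stab hB hp))
    (z₀ := p) (z₁ := q) (z₂ := gb⁻¹ * (c * q)) (z₃ := gb⁻¹ * (c * p)) m
    ⟨1, one_mem _, by simp, by simp⟩
    ⟨1, one_mem _, gb⁻¹ * c, by rw [mul_smul, ← eb, inv_smul_smul], by simp, by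
      simp [mul_assoc]⟩
    ⟨_, mb', rfl, rfl⟩
    ⟨_, m, ga⁻¹ * c, by rw [mul_smul, ← ea, inv_smul_smul], rfl, by group⟩
  have h1 : n₁ = 1 := by simpa using e₁.symm
  have h4 : n₄ = 1 := by simpa using e₇.symm
  rw [h1, one_mul] at e₂
  rw [e₂] at e₃
  have h2 : n₂ = 1 := by simpa using e₃.symm
  rw [e₅, h2, one_mul, ← mul_assoc] at e₄
  rw [e₆, h4, one_mul, ← mul_assoc] at e₈
  have h5 := mul_right_cancel e₄
  have h6 := mul_right_cancel e₈
  have := stab a b hab (n₃ * c) (by rw [h6, he']) (by rw [h5, he])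
  rw [mul_eq_one_iff_eq_inv'] at this
  rw [this]
  exact (rot Γ).inv_mem k₃

end Fam
end TwoCross

section TwoCross

variable {G ι : Type*} [Group G] [MulAction G ι]

variable {d : G → G → ℕ} {Y : ι → Set G} {Γ : ι → Subgroup G} {κ Θ : ℕ}

namespace Fam

variable (F : Fam d Y Γ κ Θ)
include F

theorem quot_invMet (hΘ : 1000 * κ ≤ Θ) : InvMet (quotDist d Y Γ κ) :=
  ⟨F.quotDist_met hΘ, F.quotDist_inv⟩

theorem qcross_of_tight {M : ℕ} {a : ι} {x y v w : G} {t : ℕ}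
    (e : coneDist d Y κ x y = quotDist d Y Γ κ x y)
    (hs : ∀ s ∈ Γ a, prDist d Y a x y ≤ prDist d Y a x (s * y) + 100 * κ)
    (C : Cross d Y κ a x y t v w) (hM : M + 300 * κ < prDist d Y a x y) :
    QCross d Y Γ κ M a x y t := by
  have h1 := quotDist_le_cone d Y Γ κ x v
  have h2 := quotDist_le_cone d Y Γ κ v w
  have h3 := quotDist_le_cone d Y Γ κ w y
  have h4 := F.quotDist_tri x v y
  have h5 := F.quotDist_tri v w y
  have h6 := F.cone_of_mem C.left C.right
  have h7 := C.time
  have h8 := C.total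
  refine ⟨v, C.left, w, C.right, by omega, by omega, fun s h => ?_⟩
  have i1 := hs s h
  have i2 := F.cross_entry C
  have i3 := F.cross_exit C
  have i4 := F.prDist_tri a x v (s * y)
  have i5 := F.prDist_tri a v (s * w) (s * y)
  have i6 := F.prDist_smul s a w y
  rw [F.fix a s h] at i6
  rw [F.prDist_of_mem C.left (F.mem_of_rot h C.right)] at i5
  omega

theorem qcross_shift_pow (hΘ : 2000 * κ ≤ Θ) {M : ℕ} (hM : 3000000 * κ ≤ M) {a : ι} {x y u : G}
    {t : ℕ} (Q : QCross d Y Γ κ M a x y t) (hx : quotDist d Y Γ κ x (u * x) ≤ 300000)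
    (hy : quotDist d Y Γ κ y (u * y) ≤ 300000) (h1 : 1000000000 ≤ t)
    (h2 : t + 1000000000 ≤ quotDist d Y Γ κ x y) {σ : ℤ}
    (hσ : σ = quotDist d Y Γ κ x y - quotDist d Y Γ κ (u * x) y) (j : ℕ) (hj : j ≤ 2000) :
    ∃ t', QCross d Y Γ κ (M - j * (1000 * κ)) (u ^ j • a) x y t' ∧ (t' : ℤ) = t + j * σ := by
  have hκ := F.large
  suffices ∃ t', QCross d Y Γ κ (M - j * (1000 * κ)) (u ^ j • a) x y t' ∧ (t' : ℤ) = t + j * σ ∧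
      t' ≤ t + j * 300000 ∧ t ≤ t' + j * 300000 by
    obtain ⟨t', h, h', -⟩ := this
    exact ⟨t', h, h'⟩
  induction j with
  | zero => exact ⟨t, by simpa using Q, by simp, by simp, by simp⟩
  | succ j ih =>
    obtain ⟨t', Q', h3, h4, h5⟩ := ih (by omega)
    obtain ⟨t'', Q'', h6⟩ := F.qcross_shift hΘ (D := 300000) (by
      have := Nat.mul_le_mul_right (1000 * κ) (show j ≤ 2000 by omega)
      omega) Q' hx hy (by omega) (by omega)
    have h7 := F.quotDist_tri (u * x) x y
    have h8 := F.quotDist_tri x (u * x) y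
    have h9 := F.quotDist_symm (u * x) x
    have h10 := Nat.add_mul j 1 (1000 * κ)
    refine ⟨t'', ?_, ?_, by omega, by omega⟩
    · rw [pow_succ', mul_smul]
      exact Q''.mono (by omega)
    · push_cast
      rw [add_mul]
      omega

theorem qcross_comm (hΘ : 2000 * κ ≤ Θ) {M : ℕ} (hM : 10000 * κ ≤ M) {a : ι} {x y u v : G}
    {t : ℕ} (Q : QCross d Y Γ κ M a x y t) (hux : quotDist d Y Γ κ x (u * x) ≤ 300000)
    (huy : quotDist d Y Γ κ y (u * y) ≤ 300000) (hvx : quotDist d Y Γ κ x (v * x) ≤ 300000)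
    (hvy : quotDist d Y Γ κ y (v * y) ≤ 300000) (h1 : 1000000000 ≤ t)
    (h2 : t + 1000000000 ≤ quotDist d Y Γ κ x y) :
    ∃ g ∈ rot Γ, g • a = (u * v * u⁻¹ * v⁻¹) • a := by
  have hκ := F.large
  have I := F.quot_invMet (by omega)
  have inv : ∀ u : G, quotDist d Y Γ κ x (u * x) ≤ 300000 →
      quotDist d Y Γ κ y (u * y) ≤ 300000 →
      quotDist d Y Γ κ (u * x) y + quotDist d Y Γ κ (u⁻¹ * x) y = 2 * quotDist d Y Γ κ x y := by
    intro u hx hy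
    obtain ⟨t₁, Q₁, e₁⟩ := F.qcross_shift hΘ (by omega) Q hx hy (by omega) (by omega)
    have h7 := F.quotDist_tri (u * x) x y
    have h8 := F.quotDist_tri x (u * x) y
    have h9 := F.quotDist_symm (u * x) x
    obtain ⟨t₂, Q₂, e₂⟩ := F.qcross_shift hΘ (by omega) Q₁ (u := u⁻¹) (D := 300000)
      (by rwa [I.dist_inv]) (by rwa [I.dist_inv]) (by omega) (by omega)
    rw [inv_smul_smul] at Q₂
    have := F.qcross_time Q₂ (Q.mono (by omega))
    omega
  have hu := inv u hux huy
  have hv := inv v hvx hvy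
  have bound : ∀ u : G, quotDist d Y Γ κ x (u * x) ≤ 300000 →
      quotDist d Y Γ κ (u * x) y ≤ quotDist d Y Γ κ x y + 300000 ∧
      quotDist d Y Γ κ x y ≤ quotDist d Y Γ κ (u * x) y + 300000 := by
    intro u hx
    have h7 := F.quotDist_tri (u * x) x y
    have h8 := F.quotDist_tri x (u * x) y
    have h9 := F.quotDist_symm (u * x) x
    omega
  have b1 := bound u hux
  have b2 := bound v hvx
  obtain ⟨t₁, Q₁, e₁⟩ := F.qcross_shift hΘ (by omega) Q (u := v⁻¹) (D := 300000)
      (by rwa [I.dist_inv]) (by rwa [I.dist_inv]) (by omega) (by omega)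
  obtain ⟨t₂, Q₂, e₂⟩ := F.qcross_shift hΘ (by omega) Q₁ (u := u⁻¹) (D := 300000)
      (by rwa [I.dist_inv]) (by rwa [I.dist_inv]) (by omega) (by omega)
  obtain ⟨t₃, Q₃, e₃⟩ := F.qcross_shift hΘ (by omega) Q₂ hvx hvy (by omega) (by omega)
  obtain ⟨t₄, Q₄, e₄⟩ := F.qcross_shift hΘ (by omega) Q₃ hux huy (by omega) (by omega)
  have : t₄ = t := by omega
  subst this
  simp only [← mul_smul, ← mul_assoc] at Q₄
  exact F.qcross_eq hΘ (M := M - 1000 * κ - 1000 * κ - 1000 * κ - 1000 * κ) (by omega)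
    (Q.mono (by omega)) Q₄

/-- Elements which shift a crossing are loxodromic. -/
theorem qcross_lox (hΘ : 2000 * κ ≤ Θ) {M : ℕ} (hM : 3000000 * κ ≤ M) {a : ι} {x y u : G}
    {t : ℕ} (Q : QCross d Y Γ κ M a x y t) (hx : quotDist d Y Γ κ x (u * x) ≤ 300000)
    (hy : quotDist d Y Γ κ y (u * y) ≤ 300000) (h1 : 1000000000 ≤ t)
    (h2 : t + 1000000000 ≤ quotDist d Y Γ κ x y) :
    (∃ g ∈ rot Γ, g • a = u • a) ∨ TLox (quotDist d Y Γ κ) 1000 u := by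
  have hκ := F.large
  have I := F.quot_invMet (by omega)
  by_cases h0 : quotDist d Y Γ κ x y = quotDist d Y Γ κ (u * x) y
  · left
    obtain ⟨t₁, Q₁, e₁⟩ := F.qcross_shift hΘ (by omega) Q hx hy (by omega) (by omega)
    have : t₁ = t := by omega
    subst this
    exact F.qcross_eq hΘ (M := M - 1000 * κ) (by omega) (Q.mono (by omega)) Q₁
  right
  obtain ⟨σ, hσ⟩ : ∃ σ : ℤ, σ = quotDist d Y Γ κ x y - quotDist d Y Γ κ (u * x) y := ⟨_, rfl⟩
  obtain ⟨v, hv, w, hw, q1, q2, -⟩ := id Q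
  have key : ∀ j : ℕ, j ≤ 2000 →
      ((quotDist d Y Γ κ v (u ^ j * v) : ℤ) ≤ j * σ + 301 ∨
        (quotDist d Y Γ κ v (u ^ j * v) : ℤ) ≤ -(j * σ) + 301) ∧
      (j * σ ≤ quotDist d Y Γ κ v (u ^ j * v) + 1) ∧
      (-(j * σ) ≤ quotDist d Y Γ κ v (u ^ j * v) + 1) := by
    intro j hj
    obtain ⟨t', ⟨v', hv', w', hw', q1', q2', -⟩, ht'⟩ :=
      F.qcross_shift_pow hΘ hM Q hx hy h1 h2 hσ j hj
    have c1 := (quotDist_le_cone d Y Γ κ v' (u ^ j * v)).trans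
      (F.cone_of_mem hv' (F.equiv _ _ _ hv))
    have c2 := (quotDist_le_cone d Y Γ κ v w).trans (F.cone_of_mem hv hw)
    have c3 := (quotDist_le_cone d Y Γ κ v' w').trans (F.cone_of_mem hv' hw')
    have c4 := F.quotDist_tri v w y
    have c5 := F.quotDist_tri v' w' y
    have c6 := I.met.order (p := x) (q := y) (x := v) (z := v') (c := 0) (by omega) (by omega)
    have c7 := F.quotDist_tri v v' (u ^ j * v)
    have c8 := F.quotDist_tri v (u ^ j * v) v'
    have c9 := F.quotDist_symm (u ^ j * v) v'
    have c10 := F.quotDist_tri x v v'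
    have c11 := F.quotDist_tri x v' v
    have c12 := F.quotDist_symm v v'
    generalize (j : ℤ) * σ = s at *
    omega
  have k1 := key 1000 (by omega)
  have k2 := key 2000 (by omega)
  have := I.tlox_of_step (w := u ^ 1000) (y := v) (by
    rw [← pow_mul, show 1000 * 2 = 2000 from rfl]
    push_cast at k1 k2
    omega)
  simpa using this.of_pow I

/-- Two crossings of a tight pair force elements with small displacement to commute. -/
theorem acyl_two_cross (stab : ∀ a b : ι, a ≠ b → ∀ g : G, g • a = a → g • b = b → g = 1)
    {M : ℕ} (hM : 4000000 * κ ≤ M) (hMΘ : 5 * M ≤ Θ) {x y : G}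
    (e : coneDist d Y κ x y = quotDist d Y Γ κ x y)
    (ht : ∀ a, ∀ s ∈ Γ a, prDist d Y a x y ≤ prDist d Y a x (s * y) + 100 * κ)
    (hex : ∃ a b, a ≠ b ∧ ∃ t v w t' v' w', Cross d Y κ a x y t v w ∧ Cross d Y κ b x y t' v' w' ∧
      M < prDist d Y a x y ∧ M < prDist d Y b x y ∧ 1000000000 ≤ t ∧ 1000000000 ≤ t' ∧
      t + 1000000000 ≤ coneDist d Y κ x y ∧ t' + 1000000000 ≤ coneDist d Y κ x y) {u v : G}
    (hux : quotDist d Y Γ κ x (u * x) ≤ 300000)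
    (huy : quotDist d Y Γ κ y (u * y) ≤ 300000) (hvx : quotDist d Y Γ κ x (v * x) ≤ 300000)
    (hvy : quotDist d Y Γ κ y (v * y) ≤ 300000) :
    u * v * u⁻¹ * v⁻¹ ∈ rot Γ ∧ (u ∈ rot Γ ∨ TLox (quotDist d Y Γ κ) 1000 u) := by
  have hκ := F.large
  have hex' : ∃ k, ∃ a b, a ≠ b ∧ ∃ t v w t' v' w', Cross d Y κ a x y t v w ∧
      Cross d Y κ b x y t' v' w' ∧ M < prDist d Y a x y ∧ M < prDist d Y b x y ∧
      1000000000 ≤ t ∧ t' + 1000000000 ≤ coneDist d Y κ x y ∧ t + k = t' := by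
    obtain ⟨a, b, hab, t, v, w, t', v', w', C, C', h⟩ := hex
    rcases le_total t t' with h' | h'
    · exact ⟨t' - t, a, b, hab, t, v, w, t', v', w', C, C', by omega⟩
    · exact ⟨t - t', b, a, hab.symm, t', v', w', t, v, w, C', C, by omega⟩
  obtain ⟨a, b, hab, t, va, wa, t', vb, wb, C, C', hDa, hDb, h1, h2, h3⟩ := Nat.find_spec hex'
  have hmin := fun m => Nat.find_min hex' (m := m)
  generalize Nat.find hex' = k at *
  have hk : k ≠ 0 := by
    rintro rfl
    rw [add_zero] at h3
    subst h3
    exact hab (F.cross_eq C C' (by omega) (by omega))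
  have hb : prDist d Y b x wa ≤ 2 * κ := by
    refine F.behrstock hab C'.right C.right ?_
    by_contra! h
    have := F.cross_order C' C (by omega) h
    omega
  have h4 := F.prDist_tri b x wa y
  obtain ⟨t'', q, w'', C''⟩ := F.exists_cross (a := b) (x := wa) (y := y) (by omega)
  have c1 := C.time
  have c2 := C.total
  have c3 := F.cone_of_mem C.left C.right
  have c4 := F.cone_tri x va wa
  have c5 := F.cone_tri x wa y
  have c6 := C''.time
  have c7 := C''.total
  have c8 := F.cone_of_mem C''.left C''.right
  have c9 := F.cone_tri q w'' y
  have c10 := F.cone_tri x wa q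
  have c11 := F.cone_tri x q y
  have ht' : t' = t + 1 + t'' :=
    F.cross_time C' (⟨C''.left, C''.right, by omega, by omega⟩ :
      Cross d Y κ b x y (t + 1 + t'') q w'')
  have hD : ∀ f, prDist d Y f wa q ≤ M + 200 * κ := by
    intro f
    by_contra! hf
    obtain ⟨g1, s, v₁, w₁, C₁, g2, g3, -⟩ := F.cross_between (x := x) (y := y) (by omega) hf
    have hfa : a ≠ f := by
      rintro rfl
      have := F.cross_time C C₁
      omega
    exact hmin (s - t) (by omega) ⟨a, f, hfa, t, va, wa, s, v₁, w₁, C, C₁, hDa, g1, h1,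
      by omega, by omega⟩
  have Qa := F.qcross_of_tight (M := M - 300 * κ) e (ht a) C (by omega)
  have Qb := F.qcross_of_tight (M := M - 300 * κ) e (ht b) C' (by omega)
  have fin := fun c => F.mem_rot_of_fix (c := c) (by omega) stab (B := M + 200 * κ) (by omega)
    (by omega) hab C.right C''.left hD
  refine ⟨fin _ (F.qcross_comm (by omega) (by omega) Qa hux huy hvx hvy h1 (by omega))
    (F.qcross_comm (by omega) (by omega) Qb hux huy hvx hvy (by omega) (by omega)), ?_⟩
  rcases F.qcross_lox (by omega) (by omega) Qa hux huy h1 (by omega) with ha | ha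
  · rcases F.qcross_lox (by omega) (by omega) Qb hux huy (by omega) (by omega) with hb | hb
    · exact .inl (fin _ ha hb)
    · exact .inr hb
  · exact .inr ha

end Fam
end TwoCross

/-! ### Acylindricity of the quotient: no crossing -/

section Steady

variable {G : Type*} [Group G] {d : G → G → ℕ}

/-- The displacement of an element which almost fixes both ends of an interval is almost constant
deep inside the interval. -/
theorem InvMet.disp_steady (I : InvMet d) {p q x y u : G} {l : ℕ} (hp : d p (u * p) ≤ l)
    (hq : d q (u * q) ≤ l) (h : d p x + d x y + d y q = d p q) (h1 : 2 * l + 300 ≤ d p x)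
    (h2 : 2 * l + 300 ≤ d y q) :
    d x (u * x) ≤ d y (u * y) + 1200 ∧ d y (u * y) ≤ d x (u * x) + 1200 := by
  have t1 := I.met.tri p x y
  have t2 := I.met.tri x y q
  have t3 := I.met.tri p x q
  have t4 := I.met.tri p y q
  have n1 := I.near_move hp hq (z := x) (by omega) (by omega) (by omega)
  have n2 := I.near_move hp hq (z := y) (by omega) (by omega) (by omega)
  have o1 := I.met.order (p := p) (q := q) (x := x) (z := u * x) (c := 600) (by omega) n1
  have o2 := I.met.order (p := p) (q := q) (x := y) (z := u * y) (c := 600) (by omega) n2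
  have i1 := I.inv u p x
  have i2 := I.inv u p y
  have i3 := I.inv u x y
  have s1 := I.met.symm (u * y) (u * x)
  have t5 := I.met.tri p (u * p) (u * y)
  have t6 := I.met.tri (u * p) p (u * y)
  have t7 := I.met.tri p (u * p) (u * x)
  have t8 := I.met.tri (u * p) p (u * x)
  have s2 := I.met.symm (u * p) p
  have b1 := I.met.buse (p := p) (p' := u * p) (x := u * x) (y := u * y) (by omega)
  have b2 := I.met.buse (p := p) (p' := u * p) (x := u * y) (y := u * x) (by omega)
  have t9 := I.met.tri p x (u * x)
  have t10 := I.met.tri p (u * x) x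
  have t11 := I.met.tri p y (u * y)
  have t12 := I.met.tri p (u * y) y
  have s3 := I.met.symm (u * x) x
  have s4 := I.met.symm (u * y) y
  omega

end Steady

section NoCross

variable {G ι : Type*} [Group G] [MulAction G ι]

variable {d : G → G → ℕ} {Y : ι → Set G} {Γ : ι → Subgroup G} {κ Θ : ℕ}

theorem PreFam.prDist_chain (F : PreFam d Y) {a : ι} {p q x y : G} {c : ℕ}
    (h : d p x + d x y + d y q ≤ d p q + c) :
    prDist d Y a x y ≤ prDist d Y a p q + c + 100000 := by
  by_contra! hD
  have h1 := F.prDist_excess (a := a) (x := x) (z := y) (by omega)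
  have h2 := F.pr_near p (F.pr_mem a x)
  have h3 := F.pr_near q (F.pr_mem a y)
  have h4 := F.met.tri p x (pr d Y a x)
  have h5 := F.met.tri q y (pr d Y a y)
  have h6 := F.met.tri p (pr d Y a p) q
  have h7 := F.met.tri (pr d Y a p) (pr d Y a q) q
  have h8 := F.met.symm (pr d Y a q) q
  have h9 := F.met.symm y q
  have h10 := F.met.symm y (pr d Y a y)
  have h11 : prDist d Y a p q = d (pr d Y a p) (pr d Y a q) := rfl
  omega

namespace Fam

variable (F : Fam d Y Γ κ Θ)
include F

theorem cone_excess {x y z : G} (hz : d x z + d z y = d x y) :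
    coneDist d Y κ x z + coneDist d Y κ z y ≤ coneDist d Y κ x y + 18 := by
  obtain ⟨v, h1, h2⟩ := F.interval_near_cone hz
  have h3 := F.cone_tri x v z
  have h4 := F.cone_tri z v y
  have h5 := F.cone_symm v z
  omega

theorem exists_between {p q : G} {k : ℕ} (hk : k ≤ coneDist d Y κ p q) :
    ∃ z, d p z + d z q = d p q ∧ k ≤ coneDist d Y κ p z + 18 ∧ coneDist d Y κ p z ≤ k + 18 ∧
      coneDist d Y κ p q ≤ coneDist d Y κ z q + k + 18 ∧
      coneDist d Y κ z q + k ≤ coneDist d Y κ p q + 18 := by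
  obtain ⟨v, h1, h2⟩ := F.cone_met.geod p q k hk
  obtain ⟨z, h3, h4⟩ := F.cone_near_interval (x := p) (y := q) (v := v) (by omega)
  have c1 := F.cone_tri p v z
  have c2 := F.cone_tri p z v
  have c3 := F.cone_tri z v q
  have c4 := F.cone_tri v z q
  have c5 := F.cone_symm v z
  exact ⟨z, h3, by omega, by omega, by omega, by omega⟩

/-- Points deep inside an interval are moved by a bounded amount. -/
theorem deep_disp {B : ℕ} {p q u z : G} (hB : ∀ f, prDist d Y f p q ≤ B)
    (hp : coneDist d Y κ p (u * p) ≤ 300300) (hq : coneDist d Y κ q (u * q) ≤ 300300)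
    (hz : d p z + d z q = d p q) (h1 : 1000000 ≤ coneDist d Y κ p z)
    (h2 : 1000000 ≤ coneDist d Y κ z q) :
    d z (u * z) ≤ 1200 + (B + 202 * κ) * 301000 := by
  have hκ := F.large
  have I := F.invMet
  obtain ⟨r, hr, hzr⟩ : ∃ r, d (u * p) r + d r (u * q) = d (u * p) (u * q) ∧ d z r ≤ 1200 := by
    rcases F.met.thin hz (u * p) with ⟨r, h3, h4⟩ | ⟨r, h3, h4⟩
    · have := F.cone_excess h3
      have := F.cone_of_le (Y := Y) (x := z) (y := r) (by omega)
      have := F.cone_tri p r z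
      have := F.cone_symm r z
      omega
    rcases F.met.thin h3 (u * q) with ⟨s, h5, h6⟩ | ⟨s, h5, h6⟩
    · exact ⟨s, h5, by have := F.met.tri z r s; omega⟩
    · have := F.cone_excess h5
      have := F.met.tri z r s
      have := F.cone_of_le (Y := Y) (x := z) (y := s) (by omega)
      have := F.cone_tri z s q
      have := F.cone_symm (u * q) q
      omega
  have hz' : d (u * p) (u * z) + d (u * z) (u * q) = d (u * p) (u * q) := by
    simpa only [F.inv] using hz
  have c1 := F.cone_excess hr
  have c2 := F.cone_excess hz'
  have c3 := F.cone_of_le (Y := Y) (x := z) (y := r) (by omega)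
  have c4 := F.cone_inv u p z
  have c5 := F.cone_tri p (u * p) r
  have c6 := F.cone_tri (u * p) p r
  have c7 := F.cone_symm (u * p) p
  have c8 := F.cone_tri p z r
  have c9 := F.cone_tri p r z
  have c10 := F.cone_symm r z
  have c11 := F.cone_met.order c1 c2
  have c12 : coneDist d Y κ r (u * z) ≤ 301000 := by
    have := F.cone_symm r (u * z)
    omega
  have hB' : ∀ f, prDist d Y f (u * p) (u * q) ≤ B := fun f => by
    have := hB (u⁻¹ • f)
    rwa [← F.prDist_smul u, smul_inv_smul] at this
  have hD : ∀ f, prDist d Y f r (u * z) ≤ B + κ := fun f => by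
    have := hB' f
    have s1 := F.met.symm r (u * z)
    have s2 := F.prDist_symm f r (u * z)
    rcases F.met.order (c := 0) hr.le hz'.le with h | h
    · have := F.prDist_chain (a := f) (p := u * p) (q := u * q) (x := r) (y := u * z) (c := 300)
        (by omega)
      omega
    · have := F.prDist_chain (a := f) (p := u * p) (q := u * q) (x := u * z) (y := r) (c := 300)
        (by omega)
      omega
  have h3 := F.dist_le_mul_cone hD
  have h4 := F.met.tri z r (u * z)
  have h5 := Nat.mul_le_mul_left (B + κ + 201 * κ) c12
  rw [show B + κ + 201 * κ = B + 202 * κ by omega] at h3 h5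
  omega

/-- Loxodromic elements which translate a long interval without crossings slowly are loxodromic in
the quotient. -/
theorem lox_no_cross {m : ℕ} (hm1 : 5000000000 * κ ≤ m) (hm2 : m ≤ 10000000000 * κ)
    (hΘ : 100000000 * κ ≤ Θ)
    (hmem : ∀ u m', TLox d m' u → (∃ y, d y (u * y) ≤ 60000) → ∃ a : ι, u • a = a)
    {p q u : G} (hB : ∀ f, prDist d Y f p q ≤ 10000200 * κ + 100000) {l : ℕ}
    (hl : l ≤ 3100000000000 * κ) (hp : d p (u * p) ≤ l) (hq : d q (u * q) ≤ l)
    (hpq : 80000000000000000000 * κ ≤ d p q) (hu : TLox d m u) :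
    TLox (quotDist d Y Γ κ) m u := by
  have hκ := F.large
  have hΘ' : 1000 * κ ≤ Θ := by omega
  have ht : 10000200 * κ + 400000 + 300 * κ ≤ Θ := by omega
  have I := F.invMet
  obtain ⟨p₂, g1, g2⟩ := F.met.geod p q (10000000000000000 * κ) (by omega)
  obtain ⟨o, g3, g4⟩ := F.met.geod p₂ q (30000000000000000000 * κ) (by omega)
  obtain ⟨q₂, g5, g6⟩ := F.met.geod o q (30000000000000000000 * κ) (by omega)
  have t1 := F.met.tri p₂ o q₂
  have t2 := F.met.tri p₂ q₂ q
  have t3 := F.met.tri p p₂ o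
  have t4 := F.met.tri p o q
  have t5 := F.met.tri p o q₂
  have t6 := F.met.tri p q₂ q
  have d1 := (I.disp_steady hp hq (x := p₂) (y := o) (by omega) (by omega) (by omega)).1
  have d2 := (I.disp_steady hp hq (x := o) (y := q₂) (by omega) (by omega) (by omega)).2
  have hB2 : ∀ f, prDist d Y f p₂ q₂ ≤ 10000200 * κ + 200000 := fun f => by
    have := hB f
    have := F.prDist_chain (a := f) (p := p) (q := q) (x := p₂) (y := q₂) (c := 0) (by omega)
    omega
  have hlo := I.disp_between (c := 0) hp hq (z := o) (by omega)
  obtain ⟨ℓ, hℓ⟩ : ∃ ℓ, ℓ = d o (u * o) := ⟨_, rfl⟩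
  rw [← hℓ] at d1 d2 hlo
  rcases Nat.lt_or_ge 1800 ℓ with h1 | h1
  · have e1 := I.double_move hp hq (z := o) (by omega) (by omega) (by omega)
    rw [← hℓ] at e1
    obtain ⟨s, hs⟩ : ∃ s, s + 1800 = ℓ := ⟨ℓ - 1800, by omega⟩
    obtain ⟨W, hW⟩ : ∃ W, W = 400 * (10000200 * κ + 400000 + 201 * κ) := ⟨_, rfl⟩
    obtain ⟨j, hj⟩ : ∃ j, j = W / s + 1 := ⟨_, rfl⟩
    have j1 : W < s * j := by
      rw [hj]
      exact Nat.lt_mul_div_succ W (by omega)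
    have j2 : j * s ≤ W + s := by
      rw [hj, Nat.add_mul, one_mul]
      exact Nat.add_le_add_right (Nat.div_mul_le_self W s) s
    have j3 : j ≤ W + 1 := by
      rw [hj]
      exact Nat.add_le_add_right (Nat.div_le_self W s) 1
    have key : ∀ k, k ≤ 2 * j → ∀ z, d z (u * z) ≤ ℓ + 1200 →
        d z (u ^ k * z) ≤ 100000000000000 * κ := by
      intro k hk z hz
      have k1 := I.dist_pow_le u z k
      have k2 : k * d z (u * z) ≤ (2 * j) * (s + 3000) := Nat.mul_le_mul hk (by omega)
      rw [mul_assoc, Nat.mul_add] at k2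
      omega
    have hD : ∀ k, k ≤ 2 * j → ∀ f, prDist d Y f o (u ^ k * o) ≤ 10000200 * κ + 400000 := by
      intro k hk f
      have n1 := key k hk p₂ (by omega)
      have n2 := key k hk q₂ (by omega)
      have n3 := I.near_move n1 n2 (z := o) (by omega) (by omega) (by omega)
      have := hB2 f
      have s1 := F.met.symm o (u ^ k * o)
      have s2 := F.prDist_symm f o (u ^ k * o)
      rcases I.met.order (p := p₂) (q := q₂) (x := o) (z := u ^ k * o) (c := 600)
        (by omega) n3 with h | h
      · have := F.prDist_chain (a := f) (p := p₂) (q := q₂) (x := o) (y := u ^ k * o) (c := 1500)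
          (by omega)
        omega
      · have := F.prDist_chain (a := f) (p := p₂) (q := q₂) (x := u ^ k * o) (y := o) (c := 1500)
          (by omega)
        omega
    have hq' : ∀ k, k ≤ 2 * j →
        quotDist d Y Γ κ o (u ^ k * o) = coneDist d Y κ o (u ^ k * o) := fun k hk =>
      F.quotDist_of_tight hΘ' ht fun a s _ => (hD k hk a).trans (Nat.le_add_left _ _)
    have q1 := hq' j (by omega)
    have q2 := hq' (2 * j) le_rfl
    have x1 := F.dist_le_mul_cone (hD j (by omega))
    have x2 := I.mul_le_disp (w := u) (y := o) (s := s) (by omega) (by omega) j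
    have x3 : 400 ≤ coneDist d Y κ o (u ^ j * o) := by
      by_contra! h
      have := Nat.mul_le_mul_left (10000200 * κ + 400000 + 201 * κ) h.le
      omega
    have e2 := I.double_move (key j (by omega) p₂ (by omega)) (key j (by omega) q₂ (by omega))
      (z := o) (by omega) (by omega) (by omega)
    rw [← pow_mul, mul_comm j 2] at e2
    have i1 := F.inv (u ^ j) o (u ^ j * o)
    have i2 := F.cone_inv (u ^ j) o (u ^ j * o)
    rw [← mul_assoc, ← pow_add, ← two_mul] at i1 i2
    obtain ⟨v, v1, v2⟩ := F.met.near_interval (x := o) (y := u ^ (2 * j) * o) (z := u ^ j * o)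
      (c := 1500) (by omega)
    have v3 := F.cone_excess v1
    have v4 := F.cone_of_le (Y := Y) (x := u ^ j * o) (y := v) (by omega)
    have v5 := F.cone_tri o v (u ^ j * o)
    have v6 := F.cone_tri (u ^ j * o) v (u ^ (2 * j) * o)
    have v7 := F.cone_symm v (u ^ j * o)
    have J := F.quot_invMet hΘ'
    have := J.tlox_of_step (w := u ^ j) (y := o) (by
      rw [← pow_mul, mul_comm j 2]
      omega)
    exact (this.of_pow J).mono (by omega)
  · exfalso
    obtain ⟨a, ha⟩ := hmem u m hu ⟨o, by omega⟩
    have key : ∀ z, d z (u * z) ≤ 3000 →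
        d z (pr d Y a z) ≤ 3000 * (100000 * m + 1) + 100000 := by
      intro z hz
      obtain ⟨k, hk⟩ : ∃ k, k = 100000 * m + 1 := ⟨_, rfl⟩
      have k1 := I.dist_pow_le u z k
      have k2 := Nat.mul_le_mul_left k hz
      have k3 := PreFam.pr_smul d Y (u ^ k) a z
      have k4 : u ^ k • a = a := by
        clear k1 k2 k3 hk
        induction k with
        | zero => simp
        | succ k ih => rw [pow_succ', mul_smul, ih, ha]
      rw [k4] at k3
      have k5 := hu k (pr d Y a z)
      rw [← k3] at k5
      have k6 : prDist d Y a z (u ^ k * z) = d (pr d Y a z) (pr d Y a (u ^ k * z)) := rfl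
      rw [← k6] at k5
      have k7 : 100000 < prDist d Y a z (u ^ k * z) := by
        by_contra! h
        have := Nat.mul_le_mul_left m h
        omega
      have := F.prDist_excess k7
      omega
    have k1 := key p₂ (by omega)
    have k2 := key q₂ (by omega)
    have k3 := F.met.tri p₂ (pr d Y a p₂) q₂
    have k4 := F.met.tri (pr d Y a p₂) (pr d Y a q₂) q₂
    have k5 := F.met.symm q₂ (pr d Y a q₂)
    have k6 : prDist d Y a p₂ q₂ = d (pr d Y a p₂) (pr d Y a q₂) := rfl
    have k7 := hB2 a
    omega

end Fam
end NoCross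

/-! ### Acylindricity of the quotient -/

section QuotAcyl

variable {G ι : Type*} [Group G] [MulAction G ι]

variable {d : G → G → ℕ} {Y : ι → Set G} {Γ : ι → Subgroup G} {κ Θ : ℕ}

namespace Fam

variable (F : Fam d Y Γ κ Θ)
include F

/-- Elements with small displacement at the ends of a long interval without crossings. -/
theorem acyl_no_cross {L m : ℕ} (A : Acyl d L m) (hL : L ≤ κ) (hm1 : 5000000000 * κ ≤ m)
    (hm2 : m ≤ 10000000000 * κ) (hΘ : 100000000 * κ ≤ Θ)
    (hmem : ∀ u m', TLox d m' u → (∃ y, d y (u * y) ≤ 60000) → ∃ a : ι, u • a = a)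
    {p q u v : G} (hB : ∀ f, prDist d Y f p q ≤ 10000200 * κ)
    (hpq : 100000000000000000000 ≤ coneDist d Y κ p q)
    (hup : coneDist d Y κ p (u * p) ≤ 300300) (huq : coneDist d Y κ q (u * q) ≤ 300300)
    (hvp : coneDist d Y κ p (v * p) ≤ 300300) (hvq : coneDist d Y κ q (v * q) ≤ 300300) :
    u * v = v * u ∧ (u = 1 ∨ TLox (quotDist d Y Γ κ) m u) := by
  have hκ := F.large
  obtain ⟨P, a1, a2, a3, a4, a5⟩ := F.exists_between (p := p) (q := q) (k := 10000000) (by omega)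
  obtain ⟨Q, b1, b2, b3, b4, b5⟩ := F.exists_between (p := P) (q := q)
    (k := coneDist d Y κ P q - 10000000) (by omega)
  have b0 : d p Q + d Q q = d p q := by
    have := F.met.tri p P Q
    have := F.met.tri p Q q
    omega
  have hQ := F.cone_tri p Q q
  have hl : ∀ w, coneDist d Y κ p (w * p) ≤ 300300 → coneDist d Y κ q (w * q) ≤ 300300 →
      d P (w * P) ≤ 3100000000000 * κ ∧ d Q (w * Q) ≤ 3100000000000 * κ := fun w h1 h2 => by
    have h3 := F.deep_disp hB h1 h2 a1 (by omega) (by omega)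
    have h4 := F.deep_disp hB h1 h2 b0 (by omega) (by omega)
    constructor <;> omega
  have hPQ : 80000000000000000000 * κ ≤ d P Q := by
    by_contra! h
    have := F.cone_le (Y := Y) (x := P) (y := Q) (k := 80000000000000000000) (by omega) (by
      rw [mul_comm]
      exact h.le)
    omega
  obtain ⟨u1, u2⟩ := hl u hup huq
  obtain ⟨v1, v2⟩ := hl v hvp hvq
  obtain ⟨h1, h2⟩ := F.invMet.acyl_long A (by omega) u1 u2 v1 v2 (by omega)
  refine ⟨h1, h2.imp_right fun h => ?_⟩
  refine F.lox_no_cross hm1 hm2 hΘ hmem (p := P) (q := Q) (fun f => ?_) le_rfl u1 u2 hPQ h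
  have := hB f
  have := F.prDist_chain (a := f) (p := p) (q := q) (x := P) (y := Q) (c := 0) (by omega)
  omega

/-- A long tight geodesic of the cone-off crosses two different axes, or has a long subsegment
without crossings. -/
theorem cross_or_not {x y : G} (hxy : 1000000000000000000000 ≤ coneDist d Y κ x y) :
    (∃ a b, a ≠ b ∧ ∃ t v w t' v' w', Cross d Y κ a x y t v w ∧ Cross d Y κ b x y t' v' w' ∧
      10000000 * κ < prDist d Y a x y ∧ 10000000 * κ < prDist d Y b x y ∧ 1000000000 ≤ t ∧
      1000000000 ≤ t' ∧ t + 1000000000 ≤ coneDist d Y κ x y ∧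
      t' + 1000000000 ≤ coneDist d Y κ x y) ∨
    ∃ p q, coneDist d Y κ x p + coneDist d Y κ p q + coneDist d Y κ q y = coneDist d Y κ x y ∧
      100000000000000000000 ≤ coneDist d Y κ p q ∧
      ∀ f, prDist d Y f p q ≤ 10000200 * κ := by
  obtain ⟨f, f1, f2, f3⟩ := F.exists_cone_geodesic x y
  have seg : ∀ i j, i ≤ j → j ≤ coneDist d Y κ x y → coneDist d Y κ x (f i) = i ∧
      coneDist d Y κ (f i) (f j) = j - i ∧
      coneDist d Y κ (f j) y = coneDist d Y κ x y - j := fun i j h1 h2 => by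
    have h3 := f3 0 i (by omega) (by omega)
    have h4 := f3 j _ h2 le_rfl
    rw [f1] at h3
    rw [f2] at h4
    exact ⟨h3, f3 i j h1 h2, h4⟩
  obtain ⟨i1, i2, i3⟩ := seg 10000000000 100000000010000000000 (by omega) (by omega)
  obtain ⟨j1, j2, j3⟩ := seg 200000000000000000000 300000000000000000000 (by omega) (by omega)
  generalize f 10000000000 = p at *
  generalize f 100000000010000000000 = q at *
  generalize f 200000000000000000000 = p' at *
  generalize f 300000000000000000000 = q' at *
  by_cases h : ∀ f, prDist d Y f p q ≤ 10000200 * κ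
  · exact Or.inr ⟨p, q, by omega, by omega, h⟩
  by_cases h' : ∀ f, prDist d Y f p' q' ≤ 10000200 * κ
  · exact Or.inr ⟨p', q', by omega, by omega, h'⟩
  left
  push Not at h h'
  obtain ⟨a, ha⟩ := h
  obtain ⟨b, hb⟩ := h'
  obtain ⟨D, t, v, w, C, c1, c2, -⟩ := F.cross_between (a := a) (x := x) (y := y) (p := p) (q := q)
    (M := 10000000 * κ) (by omega) (by omega)
  obtain ⟨D', t', v', w', C', c1', c2', -⟩ := F.cross_between (a := b) (x := x) (y := y) (p := p')
    (q := q') (M := 10000000 * κ) (by omega) (by omega)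
  refine ⟨a, b, ?_, t, v, w, t', v', w', C, C', D, D', by omega, by omega, by omega, by omega⟩
  rintro rfl
  have := F.cross_time C C'
  omega

theorem quotDist_displ {h g x : G} (hh : h ∈ rot Γ) :
    quotDist d Y Γ κ (h * x) (g * (h * x)) = quotDist d Y Γ κ x (g * x) := by
  have e : g * (h * x) = (g * h * g⁻¹) * (g * x) := by group
  rw [e, F.quotDist_smul_right (F.rot_normal.conj_mem h hh g), F.quotDist_smul_left hh]

theorem tlox_quot {m : ℕ} {g u : G} (hg : g ∈ rot Γ) (h : TLox (quotDist d Y Γ κ) m (g * u)) :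
    TLox (quotDist d Y Γ κ) m u := fun k z => by
  have h1 := h k z
  obtain ⟨n, hn, e⟩ : ∃ n ∈ rot Γ, (g * u) ^ k = n * u ^ k := by
    clear h1
    induction k with
    | zero => exact ⟨1, one_mem _, by simp⟩
    | succ k ih =>
      obtain ⟨n, hn, e⟩ := ih
      refine ⟨n * (u ^ k * g * (u ^ k)⁻¹), mul_mem hn (F.rot_normal.conj_mem g hg _), ?_⟩
      rw [pow_succ, e, pow_succ]
      group
  rwa [e, mul_assoc, F.quotDist_smul_right hn] at h1

/-- Acylindricity of the quotient, modulo the kernel. -/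
theorem acyl_quot {L m : ℕ} (A : Acyl d L m) (hL : L ≤ κ) (hm1 : 5000000000 * κ ≤ m)
    (hm2 : m ≤ 10000000000 * κ) (hΘ : 100000000 * κ ≤ Θ)
    (hmem : ∀ u m', TLox d m' u → (∃ y, d y (u * y) ≤ 60000) → ∃ a : ι, u • a = a)
    (stab : ∀ a b : ι, a ≠ b → ∀ g : G, g • a = a → g • b = b → g = 1)
    {x y u v : G} (hxy : 1000000000000000000000 ≤ quotDist d Y Γ κ x y)
    (hux : quotDist d Y Γ κ x (u * x) ≤ 300000) (huy : quotDist d Y Γ κ y (u * y) ≤ 300000)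
    (hvx : quotDist d Y Γ κ x (v * x) ≤ 300000) (hvy : quotDist d Y Γ κ y (v * y) ≤ 300000) :
    u * v * u⁻¹ * v⁻¹ ∈ rot Γ ∧ (u ∈ rot Γ ∨ TLox (quotDist d Y Γ κ) m u) := by
  have hκ := F.large
  have hΘ' : 1000 * κ ≤ Θ := by omega
  have I := F.quot_invMet hΘ'
  obtain ⟨h, hh, e, ht⟩ := F.exists_tight (Γ := Γ) x y
  rw [← F.quotDist_smul_right hh x y] at hxy e
  rw [← F.quotDist_displ hh] at huy hvy
  generalize h * y = y at *
  rcases F.cross_or_not (x := x) (y := y) (by omega) with hex | ⟨p, q, h1, h2, h3⟩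
  · obtain ⟨r1, r2⟩ := F.acyl_two_cross stab (M := 10000000 * κ) (by omega) (by omega) e ht hex
      hux huy hvx hvy
    exact ⟨r1, r2.imp_right fun r => r.mono (by omega)⟩
  have c1 := quotDist_le_cone d Y Γ κ x p
  have c2 := quotDist_le_cone d Y Γ κ p q
  have c3 := quotDist_le_cone d Y Γ κ q y
  have c4 := F.quotDist_tri (Γ := Γ) x p y
  have c5 := F.quotDist_tri (Γ := Γ) p q y
  have c6 := F.quotDist_tri (Γ := Γ) x q y
  have c7 := F.quotDist_tri (Γ := Γ) x p q
  have hd : ∀ w, quotDist d Y Γ κ x (w * x) ≤ 300000 → quotDist d Y Γ κ y (w * y) ≤ 300000 →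
      ∃ g ∈ rot Γ, coneDist d Y κ p (g * w * p) ≤ 300300 ∧
        coneDist d Y κ q (g * w * q) ≤ 300300 := fun w wx wy => by
    have d1 := I.disp_between (c := 0) wx wy (z := p) (by omega)
    have d2 := I.disp_between (c := 0) wx wy (z := q) (by omega)
    obtain ⟨g, hg, g1, g2⟩ := F.exists_lift hΘ' (B := 10000200 * κ) (by omega) (by omega)
      (u := w) h3
    exact ⟨g, hg, by rw [mul_assoc]; omega, by rw [mul_assoc]; omega⟩
  obtain ⟨g, hg, g1, g2⟩ := hd u hux huy
  obtain ⟨k, hk, k1, k2⟩ := hd v hvx hvy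
  obtain ⟨r1, r2⟩ := F.acyl_no_cross A hL hm1 hm2 hΘ hmem h3 h2 g1 g2 k1 k2
  have N := F.rot_normal
  constructor
  · have hg' : (QuotientGroup.mk' (rot Γ)) g = 1 := (QuotientGroup.eq_one_iff g).2 hg
    have hk' : (QuotientGroup.mk' (rot Γ)) k = 1 := (QuotientGroup.eq_one_iff k).2 hk
    have r3 := congrArg (QuotientGroup.mk' (rot Γ)) r1
    simp only [map_mul, hg', hk', one_mul] at r3
    refine (QuotientGroup.eq_one_iff _).1 (?_ : QuotientGroup.mk' (rot Γ) _ = 1)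
    simp only [map_mul, map_inv, r3]
    group
  · rcases r2 with r2 | r2
    · left
      rw [mul_eq_one_iff_inv_eq] at r2
      rw [← r2]
      exact inv_mem hg
    · exact Or.inr (F.tlox_quot hg r2)

end Fam
end QuotAcyl

/-! ### The induction step -/

section Step

variable {G ι : Type*} [Group G] [MulAction G ι]

variable {d : G → G → ℕ} {Y : ι → Set G} {Γ : ι → Subgroup G} {κ Θ : ℕ}

/-- The metric induced on the quotient group. -/
noncomputable def quotMet (d : G → G → ℕ) (Y : ι → Set G) (Γ : ι → Subgroup G) (κ : ℕ)
    (x y : G ⧸ rot Γ) : ℕ := quotDist d Y Γ κ x.out y.out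

namespace Fam

variable (F : Fam d Y Γ κ Θ)
include F

theorem quotMet_mk (x y : G) : quotMet d Y Γ κ x y = quotDist d Y Γ κ x y := by
  have N := F.rot_normal
  have key : ∀ x : G, ∃ h ∈ rot Γ, (QuotientGroup.mk x : G ⧸ rot Γ).out = h * x := fun x => by
    obtain ⟨h, hh⟩ := QuotientGroup.mk_out_eq_mul (rot Γ) x
    exact ⟨x * h * x⁻¹, N.conj_mem _ h.2 x, by rw [hh]; group⟩
  obtain ⟨h, hh, e⟩ := key x
  obtain ⟨g, hg, e'⟩ := key y
  rw [quotMet, e, e', F.quotDist_smul_left hh, F.quotDist_smul_right hg]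

/-- Short elements of the kernel are trivial. -/
theorem eq_one_of_mem (hΘ : 1000 * κ ≤ Θ) {h : G} (hh : h ∈ rot Γ) (h1 : d 1 h ≤ 1) : h = 1 := by
  have hκ := F.large
  cases red_of_mem F hΘ hh 1 with
  | one => rfl
  | step a s _ hs hs1 hD hr =>
    have e1 := F.prDist_spin hs hs1 1
    have e2 := F.prDist_le a 1 h
    have e3 := F.prDist_tri a 1 h (s * 1)
    have e4 := F.prDist_symm a h (s * 1)
    rw [mul_one h] at hD
    omega

end Fam

/-- The induction step: adding relators and killing the powers of short elements. -/
theorem Stage.step {L m n : ℕ} {R : Set G} (S : Stage d L m n) (hR : Relators d κ Θ R)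
    (hκ : 10000000 ≤ κ) (hL : L ≤ κ) (hm1 : 5000000000 * κ ≤ m)
    (hm2 : m ≤ 10000000000 * κ) (hΘ : 100000000 * κ ≤ Θ) (hn : m * Θ ≤ n) :
    ∃ (N : Subgroup G) (_ : N.Normal) (d' : G ⧸ N → G ⧸ N → ℕ),
      Stage d' 1000000000000000000000 m n ∧
      (∀ (x y : G) (k : ℕ), 1 ≤ k → d x y ≤ κ * k → d' x y ≤ k) ∧
      (∀ u z : G, d z (u * z) ≤ 60000 → u ^ n ∈ N) ∧ R ⊆ N ∧ ∀ h ∈ N, d 1 h ≤ 1 → h = 1 := by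
  have I := S.toInvMet
  have hΘ' : 1000 * κ ≤ Θ := by omega
  have F := Mem.fam (hR := hR) (I := I) S hκ hL hn
  have J := F.quot_invMet hΘ'
  have N := F.rot_normal
  have hmk := F.quotMet_mk
  have hT : ∀ (m' : ℕ) (u : G), TLox (quotDist d (fun a : Mem d R hR I => a.axis)
      (fun a => a.kill n) κ) m' u →
      TLox (quotMet d (fun a : Mem d R hR I => a.axis) (fun a => a.kill n) κ) m'
        (QuotientGroup.mk u) := fun m' u h k z => by
    induction z using QuotientGroup.induction_on with
    | H z =>
      rw [← QuotientGroup.mk_pow, ← QuotientGroup.mk_mul, hmk]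
      exact h k z
  have hmem : ∀ u m', TLox d m' u → (∃ y, d y (u * y) ≤ 60000) →
      ∃ a : Mem d R hR I, u • a = a := fun u m' hu hy =>
    ⟨⟨_, u, m', hu, rfl, Or.inl hy⟩,
      Mem.smul_of_mem S _ (Subgroup.mem_centralizer_singleton_iff.mpr rfl)⟩
  have stab : ∀ a b : Mem d R hR I, a ≠ b → ∀ g : G, g • a = a → g • b = b → g = 1 := by
    intro a b hab g ha hb
    by_contra h1
    exact hab (Subtype.ext ((a.2.axial S).eq_of_mem (b.2.axial S) (a.mem_of_smul S ha)
      (b.mem_of_smul S hb) h1))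
  refine ⟨_, N, quotMet d (fun a : Mem d R hR I => a.axis) (fun a => a.kill n) κ,
    ⟨⟨⟨?_, ?_, ?_, ?_, ?_⟩, ?_⟩, ?_, S.pos, ?_, ?_, S.odd⟩, ?_, ?_, ?_, ?_⟩
  · intro x
    exact J.met.self _
  · intro x y
    exact J.met.symm _ _
  · intro x y z
    exact J.met.tri _ _ _
  · intro x y k hk
    induction x using QuotientGroup.induction_on with
    | H x =>
      induction y using QuotientGroup.induction_on with
      | H y =>
        rw [hmk] at hk ⊢
        obtain ⟨z, hz⟩ := J.met.geod x y k hk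
        exact ⟨z, by rwa [hmk, hmk]⟩
  · intro x y z t
    exact J.met.hyp _ _ _ _
  · intro g x y
    induction g using QuotientGroup.induction_on with
    | H g =>
      induction x using QuotientGroup.induction_on with
      | H x =>
        induction y using QuotientGroup.induction_on with
        | H y =>
          rw [← QuotientGroup.mk_mul, ← QuotientGroup.mk_mul, hmk, hmk]
          exact J.inv g x y
  · intro x y h
    obtain ⟨g, hg, e⟩ := F.quotDist_sep h
    rw [← QuotientGroup.out_eq' x, ← QuotientGroup.out_eq' y, e, QuotientGroup.mk_mul,
      (QuotientGroup.eq_one_iff g).2 hg, one_mul]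
  · intro u v x y h
    induction u using QuotientGroup.induction_on with
    | H u =>
    induction v using QuotientGroup.induction_on with
    | H v =>
    induction x using QuotientGroup.induction_on with
    | H x =>
    induction y using QuotientGroup.induction_on with
    | H y =>
      simp only [← QuotientGroup.mk_mul, hmk] at h ⊢
      intro h1 h2 h3 h4
      obtain ⟨r1, r2⟩ := F.acyl_quot S.acyl hL hm1 hm2 hΘ hmem stab h h1 h2 h3 h4
      · refine ⟨?_, r2.imp (fun r => (QuotientGroup.eq_one_iff u).2 r) fun r => hT m u r⟩
        have := (QuotientGroup.eq_one_iff _).2 r1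
        rw [mul_assoc, ← mul_inv_rev, QuotientGroup.mk_mul, QuotientGroup.mk_inv,
          mul_inv_eq_one] at this
        exact this
  · intro u
    induction u using QuotientGroup.induction_on with
    | H u =>
      rcases Mem.tors (hR := hR) (I := I) S hκ hL hn hΘ' u with h | ⟨m', h⟩
      · left
        rw [← QuotientGroup.mk_pow]
        exact (QuotientGroup.eq_one_iff _).2 h
      · exact Or.inr ⟨m', hT m' u h⟩
  · intro x y k hk h
    rw [hmk]
    exact (quotDist_le_cone _ _ _ _ _ _).trans (F.cone_le hk h)
  · intro u z hz
    rcases S.tors u with h | ⟨m', h⟩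
    · rw [h]
      exact one_mem _
    · exact mem_rot (Mem.pow_mem_kill (⟨_, u, m', h, rfl, Or.inl ⟨z, hz⟩⟩ : Mem d R hR I)
        (Subgroup.mem_centralizer_singleton_iff.mpr rfl))
  · intro r hr
    obtain ⟨m', h⟩ := hR.lox r hr
    let a : Mem d R hR I := ⟨_, r, m', h, rfl, Or.inr hr⟩
    refine mem_rot (a := a) ?_
    unfold Mem.kill
    rw [if_pos ⟨r, hr, rfl⟩]
    exact Subgroup.mem_centralizer_singleton_iff.mpr rfl
  · exact fun h hh h1 => F.eq_one_of_mem hΘ' hh h1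

end Step

/-! ### Iteration -/

section Iterate

universe u

/-- A quotient of `G` which satisfies the conditions of the induction. -/
structure Level (G : Type u) [Group G] (κ m n : ℕ) where
  carrier : Type u
  [grp : Group carrier]
  map : G →* carrier
  surj : Function.Surjective map
  dist : carrier → carrier → ℕ
  bound : ℕ
  le : bound ≤ κ
  stage : Stage dist bound m n

attribute [instance] Level.grp

variable {G : Type u} [Group G] {κ Θ m n : ℕ}

/-- The properties of successive levels. -/
structure Level.Next (A B : Level G κ m n) : Prop where
  ker : ∀ g, A.map g = 1 → B.map g = 1
  shrink : ∀ g k, 1 ≤ k → A.dist 1 (A.map g) ≤ κ * k → B.dist 1 (B.map g) ≤ k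
  pow : ∀ g, A.dist 1 (A.map g) ≤ 60000 → B.map (g ^ n) = 1
  inj : ∀ g, A.dist 1 (A.map g) ≤ 1 → B.map g = 1 → A.map g = 1

theorem Level.exists_next (hκ : 1000000000000000000000 ≤ κ)
    (hm1 : 5000000000 * κ ≤ m) (hm2 : m ≤ 10000000000 * κ) (hΘ : 100000000 * κ ≤ Θ)
    (hn : m * Θ ≤ n) (A : Level G κ m n) {R : Set A.carrier} (hR : Relators A.dist κ Θ R) :
    ∃ B : Level G κ m n, A.Next B ∧ ∀ g, A.map g ∈ R → B.map g = 1 := by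
  obtain ⟨N, hN, d', S, h1, h2, h3, h4⟩ := A.stage.step hR (by omega) A.le hm1 hm2 hΘ hn
  refine ⟨⟨A.carrier ⧸ N, (QuotientGroup.mk' N).comp A.map,
    (QuotientGroup.mk'_surjective N).comp A.surj, d', _, hκ, S⟩, ⟨?_, ?_, ?_, ?_⟩, ?_⟩
  · intro g hg
    simp [hg]
  · intro g k hk h
    exact h1 1 _ k hk h
  · intro g h
    have := h2 (A.map g) 1 (by rwa [mul_one])
    rw [MonoidHom.comp_apply, map_pow]
    exact (QuotientGroup.eq_one_iff _).2 this
  · intro g h h'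
    exact h4 _ ((QuotientGroup.eq_one_iff _).1 h') h
  · intro g h
    exact (QuotientGroup.eq_one_iff _).2 (h3 h)

theorem relators_empty {d : G → G → ℕ} : Relators d κ Θ (∅ : Set G) :=
  ⟨fun _ h => h.elim, fun _ h => h.elim, fun _ h => h.elim, fun _ h => h.elim⟩

/-- A periodic quotient in which relators are trivial and short elements survive. -/
theorem Stage.exists_periodic {d : G → G → ℕ} {L : ℕ} {R : Set G} (S : Stage d L m n)
    (hR : Relators d κ Θ R) (hL : L ≤ κ) (hκ : 1000000000000000000000 ≤ κ)
    (hm1 : 5000000000 * κ ≤ m) (hm2 : m ≤ 10000000000 * κ) (hΘ : 100000000 * κ ≤ Θ)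
    (hn : m * Θ ≤ n) :
    ∃ N : Subgroup G, N.Normal ∧ (∀ g, g ^ n ∈ N) ∧ R ⊆ N ∧ ∀ g, d 1 g ≤ 1 → g ∈ N → g = 1 := by
  obtain ⟨A, hA, hAR⟩ := Level.exists_next hκ hm1 hm2 hΘ hn
    ⟨G, MonoidHom.id G, Function.surjective_id, d, L, hL, S⟩ hR
  have hstep : ∀ B : Level G κ m n, ∃ B' : Level G κ m n, B.Next B' := fun B => by
    obtain ⟨B', h, -⟩ := Level.exists_next hκ hm1 hm2 hΘ hn B relators_empty
    exact ⟨B', h⟩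
  choose next hnext using hstep
  obtain ⟨T, hT0, hT⟩ : ∃ T : ℕ → Level G κ m n, T 0 = A ∧ ∀ i, (T i).Next (T (i + 1)) :=
    ⟨fun i => next^[i] A, rfl, fun i => by
      simp only [Function.iterate_succ_apply']
      exact hnext _⟩
  have mono : ∀ i j, i ≤ j → ∀ g, (T i).map g = 1 → (T j).map g = 1 := by
    intro i j hij g hg
    induction j, hij using Nat.le_induction with
    | base => exact hg
    | succ j _ ih => exact (hT j).ker g ih
  refine ⟨⟨⟨⟨{g | ∃ i, (T i).map g = 1}, ?_⟩, ?_⟩, ?_⟩, ⟨?_⟩, ?_, ?_, ?_⟩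
  · rintro a b ⟨i, hi⟩ ⟨j, hj⟩
    refine ⟨max i j, ?_⟩
    rw [map_mul, mono i _ (le_max_left _ _) a hi, mono j _ (le_max_right _ _) b hj, one_mul]
  · exact ⟨0, map_one _⟩
  · rintro a ⟨i, hi⟩
    exact ⟨i, by rw [map_inv, hi, inv_one]⟩
  · rintro a ⟨i, hi⟩ g
    exact ⟨i, by rw [map_mul, map_mul, map_inv, hi, mul_one, mul_inv_cancel]⟩
  · intro g
    have key : ∀ D i, (T i).dist 1 ((T i).map g) ≤ D → ∃ j, (T j).map (g ^ n) = 1 := by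
      intro D
      induction D with
      | zero => exact fun i h => ⟨_, (hT i).pow g (by omega)⟩
      | succ D ih =>
        intro i h
        rcases Nat.eq_zero_or_pos D with rfl | hD
        · exact ⟨_, (hT i).pow g (by omega)⟩
        · refine ih (i + 1) ((hT i).shrink g D hD (h.trans ?_))
          have := Nat.mul_le_mul_right D hκ
          omega
    exact key _ 0 le_rfl
  · intro g hg
    exact ⟨0, hT0 ▸ hAR g hg⟩
  · rintro g hg ⟨i, hi⟩
    have short : ∀ i, (T i).dist 1 ((T i).map g) ≤ 1 := by
      intro i
      induction i with
      | zero =>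
        rw [hT0]
        exact hA.shrink g 1 le_rfl (hg.trans (by omega))
      | succ i ih => exact (hT i).shrink g 1 le_rfl (ih.trans (by omega))
    have h0 : (T 0).map g = 1 := by
      induction i with
      | zero => exact hi
      | succ i ih => exact ih ((hT i).inj g (short i) hi)
    rw [hT0] at h0
    exact hA.inj g hg h0

end Iterate

/-! ### Metrics in which interior points of intervals are cut points -/

/-- An invariant geodesic metric in which interior points of intervals are cut points. -/
structure CutMet {G : Type*} [Group G] (d : G → G → ℕ) : Prop where
  self : ∀ x, d x x = 0
  symm : ∀ x y, d x y = d y x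
  tri : ∀ x y z, d x z ≤ d x y + d y z
  geod : ∀ x y k, k ≤ d x y → ∃ z, d x z = k ∧ k + d z y = d x y
  sep : ∀ x y, d x y = 0 → x = y
  inv : ∀ g x y, d (g * x) (g * y) = d x y
  cut : ∀ x y z, d x z + d z y = d x y → z ≠ x → z ≠ y →
    ∀ w, d x z + d z w = d x w ∨ d w z + d z y = d w y

namespace CutMet

variable {G : Type*} [Group G] {d : G → G → ℕ}

theorem pos_of_ne (H : CutMet d) {x y : G} (h : x ≠ y) : 0 < d x y :=
  Nat.pos_of_ne_zero fun h' => h (H.sep _ _ h')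

theorem cut' (H : CutMet d) {x y z : G} (h : d x z + d z y = d x y) (w : G) :
    d x z + d z w = d x w ∨ d w z + d z y = d w y := by
  by_cases h1 : z = x
  · subst h1; left; have := H.self z; omega
  by_cases h2 : z = y
  · subst h2; right; have := H.self z; omega
  exact H.cut x y z h h1 h2 w

theorem dist_of (H : CutMet d) {x y z z' : G} (h : d x z + d z y = d x y)
    (h' : d x z' + d z' y = d x y) (hl : d x z ≤ d x z') : d z z' = d x z' - d x z := by
  have := H.symm z z'
  rcases H.cut' h z' with h1 | h1 <;> omega

theorem unique (H : CutMet d) {x y z z' : G} (h : d x z + d z y = d x y)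
    (h' : d x z' + d z' y = d x y) (hl : d x z = d x z') : z = z' :=
  H.sep _ _ (by rw [H.dist_of h h' hl.le, hl, Nat.sub_self])

theorem glue (H : CutMet d) {a b c e : G} (h : d a b + d b c = d a c)
    (h' : d b c + d c e = d b e) (hbc : b ≠ c) : d a c + d c e = d a e := by
  have := H.pos_of_ne hbc
  have := H.symm a b
  have := H.symm a c
  rcases H.cut' h' a with h1 | h1 <;> omega

theorem inter (H : CutMet d) {x y x' y' z : G} (h : d x z + d z y = d x y)
    (hx : d x x' < d x z) (hy : d y y' < d z y) : d x' z + d z y' = d x' y' := by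
  have h1 := H.symm z y
  have h2 := H.symm y' z
  have h3 := H.symm y' y
  rcases H.cut' h x' with h4 | h4
  · omega
  rcases H.cut' h4 y' with h5 | h5 <;> omega

theorem exists_proj (H : CutMet d) (x z y : G) : ∃ p, d x p + d p z = d x z ∧
    d x p + d p y = d x y ∧ d p y + d p z ≤ d y z + 2 := by
  obtain ⟨k, hk, hmax⟩ : ∃ k, (∃ p, d x p = k ∧ d x p + d p z = d x z ∧ d x p + d p y = d x y) ∧
      ∀ k', k < k' → ¬ ∃ p, d x p = k' ∧ d x p + d p z = d x z ∧ d x p + d p y = d x y := by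
    by_contra! hcon
    have h2 : ∀ N : ℕ, ∃ p, N ≤ d x p ∧ d x p + d p z = d x z ∧ d x p + d p y = d x y := by
      intro N
      induction N with
      | zero => exact ⟨x, by omega, by simp [H.self], by simp [H.self]⟩
      | succ N ih =>
        obtain ⟨p, hp, hp'⟩ := ih
        obtain ⟨k', hk', q, hq, hq'⟩ := hcon _ ⟨p, rfl, hp'⟩
        exact ⟨q, by omega, hq'⟩
    obtain ⟨p, hp, hp', -⟩ := h2 (d x z + 1)
    omega
  obtain ⟨p, hp, hp1, hp2⟩ := hk
  refine ⟨p, hp1, hp2, ?_⟩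
  have h0 := H.symm p y
  by_cases hz : d x p = d x z
  · have : p = z := H.sep _ _ (by omega)
    subst this
    have := H.self p
    omega
  obtain ⟨q, hq, hq'⟩ := H.geod x z (d x p + 1) (by omega)
  have h1 : d x q + d q z = d x z := by omega
  have h2 := H.dist_of hp1 h1 (by omega)
  rcases H.cut' h1 y with h3 | h3
  · exact absurd ⟨q, rfl, h1, h3⟩ (hmax _ (by omega))
  · have := H.tri y q p
    have := H.symm p q
    omega

theorem invMet (H : CutMet d) : InvMet d where
  met := by
    refine ⟨H.self, H.symm, H.tri, H.geod, fun x y z t => ?_⟩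
    obtain ⟨p, hp1, hp2, hp3⟩ := H.exists_proj x z y
    obtain ⟨q, hq1, hq2, hq3⟩ := H.exists_proj x z t
    have h0 := H.tri y p t
    have h1 := H.tri p q t
    have h2 := H.symm y p
    have h3 := H.symm z t
    have h4 := H.symm p q
    rcases le_total (d x p) (d x q) with h | h
    · have := H.dist_of hp1 hq1 h
      omega
    · have := H.dist_of hq1 hp1 h
      omega
  inv := H.inv

theorem shift (H : CutMet d) {x y u : G} {l : ℕ} (hx : d x (u * x) ≤ l) (hy : d y (u * y) ≤ l)
    (hD : 10 * l + 10 ≤ d x y) : ∃ β : ℤ, -l ≤ β ∧ β ≤ l ∧ ∀ z, d x z + d z y = d x y →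
      l < d x z → l < d z y → d x (u * z) + d (u * z) y = d x y ∧
        (d x (u * z) : ℤ) = d x z + β := by
  have h1 : ∀ z, d x z + d z y = d x y → l < d x z → l < d z y →
      d x (u * z) + d (u * z) y = d x y := by
    intro z hz hz1 hz2
    have e1 := H.inv u x z
    have e2 := H.inv u z y
    have e3 := H.inv u x y
    have e4 := H.symm (u * x) x
    have e5 := H.symm (u * y) y
    exact H.inter (x := u * x) (y := u * y) (x' := x) (y' := y) (z := u * z) (by omega) (by omega)
      (by omega)
  have h2 : ∀ z z', d x z + d z y = d x y → d x z' + d z' y = d x y → l < d x z → l < d z y →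
      l < d x z' → l < d z' y → d x z ≤ d x z' → d x (u * z) + (d x z' - d x z) = d x (u * z') ∨
        d x (u * z') + (d x z' - d x z) = d x (u * z) := by
    intro z z' hz hz' a1 a2 a3 a4 a5
    have e1 := H.inv u z z'
    have e2 := H.dist_of hz hz' a5
    have e5 := H.symm (u * z) (u * z')
    rcases le_total (d x (u * z)) (d x (u * z')) with e3 | e3
    · have e4 := H.dist_of (h1 z hz a1 a2) (h1 z' hz' a3 a4) e3
      omega
    · have e4 := H.dist_of (h1 z' hz' a3 a4) (h1 z hz a1 a2) e3
      omega
  have h3 : ∀ z, d x z ≤ d x (u * z) + l ∧ d x (u * z) ≤ d x z + l := by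
    intro z
    have e1 := H.inv u x z
    have e2 := H.tri (u * x) x (u * z)
    have e3 := H.tri x (u * x) (u * z)
    have e4 := H.symm (u * x) x
    omega
  obtain ⟨z₀, b1, b2⟩ := H.geod x y (l + 1) (by omega)
  obtain ⟨z₁, c1, c2⟩ := H.geod x y (4 * l + 4) (by omega)
  have k1 := h3 z₀
  have k2 := h3 z₁
  have k3 := h2 z₀ z₁ (by omega) (by omega) (by omega) (by omega) (by omega) (by omega) (by omega)
  refine ⟨d x (u * z₀) - d x z₀, by omega, by omega, fun z hz hz1 hz2 => ⟨h1 z hz hz1 hz2, ?_⟩⟩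
  have k4 := h2 z₀ z (by omega) (by omega) (by omega) (by omega) (by omega) (by omega) (by omega)
  rcases le_total (d x z) (d x z₁) with h | h
  · have k5 := h2 z z₁ (by omega) (by omega) (by omega) (by omega) (by omega) (by omega) h
    omega
  · have k5 := h2 z₁ z (by omega) (by omega) (by omega) (by omega) (by omega) (by omega) h
    omega

theorem tlox (H : CutMet d) {u z : G} {l : ℕ} (hl : 0 < l)
    (h : ∀ k ≤ 604, d z (u ^ k * z) = k * l) : TLox d 302 u := by
  have h1 := h 302 (by norm_num)
  have h2 := h (302 * 2) (by norm_num)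
  rw [pow_mul] at h2
  have h3 : TLox d 1 (u ^ 302) := H.invMet.tlox_of_step (y := z) (by omega)
  simpa using TLox.of_pow H.invMet h3

theorem acyl (H : CutMet d) {m : ℕ} (hm : 302 ≤ m) : Acyl d 10000000000 m := by
  intro u v x y hD hux huy hvx hvy
  obtain ⟨β, b1, b2, hβ⟩ := H.shift hux huy (by omega)
  obtain ⟨γ, c1, c2, hγ⟩ := H.shift hvx hvy (by omega)
  obtain ⟨z, hz, hz'⟩ := H.geod x y 5000000000 (by omega)
  have hz'' : d x z + d z y = d x y := by omega
  obtain ⟨p1, p2⟩ := hγ z hz'' (by omega) (by omega)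
  obtain ⟨p3, p4⟩ := hβ (v * z) p1 (by omega) (by omega)
  obtain ⟨q1, q2⟩ := hβ z hz'' (by omega) (by omega)
  obtain ⟨q3, q4⟩ := hγ (u * z) q1 (by omega) (by omega)
  refine ⟨?_, ?_⟩
  · have := H.unique p3 q3 (by omega)
    rw [← mul_assoc, ← mul_assoc] at this
    exact mul_right_cancel this
  by_cases h0 : β = 0
  · left
    have := H.unique q1 hz'' (by omega)
    simpa using this
  right
  have hk : ∀ k : ℕ, k ≤ 604 → d x (u ^ k * z) + d (u ^ k * z) y = d x y ∧
      (d x (u ^ k * z) : ℤ) = d x z + k * β := by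
    intro k
    induction k with
    | zero => intro _; simpa using hz''
    | succ k ih =>
      intro hk
      obtain ⟨i1, i2⟩ := ih (by omega)
      have hb : -(604 * 300000) ≤ (k : ℤ) * β ∧ (k : ℤ) * β ≤ 604 * 300000 := by
        have h1 : (k : ℤ) * β ≤ k * 300000 := mul_le_mul_of_nonneg_left b2 (by omega)
        have h2 : (k : ℤ) * (-300000) ≤ k * β := mul_le_mul_of_nonneg_left b1 (by omega)
        omega
      obtain ⟨j1, j2⟩ := hβ (u ^ k * z) i1 (by omega) (by omega)
      rw [← mul_assoc, ← pow_succ'] at j1 j2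
      refine ⟨j1, ?_⟩
      rw [j2, i2]
      push_cast
      ring
  obtain ⟨c, hc⟩ := β.eq_nat_or_neg
  refine TLox.mono hm (H.tlox (z := z) (l := c) (by omega) fun k hk' => ?_)
  obtain ⟨i1, i2⟩ := hk k hk'
  have h3 : ((k * c : ℕ) : ℤ) = k * c := by push_cast; rfl
  rcases hc with rfl | rfl
  · have := H.dist_of hz'' i1 (by omega)
    omega
  · rw [mul_neg] at i2
    have := H.dist_of i1 hz'' (by omega)
    rw [H.symm]
    omega

theorem tors (H : CutMet d) {n : ℕ} (hn : ∀ g, d 1 g ≤ 1 → g ^ n = 1) (u : G) :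
    u ^ n = 1 ∨ ∃ m', TLox d m' u := by
  obtain ⟨p, hp⟩ : ∃ p, ∀ q, d p (u * p) ≤ d q (u * q) := by
    obtain ⟨l, ⟨p, rfl⟩, hl⟩ := WellFounded.has_min (wellFounded_lt (α := ℕ))
      (Set.range fun p => d p (u * p)) ⟨_, 1, rfl⟩
    exact ⟨p, fun q => not_lt.1 (hl _ ⟨q, rfl⟩)⟩
  generalize hl : d p (u * p) = l at hp
  by_cases h1 : l ≤ 1
  · left
    have h2 := hn (p⁻¹ * (u * p)) (by
      have := H.inv p⁻¹ p (u * p)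
      rw [inv_mul_cancel] at this
      omega)
    have h3 : (p⁻¹ * u * p) ^ n = 1 := by rwa [← mul_assoc] at h2
    have := conj_pow (a := p⁻¹) (b := u) (i := n)
    rw [inv_inv, h3] at this
    have h4 : p * 1 * p⁻¹ = u ^ n := by rw [this]; group
    rw [← h4]; simp
  right
  obtain ⟨q, hq, hq'⟩ := H.geod p (u * p) 1 (by omega)
  have e1 := hp q
  have e2 := H.inv u p q
  have e3 := H.tri q (u * p) (u * q)
  have e4 := H.inv u q (u * p)
  have e5 := H.inv u p (u * p)
  have f1 : q ≠ u * p := by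
    rintro h
    rw [← h, hq] at hl
    omega
  have g1 : d p (u * p) + d (u * p) (u * q) = d p (u * q) :=
    H.glue (b := q) (by omega) (by omega) f1
  have f2 : u * p ≠ u * q := by
    intro h
    rw [← mul_left_cancel h, H.self] at hq
    omega
  have g2 : d p (u * q) + d (u * q) (u * (u * p)) = d p (u * (u * p)) :=
    H.glue (b := u * p) g1 (by omega) f2
  have g3 : d p (u * (u * p)) = 2 * l := by omega
  have f3 : ∀ k : ℕ, d (u ^ k * p) (u ^ (k + 1) * p) = l := by
    intro k
    rw [pow_succ, mul_assoc, H.inv, hl]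
  have f4 : ∀ k : ℕ, d (u ^ k * p) (u ^ (k + 2) * p) = 2 * l := by
    intro k
    rw [pow_add, mul_assoc, H.inv, pow_two, mul_assoc, g3]
  have g4 : ∀ k : ℕ, d p (u ^ k * p) = k * l ∧ d p (u ^ (k + 1) * p) = (k + 1) * l := by
    intro k
    induction k with
    | zero => simp [H.self, hl]
    | succ k ih =>
      refine ⟨by simpa using ih.2, ?_⟩
      have a1 := f3 k
      have a2 := f3 (k + 1)
      have a3 := f4 k
      have := H.glue (a := p) (b := u ^ k * p) (c := u ^ (k + 1) * p) (e := u ^ (k + 2) * p)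
        (by rw [ih.1, ih.2, f3]; ring) (by rw [f4, f3, f3]; ring) (by
          intro h
          rw [h, H.self] at a1
          omega)
      rw [ih.2, f3] at this
      rw [← this]
      ring
  exact ⟨_, H.tlox (z := p) (l := l) (by omega) fun k _ => (g4 k).1⟩

theorem stage (H : CutMet d) {n : ℕ} (hn : ∀ g, d 1 g ≤ 1 → g ^ n = 1) (ho : Odd n) {m : ℕ}
    (hm : 302 ≤ m) : Stage d 10000000000 m n where
  toInvMet := H.invMet
  sep := H.sep
  pos := by omega
  acyl := H.acyl hm
  tors := H.tors hn
  odd := ho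

end CutMet

/-! ### Free products -/

/-- A group generated by two subgroups, with a partition of its non-trivial elements according to
their first letters. -/
structure Split {G : Type*} [Group G] (P : G → Prop) (A B : Subgroup G) : Prop where
  gen : Subgroup.closure ((A : Set G) ∪ B) = ⊤
  memA : ∀ s ∈ A, s ≠ 1 → P s
  memB : ∀ s ∈ B, ¬ P s
  step : ∀ g s, s ∈ A ∨ s ∈ B → g ≠ 1 → g * s ≠ 1 → (P (g * s) ↔ P g)

section Split

variable {G : Type*} [Group G] {P : G → Prop} {A B : Subgroup G}

/-- Adjacency in the Cayley graph of a group generated by two subgroups. -/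
def wordAdj (A B : Subgroup G) (x y : G) : Prop := x⁻¹ * y ∈ A ∨ x⁻¹ * y ∈ B

/-- The word metric of a group generated by two subgroups. -/
noncomputable def wordMet (A B : Subgroup G) : G → G → ℕ := graphDist (wordAdj A B)

theorem Walk.wordAdj_mul {n : ℕ} {x y : G} (h : Walk (wordAdj A B) Set.univ n x y) (g : G) :
    Walk (wordAdj A B) Set.univ n (g * x) (g * y) := by
  induction n generalizing y with
  | zero => exact ⟨by rw [h.1], trivial⟩
  | succ n ih =>
    obtain ⟨w, h1, h2, -⟩ := h
    refine ⟨g * w, ih h1, ?_, trivial⟩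
    have : (g * w)⁻¹ * (g * y) = w⁻¹ * y := by group
    rwa [wordAdj, this]

namespace Split

theorem isGraph (H : Split P A B) : IsGraph (wordAdj A B) where
  refl x := Or.inl (by simp [A.one_mem])
  symm x y h := by
    have : y⁻¹ * x = (x⁻¹ * y)⁻¹ := by group
    rw [wordAdj, this]
    exact h.imp A.inv_mem B.inv_mem
  conn := by
    have h1 : ∀ g : G, ∃ n, Walk (wordAdj A B) Set.univ n 1 g := by
      intro g
      have hg : g ∈ Subgroup.closure ((A : Set G) ∪ B) := by rw [H.gen]; trivial
      induction hg using Subgroup.closure_induction_right with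
      | one => exact ⟨0, rfl, trivial⟩
      | mul_right x y _ hy ih =>
        obtain ⟨n, hn⟩ := ih
        exact ⟨n + 1, x, hn, by simpa [wordAdj] using hy, trivial⟩
      | mul_inv_cancel x y _ hy ih =>
        obtain ⟨n, hn⟩ := ih
        exact ⟨n + 1, x, hn, by simpa [wordAdj] using hy, trivial⟩
    intro x y
    obtain ⟨n, hn⟩ := h1 (x⁻¹ * y)
    have := hn.wordAdj_mul x
    exact ⟨n, by simpa using this⟩

theorem inv (H : Split P A B) (g x y : G) : wordMet A B (g * x) (g * y) = wordMet A B x y := by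
  have h1 : ∀ g x y : G, wordMet A B (g * x) (g * y) ≤ wordMet A B x y := fun g x y =>
    IsGraph.le_of_walk ((H.isGraph.walk x y).wordAdj_mul g)
  refine le_antisymm (h1 g x y) ?_
  have := h1 g⁻¹ (g * x) (g * y)
  simpa using this

theorem mem_of_le (H : Split P A B) {g : G} (h : wordMet A B 1 g ≤ 1) : g ∈ A ∨ g ∈ B := by
  have := H.isGraph.adj h
  simpa [wordAdj] using this

theorem side (H : Split P A B) {x y : G} (hy : y ≠ 1) (hxy : ¬ (P x ↔ P y)) :
    wordMet A B x 1 + wordMet A B 1 y ≤ wordMet A B x y := by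
  have key : ∀ n y, y ≠ 1 → ¬ (P x ↔ P y) → Walk (wordAdj A B) Set.univ n x y →
      wordMet A B x 1 + wordMet A B 1 y ≤ n := by
    intro n
    induction n with
    | zero =>
      intro y _ h h'
      exact absurd (by rw [h'.1]) h
    | succ n ih =>
      rintro y hy h ⟨w, h1, h2, -⟩
      by_cases hw : w = 1
      · subst hw
        have e1 : wordMet A B x 1 ≤ n := IsGraph.le_of_walk h1
        have e2 : wordMet A B 1 y ≤ 1 := IsGraph.dist_le_one h2
        omega
      · have e1 := H.step w (w⁻¹ * y) h2 hw (by simpa using hy)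
        rw [mul_inv_cancel_left] at e1
        have e2 := ih w hw (by rwa [← e1]) h1
        have e3 : wordMet A B 1 y ≤ wordMet A B 1 w + wordMet A B w y :=
          H.isGraph.dist_tri 1 w y
        have e4 : wordMet A B w y ≤ 1 := IsGraph.dist_le_one h2
        omega
  exact key _ y hy hxy (H.isGraph.walk x y)

theorem first (H : Split P A B) {x : G} (hx : x ≠ 1) :
    ∃ s, wordMet A B s x + 1 = wordMet A B 1 x ∧ (P x → s ∈ A) ∧ (¬ P x → s ∈ B) := by
  have h0 : wordMet A B 1 x ≠ 0 := fun h => hx (H.isGraph.dist_sep h).symm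
  obtain ⟨s, h1, h2⟩ := H.isGraph.dist_geod 1 x 1 (Nat.pos_of_ne_zero h0)
  change wordMet A B 1 s = 1 at h1
  change 1 + wordMet A B s x = wordMet A B 1 x at h2
  have hs : s ≠ 1 := by
    rintro rfl
    omega
  have h3 : P s ↔ P x := by
    by_contra h
    have e1 := H.side hx h
    have e2 : wordMet A B s 1 = wordMet A B 1 s := H.isGraph.dist_symm s 1
    omega
  refine ⟨s, by omega, fun h => ?_, fun h => ?_⟩
  · exact (H.mem_of_le h1.le).resolve_right fun h' => H.memB s h' (h3.2 h)
  · exact (H.mem_of_le h1.le).resolve_left fun h' => h (h3.1 (H.memA s h' hs))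

theorem cutMet (H : Split P A B) : CutMet (wordMet A B) where
  self _ := IsGraph.dist_self _
  symm := H.isGraph.dist_symm
  tri := H.isGraph.dist_tri
  geod := H.isGraph.dist_geod
  sep _ _ := H.isGraph.dist_sep
  inv := H.inv
  cut := by
    have main : ∀ x y : G, wordMet A B x 1 + wordMet A B 1 y = wordMet A B x y → 1 ≠ x → 1 ≠ y →
        ∀ w, wordMet A B x 1 + wordMet A B 1 w = wordMet A B x w ∨
          wordMet A B w 1 + wordMet A B 1 y = wordMet A B w y := by
      intro x y h hx hy w
      have hxy : ¬ (P x ↔ P y) := by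
        intro hP
        obtain ⟨s, s1, s2, s3⟩ := H.first hx.symm
        obtain ⟨t, t1, t2, t3⟩ := H.first hy.symm
        have h1 : wordMet A B s t ≤ 1 := by
          refine IsGraph.dist_le_one ?_
          by_cases h2 : P x
          · exact Or.inl (A.mul_mem (A.inv_mem (s2 h2)) (t2 (hP.1 h2)))
          · exact Or.inr (B.mul_mem (B.inv_mem (s3 h2)) (t3 fun h => h2 (hP.2 h)))
        have e1 : wordMet A B x y ≤ wordMet A B x s + wordMet A B s y := H.isGraph.dist_tri _ _ _
        have e2 : wordMet A B s y ≤ wordMet A B s t + wordMet A B t y := H.isGraph.dist_tri _ _ _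
        have e3 : wordMet A B x s = wordMet A B s x := H.isGraph.dist_symm _ _
        have e4 : wordMet A B x 1 = wordMet A B 1 x := H.isGraph.dist_symm _ _
        omega
      by_cases hw : w = 1
      · subst hw
        left
        have e1 : wordMet A B 1 1 = 0 := IsGraph.dist_self _
        omega
      by_cases h1 : P x ↔ P w
      · right
        exact le_antisymm (H.side hy.symm fun h2 => hxy (h1.trans h2))
          (H.isGraph.dist_tri _ _ _)
      · left
        exact le_antisymm (H.side hw h1) (H.isGraph.dist_tri _ _ _)
    intro x y z h hx hy w
    have h1 := main (z⁻¹ * x) (z⁻¹ * y) (by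
      have e1 := H.inv z (z⁻¹ * x) 1
      have e2 := H.inv z 1 (z⁻¹ * y)
      have e3 := H.inv z (z⁻¹ * x) (z⁻¹ * y)
      simp only [mul_inv_cancel_left, mul_one] at e1 e2 e3
      omega) (fun h => hx (by simpa using congrArg (z * ·) h))
      (fun h => hy (by simpa using congrArg (z * ·) h)) (z⁻¹ * w)
    have e1 : ∀ u, wordMet A B (z⁻¹ * u) 1 = wordMet A B u z := fun u => by
      rw [← H.inv z (z⁻¹ * u) 1, mul_inv_cancel_left, mul_one]
    have e2 : ∀ u, wordMet A B 1 (z⁻¹ * u) = wordMet A B z u := fun u => by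
      rw [← H.inv z 1 (z⁻¹ * u), mul_inv_cancel_left, mul_one]
    simpa only [e1, e2, H.inv] using h1

theorem inter_trivial (H : Split P A B) {s : G} (hA : s ∈ A) (hB : s ∈ B) : s = 1 := by
  by_contra h
  exact H.memB s hB (H.memA s hA h)

theorem dist_letter (H : Split P A B) {s : G} (hs : s ∈ A ∨ s ∈ B) (h1 : s ≠ 1) (x : G) :
    wordMet A B x (x * s) = 1 := by
  have h2 : wordMet A B x (x * s) ≤ 1 := IsGraph.dist_le_one (by simpa [wordAdj] using hs)
  have h3 := H.cutMet.pos_of_ne (x := x) (y := x * s) (by simpa using h1)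
  omega

theorem dist_two (H : Split P A B) {s t : G} (hs : s ≠ 1) (ht : t ≠ 1)
    (h : s ∈ A ∧ t ∈ B ∨ s ∈ B ∧ t ∈ A) (x : G) : wordMet A B x (x * s * t) = 2 := by
  have h1 := H.dist_letter (h.imp And.left And.left) hs x
  have h2 := H.dist_letter (h.symm.imp And.right And.right) ht (x * s)
  have h3 := H.cutMet.tri x (x * s) (x * s * t)
  have h4 : ¬ wordMet A B x (x * s * t) ≤ 1 := by
    intro h5
    have h6 := H.cutMet.inv x 1 (s * t)
    rw [mul_one, ← mul_assoc] at h6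
    rcases H.mem_of_le (h6 ▸ h5) with h7 | h7 <;> rcases h with ⟨a, b⟩ | ⟨a, b⟩
    · exact ht (H.inter_trivial ((A.mul_mem_cancel_left a).1 h7) b)
    · exact hs (H.inter_trivial ((A.mul_mem_cancel_right b).1 h7) a)
    · exact hs (H.inter_trivial a ((B.mul_mem_cancel_right b).1 h7))
    · exact ht (H.inter_trivial b ((B.mul_mem_cancel_left a).1 h7))
  omega

end Split

end Split

section CoprodI

open Monoid.CoprodI

variable {M : Bool → Type*} [∀ i, Group (M i)]

/-- The index of the last letter of a word. -/
def lastIdx (w : Word M) : Option Bool := w.toList.getLast?.map Sigma.fst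

theorem lastIdx_rcons {i : Bool} (p : Word.Pair M i) (h : Word.rcons p ≠ Word.empty) :
    lastIdx (Word.rcons p) = if p.tail = Word.empty then some i else lastIdx p.tail := by
  rw [Word.rcons] at h ⊢
  split_ifs with h1 h2 h2
  · simp [h1, h2] at h
  · rfl
  · simp [lastIdx, Word.cons, h2, Word.empty]
  · have : p.tail.toList ≠ [] := fun h3 => h2 (Word.ext h3)
    simp [lastIdx, Word.cons, List.getLast?_cons, List.getLast?_eq_some_getLast this]

theorem lastIdx_smul {i : Bool} (m : M i) (w : Word M) (hw : w ≠ Word.empty)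
    (hm : (of m : Monoid.CoprodI M) • w ≠ Word.empty) :
    lastIdx ((of m : Monoid.CoprodI M) • w) = lastIdx w := by
  have h1 : w = Word.rcons (Word.equivPair i w) := by
    rw [← Word.equivPair_symm, Equiv.symm_apply_apply]
  rw [Word.of_smul_def] at hm ⊢
  rw [lastIdx_rcons _ hm]
  rw [h1] at hw
  conv_rhs => rw [h1, lastIdx_rcons _ hw]

theorem lastIdx_letter {i : Bool} {s : M i} (hs : s ≠ 1) :
    lastIdx ((of s : Monoid.CoprodI M)⁻¹ • (Word.empty : Word M)) = some i := by
  have h1 : (of s : Monoid.CoprodI M)⁻¹ • (Word.empty : Word M) ≠ Word.empty := by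
    intro h
    have := congrArg Word.prod h
    rw [Word.prod_smul, Word.prod_empty, mul_one, inv_eq_one] at this
    exact hs (of_injective i (this.trans (map_one _).symm))
  rw [← map_inv] at h1 ⊢
  rw [Word.of_smul_def] at h1 ⊢
  rw [lastIdx_rcons _ h1, Word.equivPair_eq_of_fstIdx_ne (by simp [Word.fstIdx, Word.empty])]
  simp

theorem split_coprodI : Split
    (fun g : Monoid.CoprodI M => lastIdx (g⁻¹ • (Word.empty : Word M)) = some true)
    (of : M true →* Monoid.CoprodI M).range (of : M false →* Monoid.CoprodI M).range where
  gen := by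
    refine (Subgroup.eq_top_iff' _).2 fun g => ?_
    induction g using induction_on with
    | one => exact Subgroup.one_mem _
    | of i s =>
      refine Subgroup.subset_closure ?_
      cases i
      · exact Or.inr ⟨s, rfl⟩
      · exact Or.inl ⟨s, rfl⟩
    | mul x y hx hy => exact Subgroup.mul_mem _ hx hy
  memA := by
    rintro _ ⟨s, rfl⟩ hs
    exact lastIdx_letter fun h => hs (by rw [h, map_one])
  memB := by
    rintro _ ⟨s, rfl⟩
    by_cases hs : s = 1
    · subst hs
      simp [lastIdx, Word.empty]
    · rw [lastIdx_letter hs]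
      simp
  step := by
    have h0 : ∀ g : Monoid.CoprodI M, g ≠ 1 → g⁻¹ • (Word.empty : Word M) ≠ Word.empty := by
      intro g hg h
      have := congrArg Word.prod h
      rw [Word.prod_smul] at this
      simp at this
      exact hg this
    rintro g _ hs hg hgs
    have key : ∀ i, ∀ s : M i, g * of s ≠ 1 → lastIdx ((g * of s)⁻¹ • (Word.empty : Word M)) =
        lastIdx (g⁻¹ • (Word.empty : Word M)) := by
      intro i s hgs
      have := h0 _ hgs
      rw [mul_inv_rev, mul_smul, ← map_inv] at this ⊢
      exact lastIdx_smul _ _ (h0 g hg) this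
    rcases hs with ⟨s, rfl⟩ | ⟨s, rfl⟩ <;> rw [key _ s hgs]

end CoprodI

/-! ### Long relators in a free product -/

/-- A letter in one factor of a free product and a sequence of letters in the other. -/
structure Alphabet {G : Type*} [Group G] (P : G → Prop) (A B : Subgroup G) (a : G) (c : ℕ → G)
    (J : ℕ) : Prop extends Split P A B where
  mem : a ∈ A
  pow : ∀ k, 0 < k → k ≤ 2 * J → a ^ k ≠ 1
  mem' : ∀ i, c i ∈ B
  ne_one : ∀ i, c i ≠ 1
  inj : ∀ i j, c i = c j → i = j
  large : 302 ≤ J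

section Alphabet

variable {G : Type*} [Group G] {P : G → Prop} {A B : Subgroup G} {a : G} {c : ℕ → G} {J : ℕ}

/-- The letters of the `i`th relator. -/
def letter (a : G) (c : ℕ → G) (J i t : ℕ) : G :=
  if t % 2 = 0 then a ^ (t / 2 % J + 1) else if t / 2 % J = J - 1 then (c (i + 1))⁻¹ else c i

/-- The prefixes of the powers of the `i`th relator. -/
def ray (a : G) (c : ℕ → G) (J i : ℕ) : ℕ → G
  | 0 => 1
  | t + 1 => ray a c J i t * letter a c J i t

/-- The `i`th relator. -/
def relator (a : G) (c : ℕ → G) (J i : ℕ) : G := ray a c J i (2 * J)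

/-- All conjugates of the relators. -/
def relators (a : G) (c : ℕ → G) (J : ℕ) : Set G := {r | ∃ g i, r = g * relator a c J i * g⁻¹}

theorem letter_period (a : G) (c : ℕ → G) (J i t : ℕ) :
    letter a c J i (2 * J + t) = letter a c J i t := by
  have h1 : (2 * J + t) % 2 = t % 2 := by omega
  have h2 : (2 * J + t) / 2 = J + t / 2 := by omega
  rw [letter, letter, h1, h2, Nat.add_mod_left]

theorem letter_congr (a : G) (c : ℕ → G) (i : ℕ) {s t : ℕ} (h : s ≡ t [MOD 2 * J]) :
    letter a c J i s = letter a c J i t := by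
  have h1 : ∀ q t, letter a c J i (2 * J * q + t) = letter a c J i t := by
    intro q t
    induction q with
    | zero => simp
    | succ q ih =>
      rw [show 2 * J * (q + 1) + t = 2 * J + (2 * J * q + t) by ring, letter_period, ih]
  rw [← Nat.div_add_mod s (2 * J), ← Nat.div_add_mod t (2 * J), h1, h1, h]

theorem ray_add (a : G) (c : ℕ → G) (J i q t : ℕ) :
    ray a c J i (2 * J * q + t) = relator a c J i ^ q * ray a c J i t := by
  have h1 : ∀ t, ray a c J i (2 * J + t) = relator a c J i * ray a c J i t := by
    intro t
    induction t with
    | zero => simp [ray, relator]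
    | succ t ih => rw [← add_assoc, ray, ih, letter_period, ray, mul_assoc]
  induction q with
  | zero => simp
  | succ q ih =>
    have : 2 * J * (q + 1) + t = 2 * J + (2 * J * q + t) := by ring
    rw [this, h1, ih, pow_succ', mul_assoc]

theorem ray_mul (a : G) (c : ℕ → G) (J i q : ℕ) :
    ray a c J i (2 * J * q) = relator a c J i ^ q := by
  have := ray_add a c J i q 0
  simpa [ray] using this

namespace Alphabet

theorem letter_spec (H : Alphabet P A B a c J) (i t : ℕ) : letter a c J i t ≠ 1 ∧
    (t % 2 = 0 ∧ letter a c J i t ∈ A ∨ t % 2 = 1 ∧ letter a c J i t ∈ B) := by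
  have := H.large
  have h0 := Nat.mod_lt (t / 2) (show 0 < J by omega)
  rw [letter]
  split_ifs with h1 h2
  · exact ⟨H.pow _ (by omega) (by omega), Or.inl ⟨h1, A.pow_mem H.mem _⟩⟩
  · exact ⟨by simpa using H.ne_one (i + 1), Or.inr ⟨by omega, B.inv_mem (H.mem' _)⟩⟩
  · exact ⟨H.ne_one i, Or.inr ⟨by omega, H.mem' _⟩⟩

theorem letter_mem (H : Alphabet P A B a c J) (i t : ℕ) :
    letter a c J i t ∈ A ∨ letter a c J i t ∈ B :=
  (H.letter_spec i t).2.imp And.right And.right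

theorem dist_ray (H : Alphabet P A B a c J) (i : ℕ) {s t : ℕ} (hst : s ≤ t) :
    wordMet A B (ray a c J i s) (ray a c J i t) = t - s := by
  have h1 : ∀ t, wordMet A B (ray a c J i t) (ray a c J i (t + 1)) = 1 := fun t =>
    H.dist_letter (H.letter_mem i t) (H.letter_spec i t).1 _
  have h2 : ∀ t, wordMet A B (ray a c J i t) (ray a c J i (t + 2)) = 2 := by
    intro t
    refine H.dist_two (H.letter_spec i t).1 (H.letter_spec i (t + 1)).1 ?_ _
    rcases (H.letter_spec i t).2 with h3 | h3 <;> rcases (H.letter_spec i (t + 1)).2 with h4 | h4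
    · omega
    · exact Or.inl ⟨h3.2, h4.2⟩
    · exact Or.inr ⟨h3.2, h4.2⟩
    · omega
  have h3 : ∀ k, wordMet A B (ray a c J i s) (ray a c J i (s + k)) = k ∧
      wordMet A B (ray a c J i s) (ray a c J i (s + k + 1)) = k + 1 := by
    intro k
    induction k with
    | zero => exact ⟨H.cutMet.self _, h1 s⟩
    | succ k ih =>
      refine ⟨ih.2, ?_⟩
      have e1 := h1 (s + k)
      have e2 : wordMet A B (ray a c J i (s + k + 1)) (ray a c J i (s + k + 2)) = 1 :=
        h1 (s + k + 1)
      have e3 := h2 (s + k)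
      have := H.cutMet.glue (a := ray a c J i s) (b := ray a c J i (s + k))
        (c := ray a c J i (s + k + 1)) (e := ray a c J i (s + k + 2)) (by omega) (by omega)
        (fun h => by rw [h, H.cutMet.self] at e1; omega)
      rw [show s + (k + 1) + 1 = s + k + 2 by omega]
      omega
  have := (h3 (t - s)).1
  rwa [Nat.add_sub_cancel' hst] at this

theorem dist_ray' (H : Alphabet P A B a c J) (g : G) (i : ℕ) {s t : ℕ} (hst : s ≤ t) :
    wordMet A B (g * ray a c J i s) (g * ray a c J i t) = t - s := by
  rw [H.inv, H.dist_ray i hst]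

/-- Intervals between points of a ray lie on the ray. -/
theorem on_ray (H : Alphabet P A B a c J) {g z : G} {i s t : ℕ}
    (hz : wordMet A B (g * ray a c J i s) z + wordMet A B z (g * ray a c J i t) =
      wordMet A B (g * ray a c J i s) (g * ray a c J i t)) : ∃ h, z = g * ray a c J i h := by
  have key : ∀ s t, s ≤ t → wordMet A B (g * ray a c J i s) z +
      wordMet A B z (g * ray a c J i t) =
      wordMet A B (g * ray a c J i s) (g * ray a c J i t) → ∃ h, z = g * ray a c J i h := by
    intro s t hst hz
    have h1 := H.dist_ray' g i hst
    have h2 := H.dist_ray' g i (s := s) (t := s + wordMet A B (g * ray a c J i s) z) (by omega)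
    have h3 := H.dist_ray' g i (s := s + wordMet A B (g * ray a c J i s) z) (t := t) (by omega)
    exact ⟨_, H.cutMet.unique (z' := g * ray a c J i (s + wordMet A B (g * ray a c J i s) z)) hz
      (by omega) (by omega)⟩
  rcases le_total s t with h | h
  · exact key s t h hz
  · refine key t s h ?_
    have h1 := H.cutMet.symm (g * ray a c J i s) z
    have h2 := H.cutMet.symm (g * ray a c J i t) z
    have h3 := H.cutMet.symm (g * ray a c J i s) (g * ray a c J i t)
    omega

theorem pow_inj (H : Alphabet P A B a c J) {k l : ℕ} (hk : k ≤ 2 * J) (hl : l ≤ 2 * J)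
    (h : a ^ k = a ^ l) : k = l := by
  have key : ∀ k l, k ≤ 2 * J → l ≤ 2 * J → a ^ k = a ^ l → ¬ k < l := by
    intro k l hk hl h hkl
    refine H.pow (l - k) (by omega) (by omega) ?_
    have h1 : a ^ k * a ^ (l - k) = a ^ k * 1 := by
      rw [← pow_add, Nat.add_sub_cancel' hkl.le, mul_one, h]
    exact mul_left_cancel h1
  have h1 := key k l hk hl h
  have h2 := key l k hl hk h.symm
  omega

theorem letter_parity (H : Alphabet P A B a c J) {i k s t : ℕ}
    (h : letter a c J i s = letter a c J k t ∨ letter a c J i s = (letter a c J k t)⁻¹) :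
    s % 2 = t % 2 := by
  obtain ⟨h1, h2⟩ := H.letter_spec i s
  obtain ⟨-, h3⟩ := H.letter_spec k t
  have hA : letter a c J i s ∈ A ↔ letter a c J k t ∈ A := by
    rcases h with h | h <;> rw [h]
    exact A.inv_mem_iff
  have hB : letter a c J i s ∈ B ↔ letter a c J k t ∈ B := by
    rcases h with h | h <;> rw [h]
    exact B.inv_mem_iff
  rcases h2 with ⟨h2, h4⟩ | ⟨h2, h4⟩ <;> rcases h3 with ⟨h3, h5⟩ | ⟨h3, h5⟩
  · omega
  · exact absurd (H.inter_trivial h4 (hB.2 h5)) h1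
  · exact absurd (H.inter_trivial (hA.2 h5) h4) h1
  · omega

theorem letter_ne_inv (H : Alphabet P A B a c J) {i k s t : ℕ} (hs : s % 2 = 0) :
    letter a c J i s ≠ (letter a c J k t)⁻¹ := by
  intro h
  have h1 := H.letter_parity (Or.inr h)
  have := H.large
  have h2 := Nat.mod_lt (s / 2) (show 0 < J by omega)
  have h3 := Nat.mod_lt (t / 2) (show 0 < J by omega)
  rw [letter, letter, if_pos hs, if_pos (by omega), eq_inv_iff_mul_eq_one, ← pow_add] at h
  exact H.pow _ (by omega) (by omega) h

theorem letter_even (H : Alphabet P A B a c J) {i k s t : ℕ} (hs : s % 2 = 0)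
    (h : letter a c J i s = letter a c J k t) : t % 2 = 0 ∧ s / 2 % J = t / 2 % J := by
  have h1 := H.letter_parity (Or.inl h)
  have := H.large
  have h2 := Nat.mod_lt (s / 2) (show 0 < J by omega)
  have h3 := Nat.mod_lt (t / 2) (show 0 < J by omega)
  rw [letter, letter, if_pos hs, if_pos (by omega)] at h
  have := H.pow_inj (by omega) (by omega) h
  omega

theorem ray_match (H : Alphabet P A B a c J) {g g' : G} {i k t : ℕ} {h : ℕ → ℕ}
    (hh : ∀ j ≤ 4, g * ray a c J i (t + j) = g' * ray a c J k (h j)) :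
    i = k ∧ ∃ q q' : ℕ, g * relator a c J i ^ q = g' * relator a c J i ^ q' := by
  have hd : ∀ j j', j ≤ j' → j' ≤ 4 → h j + (j' - j) = h j' ∨ h j' + (j' - j) = h j := by
    intro j j' hj hj'
    have h1 := H.dist_ray' g i (s := t + j) (t := t + j') (by omega)
    rw [hh j (by omega), hh j' hj'] at h1
    rcases le_total (h j) (h j') with h2 | h2
    · rw [H.dist_ray' g' k h2] at h1
      omega
    · rw [H.cutMet.symm, H.dist_ray' g' k h2] at h1
      omega
  have hl : ∀ j, j < 4 → (ray a c J k (h j))⁻¹ * ray a c J k (h (j + 1)) =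
      letter a c J i (t + j) := by
    intro j hj
    have h1 := hh j (by omega)
    have h2 := hh (j + 1) (by omega)
    have h3 : ray a c J k (h j) = g'⁻¹ * (g * ray a c J i (t + j)) := by rw [h1]; group
    have h4 : ray a c J k (h (j + 1)) = g'⁻¹ * (g * ray a c J i (t + (j + 1))) := by
      rw [h2]; group
    rw [h3, h4, ← add_assoc, ray]
    group
  have d01 := hd 0 1 (by omega) (by omega)
  have d12 := hd 1 2 (by omega) (by omega)
  have d23 := hd 2 3 (by omega) (by omega)
  have d34 := hd 3 4 (by omega) (by omega)
  have d02 := hd 0 2 (by omega) (by omega)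
  have d13 := hd 1 3 (by omega) (by omega)
  have d24 := hd 2 4 (by omega) (by omega)
  have hdec : ∀ j, j < 4 → h (j + 1) + 1 = h j → (t + j) % 2 ≠ 0 := by
    intro j hj h1 h2
    have h3 := hl j hj
    rw [← h1, ray] at h3
    refine H.letter_ne_inv h2 (i := i) (k := k) (t := h (j + 1)) ?_
    rw [← h3]
    group
  have hinc : ∀ j, j < 4 → h j + 1 = h (j + 1) → letter a c J i (t + j) = letter a c J k (h j) := by
    intro j hj h1
    rw [← hl j hj, ← h1, ray]
    group
  have hup : h 1 = h 0 + 1 ∧ h 2 = h 0 + 2 ∧ h 3 = h 0 + 3 ∧ h 4 = h 0 + 4 := by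
    have e0 := hdec 0 (by omega)
    have e1 := hdec 1 (by omega)
    norm_num at e0 e1
    rcases Nat.even_or_odd' t with ⟨b, rfl | rfl⟩ <;> omega
  have l0 : letter a c J i t = letter a c J k (h 0) := hinc 0 (by omega) hup.1.symm
  have l1 : letter a c J i (t + 1) = letter a c J k (h 0 + 1) :=
    hup.1 ▸ hinc 1 (by omega) (by change h 1 + 1 = h 2; omega)
  have l2 : letter a c J i (t + 2) = letter a c J k (h 0 + 2) :=
    hup.2.1 ▸ hinc 2 (by omega) (by change h 2 + 1 = h 3; omega)
  have l3 : letter a c J i (t + 3) = letter a c J k (h 0 + 3) :=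
    hup.2.2.1 ▸ hinc 3 (by omega) (by change h 3 + 1 = h 4; omega)
  have hJ := H.large
  have hmod : t ≡ h 0 [MOD 2 * J] := by
    rcases Nat.mod_two_eq_zero_or_one t with h1 | h1
    · obtain ⟨h2, h3⟩ := H.letter_even h1 l0
      rw [Nat.ModEq, Nat.mod_mul, Nat.mod_mul, h1, h2, h3]
    · obtain ⟨h2, h3⟩ := H.letter_even (by omega) l1
      refine Nat.ModEq.add_right_cancel' 1 ?_
      rw [Nat.ModEq, Nat.mod_mul, Nat.mod_mul, h2, h3]
      omega
  have hik : i = k := by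
    have key : ∀ j, letter a c J i (t + j) = letter a c J k (h 0 + j) → (t + j) % 2 = 1 →
        i ≠ k → (t + j) / 2 % J = J - 1 := by
      intro j h1 h2 h3
      by_contra h4
      have h5 : ¬ (t + j) % 2 = 0 := by omega
      rw [letter_congr a c k (hmod.symm.add_right j), letter, letter] at h1
      simp only [if_neg h4, if_neg h5] at h1
      exact h3 (H.inj _ _ h1)
    have key' : ∀ b, b % J = J - 1 → ¬ (b + 1) % J = J - 1 := by
      intro b h1
      rw [Nat.add_mod, h1, Nat.mod_eq_of_lt (show 1 < J by omega), Nat.sub_add_cancel (by omega),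
        Nat.mod_self]
      omega
    by_contra h1
    rcases Nat.mod_two_eq_zero_or_one t with h2 | h2
    · refine key' _ (key 1 l1 (by omega) h1) ?_
      have := key 3 l3 (by omega) h1
      rwa [show (t + 3) / 2 = (t + 1) / 2 + 1 by omega] at this
    · refine key' _ (key 0 l0 (by omega) h1) ?_
      have := key 2 l2 (by omega) h1
      rwa [show (t + 2) / 2 = (t + 0) / 2 + 1 by omega] at this
  subst hik
  refine ⟨rfl, t / (2 * J), h 0 / (2 * J), ?_⟩
  have h1 := hh 0 (by omega)
  rw [add_zero, ← Nat.div_add_mod t (2 * J), ← Nat.div_add_mod (h 0) (2 * J),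
    show t % (2 * J) = h 0 % (2 * J) from hmod, ray_add,
    ray_add, ← mul_assoc, ← mul_assoc] at h1
  exact mul_right_cancel h1

end Alphabet

end Alphabet

section Alphabet

variable {G : Type*} [Group G] {P : G → Prop} {A B : Subgroup G} {a : G} {c : ℕ → G} {J : ℕ}

namespace Alphabet

/-- Rays with close points at both ends of a long interval have a common axis. -/
theorem close_match (H : Alphabet P A B a c J) {g g' : G} {i k s t s' t' l : ℕ}
    (h1 : wordMet A B (g * ray a c J i s) (g' * ray a c J k s') ≤ l)
    (h2 : wordMet A B (g * ray a c J i t) (g' * ray a c J k t') ≤ l) (hD : s + 2 * l + 30 ≤ t) :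
    i = k ∧ ∃ q q' : ℕ, g * relator a c J i ^ q = g' * relator a c J i ^ q' := by
  have key : ∀ j, ∃ h, j ≤ 4 → g * ray a c J i (s + l + 1 + j) = g' * ray a c J k h := by
    intro j
    by_cases hj : j ≤ 4
    · have e1 := H.dist_ray' g i (s := s) (t := s + l + 1 + j) (by omega)
      have e2 := H.dist_ray' g i (s := s + l + 1 + j) (t := t) (by omega)
      have e3 := H.dist_ray' g i (s := s) (t := t) (by omega)
      have e4 := H.cutMet.symm (g * ray a c J i (s + l + 1 + j)) (g * ray a c J i t)
      obtain ⟨h, hh⟩ := H.on_ray (H.cutMet.inter (x := g * ray a c J i s) (y := g * ray a c J i t)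
        (x' := g' * ray a c J k s') (y' := g' * ray a c J k t')
        (z := g * ray a c J i (s + l + 1 + j)) (by omega) (by omega) (by omega))
      exact ⟨h, fun _ => hh⟩
    · exact ⟨0, fun h => absurd h hj⟩
  choose h hh using key
  exact H.ray_match hh

theorem conj_eq_of_match {g g' r : G} {q q' : ℕ} (h : g * r ^ q = g' * r ^ q') :
    g * r * g⁻¹ = g' * r * g'⁻¹ := by
  have h1 : g = g' * r ^ q' * (r ^ q)⁻¹ := by rw [← h]; group
  have h2 : r ^ q' * (r ^ q)⁻¹ * r = r * (r ^ q' * (r ^ q)⁻¹) :=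
    (((Commute.refl r).pow_left q').mul_left ((Commute.refl r).pow_left q).inv_left).eq
  calc g * r * g⁻¹ = g' * (r ^ q' * (r ^ q)⁻¹ * r) * (r ^ q' * (r ^ q)⁻¹)⁻¹ * g'⁻¹ := by
        rw [h1]; group
    _ = g' * r * g'⁻¹ := by rw [h2]; group

theorem relator_move (H : Alphabet P A B a c J) (i : ℕ) {j : ℕ} (hj : 0 < j) (z : G) :
    2 * J ≤ wordMet A B z (relator a c J i ^ j * z) := by
  by_contra hc
  have h1 := H.cutMet.invMet.dist_pow_le (relator a c J i ^ j) z (2 * wordMet A B 1 z + 1)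
  have h2 := H.dist_ray i (Nat.zero_le (2 * J * (j * (2 * wordMet A B 1 z + 1))))
  rw [ray_mul, pow_mul, ray] at h2
  generalize hN : (relator a c J i ^ j) ^ (2 * wordMet A B 1 z + 1) = v at h1 h2
  have h3 := H.cutMet.tri 1 z v
  have h4 := H.cutMet.tri z (v * z) v
  have h5 := H.inv v z 1
  have h6 := H.cutMet.symm z 1
  rw [mul_one] at h5
  generalize hM : 2 * wordMet A B 1 z + 1 = M at *
  have h7 : M * wordMet A B z (relator a c J i ^ j * z) + M ≤ M * (2 * J) := by
    rw [← Nat.mul_succ]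
    exact Nat.mul_le_mul_left _ (by omega)
  have h8 : M * (2 * J) ≤ 2 * J * (j * M) := by
    rw [Nat.mul_comm M]
    exact Nat.mul_le_mul_left _ (Nat.le_mul_of_pos_left _ hj)
  omega

theorem centralizer_move (H : Alphabet P A B a c J) (g : G) (i : ℕ) {w : G}
    (hw : w ∈ Subgroup.centralizer {g * relator a c J i * g⁻¹}) (h1 : w ≠ 1) (z : G) :
    2 * J ≤ wordMet A B z (w * z) := by
  have key : ∀ w z, Commute w (relator a c J i) → w ≠ 1 → 2 * J ≤ wordMet A B z (w * z) := by
    intro w z hw h1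
    obtain ⟨-, q, q', hq⟩ := H.close_match (g := 1) (g' := w) (i := i) (k := i) (s := 0) (s' := 0)
      (l := wordMet A B 1 w) (t := 2 * J * (2 * wordMet A B 1 w + 30))
      (t' := 2 * J * (2 * wordMet A B 1 w + 30)) (by simp [ray]) (by
        have h2 := H.inv (relator a c J i ^ (2 * wordMet A B 1 w + 30)) 1 w
        rw [mul_one] at h2
        rw [ray_mul, one_mul, (hw.pow_right _).eq]
        exact h2.le) (by
        have := H.large
        have h2 : 1 * (2 * wordMet A B 1 w + 30) ≤ 2 * J * (2 * wordMet A B 1 w + 30) :=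
          Nat.mul_le_mul_right _ (by omega)
        omega)
    rw [one_mul] at hq
    rcases lt_trichotomy q q' with h | rfl | h
    · obtain ⟨e, rfl⟩ := Nat.exists_eq_add_of_lt h
      have h2 : w⁻¹ = relator a c J i ^ (e + 1) := by
        rw [add_assoc, add_comm, pow_add, ← mul_assoc] at hq
        rw [eq_comm, ← mul_eq_one_iff_eq_inv, ((hw.symm.pow_left _).eq)]
        exact (right_eq_mul.1 hq)
      have h3 := H.relator_move i (Nat.succ_pos e) (w * z)
      rw [← h2, inv_mul_cancel_left] at h3
      rwa [H.cutMet.symm]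
    · exact absurd (right_eq_mul.1 hq) h1
    · obtain ⟨e, rfl⟩ := Nat.exists_eq_add_of_lt h
      rw [add_assoc, add_comm, pow_add] at hq
      rw [← mul_right_cancel hq]
      exact H.relator_move i (Nat.succ_pos e) z
  have h2 : Commute (g⁻¹ * w * g) (relator a c J i) := by
    have h3 := Subgroup.mem_centralizer_singleton_iff.1 hw
    have h4 : g⁻¹ * (w * (g * relator a c J i * g⁻¹)) * g =
      g⁻¹ * (g * relator a c J i * g⁻¹ * w) * g := by rw [h3]
    calc g⁻¹ * w * g * relator a c J i = g⁻¹ * (w * (g * relator a c J i * g⁻¹)) * g := by group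
      _ = _ := h4
      _ = _ := by group
  have h3 := key _ (g⁻¹ * z) h2 (by
    intro h
    apply h1
    calc w = g * (g⁻¹ * w * g) * g⁻¹ := by group
      _ = 1 := by rw [h]; group)
  have h4 := H.inv g⁻¹ z (w * z)
  have h5 : g⁻¹ * w * g * (g⁻¹ * z) = g⁻¹ * (w * z) := by group
  rw [h5] at h3
  omega

theorem relator_tlox (H : Alphabet P A B a c J) (g : G) (i : ℕ) :
    TLox (wordMet A B) 1 (g * relator a c J i * g⁻¹) := by
  refine TLox.conj H.cutMet.invMet (H.cutMet.invMet.tlox_of_step (y := 1) ?_) g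
  have h1 := H.dist_ray i (Nat.zero_le (2 * J * 1))
  have h2 := H.dist_ray i (Nat.zero_le (2 * J * 2))
  have := H.large
  rw [ray_mul, ray] at h1 h2
  rw [pow_one] at h1
  rw [mul_one, mul_one]
  omega

/-- Points of the axis of a relator are almost between far points of its ray. -/
theorem axis_near (H : Alphabet P A B a c J) {m : ℕ} {g : G} {i : ℕ}
    (hA : Axial (wordMet A B) m (Subgroup.centralizer {g * relator a c J i * g⁻¹})) {x : G}
    (hx : x ∈ axis (wordMet A B) (Subgroup.centralizer {g * relator a c J i * g⁻¹})) {N : ℕ}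
    (hN : wordMet A B x g < 2 * J * N) :
    wordMet A B (g * (relator a c J i ^ N)⁻¹) x + wordMet A B x (g * relator a c J i ^ N) ≤
      4 * J * N + 10500 := by
  generalize hr : relator a c J i = r at *
  have hd : ∀ q : ℕ, ∀ y, wordMet A B (y * r ^ q) y = 2 * J * q ∧
      wordMet A B y (y * r ^ q) = 2 * J * q := by
    intro q y
    have h1 := H.dist_ray i (Nat.zero_le (2 * J * q))
    rw [ray_mul, ray, hr] at h1
    have h2 := H.inv y 1 (r ^ q)
    have h3 := H.cutMet.symm y (y * r ^ q)
    rw [mul_one] at h2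
    omega
  have hp : ∀ q : ℕ, (g * r * g⁻¹) ^ q = g * r ^ q * g⁻¹ := fun q => conj_pow
  have key : ∀ q, wordMet A B x ((g * r * g⁻¹) ^ (N * (q + 3)) * x) =
      wordMet A B x (g * r ^ N) + 2 * J * (N * (q + 1)) + wordMet A B (g * (r ^ N)⁻¹) x := by
    intro q
    have e1 : (g * r * g⁻¹) ^ (N * (q + 3)) * g = g * r ^ (N * (q + 3)) := by
      rw [hp]; group
    have e2 : g * r ^ (N * (q + 3)) = g * r ^ N * r ^ (N * (q + 2)) := by
      rw [mul_assoc, ← pow_add]; ring_nf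
    have e3 : g * r ^ (N * (q + 3)) = g * r ^ N * r ^ (N * (q + 1)) * r ^ N := by
      rw [mul_assoc, mul_assoc, ← pow_add, ← pow_add]; ring_nf
    have e4 : (g * r * g⁻¹) ^ (N * (q + 3)) * (g * (r ^ N)⁻¹) =
        g * r ^ N * r ^ (N * (q + 1)) := by
      rw [← mul_assoc, e1, e3]; group
    have f1 := H.inv ((g * r * g⁻¹) ^ (N * (q + 3))) g x
    have f2 := H.inv ((g * r * g⁻¹) ^ (N * (q + 3))) (g * (r ^ N)⁻¹) x
    rw [e1] at f1
    rw [e4] at f2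
    have d1 := (hd N g).2
    have d2 := (hd (N * (q + 3)) g).2
    have d3 := (hd (N * (q + 2)) (g * r ^ N)).2
    rw [← e2] at d3
    have d4 := (hd (N * (q + 1)) (g * r ^ N)).2
    have d5 := (hd N (g * r ^ N * r ^ (N * (q + 1)))).1
    have d6 := (hd N (g * r ^ N * r ^ (N * (q + 1)))).2
    rw [← e3] at d5 d6
    have d7 := H.cutMet.tri g (g * r ^ N) (g * r ^ N * r ^ (N * (q + 1)))
    have d8 := H.cutMet.tri g (g * r ^ N * r ^ (N * (q + 1))) (g * r ^ (N * (q + 3)))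
    generalize g * r ^ (N * (q + 3)) = o' at *
    generalize g * r ^ N * r ^ (N * (q + 1)) = o₂ at *
    generalize g * r ^ N = o₁ at *
    generalize (g * r * g⁻¹) ^ (N * (q + 3)) * x = y at *
    have n1 : 2 * J * (N * (q + 3)) = 2 * J * (N * (q + 1)) + 2 * (2 * J * N) := by ring
    have n2 : 2 * J * (N * (q + 2)) = 2 * J * (N * (q + 1)) + 2 * J * N := by ring
    have n3 : 2 * J * (N * (q + 1)) = 2 * J * (N * q) + 2 * J * N := by ring
    rw [n1] at d2
    rw [n2] at d3
    rw [n3] at d2 d3 d4 ⊢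
    have s1 := H.cutMet.symm x g
    have s2 := H.cutMet.symm o₁ g
    have c1 := H.cutMet.inter (x := g) (y := o') (x' := x) (y' := o₂) (z := o₁)
      (by omega) (by omega) (by omega)
    have c2 := H.cutMet.inter (x := g) (y := o') (x' := x) (y' := y) (z := o₂)
      (by omega) (by omega) (by omega)
    omega
  have h1 := hA.axis_move H.cutMet.invMet hx (u := (g * r * g⁻¹) ^ (N * 3))
    (Subgroup.pow_mem _ (Subgroup.mem_centralizer_singleton_iff.2 rfl) _)
  rw [← pow_mul, Nat.mul_assoc] at h1
  have h2 := key 0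
  have h3 := key 3
  rw [show 0 + 3 = 3 from rfl] at h2
  rw [show 3 + 3 = 3 * 2 from rfl] at h3
  have e1 : 4 * J * N = 2 * (2 * J * N) := by ring
  have e2 : 2 * J * (N * (0 + 1)) = 2 * J * N := by ring
  have e3 : 2 * J * (N * (3 + 1)) = 4 * (2 * J * N) := by ring
  omega

end Alphabet

end Alphabet

section Alphabet

variable {G : Type*} [Group G] {P : G → Prop} {A B : Subgroup G} {a : G} {c : ℕ → G} {J : ℕ}

namespace Alphabet

theorem near_ray (H : Alphabet P A B a c J) {m : ℕ} {g : G} {i : ℕ}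
    (hA : Axial (wordMet A B) m (Subgroup.centralizer {g * relator a c J i * g⁻¹})) {x y p : G}
    (hx : x ∈ axis (wordMet A B) (Subgroup.centralizer {g * relator a c J i * g⁻¹}))
    (hy : y ∈ axis (wordMet A B) (Subgroup.centralizer {g * relator a c J i * g⁻¹}))
    (hp : wordMet A B x p + wordMet A B p y ≤ wordMet A B x y + 100000) {N : ℕ}
    (hNx : wordMet A B x g < 2 * J * N) (hNy : wordMet A B y g < 2 * J * N) :
    ∃ t, wordMet A B p (g * (relator a c J i ^ N)⁻¹ * ray a c J i t) ≤ 121600 := by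
  have hM := H.cutMet.invMet.met
  have h1 := H.axis_near hA hx hNx
  have h2 := H.axis_near hA hy hNy
  have h0 := H.dist_ray' (g * (relator a c J i ^ N)⁻¹) i (Nat.zero_le (2 * J * (N * 2)))
  have e0 : g * (relator a c J i ^ N)⁻¹ * ray a c J i 0 = g * (relator a c J i ^ N)⁻¹ := by
    simp [ray]
  have e1 : g * (relator a c J i ^ N)⁻¹ * ray a c J i (2 * J * (N * 2)) =
      g * relator a c J i ^ N := by
    rw [ray_mul, pow_mul, pow_two]; group
  have e2 : 2 * J * (N * 2) = 4 * J * N := by ring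
  have e3 : wordMet A B (g * (relator a c J i ^ N)⁻¹) p +
      wordMet A B p (g * relator a c J i ^ N) ≤ wordMet A B (g * (relator a c J i ^ N)⁻¹)
        (g * relator a c J i ^ N) + 121300 := by
    rw [e0, e1] at h0
    generalize g * (relator a c J i ^ N)⁻¹ = o at *
    generalize g * relator a c J i ^ N = o' at *
    have t1 := H.cutMet.tri o x p
    have t2 := H.cutMet.tri p y o'
    have t3 := H.cutMet.tri o y p
    have t4 := H.cutMet.tri p x o'
    have s1 := H.cutMet.symm x y
    have s2 := H.cutMet.symm x p
    have s3 := H.cutMet.symm y p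
    rcases le_total (wordMet A B o x) (wordMet A B o y) with h | h
    · have := hM.order_left (p := o) (q := o') (x := x) (z := y) (c₁ := 10500) (c₂ := 10500)
        (by omega) (by omega) h
      omega
    · have := hM.order_left (p := o) (q := o') (x := y) (z := x) (c₁ := 10500) (c₂ := 10500)
        (by omega) (by omega) h
      omega
  obtain ⟨v, hv, hv'⟩ := hM.near_interval e3
  obtain ⟨t, rfl⟩ := H.on_ray (g := g * (relator a c J i ^ N)⁻¹) (z := v) (i := i) (s := 0)
    (t := 2 * J * (N * 2)) (by rw [e0, e1, hv])
  exact ⟨t, hv'⟩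

theorem near_match (H : Alphabet P A B a c J) {g g' p q : G} {i k s t s' t' l l' : ℕ}
    (h1 : wordMet A B p (g * ray a c J i s) ≤ l) (h2 : wordMet A B q (g * ray a c J i t) ≤ l)
    (h3 : wordMet A B p (g' * ray a c J k s') ≤ l') (h4 : wordMet A B q (g' * ray a c J k t') ≤ l')
    (hD : 4 * l + 2 * l' + 30 ≤ wordMet A B p q) :
    i = k ∧ g * relator a c J i * g⁻¹ = g' * relator a c J i * g'⁻¹ := by
  have s1 := H.cutMet.symm p (g * ray a c J i s)
  have s2 := H.cutMet.symm q (g * ray a c J i t)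
  have s3 := H.cutMet.symm (g * ray a c J i s) (g * ray a c J i t)
  have t1 := H.cutMet.tri (g * ray a c J i s) p (g' * ray a c J k s')
  have t2 := H.cutMet.tri (g * ray a c J i t) q (g' * ray a c J k t')
  have t3 := H.cutMet.tri p (g * ray a c J i s) q
  have t4 := H.cutMet.tri (g * ray a c J i s) (g * ray a c J i t) q
  rcases le_total s t with h | h
  · have h5 := H.dist_ray' g i h
    obtain ⟨h6, a, b, h7⟩ := H.close_match (g := g) (g' := g') (i := i) (k := k) (s := s)
      (s' := s') (t := t) (t' := t') (l := l + l') (by omega) (by omega) (by omega)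
    exact ⟨h6, conj_eq_of_match h7⟩
  · have h5 := H.dist_ray' g i h
    obtain ⟨h6, a, b, h7⟩ := H.close_match (g := g) (g' := g') (i := i) (k := k) (s := t)
      (s' := t') (t := s) (t' := s') (l := l + l') (by omega) (by omega) (by omega)
    exact ⟨h6, conj_eq_of_match h7⟩

theorem conj_shift (g r : G) (N : ℕ) :
    g * (r ^ N)⁻¹ * r * (g * (r ^ N)⁻¹)⁻¹ = g * r * g⁻¹ := by
  refine conj_eq_of_match (q := N) (q' := 0) ?_
  rw [inv_mul_cancel_right, pow_zero, mul_one]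

theorem relators (H : Alphabet P A B a c J) {L m n κ : ℕ} (S : Stage (wordMet A B) L m n)
    (hκ : 2000000 ≤ κ) : Relators (wordMet A B) κ (2 * J) (relators a c J) where
  conj := by
    rintro _ ⟨h, i, rfl⟩ g
    exact ⟨g * h, i, by group⟩
  lox := by
    rintro _ ⟨h, i, rfl⟩
    exact ⟨_, H.relator_tlox h i⟩
  big := by
    rintro _ ⟨h, i, rfl⟩ w hw h1 z
    exact H.centralizer_move h i hw h1 z
  overlap := by
    rintro _ ⟨g, i, rfl⟩ E ⟨u, m', hu, rfl, hc⟩ hne p q x hx y hy x' hx' y' hy' hpx hqx hpx' hqx'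
    by_contra hcon
    have I := S.toInvMet
    have hA := S.axial_centralizer (H.relator_tlox g i)
    have hE := S.axial_centralizer hu
    have hJ := H.large
    have hmul : ∀ N, N ≤ 2 * J * N := fun N => Nat.le_mul_of_pos_left _ (by omega)
    obtain ⟨N, hN1, hN2⟩ : ∃ N, wordMet A B x' g < 2 * J * N ∧ wordMet A B y' g < 2 * J * N := by
      have := hmul (wordMet A B x' g + wordMet A B y' g + 1)
      exact ⟨wordMet A B x' g + wordMet A B y' g + 1, by omega, by omega⟩
    obtain ⟨s, hs⟩ := H.near_ray hA hx' hy' hpx' hN1 hN2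
    obtain ⟨t, ht⟩ := H.near_ray hA hx' hy' hqx' hN1 hN2
    rcases hc with ⟨o, ho⟩ | ⟨h, k, rfl⟩
    · have hself : u ∈ Subgroup.centralizer {u} := Subgroup.mem_centralizer_singleton_iff.2 rfl
      have b1 := hE.axis_short I hx hself ho
      have b2 := hE.axis_short I hy hself ho
      have b3 := I.disp_between b1 b2 hpx
      have b4 := I.disp_between b1 b2 hqx
      have i1 := H.inv u p (g * (relator a c J i ^ N)⁻¹ * ray a c J i s)
      have i2 := H.inv u q (g * (relator a c J i ^ N)⁻¹ * ray a c J i t)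
      have t1 := H.cutMet.tri p (u * p) (u * (g * (relator a c J i ^ N)⁻¹ * ray a c J i s))
      have t2 := H.cutMet.tri q (u * q) (u * (g * (relator a c J i ^ N)⁻¹ * ray a c J i t))
      have key := (H.near_match (g := g * (relator a c J i ^ N)⁻¹)
        (g' := u * (g * (relator a c J i ^ N)⁻¹)) (k := i) (s' := s) (t' := t) (l' := 292900)
        hs ht (by rw [mul_assoc u]; omega) (by rw [mul_assoc u]; omega) (by omega)).2
      have e1 : u * (g * (relator a c J i ^ N)⁻¹) * relator a c J i *
          (u * (g * (relator a c J i ^ N)⁻¹))⁻¹ = u * (g * relator a c J i * g⁻¹) * u⁻¹ := by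
        rw [← conj_shift g (relator a c J i) N]; group
      rw [e1, conj_shift, eq_mul_inv_iff_mul_eq] at key
      refine hne (hE.eq_of_mem hA hself (Subgroup.mem_centralizer_singleton_iff.2 key.symm)
        (hu.ne_one I))
    · obtain ⟨M, hM1, hM2⟩ : ∃ M, wordMet A B x h < 2 * J * M ∧ wordMet A B y h < 2 * J * M := by
        have := hmul (wordMet A B x h + wordMet A B y h + 1)
        exact ⟨wordMet A B x h + wordMet A B y h + 1, by omega, by omega⟩
      obtain ⟨s', hs'⟩ := H.near_ray hE hx hy hpx hM1 hM2
      obtain ⟨t', ht'⟩ := H.near_ray hE hx hy hqx hM1 hM2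
      obtain ⟨rfl, key⟩ := H.near_match hs ht hs' ht' (by omega)
      rw [conj_shift, conj_shift] at key
      exact hne (by rw [key])

end Alphabet

end Alphabet

section Alphabet

variable {G : Type*} [Group G] {P : G → Prop} {A B : Subgroup G} {a : G} {c : ℕ → G} {J : ℕ}

namespace Alphabet

theorem ray_mem {Q : Type*} [Group Q] (f : G →* Q) (K : Subgroup Q)
    (ha : f a ∈ K) {i : ℕ} (hc : f (c i) ∈ K) {t : ℕ} (ht : t + 1 ≤ 2 * J) :
    f (ray a c J i t) ∈ K := by
  induction t with
  | zero => rw [ray, map_one]; exact K.one_mem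
  | succ t ih =>
    rw [ray, map_mul]
    refine K.mul_mem (ih (by omega)) ?_
    rw [letter]
    split_ifs with h1 h2
    · rw [map_pow]; exact K.pow_mem ha _
    · rw [Nat.mod_eq_of_lt (by omega)] at h2
      omega
    · exact hc

/-- Killing the relators leaves a group generated by two elements. -/
theorem closure_eq_top (H : Alphabet P A B a c J) (hA : ∀ s ∈ A, ∃ k : ℕ, s = a ^ k)
    (hB : ∀ s ∈ B, s ≠ 1 → ∃ i, s = c i) {Q : Type*} [Group Q] {f : G →* Q}
    (hf : Function.Surjective f) (hr : ∀ i, f (relator a c J i) = 1) :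
    Subgroup.closure {f a, f (c 0)} = ⊤ := by
  generalize hK : Subgroup.closure {f a, f (c 0)} = K
  have ha : f a ∈ K := hK ▸ Subgroup.subset_closure (by simp)
  have hc : ∀ i, f (c i) ∈ K := by
    intro i
    induction i with
    | zero => exact hK ▸ Subgroup.subset_closure (by simp)
    | succ i ih =>
      have h0 := H.large
      obtain ⟨t, ht⟩ : ∃ t, 2 * J = t + 1 := ⟨2 * J - 1, by omega⟩
      have h1 := ray_mem (J := J) f K ha ih (t := t) (by omega)
      have h2 := hr i
      have h3 : letter a c J i t = (c (i + 1))⁻¹ := by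
        rw [letter, if_neg (by omega), if_pos]
        rw [Nat.mod_eq_of_lt (by omega)]
        omega
      rw [relator, ht, ray, h3, map_mul, map_inv, mul_inv_eq_one] at h2
      rwa [← h2]
  have h1 : Subgroup.closure ((A : Set G) ∪ B) ≤ K.comap f := by
    rw [Subgroup.closure_le]
    rintro s (hs | hs)
    · obtain ⟨k, rfl⟩ := hA s hs
      rw [SetLike.mem_coe, Subgroup.mem_comap, map_pow]
      exact K.pow_mem ha _
    · by_cases h : s = 1
      · subst h
        exact Subgroup.one_mem _
      · obtain ⟨i, rfl⟩ := hB s hs h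
        exact hc i
  rw [H.gen] at h1
  refine (Subgroup.eq_top_iff' _).2 fun q => ?_
  obtain ⟨g, rfl⟩ := hf q
  exact h1 (Subgroup.mem_top g)

end Alphabet

end Alphabet

/-- The direct product of a group with infinitely many cyclic groups of order `n`. -/
abbrev Ext (C : Type*) (n : ℕ) : Type _ := C × Multiplicative (ℕ →₀ ZMod n)

section Ext

variable {C : Type*} [Group C] {n : ℕ}

theorem Ext.pow_eq_one (h : ∀ c : C, c ^ n = 1) (x : Ext C n) : x ^ n = 1 := by
  refine Prod.ext (h x.1) ?_
  change x.2 ^ n = 1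
  refine Multiplicative.toAdd.injective ?_
  rw [toAdd_pow, toAdd_one]
  ext i
  simp

/-- A generator of one of the cyclic factors. -/
noncomputable def Ext.gen (C : Type*) [Group C] (n : ℕ) : Ext C n :=
  (1, Multiplicative.ofAdd (Finsupp.single 0 1))

theorem Ext.gen_pow {k : ℕ} (h0 : 0 < k) (hk : k < n) : Ext.gen C n ^ k ≠ 1 := by
  intro h
  have h1 : (Ext.gen C n ^ k).2 = 1 := by rw [h]; rfl
  have h2 := congrArg (fun f : Multiplicative (ℕ →₀ ZMod n) => Multiplicative.toAdd f 0) h1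
  simp [Ext.gen] at h2
  rw [ZMod.natCast_eq_zero_iff] at h2
  exact absurd (Nat.le_of_dvd h0 h2) (by omega)

theorem Ext.exists_enum [Countable C] (hn : 1 < n) :
    ∃ c : ℕ → Ext C n, Function.Injective c ∧ (∀ i, c i ≠ 1) ∧ ∀ x, x ≠ 1 → ∃ i, x = c i := by
  have : Fact (1 < n) := ⟨hn⟩
  have : NeZero n := ⟨by omega⟩
  have : Infinite (Ext C n) := by
    have : Infinite (ℕ →₀ ZMod n) := inferInstance
    exact Prod.infinite_of_right
  have : Countable (Multiplicative (ℕ →₀ ZMod n)) := inferInstanceAs (Countable (ℕ →₀ ZMod n))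
  have : Infinite {x : Ext C n // x ≠ 1} :=
    (Set.finite_singleton (1 : Ext C n)).infinite_compl.to_subtype
  obtain ⟨e⟩ := nonempty_equiv_of_countable (α := ℕ) (β := {x : Ext C n // x ≠ 1})
  refine ⟨fun i => e i, fun i j h => e.injective (Subtype.ext h), fun i => (e i).2, fun x hx =>
    ⟨e.symm ⟨x, hx⟩, ?_⟩⟩
  simp

end Ext

open Monoid.CoprodI in
/-- Countable periodic groups embed in two-generated periodic groups. -/
theorem exists_two_generated {C : Type} [Group C] [Countable C] {n : ℕ} (ho : Odd n)
    (hn : 1000000000000000000000000000000000000000000000000000000000000 ≤ n)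
    (hC : ∀ c : C, c ^ n = 1) : ∃ (Q : Type) (_ : Group Q), (∀ q : Q, q ^ n = 1) ∧
      (∃ x y : Q, Subgroup.closure {x, y} = ⊤) ∧ ∃ φ : C →* Q, Function.Injective φ := by
  obtain ⟨c, hc, hc1, hc2⟩ := Ext.exists_enum (C := C) (n := n) (by omega)
  let H : Bool → Subgroup (Ext C n) := fun b => bif b then Subgroup.zpowers (Ext.gen C n) else ⊤
  have hS := split_coprodI (M := fun b => ↥(H b))
  have hH : ∀ b, ∀ x : H b, x ^ n = 1 := fun b x => Subtype.ext (Ext.pow_eq_one hC _)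
  let g : H true := ⟨Ext.gen C n, Subgroup.mem_zpowers _⟩
  let e : Ext C n →* H false := (Subgroup.topEquiv (G := Ext C n)).symm.toMonoidHom
  have he : Function.Bijective e := (Subgroup.topEquiv (G := Ext C n)).symm.bijective
  let a : Monoid.CoprodI fun b => ↥(H b) := of g
  let c' : ℕ → Monoid.CoprodI fun b => ↥(H b) := fun i => of (e (c i))
  have hA : Alphabet _ _ _ a c' 100000000000000000000000000000 :=
    { toSplit := hS
      mem := ⟨g, rfl⟩
      pow := by
        intro k h0 hk h
        rw [← map_pow, map_eq_one_iff _ (of_injective true)] at h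
        exact Ext.gen_pow (C := C) h0 (by omega) (congrArg Subtype.val h)
      mem' := fun i => ⟨_, rfl⟩
      ne_one := by
        intro i h
        rw [map_eq_one_iff _ (of_injective false), map_eq_one_iff _ he.1] at h
        exact hc1 i h
      inj := fun i j h => hc (he.1 (of_injective false h))
      large := by norm_num }
  have hl : ∀ x, wordMet (of (i := true)).range (of (M := fun b => ↥(H b)) (i := false)).range 1 x
      ≤ 1 → x ^ n = 1 := by
    intro x hx
    rcases hS.mem_of_le hx with ⟨y, rfl⟩ | ⟨y, rfl⟩ <;> rw [← map_pow, hH, map_one]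
  have st := hS.cutMet.stage hl ho (m := 5000000000000000000000000000000) (by norm_num)
  obtain ⟨N, hN, h1, h2, h3⟩ := st.exists_periodic (κ := 1000000000000000000000)
    (hA.relators st (by norm_num)) (by norm_num) le_rfl (by norm_num) (by norm_num) (by norm_num)
    (by omega)
  refine ⟨_ ⧸ N, inferInstance, ?_, ⟨_, _, hA.closure_eq_top (f := QuotientGroup.mk' N) ?_ ?_
    (QuotientGroup.mk'_surjective N) ?_⟩, (QuotientGroup.mk' N).comp (of.comp (e.comp
      (MonoidHom.inl _ _))), ?_⟩
  · intro q
    obtain ⟨x, rfl⟩ := QuotientGroup.mk'_surjective N q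
    rw [← map_pow]
    exact (QuotientGroup.eq_one_iff _).2 (h1 x)
  · rintro _ ⟨y, rfl⟩
    have hg : IsOfFinOrder (Ext.gen C n) :=
      isOfFinOrder_iff_pow_eq_one.2 ⟨n, by omega, Ext.pow_eq_one hC _⟩
    obtain ⟨k, hk⟩ := hg.mem_powers_iff_mem_zpowers.2 y.2
    refine ⟨k, ?_⟩
    rw [← map_pow]
    exact congrArg _ (Subtype.ext hk.symm)
  · rintro _ ⟨y, rfl⟩ hy
    obtain ⟨z, rfl⟩ := he.2 y
    obtain ⟨i, rfl⟩ := hc2 z fun h => hy (by rw [h, map_one, map_one])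
    exact ⟨i, rfl⟩
  · intro i
    exact (QuotientGroup.eq_one_iff _).2 (h2 ⟨1, i, by group⟩)
  · rw [injective_iff_map_eq_one]
    intro x hx
    have h4 := (QuotientGroup.eq_one_iff _).1 hx
    have h5 := h3 _ (IsGraph.dist_le_one (by simp [wordAdj])) h4
    have h6 := he.1 ((of_injective false (h5.trans (map_one _).symm)).trans (map_one _).symm)
    exact congrArg Prod.fst h6

/-- A homomorphism to a periodic group factors through the Burnside quotient. -/
theorem burnsideQuotient_lift {G Q : Type} [Group G] [Group Q] {n : ℕ} (hQ : ∀ q : Q, q ^ n = 1)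
    {f : G →* Q} (hf : Function.Surjective f) :
    ∃ π : BurnsideQuotient G n →* Q, Function.Surjective π := by
  have h : powerSubgroup G n ≤ f.ker := by
    refine Subgroup.normalClosure_le_normal ?_
    rintro _ ⟨x, rfl⟩
    rw [SetLike.mem_coe, MonoidHom.mem_ker, map_pow, hQ]
  refine ⟨QuotientGroup.lift _ f h, fun q => ?_⟩
  obtain ⟨x, rfl⟩ := hf q
  exact ⟨QuotientGroup.mk x, rfl⟩

theorem exists_surjective_freeGroup {S Q : Type} [Group Q] (hS : ∃ s t : S, s ≠ t) {x y : Q}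
    (h : Subgroup.closure {x, y} = ⊤) : ∃ f : FreeGroup S →* Q, Function.Surjective f := by
  obtain ⟨s, t, hst⟩ := hS
  refine ⟨FreeGroup.lift fun z => if z = s then x else if z = t then y else 1, ?_⟩
  rw [← MonoidHom.range_eq_top, eq_top_iff, ← h, Subgroup.closure_le]
  rintro _ (rfl | rfl)
  · exact ⟨FreeGroup.of s, by simp⟩
  · exact ⟨FreeGroup.of t, by simp [hst.symm]⟩

end BurnsideSQ

/-- Theorem 2.16, Sonkin / `theo:sq`.
For large enough odd `n` the free Burnside group `B(S, n)` on at least two generators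
is SQ-universal in the Burnside variety: every countable `n`-periodic group embeds in
a quotient of `B(S, n)`. -/
theorem free_burnside_SQ_universal :
    ∃ n₀ : ℕ, ∀ n : ℕ, Odd n → n₀ ≤ n →
    ∀ S : Type, (∃ s t : S, s ≠ t) →
    ∀ (C : Type) [Group C], Countable C → (∀ c : C, c ^ n = 1) →
      ∃ (Q : GrpB) (π : BurnsideQuotient (FreeGroup S) n →* Q.carrier),
        Function.Surjective π ∧ ∃ φ : C →* Q.carrier, Function.Injective φ := by
  refine ⟨1000000000000000000000000000000000000000000000000000000000000, ?_⟩
  intro n ho hn S hS C _ _ hC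
  obtain ⟨Q, _, hQ, ⟨x, y, hxy⟩, hφ⟩ := BurnsideSQ.exists_two_generated ho hn hC
  obtain ⟨f, hf⟩ := BurnsideSQ.exists_surjective_freeGroup hS hxy
  obtain ⟨π, hπ⟩ := BurnsideSQ.burnsideQuotient_lift hQ hf
  exact ⟨⟨Q⟩, π, hπ, hφ⟩
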